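/- Let K be a number field, let f₁, …, f_r ∈ K[X] be pairwise distinct monic irreducible polynomials, each symmetric of even degree, let n₁, …, n_r ≥ 1 be integers, and set f = ∏ f_i^{n_i}, g = ∏ f_i and E_i = K[X]/(f_i). Assume the fields E_i are pairwise independent over K, i.e. E_i ⊗_K E_j is a field for all i ≠ j. Let B be a nondegenerate symmetric bilinear form on a K-vector space V of dimension deg f. Suppose that: for every nonzero prime ideal v of the ring of integers of K, the base change of B to the v-adic completion K_v admits an isometry whose characteristic polynomial is the image of f and whose minimal polynomial is the image of g; and for every ring homomorphism φ : K → ℝ, the base change of B to ℝ along φ admits an isometry with characteristic polynomial the image of f and minimal polynomial the image of g. Then B admits an isometry with characteristic polynomial f and minimal polynomial g. -/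

import Mathlib

open TensorProduct Polynomial

set_option synthInstance.maxHeartbeats 1000000
set_option maxHeartbeats 1000000

/-- `B` admits an isometry with characteristic polynomial `F` and minimal polynomial `G`. -/
def HasIsometryWith (L : Type*) [Field L] (W : Type*) [AddCommGroup W] [Module L W]
    [Module.Finite L W] (B : LinearMap.BilinForm L W) (F G : Polynomial L) : Prop :=
  ∃ t : W ≃ₗ[L] W, (∀ x y, B (t x) (t y) = B x y) ∧
    LinearMap.charpoly (t : W →ₗ[L] W) = F ∧ minpoly L (t : W →ₗ[L] W) = G

set_option linter.unusedSectionVars false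
set_option linter.unusedVariables false
set_option linter.unusedSimpArgs false

universe u

/-- `c` is a value of the form `x² - a y²`. -/
def IsNrm {F : Type*} [Field F] (a c : F) : Prop := ∃ x y : F, x ^ 2 - a * y ^ 2 = c

section Nrm
variable {F : Type*} [Field F]

theorem IsNrm.mul {a c d : F} (hc : IsNrm a c) (hd : IsNrm a d) : IsNrm a (c * d) := by
  obtain ⟨x, y, rfl⟩ := hc
  obtain ⟨z, w, rfl⟩ := hd
  exact ⟨x * z + a * (y * w), x * w + y * z, by ring⟩

theorem isNrm_sq (a c : F) : IsNrm a (c ^ 2) := ⟨c, 0, by ring⟩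

theorem isNrm_one (a : F) : IsNrm a 1 := ⟨1, 0, by ring⟩

theorem isNrm_neg_self (a : F) : IsNrm a (-a) := ⟨0, 1, by ring⟩

theorem IsNrm.inv {a c : F} (hc : IsNrm a c) : IsNrm a c⁻¹ := by
  by_cases h : c = 0
  · simpa [h] using hc
  · have := hc.mul (isNrm_sq a c⁻¹)
    rwa [show c * c⁻¹ ^ 2 = c⁻¹ by field_simp] at this

theorem IsNrm.of_mul_left {a c d : F} (h0 : c ≠ 0) (hc : IsNrm a c) (h : IsNrm a (c * d)) :
    IsNrm a d := by
  have := hc.inv.mul h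
  rwa [inv_mul_cancel_left₀ h0] at this

theorem isNrm_mul_sq_left {a d : F} (hd : d ≠ 0) (c : F) : IsNrm (a * d ^ 2) c ↔ IsNrm a c := by
  constructor
  · rintro ⟨x, y, rfl⟩; exact ⟨x, d * y, by ring⟩
  · rintro ⟨x, y, rfl⟩; exact ⟨x, d⁻¹ * y, by field_simp⟩

theorem isNrm_mul_sq_right {d : F} (hd : d ≠ 0) (a c : F) : IsNrm a (c * d ^ 2) ↔ IsNrm a c := by
  constructor
  · intro h; rw [mul_comm] at h; exact (isNrm_sq a d).of_mul_left (pow_ne_zero 2 hd) h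
  · exact fun h => h.mul (isNrm_sq a d)

theorem isNrm_of_isSquare [NeZero (2 : F)] {a : F} (ha : IsSquare a) (h0 : a ≠ 0) (c : F) :
    IsNrm a c := by
  obtain ⟨d, rfl⟩ := ha
  have hd : d ≠ 0 := fun h => h0 (by simp [h])
  have h2 : (2 : F) ≠ 0 := NeZero.ne 2
  exact ⟨(c + 1) / 2, (c - 1) / (2 * d), by field_simp; ring⟩

theorem IsNrm.symm [NeZero (2 : F)] {a c : F} (h0 : c ≠ 0) (h : IsNrm a c) :
    IsNrm c a := by
  obtain ⟨x, y, rfl⟩ := h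
  by_cases hy : y = 0
  · subst hy
    exact isNrm_of_isSquare ⟨x, by ring⟩ h0 a
  · exact ⟨x / y, 1 / y, by field_simp; ring⟩

theorem isNrm_comm [NeZero (2 : F)] {a c : F} (ha : a ≠ 0) (hc : c ≠ 0) :
    IsNrm a c ↔ IsNrm c a := ⟨IsNrm.symm hc, IsNrm.symm ha⟩

theorem IsNrm.map {F' : Type*} [Field F'] (φ : F →+* F') {a c : F} (h : IsNrm a c) :
    IsNrm (φ a) (φ c) := by
  obtain ⟨x, y, rfl⟩ := h
  exact ⟨φ x, φ y, by simp⟩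

/-- The group of nonzero values of `x² - a y²`. -/
def nrmGroup (a : F) : Subgroup Fˣ where
  carrier := {c | IsNrm a (c : F)}
  one_mem' := isNrm_one a
  mul_mem' := fun h h' => by
    show IsNrm a ((_ * _ : Fˣ) : F)
    rw [Units.val_mul]; exact IsNrm.mul h h'
  inv_mem' := fun {c} h => by
    show IsNrm a ((c⁻¹ : Fˣ) : F)
    rw [Units.val_inv_eq_inv_val]; exact IsNrm.inv h

theorem mem_nrmGroup {a : F} {c : Fˣ} : c ∈ nrmGroup a ↔ IsNrm a (c : F) := Iff.rfl

/-- The group of squares. -/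
def sqGroup (G : Type*) [CommGroup G] : Subgroup G := (powMonoidHom 2 : G →* G).range

theorem mem_sqGroup {G : Type*} [CommGroup G] {g : G} : g ∈ sqGroup G ↔ ∃ h, h ^ 2 = g := Iff.rfl

theorem mem_sqGroup_units {c : Fˣ} : c ∈ sqGroup Fˣ ↔ IsSquare (c : F) := by
  rw [mem_sqGroup]
  constructor
  · rintro ⟨h, rfl⟩; exact ⟨h, by simp [sq]⟩
  · rintro ⟨d, hd⟩
    have : d ≠ 0 := fun h => c.ne_zero (by simp [hd, h])
    exact ⟨Units.mk0 d this, by ext; simp [hd, sq]⟩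

theorem sqGroup_le_nrmGroup (a : F) : sqGroup Fˣ ≤ nrmGroup a := by
  rintro _ ⟨c, rfl⟩
  simpa [mem_nrmGroup] using isNrm_sq a (c : F)

end Nrm

section LocalRing
open IsLocalRing
variable {O : Type*} [CommRing O] [IsDomain O] [IsDiscreteValuationRing O] [HenselianLocalRing O]
  {F : Type*} [Field F] [Algebra O F] [IsFractionRing O F]

/-- Hensel's lemma for `t² + t = ρ`. -/
theorem exists_sq_add_self_eq {ρ t : O} (hu : IsUnit (1 + 4 * ρ))
    (ht : t ^ 2 + t - ρ ∈ maximalIdeal O) : ∃ s : O, s ^ 2 + s = ρ := by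
  have hmon : (X ^ 2 + X - C ρ : O[X]).Monic := by monicity!
  have hder : IsUnit ((X ^ 2 + X - C ρ : O[X]).derivative.eval t) := by
    have e : (2 * t + 1) ^ 2 = (1 + 4 * ρ) + 4 * (t ^ 2 + t - ρ) := by ring
    have : IsUnit ((2 * t + 1) ^ 2) := by
      rw [e]
      by_contra h
      have h1 := (mem_maximalIdeal _).2 h
      have h2 := Ideal.mul_mem_left (maximalIdeal O) 4 ht
      exact (mem_maximalIdeal _).1 ((Ideal.add_mem_iff_left _ h2).1 h1) hu
    have h3 : IsUnit (2 * t + 1) := by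
      rwa [isUnit_pow_iff two_ne_zero] at this
    simpa [one_add_one_eq_two] using h3
  obtain ⟨s, hs, -⟩ := HenselianLocalRing.is_henselian _ hmon t (by simpa using ht) hder
  refine ⟨s, ?_⟩
  simp [IsRoot] at hs
  linear_combination hs

theorem isSquare_one_add_four_mul {ρ t : O} (hu : IsUnit (1 + 4 * ρ))
    (ht : t ^ 2 + t - ρ ∈ maximalIdeal O) : IsSquare (1 + 4 * ρ) := by
  obtain ⟨s, rfl⟩ := exists_sq_add_self_eq hu ht
  exact ⟨2 * s + 1, by ring⟩

theorem isSquare_one_add_four_mul_of_mem {ρ : O} (h : ρ ∈ maximalIdeal O) :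
    IsSquare (1 + 4 * ρ) := by
  refine isSquare_one_add_four_mul (t := 0) ?_ (by simpa using h)
  by_contra h'
  have := (Ideal.add_mem_iff_left _ (Ideal.mul_mem_left _ 4 h)).1 ((mem_maximalIdeal _).2 h')
  exact (mem_maximalIdeal _).1 this isUnit_one

theorem exists_forall_sq_add_self_sub_notMem [Finite (ResidueField O)] :
    ∃ ρ : O, ∀ t : O, t ^ 2 + t - ρ ∉ maximalIdeal O := by
  have hninj : ¬ Function.Injective (fun t : ResidueField O => t ^ 2 + t) := by
    intro h
    have := @h 0 (-1) (by ring)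
    simp at this
  rw [Finite.injective_iff_surjective] at hninj
  simp only [Function.Surjective, not_forall, not_exists] at hninj
  obtain ⟨r, hr⟩ := hninj
  obtain ⟨ρ, rfl⟩ := residue_surjective r
  refine ⟨ρ, fun t ht => hr (residue O t) ?_⟩
  rw [← sub_eq_zero, ← map_pow, ← map_add, ← map_sub]
  exact (residue_eq_zero_iff _).2 ht

variable (F) in
/-- Every nonzero element is a unit times a power of the uniformizer. -/
theorem exists_unit_mul_zpow {π : O} (hπ : Irreducible π) {x : F} (hx : x ≠ 0) :
    ∃ (n : ℤ) (u : Oˣ), x = algebraMap O F u * algebraMap O F π ^ n := by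
  obtain ⟨a, b, hb, rfl⟩ := IsFractionRing.div_surjective (A := O) x
  have hb0 : b ≠ 0 := nonZeroDivisors.ne_zero hb
  have ha0 : a ≠ 0 := fun h => hx (by simp [h])
  obtain ⟨n, u, rfl⟩ := IsDiscreteValuationRing.eq_unit_mul_pow_irreducible ha0 hπ
  obtain ⟨m, w, rfl⟩ := IsDiscreteValuationRing.eq_unit_mul_pow_irreducible hb0 hπ
  have hp : algebraMap O F π ≠ 0 := by simpa using hπ.ne_zero
  have hw : algebraMap O F (w : O) ≠ 0 := by simp
  refine ⟨n - m, u * w⁻¹, ?_⟩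
  have h1 : algebraMap O F ((w⁻¹ : Oˣ) : O) = (algebraMap O F (w : O))⁻¹ := eq_inv_of_mul_eq_one_left (by rw [← map_mul]; simp)
  simp only [Units.val_mul, map_mul, map_pow, h1, zpow_sub₀ hp, zpow_natCast]
  field_simp

theorem unit_mul_zpow_eq_one {π : O} (hπ : Irreducible π) {n : ℤ} {u : Oˣ}
    (h : algebraMap O F u * algebraMap O F π ^ n = 1) : n = 0 := by
  have hp : algebraMap O F π ≠ 0 := by simpa using hπ.ne_zero
  have key : ∀ (k : ℕ) (u : Oˣ), algebraMap O F u * algebraMap O F π ^ k = 1 → k = 0 := by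
    intro k u h
    by_contra hk
    rw [← map_pow, ← map_mul, ← map_one (algebraMap O F)] at h
    have := IsFractionRing.injective O F h
    have h2 : IsUnit (π ^ k) := IsUnit.of_mul_eq_one_right (u : O) this
    exact hπ.not_isUnit ((isUnit_pow_iff hk).1 h2)
  rcases Int.eq_nat_or_neg n with ⟨k, rfl | rfl⟩
  · have := key k u (by simpa using h)
    simp [this]
  · have := key k u⁻¹ (by
      have hw : algebraMap O F (u : O) ≠ 0 := by simp
      have h1 : algebraMap O F ((u⁻¹ : Oˣ) : O) = (algebraMap O F (u : O))⁻¹ := eq_inv_of_mul_eq_one_left (by rw [← map_mul]; simp)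
      rw [h1]
      rw [zpow_neg, zpow_natCast] at h
      field_simp at h
      rw [h]; field_simp)
    simp [this]

theorem unit_mul_zpow_inj {π : O} (hπ : Irreducible π) {n m : ℤ} {u w : Oˣ}
    (h : algebraMap O F u * algebraMap O F π ^ n = algebraMap O F w * algebraMap O F π ^ m) :
    n = m := by
  have hp : algebraMap O F π ≠ 0 := by simpa using hπ.ne_zero
  have hw : algebraMap O F (w : O) ≠ 0 := by simp
  have h1 : algebraMap O F ((w⁻¹ : Oˣ) : O) = (algebraMap O F (w : O))⁻¹ := eq_inv_of_mul_eq_one_left (by rw [← map_mul]; simp)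
  have := unit_mul_zpow_eq_one (F := F) hπ (n := n - m) (u := u * w⁻¹) (by
    rw [Units.val_mul, map_mul, h1, zpow_sub₀ hp]
    have := zpow_ne_zero m hp
    field_simp
    rw [h])
  omega

end LocalRing

section LocalField
open IsLocalRing
variable {O : Type*} [CommRing O] [IsDomain O] [IsDiscreteValuationRing O] [HenselianLocalRing O]
  {F : Type*} [Field F] [Algebra O F] [IsFractionRing O F]

theorem exists_primitive {π : O} (hπ : Irreducible π) {x y : F} (h : x ≠ 0 ∨ y ≠ 0) :
    ∃ (n : ℤ) (a b : O), (IsUnit a ∨ IsUnit b) ∧ x = algebraMap O F π ^ n * algebraMap O F a ∧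
      y = algebraMap O F π ^ n * algebraMap O F b := by
  have hp : algebraMap O F π ≠ 0 := by simpa using hπ.ne_zero
  have key : ∀ {x y : F}, x ≠ 0 → ∃ (n : ℤ) (a b : O), (IsUnit a ∨ IsUnit b) ∧
      x = algebraMap O F π ^ n * algebraMap O F a ∧
      y = algebraMap O F π ^ n * algebraMap O F b := by
    intro x y hx
    obtain ⟨n, u, hu⟩ := exists_unit_mul_zpow F hπ hx
    by_cases hy : y = 0
    · exact ⟨n, u, 0, Or.inl u.isUnit, by rw [hu, mul_comm], by simp [hy]⟩
    obtain ⟨m, w, hw⟩ := exists_unit_mul_zpow F hπ hy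
    rcases le_total n m with hnm | hnm
    · obtain ⟨k, hk⟩ := Int.le.dest hnm
      refine ⟨n, u, w * π ^ k, Or.inl u.isUnit, by rw [hu, mul_comm], ?_⟩
      rw [hw, ← hk, zpow_add₀ hp, map_mul, map_pow, zpow_natCast]; ring
    · obtain ⟨k, hk⟩ := Int.le.dest hnm
      refine ⟨m, u * π ^ k, w, Or.inr w.isUnit, ?_, by rw [hw, mul_comm]⟩
      rw [hu, ← hk, zpow_add₀ hp, map_mul, map_pow, zpow_natCast]; ring
  rcases h with h | h
  · exact key h
  · obtain ⟨n, a, b, h1, h2, h3⟩ := key (x := y) (y := x) h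
    exact ⟨n, b, a, h1.symm, h3, h2⟩

/-- Norms from the unramified quadratic extension have even valuation. -/
theorem even_of_isNrm_one_add_four [CharZero F] {π : O} (hπ : Irreducible π) {ρ : O}
    (hρ : ∀ t : O, t ^ 2 + t - ρ ∉ maximalIdeal O) {c : F} (hc : c ≠ 0)
    (h : IsNrm (algebraMap O F (1 + 4 * ρ)) c) :
    ∃ (k : ℤ) (u : Oˣ), c = algebraMap O F u * algebraMap O F π ^ (2 * k) := by
  have hp : algebraMap O F π ≠ 0 := by simpa using hπ.ne_zero
  obtain ⟨x, y, hxy⟩ := h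
  set s : F := (x - y) / 2 with hs
  have hx : x = y + 2 * s := by rw [hs]; ring
  have hc4 : c = 4 * (s ^ 2 + s * y - algebraMap O F ρ * y ^ 2) := by
    rw [← hxy, hx]; simp only [map_add, map_one, map_mul, map_ofNat]; ring
  have hsy : s ≠ 0 ∨ y ≠ 0 := by
    by_contra h0
    push Not at h0
    exact hc (by rw [hc4, h0.1, h0.2]; ring)
  obtain ⟨n, a, b, hab, ha, hb⟩ := exists_primitive hπ hsy
  have hunit : IsUnit (a ^ 2 + a * b - ρ * b ^ 2) := by
    by_contra hnu
    rw [← mem_nonunits_iff, ← mem_maximalIdeal] at hnu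
    by_cases hbu : IsUnit b
    · obtain ⟨b, rfl⟩ := hbu
      apply hρ (a * (b⁻¹ : Oˣ))
      have := Ideal.mul_mem_left _ ((b⁻¹ : Oˣ) ^ 2 : O) hnu
      convert this using 1
      have hb : (b : O) * (b⁻¹ : Oˣ) = 1 := by simp
      linear_combination (-(a * (b⁻¹ : Oˣ)) + ρ * ((b:O) * (b⁻¹ : Oˣ) + 1)) * hb
    · have hau := hab.resolve_right hbu
      rw [← mem_nonunits_iff, ← mem_maximalIdeal] at hbu
      have h1 : a ^ 2 ∈ maximalIdeal O := by
        have h2 := Ideal.mul_mem_left _ (ρ * b - a) hbu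
        have := Ideal.add_mem _ hnu h2
        convert this using 1; ring
      exact (mem_maximalIdeal _).1 h1 (hau.pow 2)
  obtain ⟨e, η, h2⟩ := exists_unit_mul_zpow F hπ (two_ne_zero (α := F))
  obtain ⟨w, hw⟩ := hunit
  refine ⟨e + n, η ^ 2 * w, ?_⟩
  rw [hc4, ha, hb, Units.val_mul, hw, show (4 : F) = 2 ^ 2 by norm_num, h2, two_mul,
    zpow_add₀ hp, zpow_add₀ hp]
  simp only [map_sub, map_add, map_mul, map_pow, Units.val_pow_eq_pow_val]
  ring

theorem isUnit_one_add_four {ρ : O} (hρ : ∀ t : O, t ^ 2 + t - ρ ∉ maximalIdeal O) :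
    IsUnit (1 + 4 * ρ) := by
  by_contra h
  have hm := (mem_maximalIdeal _).2 h
  by_cases h2 : IsUnit (2 : O)
  · obtain ⟨w, hw⟩ := h2
    apply hρ (-(w⁻¹ : Oˣ))
    have h3 := Ideal.mul_mem_left _ (-((w⁻¹ : Oˣ) : O) ^ 2) hm
    convert h3 using 1
    have : (2 : O) * (w⁻¹ : Oˣ) = 1 := by rw [← hw]; simp
    linear_combination (((w⁻¹ : Oˣ) : O) + ρ * (2 * ((w⁻¹ : Oˣ) : O) + 1)) * this
  · have h2m := (mem_maximalIdeal _).2 h2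
    have h4 : 4 * ρ ∈ maximalIdeal O := by
      have := Ideal.mul_mem_left _ (2 * ρ) h2m
      convert this using 1; ring
    exact (mem_maximalIdeal _).1 ((Ideal.add_mem_iff_left _ h4).1 hm) isUnit_one

theorem exists_sub_sq_mem [Finite (ResidueField O)] (h2 : (2 : O) ∈ maximalIdeal O) (β : O) :
    ∃ δ : O, β - δ ^ 2 ∈ maximalIdeal O := by
  have hchar : ringChar (ResidueField O) = 2 := by
    have : ((2 : ℕ) : ResidueField O) = 0 := by
      have := (residue_eq_zero_iff (R := O) _).2 h2
      rw [Nat.cast_ofNat, ← map_ofNat (residue O) 2]; exact this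
    exact (CharP.ringChar_of_prime_eq_zero Nat.prime_two this)
  cases nonempty_fintype (ResidueField O)
  obtain ⟨r, hr⟩ := FiniteField.isSquare_of_char_two hchar (residue O β)
  obtain ⟨δ, rfl⟩ := residue_surjective r
  refine ⟨δ, (residue_eq_zero_iff _).1 ?_⟩
  rw [map_sub, hr, map_pow]; ring

theorem unit_normal_form [Finite (ResidueField O)] {π : O} (hπ : Irreducible π) {e : ℕ} {η : Oˣ}
    (h2 : (2 : O) = η * π ^ e) (u : Oˣ) (k : ℕ) (hk : k ≤ 2 * e) :
    ∃ w : Oˣ, π ^ k ∣ (u * w ^ 2 : O) - 1 ∨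
      ∃ j < 2 * e, Odd j ∧ ∃ ε : Oˣ, (u * w ^ 2 : O) = 1 + ε * π ^ j := by
  have hmem : ∀ x : O, x ∈ maximalIdeal O ↔ π ∣ x := fun x => by
    rw [hπ.maximalIdeal_eq, Ideal.mem_span_singleton]
  induction k with
  | zero => exact ⟨1, Or.inl (by simp)⟩
  | succ k ih =>
    obtain ⟨w, ⟨β, hβ⟩ | h⟩ := ih (by omega)
    swap
    · exact ⟨w, Or.inr h⟩
    by_cases hβu : IsUnit β
    swap
    · refine ⟨w, Or.inl ?_⟩
      obtain ⟨t, rfl⟩ := (hmem β).1 ((mem_maximalIdeal _).2 hβu)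
      exact ⟨t, by rw [hβ]; ring⟩
    have he : 1 ≤ e := by omega
    have h2m : (2 : O) ∈ maximalIdeal O := by
      rw [hmem, h2]; exact Dvd.dvd.mul_left (dvd_pow_self π (by omega)) _
    obtain ⟨β, rfl⟩ := hβu
    rcases Nat.even_or_odd k with hev | hodd
    swap
    · exact ⟨w, Or.inr ⟨k, by omega, hodd, β, by linear_combination hβ⟩⟩
    obtain ⟨j, rfl⟩ := hev
    rcases Nat.eq_zero_or_pos j with rfl | hj
    · obtain ⟨δ, hδ⟩ := exists_sub_sq_mem h2m ((u⁻¹ : Oˣ) : O)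
      have hδu : IsUnit δ := by
        by_contra hn
        have := Ideal.add_mem _ hδ (Ideal.mul_mem_left _ δ ((mem_maximalIdeal _).2 hn))
        exact (mem_maximalIdeal _).1 (by convert this using 1; ring) (u⁻¹).isUnit
      obtain ⟨δ, rfl⟩ := hδu
      refine ⟨δ, Or.inl ?_⟩
      have := (hmem _).1 (Ideal.mul_mem_left _ (-(u : O)) hδ)
      convert this using 1
      · simp
      · have : (u : O) * (u⁻¹ : Oˣ) = 1 := by simp
        linear_combination this
    · obtain ⟨δ, hδ⟩ := exists_sub_sq_mem h2m (β : O)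
      obtain ⟨t, ht⟩ := (hmem _).1 hδ
      obtain ⟨z, hz⟩ := (hmem _).1 h2m
      have hu1 : IsUnit (1 + π ^ j * δ) := by
        by_contra hn
        have h3 : π ^ j * δ ∈ maximalIdeal O :=
          (hmem _).2 (Dvd.dvd.mul_right (dvd_pow_self π (by omega)) _)
        exact (mem_maximalIdeal _).1 ((Ideal.add_mem_iff_left _ h3).1 ((mem_maximalIdeal _).2 hn))
          isUnit_one
      obtain ⟨w', hw'⟩ := hu1
      refine ⟨w * w', Or.inl ?_⟩
      have e1 : (u * ((w * w' : Oˣ) : O) ^ 2 : O) - 1 =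
          π ^ (j + j) * (β - δ ^ 2) + π ^ (j + j) * (2 * δ ^ 2) + 2 * π ^ j * δ +
          π ^ (j + j) * β * (2 * π ^ j * δ + π ^ (j + j) * δ ^ 2) := by
        rw [Units.val_mul, hw']
        have : (u : O) * w ^ 2 = 1 + π ^ (j + j) * β := by linear_combination hβ
        calc (u * (w * (1 + π ^ j * δ)) ^ 2 : O) - 1 = (u * w ^ 2) * (1 + π ^ j * δ) ^ 2 - 1 := by
              ring
          _ = _ := by rw [this]; ring
      have hej : e = 1 + j + (e - 1 - j) := by omega
      have d2 : π ^ (j + j + 1) ∣ 2 * π ^ j := by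
        rw [h2, hej]; exact ⟨η * π ^ (e - 1 - j), by ring⟩
      have dj : π ^ (j + j + 1) ∣ π ^ (j + j) * π ^ j := by
        rw [← pow_add]; exact pow_dvd_pow _ (by omega)
      rw [e1]
      refine dvd_add (dvd_add (dvd_add ?_ ?_) ?_) ?_
      · rw [ht]; exact ⟨t, by ring⟩
      · exact ⟨z * δ ^ 2, by linear_combination π ^ (j + j) * δ ^ 2 * hz⟩
      · exact Dvd.dvd.mul_right d2 _
      · obtain ⟨q, hq⟩ := dj
        exact ⟨q * β * (2 * δ + π ^ j * δ ^ 2), by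
          linear_combination (β * (2 * δ + π ^ j * δ ^ 2)) * hq⟩

/-- Nondegeneracy of the local symbol. -/
theorem exists_not_isNrm [CharZero F] [Finite (ResidueField O)] {a : F} (ha : a ≠ 0)
    (hsq : ¬ IsSquare a) : ∃ c : F, c ≠ 0 ∧ ¬ IsNrm a c := by
  by_contra! hall
  obtain ⟨π, hπ⟩ := IsDiscreteValuationRing.exists_irreducible O
  have hp : algebraMap O F π ≠ 0 := by simpa using hπ.ne_zero
  have hmem : ∀ x : O, x ∈ maximalIdeal O ↔ π ∣ x := fun x => by
    rw [hπ.maximalIdeal_eq, Ideal.mem_span_singleton]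
  obtain ⟨ρ, hρ⟩ := exists_forall_sq_add_self_sub_notMem (O := O)
  have hΔu := isUnit_one_add_four hρ
  have hΔ : algebraMap O F (1 + 4 * ρ) ≠ 0 :=
    (map_ne_zero_iff _ (IsFractionRing.injective O F)).2 hΔu.ne_zero
  obtain ⟨n, u, rfl⟩ : ∃ (n : ℤ) (u : Oˣ), a = algebraMap O F u * algebraMap O F π ^ (2 * n) :=
    even_of_isNrm_one_add_four hπ hρ ha ((hall _ hΔ).symm hΔ)
  have hsq' : ∀ w : Oˣ, ¬ IsSquare ((u * w ^ 2 : O)) := by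
    rintro w ⟨d, hd⟩
    apply hsq
    have hw : algebraMap O F (w : O) ≠ 0 := by simp
    refine ⟨algebraMap O F d * (algebraMap O F w)⁻¹ * algebraMap O F π ^ n, ?_⟩
    have := congrArg (algebraMap O F) hd
    simp only [map_mul, map_pow] at this
    rw [two_mul, zpow_add₀ hp]
    field_simp
    linear_combination this
  have hall' : ∀ (w : Oˣ) (c : F), c ≠ 0 → IsNrm (algebraMap O F (u * w ^ 2 : O)) c := by
    intro w c hc
    have h1 := hall c hc
    rw [mul_comm 2 n, zpow_mul, show ((2 : ℤ)) = ((2 : ℕ) : ℤ) from rfl, zpow_natCast,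
      isNrm_mul_sq_left (zpow_ne_zero n hp)] at h1
    rw [map_mul, map_pow, isNrm_mul_sq_left (by simp)]
    exact h1
  have h20 : (2 : O) ≠ 0 := by
    intro h
    have := congrArg (algebraMap O F) h
    rw [map_ofNat, map_zero] at this
    exact two_ne_zero this
  obtain ⟨e, η, h2⟩ := IsDiscreteValuationRing.eq_unit_mul_pow_irreducible h20 hπ
  obtain ⟨w, ⟨β, hβ⟩ | ⟨j, hj, hodd, ε, hε⟩⟩ := unit_normal_form hπ h2 u (2 * e) le_rfl
  · set ρ' : O := ((η⁻¹ : Oˣ) : O) ^ 2 * β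
    have e1 : (u * w ^ 2 : O) = 1 + 4 * ρ' := by
      have h4 : (4 : O) * ((η⁻¹ : Oˣ) : O) ^ 2 = π ^ (2 * e) := by
        have : (η : O) * (η⁻¹ : Oˣ) = 1 := by simp
        calc (4 : O) * ((η⁻¹ : Oˣ) : O) ^ 2 = 2 ^ 2 * ((η⁻¹ : Oˣ) : O) ^ 2 := by norm_num
          _ = (η * (η⁻¹ : Oˣ)) ^ 2 * π ^ (2 * e) := by rw [h2]; ring
          _ = _ := by rw [this]; ring
      linear_combination hβ - β * h4
    by_cases hr : ∃ t : O, t ^ 2 + t - ρ' ∈ maximalIdeal O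
    · obtain ⟨t, ht⟩ := hr
      apply hsq' w
      rw [e1]
      refine isSquare_one_add_four_mul ?_ ht
      rw [← e1]; exact (u * w ^ 2).isUnit
    · push Not at hr
      have := hall' w _ hp
      rw [e1] at this
      obtain ⟨k, v, hk⟩ := even_of_isNrm_one_add_four hπ hr hp this
      have := unit_mul_zpow_inj (F := F) hπ (n := 1) (m := 2 * k) (u := 1) (w := v) (by simpa using hk)
      omega
  · set α : O := ε * π ^ j
    set β : O := η ^ 2 * π ^ (2 * e - j) * ρ * (ε⁻¹ : Oˣ) * (1 + α)
    have hαβ : α * β = 4 * ρ * (1 + α) := by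
      have : (ε : O) * (ε⁻¹ : Oˣ) = 1 := by simp
      have h4 : (4 : O) = η ^ 2 * (π ^ j * π ^ (2 * e - j)) := by
        rw [← pow_add, show j + (2 * e - j) = 2 * e by omega,
          show (4 : O) = 2 ^ 2 by norm_num, h2]; ring
      rw [h4]
      simp only [α, β]
      linear_combination (η ^ 2 * (π ^ j * π ^ (2 * e - j)) * ρ * (1 + ε * π ^ j)) * this
    have hβu : IsUnit (1 + β) := by
      by_contra hn
      have h3 : β ∈ maximalIdeal O := by
        rw [hmem]
        have : π ∣ π ^ (2 * e - j) := dvd_pow_self π (by omega)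
        simp only [β]
        exact (((this.mul_left _).mul_right _).mul_right _).mul_right _
      exact (mem_maximalIdeal _).1 ((Ideal.add_mem_iff_left _ h3).1 ((mem_maximalIdeal _).2 hn))
        isUnit_one
    obtain ⟨b, hb⟩ := hβu
    set ξ : F := algebraMap O F (-(α * (1 + β)))
    have hξ : ξ = algebraMap O F ((-ε * b : Oˣ) : O) * algebraMap O F π ^ (j : ℤ) := by
      simp only [ξ, ← hb, α, zpow_natCast, Units.val_mul, Units.val_neg, map_neg, map_mul, map_pow]
      ring
    have hξ0 : ξ ≠ 0 := by rw [hξ]; simp [hπ.ne_zero]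
    have h1 : IsNrm ξ (algebraMap O F (u * w ^ 2 : O) * algebraMap O F (1 + 4 * ρ)) := by
      refine ⟨1, 1, ?_⟩
      rw [hε, ← map_mul]
      simp only [ξ]
      rw [show (1 + α) * (1 + 4 * ρ) = 1 - -(α * (1 + β)) by linear_combination -hαβ]
      simp
    have h2' : IsNrm ξ (algebraMap O F (u * w ^ 2 : O)) := (hall' w ξ hξ0).symm hξ0
    have h3 := (h2'.of_mul_left (by simp) h1).symm hΔ
    obtain ⟨k, v, hk⟩ := even_of_isNrm_one_add_four hπ hρ hξ0 h3
    rw [hξ] at hk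
    have := unit_mul_zpow_inj (F := F) hπ hk
    rw [Nat.odd_iff] at hodd
    omega

end LocalField

section SqIndex

theorem sqGroup_index_congr {G H : Type*} [CommGroup G] [CommGroup H] (e : G ≃* H) :
    (sqGroup G).index = (sqGroup H).index := by
  have : (sqGroup G) = (sqGroup H).comap e.toMonoidHom := by
    ext g
    simp only [Subgroup.mem_comap, mem_sqGroup]
    constructor
    · rintro ⟨h, rfl⟩; exact ⟨e h, by simp⟩
    · rintro ⟨h, hh⟩; exact ⟨e.symm h, by simpa using congrArg e.symm hh⟩
  rw [this, Subgroup.index_comap_of_surjective _ e.surjective]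

theorem sqGroup_index_prod (G H : Type*) [CommGroup G] [CommGroup H] :
    (sqGroup (G × H)).index = (sqGroup G).index * (sqGroup H).index := by
  rw [← Subgroup.index_prod]
  congr 1
  ext ⟨g, h⟩
  simp only [Subgroup.mem_prod, mem_sqGroup, Prod.exists, Prod.pow_mk, Prod.mk.injEq]
  exact ⟨fun ⟨a, b, h1, h2⟩ => ⟨⟨a, h1⟩, ⟨b, h2⟩⟩, fun ⟨⟨a, h1⟩, ⟨b, h2⟩⟩ => ⟨a, b, h1, h2⟩⟩

theorem sqGroup_index_int_pi (ι : Type*) [Fintype ι] :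
    (sqGroup (Multiplicative (ι → ℤ))).index = 2 ^ Fintype.card ι := by
  let f : Multiplicative (ι → ℤ) →* Multiplicative (ι → ZMod 2) :=
    AddMonoidHom.toMultiplicative ((Int.castAddHom (ZMod 2)).compLeft ι)
  have hf : Function.Surjective f := by
    intro x
    choose y hy using fun i => ZMod.intCast_surjective (Multiplicative.toAdd x i)
    exact ⟨Multiplicative.ofAdd y, congrArg Multiplicative.ofAdd (funext hy)⟩
  have hk : sqGroup (Multiplicative (ι → ℤ)) = f.ker := by
    ext x
    rw [mem_sqGroup, MonoidHom.mem_ker]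
    have h1 : f x = 1 ↔ ∀ i, ((Multiplicative.toAdd x i : ℤ) : ZMod 2) = 0 :=
      ⟨fun h i => congrFun (congrArg Multiplicative.toAdd h) i,
        fun h => congrArg Multiplicative.ofAdd (funext h)⟩
    rw [h1]
    constructor
    · rintro ⟨h, rfl⟩ i
      have : (Multiplicative.toAdd (h ^ 2 : Multiplicative (ι → ℤ)) : ι → ℤ) i =
          2 * (Multiplicative.toAdd h : ι → ℤ) i := by
        simp [toAdd_pow]
      rw [this]; push_cast; rw [show (2 : ZMod 2) = 0 from rfl, zero_mul]
    · intro h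
      have : ∀ i, ∃ z : ℤ, Multiplicative.toAdd x i = 2 * z := fun i => by
        have := (ZMod.intCast_zmod_eq_zero_iff_dvd _ 2).1 (h i)
        exact this
      choose z hz using this
      refine ⟨Multiplicative.ofAdd z, ?_⟩
      apply Multiplicative.toAdd.injective
      funext i
      rw [hz i]; simp [toAdd_pow]
  rw [hk, Subgroup.index_ker, MonoidHom.range_eq_top.2 hf]
  rw [Nat.card_congr Subgroup.topEquiv.toEquiv]
  simp [Nat.card_congr (Multiplicative.toAdd (α := ι → ZMod 2)), Nat.card_fun, Nat.card_eq_fintype_card]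

theorem sqGroup_index_int : (sqGroup (Multiplicative ℤ)).index = 2 := by
  rw [sqGroup_index_congr (AddEquiv.toMultiplicative (AddEquiv.funUnique Unit ℤ).symm :
    Multiplicative ℤ ≃* Multiplicative (Unit → ℤ)), sqGroup_index_int_pi]
  simp

end SqIndex

section LocalField
open IsLocalRing
variable {O : Type*} [CommRing O] [IsDomain O] [IsDiscreteValuationRing O] [HenselianLocalRing O]
  {F : Type*} [Field F] [Algebra O F] [IsFractionRing O F]

theorem isSquare_of_residue (h2 : IsUnit (2 : O)) {u : O} (hu : IsUnit u)
    (h : IsSquare (residue O u)) : IsSquare u := by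
  obtain ⟨w, hw⟩ := h2
  obtain ⟨r, hr⟩ := h
  obtain ⟨d, rfl⟩ := residue_surjective r
  have hw' : (2 : O) * (w⁻¹ : Oˣ) = 1 := by rw [← hw]; simp
  have e : u = 1 + 4 * ((u - 1) * ((w⁻¹ : Oˣ) : O) ^ 2) := by
    linear_combination (1 - u) * (2 * ((w⁻¹ : Oˣ) : O) + 1) * hw'
  rw [e]
  refine isSquare_one_add_four_mul (t := (d - 1) * (w⁻¹ : Oˣ)) (by rwa [← e]) ?_
  have h3 : d ^ 2 - u ∈ maximalIdeal O := by
    rw [← residue_eq_zero_iff, map_sub, hr, map_pow]; ring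
  convert Ideal.mul_mem_left _ (((w⁻¹ : Oˣ) : O) ^ 2) h3 using 1
  linear_combination (1 - d) * ((w⁻¹ : Oˣ) : O) * hw'

variable [Finite (ResidueField O)]

theorem ringChar_residueField_ne_two (h2 : IsUnit (2 : O)) : ringChar (ResidueField O) ≠ 2 := by
  intro h
  have : ((2 : ℕ) : ResidueField O) = 0 := by
    rw [← h]; exact ringChar.Nat.cast_ringChar
  have h3 := h2.map (residue O)
  rw [map_ofNat] at h3
  exact h3.ne_zero (by exact_mod_cast this)

theorem isSquare_mul_of_not (h2 : IsUnit (2 : O)) {u w : O} (hu : IsUnit u) (hw : IsUnit w)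
    (hu' : ¬ IsSquare u) (hw' : ¬ IsSquare w) : IsSquare (u * w) := by
  classical
  apply isSquare_of_residue h2 (hu.mul hw)
  cases nonempty_fintype (ResidueField O)
  have h1 : ¬ IsSquare (residue O u) := fun h => hu' (isSquare_of_residue h2 hu h)
  have h3 : ¬ IsSquare (residue O w) := fun h => hw' (isSquare_of_residue h2 hw h)
  have hc := ringChar_residueField_ne_two h2
  rw [← quadraticChar_neg_one_iff_not_isSquare] at h1 h3
  rw [map_mul]
  have hne : residue O u * residue O w ≠ 0 :=
    mul_ne_zero (hu.map (residue O)).ne_zero (hw.map (residue O)).ne_zero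
  rw [← quadraticChar_one_iff_isSquare hne, map_mul, h1, h3]; norm_num

/-- At a nondyadic place, units are norms from extensions generated by square roots of units. -/
theorem isNrm_units (h2 : IsUnit (2 : O)) {u w : O} (hu : IsUnit u) (hw : IsUnit w) :
    IsNrm (algebraMap O F u) (algebraMap O F w) := by
  cases nonempty_fintype (ResidueField O)
  have hc := FiniteField.odd_card_of_char_ne_two (ringChar_residueField_ne_two h2)
  have hur := (hu.map (residue O)).ne_zero
  obtain ⟨a, b, hab⟩ := FiniteField.exists_root_sum_quadratic
    (f := (X ^ 2 - C (residue O w) : (ResidueField O)[X])) (g := - C (residue O u) * X ^ 2)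
    (by compute_degree!) (by rw [neg_mul, degree_neg, degree_C_mul_X_pow 2 hur]; rfl) hc
  obtain ⟨x, rfl⟩ := residue_surjective a
  obtain ⟨y, rfl⟩ := residue_surjective b
  set c := x ^ 2 - u * y ^ 2
  have hcw : residue O c = residue O w := by
    simp at hab
    simp only [c, map_sub, map_mul, map_pow]
    linear_combination hab
  have hcu : IsUnit c := by
    by_contra hn
    rw [(residue_eq_zero_iff c).2 ((mem_maximalIdeal _).2 hn)] at hcw
    exact (hw.map (residue O)).ne_zero hcw.symm
  obtain ⟨d, hd⟩ : IsSquare (c * w) := by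
    apply isSquare_of_residue h2 (hcu.mul hw)
    rw [map_mul, hcw]; exact ⟨_, rfl⟩
  have h3 : IsNrm (algebraMap O F u) (algebraMap O F c) :=
    ⟨algebraMap O F x, algebraMap O F y, by simp [c]⟩
  refine h3.of_mul_left (by simpa using hcu.ne_zero) ?_
  rw [← map_mul, hd, ← sq, map_pow]
  exact isNrm_sq _ _

variable (F) in
/-- `Fˣ` is the product of the unit group and the group generated by a uniformizer. -/
theorem sqGroup_index_eq_two_mul :
    (sqGroup Fˣ).index = 2 * (sqGroup Oˣ).index := by
  obtain ⟨π, hπ⟩ := IsDiscreteValuationRing.exists_irreducible O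
  have hp : algebraMap O F π ≠ 0 := by simpa using hπ.ne_zero
  let f : Oˣ × Multiplicative ℤ →* Fˣ :=
    (Units.map (algebraMap O F).toMonoidHom).coprod (zpowersHom Fˣ (Units.mk0 _ hp))
  have hfv : ∀ u n, ((f (u, Multiplicative.ofAdd n) : Fˣ) : F) =
      algebraMap O F u * algebraMap O F π ^ n := by
    intro u n; simp [f, zpowersHom]
  have hbij : Function.Bijective f := by
    constructor
    · rw [injective_iff_map_eq_one]
      rintro ⟨u, n⟩ h
      have h1 := congrArg (Units.val) h
      have h2 := hfv u (Multiplicative.toAdd n)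
      rw [ofAdd_toAdd, h1, Units.val_one] at h2
      have hn := unit_mul_zpow_eq_one hπ h2.symm
      have hn' : n = 1 := Multiplicative.toAdd.injective hn
      rw [hn, zpow_zero, mul_one, ← map_one (algebraMap O F)] at h2
      have hu : u = 1 := Units.ext (IsFractionRing.injective O F h2.symm)
      rw [hn', hu]; rfl
    · intro x
      obtain ⟨n, u, hx⟩ := exists_unit_mul_zpow F hπ x.ne_zero
      exact ⟨(u, Multiplicative.ofAdd n), Units.ext (by rw [hfv, hx])⟩
  rw [← sqGroup_index_congr (MulEquiv.ofBijective f hbij), sqGroup_index_prod, sqGroup_index_int,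
    mul_comm]

/-- The higher unit groups. -/
def unitGroupMod (a : O) : Subgroup Oˣ :=
  (Units.map (Ideal.Quotient.mk (Ideal.span {a})).toMonoidHom).ker

theorem mem_unitGroupMod {a : O} {u : Oˣ} : u ∈ unitGroupMod a ↔ a ∣ (u : O) - 1 := by
  rw [unitGroupMod, MonoidHom.mem_ker, Units.ext_iff, ← Ideal.mem_span_singleton,
    ← Ideal.Quotient.eq_zero_iff_mem, map_sub, sub_eq_zero]
  simp

theorem finite_quotient_pow {π : O} (hπ : Irreducible π) (k : ℕ) :
    Finite (O ⧸ Ideal.span {π ^ k}) := by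
  rw [← Ideal.span_singleton_pow, ← hπ.maximalIdeal_eq]
  have : Finite (O ⧸ maximalIdeal O) := ‹Finite (ResidueField O)›
  exact Ideal.finite_quotient_pow (IsNoetherian.noetherian _) k

theorem unitGroupMod_index_ne_zero {π : O} (hπ : Irreducible π) (k : ℕ) :
    (unitGroupMod (π ^ k)).index ≠ 0 := by
  have := finite_quotient_pow hπ k
  rw [unitGroupMod, Subgroup.index_ker]
  exact Nat.card_pos.ne'

theorem unitGroupMod_relIndex {π : O} (hπ : Irreducible π) (e : ℕ) :
    (unitGroupMod (π ^ (2 * e + 1))).relIndex (unitGroupMod (π ^ (e + 1))) =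
      Nat.card (O ⧸ Ideal.span {π ^ e}) := by
  have hunit : ∀ z : O, IsUnit (1 + π ^ (e + 1) * z) := fun z => by
    by_contra hn
    have h3 : π ^ (e + 1) * z ∈ maximalIdeal O := by
      rw [hπ.maximalIdeal_eq, Ideal.mem_span_singleton]
      exact (dvd_pow_self π (by omega)).mul_right _
    exact (mem_maximalIdeal _).1 ((Ideal.add_mem_iff_left _ h3).1 ((mem_maximalIdeal _).2 hn))
      isUnit_one
  let g : O → unitGroupMod (π ^ (e + 1)) := fun z =>
    ⟨(hunit z).unit, mem_unitGroupMod.2 ⟨z, by simp⟩⟩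
  have hg : ∀ z, (((g z : unitGroupMod (π ^ (e + 1))) : Oˣ) : O) = 1 + π ^ (e + 1) * z :=
    fun z => rfl
  set N := (unitGroupMod (π ^ (2 * e + 1))).subgroupOf (unitGroupMod (π ^ (e + 1)))
  have hN : ∀ x y : unitGroupMod (π ^ (e + 1)), x⁻¹ * y ∈ N ↔
      π ^ (2 * e + 1) ∣ ((y : Oˣ) : O) - ((x : Oˣ) : O) := by
    intro x y
    rw [Subgroup.mem_subgroupOf, mem_unitGroupMod]
    have e1 : ((y : Oˣ) : O) - ((x : Oˣ) : O) =
        ((x : Oˣ) : O) * ((((x⁻¹ * y : unitGroupMod (π ^ (e + 1))) : Oˣ) : O) - 1) := by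
      simp [mul_sub]
    rw [e1, Units.dvd_mul_left]
  let f : Multiplicative O →* (unitGroupMod (π ^ (e + 1))) ⧸ N := MonoidHom.mk'
    (fun z => QuotientGroup.mk (g (Multiplicative.toAdd z))) (by
      intro a b
      rw [← QuotientGroup.mk_mul, QuotientGroup.eq, hN]
      refine ⟨π * (Multiplicative.toAdd a * Multiplicative.toAdd b), ?_⟩
      rw [Subgroup.coe_mul, Units.val_mul, hg, hg, hg, toAdd_mul]
      ring)
  have hfs : Function.Surjective f := by
    intro q
    obtain ⟨x, rfl⟩ := QuotientGroup.mk_surjective q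
    obtain ⟨z, hz⟩ := mem_unitGroupMod.1 x.2
    refine ⟨Multiplicative.ofAdd z, ?_⟩
    have h1 : g z = x := Subtype.ext (Units.ext (by rw [hg, ← hz]; ring))
    show QuotientGroup.mk (g z) = _
    rw [h1]
  have hker : f.ker = AddSubgroup.toSubgroup (Ideal.span {π ^ e}).toAddSubgroup := by
    ext z
    rw [MonoidHom.mem_ker]
    have h1 : f z = 1 ↔ (1 : unitGroupMod (π ^ (e + 1)))⁻¹ * g (Multiplicative.toAdd z) ∈ N := by
      rw [← QuotientGroup.eq]; exact eq_comm
    rw [h1, hN, hg]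
    have h2 : z ∈ AddSubgroup.toSubgroup (Ideal.span {π ^ e}).toAddSubgroup ↔
      π ^ e ∣ (Multiplicative.toAdd z : O) :=
      (Ideal.mem_span_singleton (x := (Multiplicative.toAdd z : O)) (y := π ^ e))
    rw [h2, show 2 * e + 1 = (e + 1) + e by ring, pow_add]
    simp only [Subgroup.coe_one, Units.val_one, add_sub_cancel_left]
    exact mul_dvd_mul_iff_left (pow_ne_zero _ hπ.ne_zero)
  rw [Subgroup.relIndex, Subgroup.index, ← Nat.card_congr (QuotientGroup.quotientKerEquivOfSurjective f hfs).toEquiv,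
    hker]
  rfl

theorem sqGroup_units_index [CharZero O] :
    (sqGroup Oˣ).index = 2 * Nat.card (O ⧸ Ideal.span {(2 : O)}) := by
  obtain ⟨π, hπ⟩ := IsDiscreteValuationRing.exists_irreducible O
  obtain ⟨e, η, h2⟩ := IsDiscreteValuationRing.eq_unit_mul_pow_irreducible (two_ne_zero (α := O)) hπ
  have hspan : Ideal.span {(2 : O)} = Ideal.span {π ^ e} := by
    rw [Ideal.span_singleton_eq_span_singleton, h2]
    exact associated_unit_mul_left _ _ η.isUnit
  have h4 : (4 : O) = η ^ 2 * π ^ (2 * e) := by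
    rw [show (4 : O) = 2 ^ 2 by norm_num, h2]; ring
  set U := unitGroupMod (π ^ (2 * e + 1))
  set V := unitGroupMod (π ^ (e + 1))
  set W := U.comap (powMonoidHom 2 : Oˣ →* Oˣ) with hW
  have hUsq : U ≤ sqGroup Oˣ := by
    intro u hu
    obtain ⟨z, hz⟩ := mem_unitGroupMod.1 hu
    have h5 : (u : O) = 1 + 4 * (((η⁻¹ : Oˣ) : O) ^ 2 * π * z) := by
      have : (η : O) * (η⁻¹ : Oˣ) = 1 := by simp
      rw [h4]
      linear_combination hz - π ^ (2 * e + 1) * z * (η * (η⁻¹ : Oˣ) + 1) * this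
    obtain ⟨d, hd⟩ := isSquare_one_add_four_mul_of_mem (O := O)
      (ρ := ((η⁻¹ : Oˣ) : O) ^ 2 * π * z) (by
        rw [hπ.maximalIdeal_eq, Ideal.mem_span_singleton]
        exact (dvd_mul_left _ _).mul_right _)
    rw [← h5] at hd
    have hdu : IsUnit d := isUnit_of_mul_isUnit_left (hd ▸ u.isUnit)
    exact ⟨hdu.unit, Units.ext (by simp [hd, sq])⟩
  have hVW : V ≤ W := by
    intro u hu
    obtain ⟨z, hz⟩ := mem_unitGroupMod.1 hu
    rw [hW, Subgroup.mem_comap]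
    refine mem_unitGroupMod.2 ⟨η * z + π * z ^ 2, ?_⟩
    have hz' : (u : O) = 1 + π ^ (e + 1) * z := by linear_combination hz
    simp only [powMonoidHom_apply, Units.val_pow_eq_pow_val, hz']
    linear_combination π ^ (e + 1) * z * h2
  have hUV : U ≤ V := by
    intro u hu
    exact mem_unitGroupMod.2 ((pow_dvd_pow π (by omega)).trans (mem_unitGroupMod.1 hu))
  have hVrel : V.relIndex W = 2 := by
    rw [Subgroup.relIndex_eq_two_iff]
    have hpe : ¬ π ^ (e + 1) ∣ 2 := by
      rw [h2, Units.dvd_mul_left, pow_dvd_pow_iff hπ.ne_zero hπ.not_isUnit]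
      omega
    refine ⟨-1, ?_, fun b hb => ?_⟩
    · rw [hW, Subgroup.mem_comap]; exact mem_unitGroupMod.2 (by simp)
    · rw [hW, Subgroup.mem_comap] at hb
      have hb' := mem_unitGroupMod.1 hb
      simp only [powMonoidHom_apply, Units.val_pow_eq_pow_val] at hb'
      have hb2 : (b : O) ^ 2 - 1 = (b - 1) * (b + 1) := by ring
      rw [hb2] at hb'
      rw [mem_unitGroupMod, mem_unitGroupMod]
      have e1 : ((b * -1 : Oˣ) : O) - 1 = -(b + 1) := by simp; ring
      rw [e1, dvd_neg]
      have hnot : ¬ (π ^ (e + 1) ∣ (b : O) - 1 ∧ π ^ (e + 1) ∣ (b : O) + 1) := by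
        rintro ⟨h1, h3⟩
        apply hpe
        convert dvd_sub h3 h1 using 1; ring
      have hor : π ^ (e + 1) ∣ (b : O) - 1 ∨ π ^ (e + 1) ∣ (b : O) + 1 := by
        by_contra hc
        push Not at hc
        by_cases h0 : (b : O) - 1 = 0
        · exact hc.1 (by simp [h0])
        by_cases h1 : (b : O) + 1 = 0
        · exact hc.2 (by simp [h1])
        obtain ⟨m, r, hr⟩ := IsDiscreteValuationRing.eq_unit_mul_pow_irreducible h0 hπ
        obtain ⟨n, s, hs⟩ := IsDiscreteValuationRing.eq_unit_mul_pow_irreducible h1 hπ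
        rw [hr, hs, show (r * π ^ m * (s * π ^ n) : O) = (r * s : Oˣ) * π ^ (m + n) by
          rw [Units.val_mul]; ring, Units.dvd_mul_left,
          pow_dvd_pow_iff hπ.ne_zero hπ.not_isUnit] at hb'
        rw [hr, hs, Units.dvd_mul_left, Units.dvd_mul_left,
          pow_dvd_pow_iff hπ.ne_zero hπ.not_isUnit, pow_dvd_pow_iff hπ.ne_zero hπ.not_isUnit] at hc
        omega
      rcases hor with h | h
      · exact Or.inr ⟨h, fun h' => hnot ⟨h, h'⟩⟩
      · exact Or.inl ⟨h, fun h' => hnot ⟨h', h⟩⟩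
  have i1 : U.relIndex (sqGroup Oˣ) = W.index := by
    rw [hW, Subgroup.index_comap]; rfl
  have i2 := Subgroup.relIndex_mul_index hUsq
  have i3 := Subgroup.relIndex_mul_index (hUV.trans hVW)
  have i4 := Subgroup.relIndex_mul_relIndex U V W hUV hVW
  have i0 : U.index ≠ 0 := unitGroupMod_index_ne_zero hπ _
  have hWi : W.index ≠ 0 := fun h => i0 (by rw [← i3, h, mul_zero])
  rw [i1] at i2
  have i5 : (sqGroup Oˣ).index = U.relIndex W := by
    apply Nat.eq_of_mul_eq_mul_left (Nat.pos_of_ne_zero hWi)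
    rw [i2, ← i3, mul_comm]
  rw [i5, ← i4, hVrel, unitGroupMod_relIndex hπ, hspan, mul_comm]

variable (F) in
theorem sqGroup_index_local [CharZero O] :
    (sqGroup Fˣ).index = 4 * Nat.card (O ⧸ Ideal.span {(2 : O)}) := by
  rw [sqGroup_index_eq_two_mul F (O := O), sqGroup_units_index, ← mul_assoc]; norm_num

end LocalField

section

open NumberField IsDedekindDomain

section Henselian

theorem henselianLocalRing_of_norm {F : Type*} [NormedField F] [CompleteSpace F]
    (O : ValuationSubring F) (hO : ∀ x, x ∈ O ↔ ‖x‖ ≤ 1) [IsDiscreteValuationRing O] :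
    HenselianLocalRing O := by
  obtain ⟨π, hπ⟩ := IsDiscreteValuationRing.exists_irreducible O
  have hπ0 : (π : F) ≠ 0 := by simpa using hπ.ne_zero
  have hpos : 0 < ‖(π : F)‖ := norm_pos_iff.2 hπ0
  have hlt : ‖(π : F)‖ < 1 := by
    by_contra h
    push Not at h
    have : (π : F)⁻¹ ∈ O := (hO _).2 (by rw [norm_inv]; exact inv_le_one_of_one_le₀ h)
    exact hπ.not_isUnit (IsUnit.of_mul_eq_one ⟨_, this⟩ (Subtype.ext (mul_inv_cancel₀ hπ0)))
  have hmem : ∀ (n : ℕ) (x : O), x ∈ IsLocalRing.maximalIdeal O ^ n ↔ ‖(x : F)‖ ≤ ‖(π : F)‖ ^ n := by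
    intro n x
    rw [hπ.maximalIdeal_eq, Ideal.span_singleton_pow, Ideal.mem_span_singleton]
    constructor
    · rintro ⟨y, rfl⟩
      have := (hO y).1 y.2
      push_cast
      rw [norm_mul, norm_pow]
      exact mul_le_of_le_one_right (by positivity) this
    · intro h
      refine ⟨⟨x / π ^ n, (hO _).2 ?_⟩, ?_⟩
      · rw [norm_div, norm_pow]; exact div_le_one_of_le₀ h (by positivity)
      · apply Subtype.ext; push_cast; field_simp
  have : IsAdicComplete (IsLocalRing.maximalIdeal O) O :=
    { haus' := by
        intro x hx
        have h1 : ∀ n : ℕ, ‖(x : F)‖ ≤ ‖(π : F)‖ ^ n := fun n => by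
          have := hx n
          rw [SModEq.zero, smul_eq_mul, Ideal.mul_top] at this
          exact (hmem n x).1 this
        have h2 : ‖(x : F)‖ ≤ 0 :=
          ge_of_tendsto' (tendsto_pow_atTop_nhds_zero_of_lt_one hpos.le hlt) h1
        exact Subtype.ext (norm_le_zero_iff.1 h2)
      prec' := by
        intro f hf
        have hf' : ∀ {m n}, m ≤ n → ‖(f m : F) - f n‖ ≤ ‖(π : F)‖ ^ m := fun {m n} h => by
          have := hf h
          rw [SModEq.sub_mem, smul_eq_mul, Ideal.mul_top] at this
          exact (hmem m _).1 this
        have hc : CauchySeq (fun n => (f n : F)) := by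
          apply cauchySeq_of_le_geometric (r := ‖(π : F)‖) (C := 1) hlt
          intro n
          rw [dist_eq_norm, one_mul]
          exact hf' (Nat.le_succ n)
        obtain ⟨L, hL⟩ := cauchySeq_tendsto_of_complete hc
        have hLn : ∀ n, ‖(f n : F) - L‖ ≤ ‖(π : F)‖ ^ n := by
          intro n
          refine le_of_tendsto ((tendsto_const_nhds.sub hL).norm) ?_
          filter_upwards [Filter.eventually_ge_atTop n] with m hm using hf' hm
        have hLO : L ∈ O := by
          rw [hO]
          refine le_of_tendsto hL.norm (Filter.Eventually.of_forall fun n => (hO _).1 (f n).2)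
        refine ⟨⟨L, hLO⟩, fun n => ?_⟩
        rw [SModEq.sub_mem, smul_eq_mul, Ideal.mul_top]
        exact (hmem n _).2 (hLn n) }
  have h : HenselianRing O (IsLocalRing.maximalIdeal O) := inferInstance
  refine ⟨fun f hf a₀ h₁ h₂ => h.is_henselian f hf a₀ h₁ ?_⟩
  exact h₂.map (Ideal.Quotient.mk _)

end Henselian

section Adic
variable {K : Type*} [Field K] [NumberField K] (p : HeightOneSpectrum (𝓞 K))

theorem adic_norm_le_one_iff (x : p.adicCompletion K) :
    x ∈ p.adicCompletionIntegers K ↔ ‖x‖ ≤ 1 := by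
  rw [HeightOneSpectrum.mem_adicCompletionIntegers, FinitePlace.norm_def]
  have h := WithZeroMulInt.toNNReal_strictMono (HeightOneSpectrum.one_lt_absNorm_nnreal p)
  rw [← NNReal.coe_one, NNReal.coe_le_coe, ← map_one (WithZeroMulInt.toNNReal
    (HeightOneSpectrum.absNorm_ne_zero p)), h.le_iff_le]

theorem adic_norm_algebraMap (x : K) : ‖algebraMap K (p.adicCompletion K) x‖ =
    HeightOneSpectrum.adicAbv K p x := FinitePlace.norm_embedding p x

theorem valued_algebraMap (x : K) :
    Valued.v (algebraMap K (p.adicCompletion K) x) = p.valuation K x :=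
  p.valuedAdicCompletion_eq_valuation' x

instance henselian_adicCompletionIntegers : HenselianLocalRing (p.adicCompletionIntegers K) :=
  henselianLocalRing_of_norm _ (adic_norm_le_one_iff p)

instance charZero_adicCompletion : CharZero (p.adicCompletion K) :=
  charZero_of_injective_algebraMap (algebraMap K _).injective

instance charZero_adicCompletionIntegers : CharZero (p.adicCompletionIntegers K) :=
  charZero_of_injective_algebraMap (R := 𝓞 K) (FaithfulSMul.algebraMap_injective _ _)

theorem adic_norm_lt_iff (x : p.adicCompletion K) (γ : WithZero (Multiplicative ℤ)) :
    ‖x‖ < WithZeroMulInt.toNNReal (HeightOneSpectrum.absNorm_ne_zero p) γ ↔ Valued.v x < γ := by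
  rw [FinitePlace.norm_def, NNReal.coe_lt_coe]
  exact (WithZeroMulInt.toNNReal_strictMono (HeightOneSpectrum.one_lt_absNorm_nnreal p)).lt_iff_lt

/-- The integers are dense in the completed ring of integers. -/
theorem exists_integer_valued_sub_lt (x : p.adicCompletionIntegers K)
    {γ : WithZero (Multiplicative ℤ)} (hγ : γ ≠ 0) : ∃ r : 𝓞 K,
    Valued.v ((x : p.adicCompletion K) -
      algebraMap K (p.adicCompletion K) (algebraMap (𝓞 K) K r)) < γ := by
  have hm : min γ 1 ≠ 0 := by
    rcases min_choice γ 1 with h | h <;> rw [h]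
    · exact hγ
    · exact one_ne_zero
  have hpos : (0 : ℝ) < WithZeroMulInt.toNNReal (HeightOneSpectrum.absNorm_ne_zero p) (min γ 1) := by
    rw [NNReal.coe_pos, pos_iff_ne_zero]
    exact (_root_.map_ne_zero _).2 hm
  obtain ⟨k, hk⟩ := (p.denseRange_algebraMap K).exists_dist_lt (x : p.adicCompletion K) hpos
  rw [dist_eq_norm, adic_norm_lt_iff] at hk
  have hk1 : p.valuation K k ≤ 1 := by
    rw [← valued_algebraMap]
    have := (Valued.v (R := p.adicCompletion K)).map_sub (x : p.adicCompletion K)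
      ((x : p.adicCompletion K) - algebraMap K _ k)
    rw [sub_sub_cancel] at this
    exact this.trans (max_le ((HeightOneSpectrum.mem_adicCompletionIntegers _ _ _).1 x.2)
      (hk.le.trans (min_le_right _ _)))
  obtain ⟨r, hr⟩ := p.exists_valuation_sub_lt_of_integer hk1 (Units.mk0 γ hγ)
  refine ⟨r, ?_⟩
  rw [← valued_algebraMap, map_sub] at hr
  rw [show (x : p.adicCompletion K) - algebraMap K (p.adicCompletion K) (algebraMap (𝓞 K) K r) =
    ((x : p.adicCompletion K) - algebraMap K _ k) -
      (algebraMap K (p.adicCompletion K) (algebraMap (𝓞 K) K r) - algebraMap K _ k) by ring]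
  refine (Valuation.map_sub _ _ _).trans_lt (max_lt (hk.trans_le (min_le_left _ _)) hr)

/-- Quotients of the completed ring of integers. -/
theorem dvd_iff_valued_le {a b : p.adicCompletionIntegers K} :
    a ∣ b ↔ Valued.v (b : p.adicCompletion K) ≤ Valued.v (a : p.adicCompletion K) :=
  (Valuation.valuationSubring.integers _).dvd_iff_le

noncomputable def adicQuotientMap (a : p.adicCompletionIntegers K) :
    𝓞 K →+* p.adicCompletionIntegers K ⧸ Ideal.span {a} :=
  (Ideal.Quotient.mk _).comp (algebraMap _ _)

theorem adicQuotientMap_surjective {a : p.adicCompletionIntegers K} (ha : a ≠ 0) :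
    Function.Surjective (adicQuotientMap p a) := by
  intro y
  obtain ⟨x, rfl⟩ := Ideal.Quotient.mk_surjective y
  have ha' : Valued.v (a : p.adicCompletion K) ≠ 0 := by
    rw [Valuation.ne_zero_iff]; simpa using ha
  obtain ⟨r, hr⟩ := exists_integer_valued_sub_lt p x ha'
  refine ⟨r, ?_⟩
  symm
  rw [adicQuotientMap, RingHom.comp_apply, Ideal.Quotient.eq, Ideal.mem_span_singleton,
    dvd_iff_valued_le]
  exact hr.le

theorem adicQuotientMap_ker (a : p.adicCompletionIntegers K) (r : 𝓞 K) :
    r ∈ RingHom.ker (adicQuotientMap p a) ↔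
      p.valuation K (algebraMap (𝓞 K) K r) ≤ Valued.v (a : p.adicCompletion K) := by
  rw [RingHom.mem_ker, adicQuotientMap, RingHom.comp_apply, Ideal.Quotient.eq_zero_iff_mem,
    Ideal.mem_span_singleton, dvd_iff_valued_le, ← valued_algebraMap]
  rfl

theorem ker_adicQuotientMap_two : RingHom.ker (adicQuotientMap p 2) =
    p.maxPowDividing (Ideal.span {(2 : 𝓞 K)}) := by
  ext r
  rw [adicQuotientMap_ker, HeightOneSpectrum.maxPowDividing, ← p.intValuation_le_pow_iff_mem,
    ← p.intValuation_if_neg two_ne_zero, p.valuation_of_algebraMap]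
  have : (((2 : p.adicCompletionIntegers K)) : p.adicCompletion K) =
    algebraMap K (p.adicCompletion K) (algebraMap (𝓞 K) K 2) := by
    rw [_root_.map_ofNat, _root_.map_ofNat]; rfl
  rw [this, valued_algebraMap, p.valuation_of_algebraMap]

theorem card_quotient_two : (Nat.card (p.adicCompletionIntegers K ⧸
    Ideal.span {(2 : p.adicCompletionIntegers K)}) : ℝ) = ‖(2 : p.adicCompletion K)‖⁻¹ := by
  have h := HeightOneSpectrum.embedding_mul_absNorm K p (two_ne_zero (α := 𝓞 K))
  rw [← ker_adicQuotientMap_two, Ideal.absNorm_apply, Submodule.cardQuot_apply,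
    Nat.card_congr (RingHom.quotientKerEquivOfSurjective
      (adicQuotientMap_surjective p two_ne_zero)).toEquiv] at h
  rw [eq_inv_of_mul_eq_one_right h, _root_.map_ofNat, _root_.map_ofNat]

instance finite_residueField_adic :
    Finite (IsLocalRing.ResidueField (p.adicCompletionIntegers K)) := by
  obtain ⟨π, hπ⟩ := IsDiscreteValuationRing.exists_irreducible (p.adicCompletionIntegers K)
  have h := adicQuotientMap_surjective p hπ.ne_zero
  have hk : p.asIdeal ≤ RingHom.ker (adicQuotientMap p π) := by
    intro r hr
    rw [adicQuotientMap, RingHom.mem_ker, RingHom.comp_apply, Ideal.Quotient.eq_zero_iff_mem,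
      ← hπ.maximalIdeal_eq, IsLocalRing.mem_maximalIdeal, mem_nonunits_iff,
      HeightOneSpectrum.adicCompletionIntegers.isUnit_iff_valued_eq_one]
    have := (p.valuation_lt_one_iff_mem (K := K) r).2 hr
    rw [← valued_algebraMap] at this
    exact this.ne
  have hfin : Finite (𝓞 K ⧸ p.asIdeal) := p.asIdeal.finiteQuotientOfFreeOfNeBot p.ne_bot
  have h2 : Function.Surjective (Ideal.Quotient.lift p.asIdeal (adicQuotientMap p π) hk) :=
    Ideal.Quotient.lift_surjective_of_surjective _ hk h
  have h3 := Finite.of_surjective _ h2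
  show Finite (_ ⧸ IsLocalRing.maximalIdeal _)
  rwa [hπ.maximalIdeal_eq]

end Adic

section OpenSquares

theorem isOpen_isSquare {F : Type*} [NontriviallyNormedField F] [CompleteSpace F]
    (h2 : (2 : F) ≠ 0) : IsOpen {x : F | x ≠ 0 ∧ IsSquare x} := by
  rw [isOpen_iff_mem_nhds]
  rintro _ ⟨h0, y, rfl⟩
  have hy : y ≠ 0 := fun h => h0 (by simp [h])
  have hd : HasStrictDerivAt (fun x : F => x * x) (2 * y) y := by
    rw [show 2 * y = 1 * y + y * 1 by ring]
    exact (hasStrictDerivAt_id y).mul (hasStrictDerivAt_id y)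
  have h3 := hd.map_nhds_eq (mul_ne_zero h2 hy)
  have h4 : {x : F | x ≠ 0 ∧ IsSquare x} ∈ Filter.map (fun x : F => x * x) (nhds y) := by
    rw [Filter.mem_map]
    filter_upwards [isOpen_ne.mem_nhds hy] with z hz
    exact ⟨mul_self_ne_zero.2 hz, z, rfl⟩
  rwa [h3] at h4

end OpenSquares

variable (K : Type u) [Field K] [NumberField K]

/-- The places of a number field. -/
abbrev Place := InfinitePlace K ⊕ HeightOneSpectrum (𝓞 K)

namespace Place
variable {K}

/-- The completion at a place. -/
def L : Place K → Type u
  | Sum.inl v => v.Completion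
  | Sum.inr p => p.adicCompletion K

noncomputable instance instNormedField : ∀ v : Place K, NormedField (L v)
  | Sum.inl v => inferInstanceAs (NormedField v.Completion)
  | Sum.inr p => inferInstanceAs (NormedField (p.adicCompletion K))

instance instCompleteSpace : ∀ v : Place K, CompleteSpace (L v)
  | Sum.inl v => inferInstanceAs (CompleteSpace v.Completion)
  | Sum.inr p => inferInstanceAs (CompleteSpace (p.adicCompletion K))

noncomputable instance instAlgebra : ∀ v : Place K, Algebra K (L v)
  | Sum.inl v => inferInstanceAs (Algebra K v.Completion)
  | Sum.inr p => inferInstanceAs (Algebra K (p.adicCompletion K))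

instance instCharZero (v : Place K) : CharZero (L v) :=
  charZero_of_injective_algebraMap (algebraMap K _).injective

/-- The map from `K` to the completion at `v`. -/
noncomputable abbrev ι (v : Place K) : K →+* L v := algebraMap K (L v)

theorem denseRange_ι : ∀ v : Place K, DenseRange (ι v)
  | Sum.inl v => (InfinitePlace.Completion.denseRange_coe v).comp
      (WithAbs.equiv v.1).symm.surjective.denseRange (InfinitePlace.Completion.continuous_coe v)
  | Sum.inr p => p.denseRange_algebraMap K

/-- The absolute value attached to a place. -/
noncomputable def abv (v : Place K) : AbsoluteValue K ℝ where
  toFun x := ‖ι v x‖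
  map_mul' x y := by rw [map_mul, norm_mul]
  nonneg' x := norm_nonneg _
  eq_zero' x := by simp
  add_le' x y := by rw [map_add]; exact norm_add_le _ _

theorem abv_inl (v : InfinitePlace K) : abv (Sum.inl v) = v.1 := by
  ext x
  exact InfinitePlace.Completion.norm_coe v (WithAbs.toAbs v.1 x)

theorem abv_inr (p : HeightOneSpectrum (𝓞 K)) (x : K) :
    abv (Sum.inr p) x = HeightOneSpectrum.adicAbv K p x := adic_norm_algebraMap p x

theorem abv_inr_lt_one_iff (p : HeightOneSpectrum (𝓞 K)) (x : 𝓞 K) :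
    abv (Sum.inr p) x < 1 ↔ x ∈ p.asIdeal := by
  rw [abv_inr]
  exact p.adicAbv_coe_lt_one_iff (HeightOneSpectrum.one_lt_absNorm_nnreal p) x

theorem abv_isNontrivial (v : Place K) : (abv v).IsNontrivial := by
  rcases v with v | p
  · rw [abv_inl]; exact v.isNontrivial
  · obtain ⟨x, hx, hx0⟩ := Submodule.exists_mem_ne_zero_of_ne_bot p.ne_bot
    exact ⟨x, by simpa using hx0, ((abv_inr_lt_one_iff p x).2 hx).ne⟩

theorem abv_not_isEquiv {v w : Place K} (h : v ≠ w) : ¬ (abv v).IsEquiv (abv w) := by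
  have key : ∀ (v : InfinitePlace K) (p : HeightOneSpectrum (𝓞 K)),
      ¬ (abv (Sum.inl v)).IsEquiv (abv (Sum.inr p)) := by
    intro v p h
    have h1 : abv (Sum.inl v) (2 : K)⁻¹ < 1 := by
      rw [abv_inl, map_inv₀]
      have h2 : v.1 (2 : K) = 2 := by
        obtain ⟨φ, hφ⟩ := v.2
        rw [← hφ, place_apply, _root_.map_ofNat]; simp
      rw [h2]; norm_num
    rw [h.lt_one_iff, map_inv₀] at h1
    have h2 : abv (Sum.inr p) (2 : K) ≤ 1 := by
      rw [abv_inr]; exact HeightOneSpectrum.adicAbv_natCast_le_one K p 2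
    have h3 : 0 < abv (Sum.inr p) (2 : K) := (abv _).pos two_ne_zero
    exact absurd (one_le_inv₀ h3 |>.2 h2) (not_le.2 h1)
  rcases v with v | p <;> rcases w with w | q
  · rw [abv_inl, abv_inl, ← InfinitePlace.eq_iff_isEquiv]
    exact fun h' => h (by rw [h'])
  · exact key v q
  · exact fun h' => key w p h'.symm
  · intro h'
    apply h
    congr 1
    ext x
    rw [← abv_inr_lt_one_iff, ← abv_inr_lt_one_iff]
    exact h'.lt_one_iff

theorem exists_one_lt_norm (v : Place K) : ∃ x : L v, 1 < ‖x‖ := by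
  obtain ⟨x, hx⟩ := (abv_isNontrivial v).exists_abv_gt_one
  exact ⟨ι v x, hx⟩

theorem isOpen_sq (v : Place K) : IsOpen {x : L v | x ≠ 0 ∧ IsSquare x} :=
  let : NontriviallyNormedField (L v) :=
    { instNormedField v with non_trivial := exists_one_lt_norm v }
  isOpen_isSquare two_ne_zero

theorem exists_norm_sub_lt (S : Finset (Place K)) (x : ∀ v : Place K, L v) {ε : ℝ} (hε : 0 < ε) :
    ∃ a : K, ∀ v ∈ S, ‖ι v a - x v‖ < ε := by
  have h1 : ∀ v : Place K, ∃ k : K, ‖ι v k - x v‖ < ε / 2 := fun v => by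
    obtain ⟨k, hk⟩ := (denseRange_ι v).exists_dist_lt (x v) (half_pos hε)
    exact ⟨k, by rwa [dist_comm, dist_eq_norm] at hk⟩
  choose k hk using h1
  have h2 := AbsoluteValue.denseRange_algebraMap_pi (ι := S) (F := K) (v := fun v => abv v.1)
    (fun v => abv_isNontrivial v.1) (fun v w h => abv_not_isEquiv (fun h' => h (Subtype.ext h')))
  obtain ⟨a, ha⟩ := h2.exists_dist_lt (fun v : S => WithAbs.toAbs (abv v.1) (k v.1)) (half_pos hε)
  refine ⟨a, fun v hv => ?_⟩
  have h3 := (dist_le_pi_dist _ _ ⟨v, hv⟩).trans_lt ha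
  rw [dist_comm, dist_eq_norm] at h3
  have h4 : ‖ι v (a - k v)‖ < ε / 2 := h3
  rw [map_sub] at h4
  calc ‖ι v a - x v‖ = ‖(ι v a - ι v (k v)) + (ι v (k v) - x v)‖ := by congr 1; ring
    _ ≤ _ := norm_add_le _ _
    _ < ε := by linarith [hk v]

/-- Weak approximation. -/
theorem weak_approx {n : Type*} [Finite n] (S : Finset (Place K)) (U : ∀ v : Place K, Set (n → L v))
    (hU : ∀ v ∈ S, IsOpen (U v)) (hne : ∀ v ∈ S, (U v).Nonempty) :
    ∃ a : n → K, ∀ v ∈ S, (fun i => ι v (a i)) ∈ U v := by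
  classical
  cases nonempty_fintype n
  have h1 : ∀ v : Place K, ∃ x : n → L v, ∃ ε > 0, v ∈ S → Metric.ball x ε ⊆ U v := by
    intro v
    by_cases hv : v ∈ S
    · obtain ⟨x, hx⟩ := hne v hv
      obtain ⟨ε, hε, h⟩ := Metric.isOpen_iff.1 (hU v hv) x hx
      exact ⟨x, ε, hε, fun _ => h⟩
    · exact ⟨0, 1, one_pos, fun h => absurd h hv⟩
  choose x ε hε hx using h1
  obtain ⟨δ, hδ, hδ'⟩ : ∃ δ > 0, ∀ v ∈ S, δ ≤ ε v := by
    rcases S.eq_empty_or_nonempty with rfl | hS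
    · exact ⟨1, one_pos, by simp⟩
    · exact ⟨S.inf' hS ε, by rw [gt_iff_lt, Finset.lt_inf'_iff]; exact fun v _ => hε v,
        fun v hv => Finset.inf'_le _ hv⟩
  choose a ha using fun i : n => exists_norm_sub_lt S (fun v => x v i) hδ
  refine ⟨a, fun v hv => hx v hv ?_⟩
  rw [Metric.mem_ball, dist_pi_lt_iff (hε v)]
  intro i
  rw [dist_eq_norm]
  exact (ha i v hv).trans_le (hδ' v hv)

/-- Weak approximation modulo squares. -/
theorem exists_isSquare_mul (S : Finset (Place K)) (x : ∀ v : Place K, L v)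
    (hx : ∀ v ∈ S, x v ≠ 0) :
    ∃ a : K, a ≠ 0 ∧ ∀ v ∈ S, IsSquare (ι v a * x v) := by
  by_cases hS : S = ∅
  · exact ⟨1, one_ne_zero, by simp [hS]⟩
  obtain ⟨w, hw⟩ := Finset.nonempty_of_ne_empty hS
  obtain ⟨a, ha⟩ := weak_approx (n := Unit) S
    (fun v => {y : Unit → L v | y () * x v ∈ {z : L v | z ≠ 0 ∧ IsSquare z}})
    (fun v _ => (isOpen_sq v).preimage (by fun_prop))
    (fun v hv => ⟨fun _ => x v, mul_self_ne_zero.2 (hx v hv), x v, rfl⟩)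
  refine ⟨a (), fun h => ?_, fun v hv => (ha v hv).2⟩
  have := (ha w hw).1
  simp [h] at this

end Place

variable {K : Type u} [Field K] [NumberField K]

namespace Place

theorem sqGroup_index_real : (sqGroup ℝˣ).index = 2 := by
  rw [Subgroup.index_eq_two_iff]
  refine ⟨-1, fun b => ?_⟩
  rw [mem_sqGroup_units, mem_sqGroup_units]
  simp only [Units.val_mul, Units.val_neg, Units.val_one, Real.isSquare_iff]
  rcases lt_or_gt_of_ne b.ne_zero with h | h
  · exact Or.inl ⟨by linarith, by linarith⟩
  · exact Or.inr ⟨by linarith, by linarith⟩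

theorem sqGroup_index_complex : (sqGroup ℂˣ).index = 1 := by
  rw [Subgroup.index_eq_one, eq_top_iff]
  intro b _
  rw [mem_sqGroup_units]
  exact IsAlgClosed.exists_eq_mul_self b.1

theorem sqGroup_index_inr (p : HeightOneSpectrum (𝓞 K)) :
    (((sqGroup (p.adicCompletion K)ˣ).index : ℕ) : ℝ) * abv (Sum.inr p) 2 = 4 := by
  have h := card_quotient_two p
  have h2 := sqGroup_index_local (O := p.adicCompletionIntegers K) (p.adicCompletion K)
  have h3 : abv (Sum.inr p : Place K) 2 = ‖(2 : p.adicCompletion K)‖ := by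
    show ‖algebraMap K (p.adicCompletion K) 2‖ = _
    rw [_root_.map_ofNat]
  rw [h2, h3]
  push_cast
  rw [h, mul_assoc, inv_mul_cancel₀ (norm_ne_zero_iff.2 two_ne_zero), mul_one]

theorem sqGroup_index_inl (v : InfinitePlace K) :
    (((sqGroup v.Completionˣ).index : ℕ) : ℝ) * (v 2) ^ v.mult = 4 := by
  have h2 : v (2 : K) = 2 := by
    obtain ⟨φ, hφ⟩ := v.2
    show v.1 2 = 2
    rw [← hφ, place_apply, _root_.map_ofNat]; simp
  by_cases h : v.IsReal
  · rw [sqGroup_index_congr (Units.mapEquiv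
      (InfinitePlace.Completion.ringEquivRealOfIsReal h).toMulEquiv), sqGroup_index_real,
      h2, InfinitePlace.mult, if_pos h]
    norm_num
  · rw [sqGroup_index_congr (Units.mapEquiv
      (InfinitePlace.Completion.ringEquivComplexOfIsComplex
        (InfinitePlace.not_isReal_iff_isComplex.1 h)).toMulEquiv), sqGroup_index_complex,
      h2, InfinitePlace.mult, if_neg h]
    norm_num

theorem abv_inl_two (v : InfinitePlace K) : abv (Sum.inl v) (2 : K) = 2 := by
  rw [abv_inl]
  obtain ⟨φ, hφ⟩ := v.2
  rw [← hφ, place_apply, _root_.map_ofNat]; simp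

theorem finite_abv_ne_one {x : K} (hx : x ≠ 0) : {v : Place K | abv v x ≠ 1}.Finite := by
  have h : (Set.range (Sum.inl : InfinitePlace K → Place K) ∪ Sum.inr ''
      (FinitePlace.equivHeightOneSpectrum ''
        Function.mulSupport (fun w : FinitePlace K => w x))).Finite :=
    (Set.finite_range _).union (((FinitePlace.hasFiniteMulSupport hx).image _).image _)
  refine h.subset ?_
  rintro (v | p) hv
  · exact Or.inl ⟨v, rfl⟩
  · exact Or.inr ⟨p, ⟨FinitePlace.equivHeightOneSpectrum.symm p, hv, by simp⟩, rfl⟩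

theorem inl_mem {S : Finset (Place K)} (hS : ∀ v ∉ S, abv v 2 = 1) (v : InfinitePlace K) :
    Sum.inl v ∈ S := by
  by_contra h
  have := hS _ h
  rw [abv_inl_two] at this
  norm_num at this

theorem prod_sqGroup_index (S : Finset (Place K)) (hS : ∀ v ∉ S, abv v 2 = 1) :
    ∏ v ∈ S, (sqGroup (L v)ˣ).index = 4 ^ S.card := by
  have h1 : S = Finset.univ.disjSum S.toRight := by
    rw [← S.toLeft_disjSum_toRight]
    congr 1
    · ext v; simp [inl_mem hS v]
    · simp
  have hpf := prod_abs_eq_one (K := K) (x := 2) two_ne_zero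
  rw [← finprod_comp_equiv FinitePlace.equivHeightOneSpectrum.symm] at hpf
  have h3 : ∀ p : HeightOneSpectrum (𝓞 K), (FinitePlace.equivHeightOneSpectrum.symm p) (2 : K)
      = abv (Sum.inr p) 2 := fun p => rfl
  simp only [h3] at hpf
  rw [finprod_eq_prod_of_mulSupport_subset (s := S.toRight)] at hpf
  · have : ((∏ v ∈ S, (sqGroup (L v)ˣ).index : ℕ) : ℝ) = 4 ^ S.card := by
      calc ((∏ v ∈ S, (sqGroup (L v)ˣ).index : ℕ) : ℝ) =
          ((∏ v ∈ S, (sqGroup (L v)ˣ).index : ℕ) : ℝ) * ((∏ w : InfinitePlace K, (w 2) ^ w.mult)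
            * ∏ i ∈ S.toRight, (abv (Sum.inr i)) 2) := by rw [hpf, mul_one]
        _ = _ := by
          nth_rw 1 [h1]
          rw [Finset.prod_disjSum]
          push_cast
          rw [mul_mul_mul_comm, ← Finset.prod_mul_distrib, ← Finset.prod_mul_distrib]
          rw [show S.card = (Finset.univ.disjSum S.toRight).card from congrArg _ h1]
          rw [Finset.card_disjSum, pow_add]
          congr 1
          · exact Finset.prod_eq_pow_card fun v _ => sqGroup_index_inl v
          · exact Finset.prod_eq_pow_card fun v _ => sqGroup_index_inr v
    exact_mod_cast this
  · intro p hp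
    by_contra h
    exact hp (hS _ (by simpa using h))

end Place

variable {K : Type u} [Field K] [NumberField K]

theorem sqGroup_index_of_existsUnique {G T : Type*} [CommGroup G] [CommGroup T] (j : T →* G)
    {k : ℕ} (e : Fin k → G)
    (h : ∀ x : G, ∃! tn : T × (Fin k → ℤ), x = j tn.1 * ∏ i, e i ^ tn.2 i) :
    (sqGroup G).index = (sqGroup T).index * 2 ^ k := by
  let φ : T × Multiplicative (Fin k → ℤ) →* G :=
    { toFun := fun tn => j tn.1 * ∏ i, e i ^ (tn.2.toAdd i)
      map_one' := by simp
      map_mul' := fun a b => by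
        simp [zpow_add, Finset.prod_mul_distrib, mul_mul_mul_comm] }
  have hφ : Function.Bijective φ := by
    constructor
    · intro a b hab
      exact (h (φ a)).unique (y₁ := (a.1, a.2.toAdd)) (y₂ := (b.1, b.2.toAdd)) rfl hab
    · intro x
      obtain ⟨tn, htn, -⟩ := h x
      exact ⟨(tn.1, Multiplicative.ofAdd tn.2), htn.symm⟩
  rw [← sqGroup_index_congr (MulEquiv.ofBijective φ hφ), sqGroup_index_prod,
    sqGroup_index_int_pi, Fintype.card_fin]

theorem sqGroup_index_units : (sqGroup (𝓞 K)ˣ).index = 2 ^ (Fintype.card (InfinitePlace K)) := by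
  rw [sqGroup_index_of_existsUnique (Units.torsion K).subtype (Units.fundSystem K)
    (Units.exist_unique_eq_mul_prod K), sqGroup, IsCyclic.index_powMonoidHom_range,
    Nat.gcd_eq_right, ← pow_succ', Units.rank, Nat.sub_add_cancel Fintype.card_pos]
  exact (Units.even_torsionOrder K).two_dvd

namespace Place

/-- The units outside of a set of places. -/
def sUnits (S : Finset (Place K)) : Subgroup Kˣ where
  carrier := {u | ∀ v ∉ S, abv v u = 1}
  one_mem' v _ := by simp
  mul_mem' ha hb v hv := by simp [ha v hv, hb v hv]
  inv_mem' ha v hv := by simp [ha v hv]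

theorem mem_sUnits {S : Finset (Place K)} {u : Kˣ} : u ∈ sUnits S ↔ ∀ v ∉ S, abv v u = 1 := Iff.rfl

theorem sUnits_mono {S T : Finset (Place K)} (h : S ⊆ T) : sUnits S ≤ sUnits T :=
  fun _ hu v hv => hu v fun h' => hv (h h')

theorem abv_inr_le_one_iff (p : HeightOneSpectrum (𝓞 K)) (x : K) :
    abv (Sum.inr p) x ≤ 1 ↔ p.valuation K x ≤ 1 := by
  rw [← valued_algebraMap, ← HeightOneSpectrum.mem_adicCompletionIntegers, adic_norm_le_one_iff]
  rfl

theorem abv_inr_eq_one_iff (p : HeightOneSpectrum (𝓞 K)) (x : K) :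
    abv (Sum.inr p) x = 1 ↔ p.valuation K x = 1 := by
  by_cases hx : x = 0
  · simp [hx]
  have h0 : 0 < abv (Sum.inr p) x := (abv _).pos hx
  have h1 : 0 < p.valuation K x := by simpa [zero_lt_iff] using hx
  have h := abv_inr_le_one_iff p x
  have h' := abv_inr_le_one_iff p x⁻¹
  rw [map_inv₀, map_inv₀, inv_le_one₀ h0, inv_le_one₀ h1] at h'
  exact ⟨fun e => le_antisymm (h.1 e.le) (h'.1 e.ge), fun e => le_antisymm (h.2 e.le) (h'.2 e.ge)⟩

/-- The additive valuation. -/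
noncomputable def ord (p : HeightOneSpectrum (𝓞 K)) (u : Kˣ) : ℤ :=
  (p.valuationOfNeZero u).toAdd

theorem ord_mul (p : HeightOneSpectrum (𝓞 K)) (u w : Kˣ) : ord p (u * w) = ord p u + ord p w := by
  simp [ord]

theorem valuation_eq_exp (p : HeightOneSpectrum (𝓞 K)) (u : Kˣ) :
    p.valuation K (u : K) = WithZero.exp (ord p u) := by
  rw [← HeightOneSpectrum.valuationOfNeZero_eq]
  rfl

theorem ord_eq_zero_iff (p : HeightOneSpectrum (𝓞 K)) (u : Kˣ) :
    ord p u = 0 ↔ abv (Sum.inr p) u = 1 := by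
  rw [abv_inr_eq_one_iff, valuation_eq_exp, ← WithZero.exp_zero, WithZero.exp_inj]

theorem exists_ord_ne_zero (p : HeightOneSpectrum (𝓞 K)) :
    ∃ u : Kˣ, ord p u ≠ 0 ∧ ∀ q, q ≠ p → ord q u = 0 := by
  set h := Fintype.card (ClassGroup (𝓞 K)) with hh
  have h1 : (⟨p.asIdeal, mem_nonZeroDivisors_of_ne_zero p.ne_bot⟩ : nonZeroDivisors (Ideal (𝓞 K))) ^ h
    = ⟨p.asIdeal ^ h, mem_nonZeroDivisors_of_ne_zero (pow_ne_zero _ p.ne_bot)⟩ := rfl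
  have h2 : (p.asIdeal ^ h).IsPrincipal := by
    rw [← ClassGroup.mk0_eq_one_iff (mem_nonZeroDivisors_of_ne_zero (pow_ne_zero _ p.ne_bot)), ← h1,
      map_pow, hh, pow_card_eq_one]
  obtain ⟨x, hx⟩ := h2
  rw [← Ideal.span] at hx
  have hx0 : x ≠ 0 := by
    rintro rfl
    exact pow_ne_zero h p.ne_bot (by simpa using hx)
  have hmem : x ∈ p.asIdeal ^ h := hx ▸ Ideal.mem_span_singleton_self x
  refine ⟨Units.mk0 (x : K) (by simpa using hx0), fun h0 => ?_, fun q hq => ?_⟩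
  · rw [ord_eq_zero_iff] at h0
    exact ((abv_inr_lt_one_iff p x).2 (Ideal.pow_le_self Fintype.card_ne_zero hmem)).ne h0
  · rw [ord_eq_zero_iff]
    by_contra hne
    have hle : abv (Sum.inr q) (x : K) ≤ 1 := by
      rw [abv_inr_le_one_iff]; exact q.valuation_le_one x
    have hxq := (abv_inr_lt_one_iff q x).1 (lt_of_le_of_ne hle hne)
    have h3 : p.asIdeal ^ h ≤ q.asIdeal := by
      rw [hx, Ideal.span_singleton_le_iff_mem]; exact hxq
    have h4 := Ideal.IsPrime.le_of_pow_le h3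
    have h5 := p.isMaximal.eq_of_le q.isPrime.ne_top h4
    exact hq (HeightOneSpectrum.ext h5.symm)

theorem exists_units_of_ord_eq_zero (x : Kˣ) (hx : ∀ p, ord p x = 0) :
    ∃ u : (𝓞 K)ˣ, x = Units.map (algebraMap (𝓞 K) K).toMonoidHom u := by
  have h1 : ∀ y : Kˣ, (∀ p, ord p y = 0) → ∃ a : 𝓞 K, algebraMap (𝓞 K) K a = y := by
    intro y hy
    refine HeightOneSpectrum.mem_integers_of_valuation_le_one K (y : K) fun p => ?_
    rw [valuation_eq_exp, hy, WithZero.exp_zero]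
  obtain ⟨a, ha⟩ := h1 x hx
  obtain ⟨b, hb⟩ := h1 x⁻¹ fun p => by
    have h2 := ord_mul p x x⁻¹
    rw [mul_inv_cancel, hx] at h2
    simpa [ord] using h2.symm
  have hab : a * b = 1 := by
    apply FaithfulSMul.algebraMap_injective (𝓞 K) K
    rw [map_mul, ha, hb]; simp
  exact ⟨⟨a, b, hab, by rw [mul_comm, hab]⟩, Units.ext ha.symm⟩

theorem valuation_unit (p : HeightOneSpectrum (𝓞 K)) (u : (𝓞 K)ˣ) :
    p.valuation K (algebraMap (𝓞 K) K u) = 1 := by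
  refine le_antisymm (p.valuation_le_one _) (not_lt.1 fun h => ?_)
  have h1 := (p.valuation_lt_one_iff_mem (K := K) (u : 𝓞 K)).1 h
  exact p.isPrime.ne_top (Ideal.eq_top_of_isUnit_mem _ h1 u.isUnit)

theorem sqGroup_index_sUnits (S : Finset (Place K)) (hS : ∀ v, Sum.inl v ∈ S) :
    (sqGroup (sUnits S)).index = 2 ^ S.card := by
  classical
  let φ : Additive (sUnits S) →ₗ[ℤ] (S.toRight → ℤ) := AddMonoidHom.toIntLinearMap
    { toFun := fun u p => ord p.1 u.toMul.1
      map_zero' := by ext p; simp [ord]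
      map_add' := fun a b => by ext p; simp [ord_mul] }
  have hφ : ∀ (u : sUnits S) p, φ (Additive.ofMul u) p = ord p.1 u.1 := fun _ _ => rfl
  have hrank : Module.finrank ℤ (LinearMap.range φ) = S.toRight.card := by
    apply le_antisymm
    · refine (Submodule.finrank_le _).trans ?_
      simp
    · have h1 : ∀ p : S.toRight, ∃ u : sUnits S, ord p.1 u.1 ≠ 0 ∧ ∀ q, q ≠ p.1 → ord q u.1 = 0 := by
        intro p
        obtain ⟨u, hu, hu'⟩ := exists_ord_ne_zero p.1
        refine ⟨⟨u, ?_⟩, hu, hu'⟩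
        rintro (v | q) hv
        · exact absurd (hS v) hv
        · rw [← ord_eq_zero_iff]
          refine hu' q ?_
          rintro rfl
          exact hv (Finset.mem_toRight.1 p.2)
      choose u hu hu' using h1
      have h2 : LinearIndependent ℤ fun p : S.toRight =>
          (⟨φ (Additive.ofMul (u p)), LinearMap.mem_range_self _ _⟩ : LinearMap.range φ) := by
        rw [Fintype.linearIndependent_iff]
        intro g hg p
        have h3 := congrFun (congrArg Subtype.val hg) p
        simp only [AddSubmonoidClass.coe_finsetSum, Submodule.coe_smul, Finset.sum_apply,
          Pi.smul_apply, hφ, smul_eq_mul, Submodule.coe_zero, Pi.zero_apply] at h3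
        rw [Finset.sum_eq_single p] at h3
        · exact (mul_eq_zero.1 h3).resolve_right (hu p)
        · intro q _ hq
          rw [hu' q p (fun h => hq (Subtype.ext h.symm)), mul_zero]
        · simp
      simpa using h2.fintype_card_le_finrank
  let b := Module.finBasis ℤ (LinearMap.range φ)
  have hb : ∀ i, ∃ u : sUnits S, φ (Additive.ofMul u) = b i := fun i => by
    obtain ⟨u, hu⟩ := (b i).2
    exact ⟨u.toMul, hu⟩
  choose e he using hb
  let j : (𝓞 K)ˣ →* sUnits S :=
    (Units.map (algebraMap (𝓞 K) K).toMonoidHom).codRestrict (sUnits S) (by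
      rintro u (v | p) hv
      · exact absurd (hS v) hv
      · rw [abv_inr_eq_one_iff]
        exact valuation_unit p u)
  have hj : ∀ u, φ (Additive.ofMul (j u)) = 0 := by
    intro u
    ext p
    rw [hφ, Pi.zero_apply, ord_eq_zero_iff, abv_inr_eq_one_iff]
    exact valuation_unit p.1 u
  have hprod : ∀ (n : Fin (Module.finrank ℤ (LinearMap.range φ)) → ℤ),
      φ (Additive.ofMul (∏ i, e i ^ n i)) = ((∑ i, n i • b i : LinearMap.range φ) : S.toRight → ℤ) := by
    intro n
    rw [ofMul_prod, map_sum]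
    simp only [ofMul_zpow, map_zsmul, he, AddSubmonoidClass.coe_finsetSum, Submodule.coe_smul]
  have hjinj : Function.Injective j := by
    intro x y hxy
    have := congrArg (fun z : sUnits S => (z.1 : K)) hxy
    exact Units.ext (FaithfulSMul.algebraMap_injective (𝓞 K) K this)
  rw [sqGroup_index_of_existsUnique j e, sqGroup_index_units, hrank, ← pow_add]
  · congr 1
    rw [← S.card_toLeft_add_card_toRight]
    congr 1
    rw [← Finset.card_univ]
    congr 1
    ext v; simp [hS v]
  · intro x
    obtain ⟨n, hn⟩ : ∃ n : Fin (Module.finrank ℤ (LinearMap.range φ)) → ℤ, φ (Additive.ofMul x) = φ (Additive.ofMul (∏ i, e i ^ n i)) := by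
      refine ⟨fun i => b.repr ⟨φ (Additive.ofMul x), LinearMap.mem_range_self _ _⟩ i, ?_⟩
      rw [hprod, b.sum_repr]
    obtain ⟨u, hu⟩ : ∃ u, x * (∏ i, e i ^ n i)⁻¹ = j u := by
      have h0 : φ (Additive.ofMul (x * (∏ i, e i ^ n i)⁻¹)) = 0 := by
        rw [ofMul_mul, ofMul_inv, map_add, map_neg, hn, add_neg_cancel]
      obtain ⟨u, hu⟩ := exists_units_of_ord_eq_zero (x * (∏ i, e i ^ n i)⁻¹ : sUnits S).1 (by
        intro p
        by_cases hp : Sum.inr p ∈ S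
        · rw [← hφ _ ⟨p, by simpa using hp⟩, h0]; rfl
        · rw [ord_eq_zero_iff]
          exact (x * (∏ i, e i ^ n i)⁻¹ : sUnits S).2 _ hp)
      exact ⟨u, Subtype.ext hu⟩
    refine ⟨(u, n), ?_, ?_⟩
    · simp only
      rw [← hu, inv_mul_cancel_right]
    · rintro ⟨u', n'⟩ h'
      simp only at h'
      have hn' : n' = n := by
        have h1 : φ (Additive.ofMul x) = φ (Additive.ofMul (∏ i, e i ^ n' i)) := by
          rw [h', ofMul_mul, map_add, hj, zero_add]
        rw [hn, hprod, hprod] at h1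
        have h2 := b.linearIndependent
        rw [Fintype.linearIndependent_iff] at h2
        have h3 := h2 (fun i => n' i - n i) (by
          simp only [sub_smul, Finset.sum_sub_distrib]
          rw [sub_eq_zero]
          exact Subtype.ext h1.symm)
        ext i
        linarith [h3 i]
      subst hn'
      congr 1
      apply hjinj
      rw [← hu, h', mul_inv_cancel_right]

end Place

variable {K : Type u} [Field K] [NumberField K]

/-- The absolute value pulled back from a normed field. -/
noncomputable def normAbv {F Ω : Type*} [Field F] [NormedField Ω] (φ : F →+* Ω) :
    AbsoluteValue F ℝ where
  toFun x := ‖φ x‖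
  map_mul' x y := by rw [map_mul, norm_mul]
  nonneg' x := norm_nonneg _
  eq_zero' x := by simp
  add_le' x y := by rw [map_add]; exact norm_add_le _ _

theorem normAbv_apply {F Ω : Type*} [Field F] [NormedField Ω] (φ : F →+* Ω) (x : F) :
    normAbv φ x = ‖φ x‖ := rfl

/-- The norm is either nonarchimedean or inherited from `ℂ`. -/
def StdNorm (Ω : Type*) [NormedField Ω] : Prop :=
  IsUltrametricDist Ω ∨ ∃ j : Ω →+* ℂ, ∀ x, ‖j x‖ = ‖x‖

namespace Place

theorem abv_eq_normAbv (v : Place K) : abv v = normAbv (ι v) := rfl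

theorem stdNorm : ∀ v : Place K, StdNorm (L v)
  | Sum.inl v => Or.inr ⟨InfinitePlace.Completion.extensionEmbedding v, fun x => by
      have h := (InfinitePlace.Completion.isometry_extensionEmbedding v).norm_map_of_map_zero
        (map_zero _) x
      exact h⟩
  | Sum.inr p => Or.inl (inferInstanceAs (IsUltrametricDist (p.adicCompletion K)))

theorem exists_isEquiv {Ω : Type*} [NormedField Ω] (hΩ : StdNorm Ω) (φ : K →+* Ω)
    (hφ : (normAbv φ).IsNontrivial) : ∃ v : Place K, (abv v).IsEquiv (normAbv φ) := by
  rcases hΩ with hu | ⟨j, hj⟩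
  · have hφle : ∀ x : 𝓞 K, ‖φ x‖ ≤ 1 := by
      intro x
      have hx : IsIntegral ℤ (φ x) := by
        have := (RingOfIntegers.isIntegral_coe x).map (φ.toIntAlgHom)
        exact this
      obtain ⟨P, hP, hP0⟩ := hx
      by_contra hlt
      rw [not_le] at hlt
      have h1 : φ x ^ P.natDegree = - ∑ i ∈ Finset.range P.natDegree,
          (algebraMap ℤ Ω (P.coeff i)) * φ x ^ i := by
        rw [eval₂_eq_sum_range, Finset.sum_range_succ, hP.coeff_natDegree, map_one, one_mul] at hP0
        linear_combination hP0
      rcases Nat.eq_zero_or_pos P.natDegree with hd | hd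
      · rw [hd] at h1; simp at h1
      have h2 : ‖φ x ^ P.natDegree‖ ≤ ‖φ x‖ ^ (P.natDegree - 1) := by
        rw [h1, norm_neg]
        refine IsUltrametricDist.norm_sum_le_of_forall_le_of_nonneg (by positivity) ?_
        intro i hi
        rw [norm_mul, norm_pow]
        have h3 : ‖algebraMap ℤ Ω (P.coeff i)‖ ≤ 1 := by
          rw [eq_intCast]; exact IsUltrametricDist.norm_intCast_le_one Ω _
        calc _ ≤ 1 * ‖φ x‖ ^ i := by gcongr
          _ ≤ _ := by
            rw [one_mul]
            exact pow_le_pow_right₀ hlt.le (by have := Finset.mem_range.1 hi; omega)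
      rw [norm_pow] at h2
      exact absurd h2 (not_le.2 (pow_lt_pow_right₀ hlt (by omega)))
    let Q : Ideal (𝓞 K) :=
      { carrier := {x | ‖φ x‖ < 1}
        add_mem' := fun {a b} ha hb => by
          show ‖φ (algebraMap _ _ (a + b))‖ < 1
          rw [map_add, map_add]
          exact (IsUltrametricDist.norm_add_le_max _ _).trans_lt (max_lt ha hb)
        zero_mem' := by simp
        smul_mem' := fun c x hx => by
          show ‖φ (algebraMap _ _ (c * x))‖ < 1
          rw [map_mul, map_mul, norm_mul]
          exact mul_lt_one_of_nonneg_of_lt_one_right (hφle c) (norm_nonneg _) hx }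
    have hmem : ∀ x, x ∈ Q ↔ ‖φ x‖ < 1 := fun x => Iff.rfl
    have hprime : Q.IsPrime := by
      constructor
      · rw [Ne, Ideal.eq_top_iff_one, hmem]; simp
      · intro x y hxy
        by_contra hcon
        rw [not_or, hmem, hmem, not_lt, not_lt] at hcon
        have hxy' : ‖φ (algebraMap _ K (x * y))‖ < 1 := hxy
        rw [map_mul, map_mul, norm_mul] at hxy'
        nlinarith [hcon.1, hcon.2]
    have hbot : Q ≠ ⊥ := by
      obtain ⟨x, hx0, hx⟩ := hφ
      intro hb
      have hall : ∀ a : 𝓞 K, a ≠ 0 → ‖φ a‖ = 1 := fun a ha => by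
        refine le_antisymm (hφle a) (not_lt.1 fun h => ha ?_)
        have : a ∈ Q := h
        rwa [hb] at this
      obtain ⟨a, b, hb, rfl⟩ := IsFractionRing.div_surjective (A := 𝓞 K) x
      apply hx
      have ha0 : a ≠ 0 := by rintro rfl; simp at hx0
      rw [normAbv_apply, map_div₀, norm_div, hall a ha0, hall b (nonZeroDivisors.ne_zero hb), div_one]
    let q : HeightOneSpectrum (𝓞 K) := ⟨Q, hprime, hbot⟩
    refine ⟨Sum.inr q, AbsoluteValue.isEquiv_of_lt_one_imp (abv_isNontrivial _) fun x hx => ?_⟩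
    obtain ⟨n, ⟨d, hd⟩, hxn⟩ := q.exists_primeCompl_mul_eq_of_integer x
      ((abv_inr_le_one_iff q x).1 hx.le)
    have hd1 : ‖φ (algebraMap (𝓞 K) K d)‖ = 1 := le_antisymm (hφle d) (not_lt.1 hd)
    have hd2 : abv (Sum.inr q) (algebraMap (𝓞 K) K d) = 1 := by
      rw [abv_inr_eq_one_iff]
      refine le_antisymm (q.valuation_le_one _) (not_lt.1 fun h => hd ?_)
      exact (q.valuation_lt_one_iff_mem d).1 h
    have hn1 : abv (Sum.inr q) (algebraMap (𝓞 K) K n) < 1 := by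
      rw [← hxn, map_mul, hd2]; simpa using hx
    have hn2 : ‖φ (algebraMap (𝓞 K) K n)‖ < 1 := (abv_inr_lt_one_iff q n).1 hn1
    rw [← hxn, map_mul, norm_mul, hd1, mul_one] at hn2
    exact hn2
  · refine ⟨Sum.inl (InfinitePlace.mk (j.comp φ)), ?_⟩
    rw [abv_inl]
    have : (InfinitePlace.mk (j.comp φ)).1 = normAbv φ := by
      ext x
      exact (InfinitePlace.apply (j.comp φ) x).trans (hj _)
    rw [this]
    exact AbsoluteValue.IsEquiv.refl _

theorem exists_completion_hom {Ω : Type*} [NormedField Ω] [CompleteSpace Ω] (φ : K →+* Ω)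
    (v : Place K) (h : (abv v).IsEquiv (normAbv φ)) :
    ∃ ψ : L v →+* Ω, Continuous ψ ∧ ∀ x, ψ (ι v x) = φ x := by
  obtain ⟨c, hc, hcφ⟩ := AbsoluteValue.isEquiv_iff_exists_rpow_eq.1 h
  let _ : UniformSpace K := UniformSpace.comap (ι v) inferInstance
  have hui : IsUniformInducing (ι v) := ⟨rfl⟩
  have : IsUniformAddGroup K := hui.isUniformAddGroup (ι v)
  have huc : UniformContinuous φ := by
    apply uniformContinuous_of_continuousAt_zero
    rw [ContinuousAt, map_zero, tendsto_zero_iff_norm_tendsto_zero]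
    have h1 : (fun x => ‖φ x‖) = fun x => ‖ι v x‖ ^ c := by
      ext x; exact (congrFun hcφ x).symm
    rw [h1]
    have h2 : Filter.Tendsto (fun x => ‖ι v x‖) (nhds 0) (nhds 0) := by
      have := (hui.uniformContinuous.continuous.norm).tendsto (0 : K)
      simpa using this
    have h3 := (Real.continuousAt_rpow_const 0 c (Or.inr hc.le)).tendsto.comp h2
    rwa [Real.zero_rpow hc.ne'] at h3
  refine ⟨IsDenseInducing.extendRingHom hui (denseRange_ι v) huc, ?_, ?_⟩
  · exact (uniformContinuous_uniformly_extend hui (denseRange_ι v) huc).continuous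
  · exact fun x => uniformly_extend_of_ind hui (denseRange_ι v) huc x

section Extension
variable {E : Type u} [Field E] [NumberField E] [Algebra K E]

/-- The place `w` of `E` lies over the place `v` of `K`. -/
def Over (w : Place E) (v : Place K) : Prop :=
  (abv v).IsEquiv (normAbv ((ι w).comp (algebraMap K E)))

theorem Over.lt_one_iff {w : Place E} {v : Place K} (h : Over w v) (x : K) :
    abv v x < 1 ↔ abv w (algebraMap K E x) < 1 := AbsoluteValue.IsEquiv.lt_one_iff h

theorem Over.le_one_iff {w : Place E} {v : Place K} (h : Over w v) (x : K) :
    abv v x ≤ 1 ↔ abv w (algebraMap K E x) ≤ 1 := AbsoluteValue.IsEquiv.le_one_iff h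

theorem Over.eq_one_iff {w : Place E} {v : Place K} (h : Over w v) (x : K) :
    abv v x = 1 ↔ abv w (algebraMap K E x) = 1 := AbsoluteValue.IsEquiv.eq_one_iff h

theorem Over.unique {w : Place E} {v v' : Place K} (h : Over w v) (h' : Over w v') : v = v' := by
  by_contra hne
  exact abv_not_isEquiv hne (h.trans h'.symm)

theorem exists_over (w : Place E) : ∃ v : Place K, Over w v := by
  refine exists_isEquiv (stdNorm w) _ ?_
  rcases w with w | Q
  · refine ⟨2, two_ne_zero, ?_⟩
    have := abv_inl_two w
    rw [normAbv_apply, RingHom.comp_apply, _root_.map_ofNat]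
    change abv (Sum.inl w) (2 : E) ≠ 1
    rw [this]; norm_num
  · have h1 := (abv_inr_lt_one_iff Q (Ideal.absNorm Q.asIdeal : 𝓞 E)).2 (Ideal.absNorm_mem Q.asIdeal)
    refine ⟨Ideal.absNorm Q.asIdeal, ?_, ?_⟩
    · rw [Ne, Nat.cast_eq_zero, Ideal.absNorm_eq_zero_iff]; exact Q.ne_bot
    · rw [normAbv_apply, RingHom.comp_apply, map_natCast]
      simp only [map_natCast] at h1
      exact h1.ne

theorem exists_over' (v : Place K) : ∃ w : Place E, Over w v := by
  have : Algebra.IsAlgebraic K E := Algebra.IsAlgebraic.tower_top (K := ℚ) K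
  rcases v with v | p
  · obtain ⟨w, hw⟩ := InfinitePlace.comap_surjective (k := K) (K := E) v
    refine ⟨Sum.inl w, ?_⟩
    have h1 : abv (Sum.inl v) = normAbv ((ι (Sum.inl w)).comp (algebraMap K E)) := by
      ext x
      have h2 : normAbv ((ι (Sum.inl w)).comp (algebraMap K E)) x =
        abv (Sum.inl w) (algebraMap K E x) := rfl
      rw [h2, abv_inl, abv_inl, ← hw]
      rfl
    rw [Over, h1]
    exact AbsoluteValue.IsEquiv.refl _
  · obtain ⟨Q, hQ, hQp⟩ := Ideal.exists_maximal_ideal_liesOver_of_isIntegral (S := 𝓞 E) p.asIdeal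
    have hQ0 : Q ≠ ⊥ := Ideal.ne_bot_of_liesOver_of_ne_bot p.ne_bot Q
    obtain ⟨v, hv⟩ := exists_over (K := K) (Sum.inr ⟨Q, hQ.isPrime, hQ0⟩)
    refine ⟨Sum.inr ⟨Q, hQ.isPrime, hQ0⟩, ?_⟩
    have hpe : v = Sum.inr p := by
      have hlt : ∀ x : 𝓞 K, abv v x < 1 ↔ x ∈ p.asIdeal := fun x => by
        rw [hv.lt_one_iff, hQp.over, Ideal.mem_comap]
        exact abv_inr_lt_one_iff ⟨Q, hQ.isPrime, hQ0⟩ (algebraMap (𝓞 K) (𝓞 E) x)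
      rcases v with v | q
      · have h1 := (hlt _).2 (Ideal.absNorm_mem p.asIdeal)
        exfalso
        simp only [map_natCast] at h1
        rw [abv_inl] at h1
        obtain ⟨φ, hφ⟩ := v.2
        rw [← hφ, place_apply, map_natCast, Complex.norm_natCast] at h1
        have h3 : Ideal.absNorm p.asIdeal = 0 := by exact_mod_cast Nat.lt_one_iff.1 (by exact_mod_cast h1)
        rw [Ideal.absNorm_eq_zero_iff] at h3
        exact p.ne_bot h3
      · congr 1
        ext x
        rw [← hlt, abv_inr_lt_one_iff]
    rwa [← hpe]

theorem Over.exists_hom {w : Place E} {v : Place K} (h : Over w v) :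
    ∃ ψ : L v →+* L w, Continuous ψ ∧ ∀ x, ψ (ι v x) = ι w (algebraMap K E x) :=
  exists_completion_hom _ v h

theorem finite_over (v : Place K) : {w : Place E | Over w v}.Finite := by
  obtain ⟨x, hx0, hx⟩ := abv_isNontrivial v
  refine (finite_abv_ne_one (K := E) (x := algebraMap K E x) (by simpa using hx0)).subset ?_
  intro w hw
  exact fun h => hx ((Over.eq_one_iff hw x).2 h)

variable (E) in
/-- The places of `E` over the places in `S`. -/
noncomputable def above (S : Finset (Place K)) : Finset (Place E) :=
  Set.Finite.toFinset (s := {w : Place E | ∃ v ∈ S, Over w v}) (by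
    have : {w : Place E | ∃ v ∈ S, Over w v} = ⋃ v ∈ S, {w : Place E | Over w v} := by ext; simp
    rw [this]
    exact S.finite_toSet.biUnion fun v _ => finite_over v)

theorem mem_above {S : Finset (Place K)} {w : Place E} : w ∈ above E S ↔ ∃ v ∈ S, Over w v := by
  simp [above]

theorem Over.mem_above {S : Finset (Place K)} {w : Place E} {v : Place K} (h : Over w v) :
    w ∈ above E S ↔ v ∈ S := by
  rw [Place.mem_above]
  exact ⟨fun ⟨v', hv', h'⟩ => h.unique h' ▸ hv', fun hv => ⟨v, hv, h⟩⟩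

end Extension
end Place

section NormIndex

theorem norm_index_le {A C : Type*} [CommGroup A] [CommGroup C] (i : A →* C) (N : C →* A)
    (hN : ∀ a, N (i a) = a ^ 2) {s t : ℕ} (hA : (sqGroup A).index = 2 ^ s)
    (hC : (sqGroup C).index = 2 ^ t) (h1 : ∀ c, N c ∈ sqGroup A → ∃ a c', c = i a * c' ^ 2)
    (b : A) (hb : b ∉ sqGroup A) (hb' : i b ∈ sqGroup C) :
    N.range.index ≠ 0 ∧ N.range.index * 2 ^ (t + 1) ≤ 2 ^ (2 * s) := by
  have hle : sqGroup A ≤ N.range := by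
    rintro _ ⟨a, rfl⟩
    exact ⟨i a, hN a⟩
  have e1 : ((sqGroup A).comap N).index * N.range.index = 2 ^ s := by
    rw [← hA, Subgroup.index_comap, Subgroup.relIndex_mul_index hle]
  let P := (sqGroup C).comap i
  have hP : sqGroup A ≤ P := by
    rintro _ ⟨a, rfl⟩
    exact ⟨i a, by simp⟩
  have e2 : (sqGroup A).relIndex P * P.index = 2 ^ s := by
    rw [Subgroup.relIndex_mul_index hP, hA]
  let D := i.range ⊔ sqGroup C
  have e3 : P.index * D.index = 2 ^ t := by
    rw [← hC, ← Subgroup.relIndex_mul_index (le_sup_right : sqGroup C ≤ D)]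
    congr 1
    rw [Subgroup.index_comap]
    exact (Subgroup.relIndex_sup_right i.range (sqGroup C)).symm
  have hD : (sqGroup A).comap N ≤ D := by
    intro c hc
    obtain ⟨a, c', rfl⟩ := h1 c hc
    exact Subgroup.mul_mem_sup ⟨a, rfl⟩ ⟨c', rfl⟩
  have e4 : ((sqGroup A).comap N).index ≠ 0 := fun h => by
    rw [h, zero_mul] at e1; exact absurd e1.symm (by positivity)
  have e5 : D.index ≤ ((sqGroup A).comap N).index :=
    Nat.le_of_dvd (Nat.pos_of_ne_zero e4) (Subgroup.index_dvd_of_le hD)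
  have e6 : 2 ≤ (sqGroup A).relIndex P := by
    have h0 : (sqGroup A).relIndex P ≠ 0 := fun h => by
      rw [h, zero_mul] at e2; exact absurd e2.symm (by positivity)
    have h1 : (sqGroup A).relIndex P ≠ 1 := by
      rw [Ne, Subgroup.relIndex_eq_one]
      exact fun h => hb (h hb')
    omega
  refine ⟨fun h => by rw [h, mul_zero] at e1; exact absurd e1.symm (by positivity), ?_⟩
  calc N.range.index * 2 ^ (t + 1) = N.range.index * (2 * P.index) * D.index := by
        rw [pow_succ, ← e3]; ring
    _ ≤ N.range.index * ((sqGroup A).relIndex P * P.index) * ((sqGroup A).comap N).index := by gcongr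
    _ = 2 ^ (2 * s) := by rw [e2, mul_right_comm, mul_comm (N.range.index), e1]; ring

end NormIndex

variable {K : Type u} [Field K] [NumberField K]

/-- `E = K(θ)` with `θ ^ 2 = b`, and `σ` is the nontrivial automorphism. -/
structure IsQuad {E : Type*} [Field E] [Algebra K E] (b : K) (θ : E) (σ : E →ₐ[K] E) : Prop where
  sq : θ ^ 2 = algebraMap K E b
  conj : σ θ = -θ
  repr : ∀ z : E, ∃ x y : K, z = algebraMap K E x + algebraMap K E y * θ

theorem exists_isQuad {b : K} (hb : ¬ IsSquare b) :
    ∃ (E : Type u) (_ : Field E) (_ : NumberField E) (_ : Algebra K E) (θ : E) (σ : E →ₐ[K] E),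
      IsQuad b θ σ := by
  have hirr : Irreducible (X ^ 2 - C b : K[X]) := by
    rw [X_pow_sub_C_irreducible_iff_of_prime Nat.prime_two]
    exact fun c hc => hb ⟨c, by rw [← hc, sq]⟩
  have : Fact (Irreducible (X ^ 2 - C b : K[X])) := ⟨hirr⟩
  have hmonic : (X ^ 2 - C b : K[X]).Monic := monic_X_pow_sub_C b two_ne_zero
  let pb := AdjoinRoot.powerBasis hmonic.ne_zero
  have : FiniteDimensional K (AdjoinRoot (X ^ 2 - C b)) := pb.finite
  have : CharZero (AdjoinRoot (X ^ 2 - C b)) :=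
    charZero_of_injective_algebraMap (algebraMap K (AdjoinRoot (X ^ 2 - C b))).injective
  have hnf : NumberField (AdjoinRoot (X ^ 2 - C b)) :=
    { to_charZero := inferInstance
      to_finiteDimensional := Module.Finite.trans K _ }
  have hroot : (AdjoinRoot.root (X ^ 2 - C b : K[X])) ^ 2 = algebraMap K _ b := by
    have := AdjoinRoot.eval₂_root (X ^ 2 - C b : K[X])
    simp only [eval₂_sub, eval₂_X_pow, eval₂_C, sub_eq_zero] at this
    exact this
  let σ : AdjoinRoot (X ^ 2 - C b) →ₐ[K] AdjoinRoot (X ^ 2 - C b) :=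
    AdjoinRoot.liftAlgHom _ (Algebra.ofId _ _) (-AdjoinRoot.root (X ^ 2 - C b)) (by
      simp only [eval₂_sub, eval₂_X_pow, eval₂_C, neg_sq, hroot]
      exact sub_self _)
  refine ⟨AdjoinRoot (X ^ 2 - C b), inferInstance, hnf, inferInstance,
    AdjoinRoot.root _, σ, hroot, AdjoinRoot.liftAlgHom_root _ _ _ _, fun z => ?_⟩
  obtain ⟨g, rfl⟩ := AdjoinRoot.mk_surjective z
  have h1 : AdjoinRoot.mk (X ^ 2 - C b) g = AdjoinRoot.mk (X ^ 2 - C b) (g %ₘ (X ^ 2 - C b)) := by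
    rw [AdjoinRoot.mk_eq_mk]
    exact ⟨g /ₘ (X ^ 2 - C b), by linear_combination -(modByMonic_add_div g (X ^ 2 - C b))⟩
  have h2 : (g %ₘ (X ^ 2 - C b)).natDegree < 2 := by
    have := natDegree_modByMonic_lt g hmonic (fun h => by
      have := congrArg natDegree h; rw [natDegree_X_pow_sub_C] at this; simp at this)
    rwa [natDegree_X_pow_sub_C] at this
  refine ⟨(g %ₘ (X ^ 2 - C b)).coeff 0, (g %ₘ (X ^ 2 - C b)).coeff 1, ?_⟩
  rw [h1]
  conv_lhs => rw [eq_X_add_C_of_natDegree_le_one (Nat.lt_succ_iff.1 h2)]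
  rw [map_add, map_mul, AdjoinRoot.mk_X, AdjoinRoot.mk_C, AdjoinRoot.mk_C, add_comm]
  rfl

namespace Place

/-- A set of places outside of which everything is unramified and principal. -/
structure Adm (S : Finset (Place K)) : Prop where
  two : ∀ v ∉ S, abv v 2 = 1
  unif : ∀ p : HeightOneSpectrum (𝓞 K), Sum.inr p ∉ S → ∃ u : Kˣ, ord p u = 1 ∧
    ∀ q, Sum.inr q ∉ S → q ≠ p → ord q u = 0

theorem Adm.mono {S T : Finset (Place K)} (h : Adm S) (hST : S ⊆ T) : Adm T :=
  ⟨fun v hv => h.two v fun h' => hv (hST h'), fun p hp => by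
    obtain ⟨u, hu, hu'⟩ := h.unif p fun h' => hp (hST h')
    exact ⟨u, hu, fun q hq => hu' q fun h' => hq (hST h')⟩⟩

theorem Adm.inl_mem {S : Finset (Place K)} (h : Adm S) (v : InfinitePlace K) : Sum.inl v ∈ S :=
  Place.inl_mem h.two v

theorem ord_one (p : HeightOneSpectrum (𝓞 K)) : ord p 1 = 0 := by simp [ord]

theorem ord_inv (p : HeightOneSpectrum (𝓞 K)) (u : Kˣ) : ord p u⁻¹ = - ord p u := by simp [ord]

theorem ord_zpow (p : HeightOneSpectrum (𝓞 K)) (u : Kˣ) (n : ℤ) : ord p (u ^ n) = n * ord p u := by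
  simp [ord]

theorem exists_adm (S₀ : Finset (Place K)) : ∃ S, S₀ ⊆ S ∧ Adm S := by
  classical
  have h1 : ∀ c : ClassGroup (𝓞 K), ∃ I : nonZeroDivisors (Ideal (𝓞 K)), ClassGroup.mk0 I = c :=
    ClassGroup.mk0_surjective
  choose I hI using h1
  have h2 : ∀ c, ∃ x ∈ (I c : Ideal (𝓞 K)), x ≠ 0 := fun c =>
    Submodule.exists_mem_ne_zero_of_ne_bot (nonZeroDivisors.ne_zero (I c).2)
  choose x hxI hx0 using h2
  have h3 : ({v : Place K | abv v 2 ≠ 1} ∪ ⋃ c, {v : Place K | abv v (x c) ≠ 1}).Finite :=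
    (finite_abv_ne_one two_ne_zero).union
      (Set.finite_iUnion fun c => finite_abv_ne_one (by simpa using hx0 c))
  refine ⟨S₀ ∪ h3.toFinset, Finset.subset_union_left, ?_, ?_⟩
  · intro v hv
    by_contra h
    exact hv (Finset.mem_union_right _ (by simp [h]))
  · intro p hp
    have hnot : ∀ q : HeightOneSpectrum (𝓞 K), Sum.inr q ∉ S₀ ∪ h3.toFinset → ∀ c,
        ¬ (I c : Ideal (𝓞 K)) ≤ q.asIdeal := by
      intro q hq c hle
      apply hq
      refine Finset.mem_union_right _ ?_
      rw [Set.Finite.mem_toFinset]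
      exact Or.inr (Set.mem_iUnion.2 ⟨c, ((abv_inr_lt_one_iff q (x c)).2 (hle (hxI c))).ne⟩)
    set P : nonZeroDivisors (Ideal (𝓞 K)) := ⟨p.asIdeal, mem_nonZeroDivisors_of_ne_zero p.ne_bot⟩
    set c := (ClassGroup.mk0 P)⁻¹ with hc
    have h4 : (p.asIdeal * (I c : Ideal (𝓞 K))).IsPrincipal := by
      have h5 : ClassGroup.mk0 (P * I c) = 1 := by rw [map_mul, hI, hc, mul_inv_cancel]
      exact (ClassGroup.mk0_eq_one_iff (P * I c).2).1 h5
    obtain ⟨y, hy⟩ := h4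
    rw [← Ideal.span] at hy
    have hy0 : y ≠ 0 := by
      rintro rfl
      have : p.asIdeal * (I c : Ideal (𝓞 K)) = 0 := by simpa using hy
      rcases mul_eq_zero.1 this with h | h
      · exact p.ne_bot h
      · exact nonZeroDivisors.ne_zero (I c).2 h
    refine ⟨(Units.mk0 (y : K) (by simpa using hy0))⁻¹, ?_, fun q hq hqp => ?_⟩
    · have h5 : y ∈ p.asIdeal ^ 1 := by
        rw [pow_one]
        have h6 : Ideal.span {y} ≤ p.asIdeal := hy.symm.le.trans Ideal.mul_le_left
        exact h6 (Ideal.mem_span_singleton_self y)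
      have h6 : y ∉ p.asIdeal ^ 2 := by
        intro h
        have h7 : p.asIdeal * (I c : Ideal (𝓞 K)) ≤ p.asIdeal * p.asIdeal := by
          rw [hy, ← sq, Ideal.span_singleton_le_iff_mem]; exact h
        have h8 := Ideal.dvd_iff_le.2 h7
        rw [mul_dvd_mul_iff_left p.ne_bot, Ideal.dvd_iff_le] at h8
        exact hnot p hp c h8
      rw [← HeightOneSpectrum.intValuation_le_pow_iff_mem, ← p.valuation_of_algebraMap (K := K)] at h5 h6
      have h9 := valuation_eq_exp p (Units.mk0 (y : K) (by simpa using hy0))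
      rw [Units.val_mk0] at h9
      rw [h9, WithZero.exp_le_exp] at h5 h6
      rw [ord_inv]
      push_cast at h5 h6
      omega
    · rw [ord_inv, neg_eq_zero, ord_eq_zero_iff]
      by_contra hne
      have hle : abv (Sum.inr q) (y : K) ≤ 1 := by
        rw [abv_inr_le_one_iff]; exact q.valuation_le_one y
      have hxq := (abv_inr_lt_one_iff q y).1 (lt_of_le_of_ne hle hne)
      have h3 : p.asIdeal * (I c : Ideal (𝓞 K)) ≤ q.asIdeal := by
        rw [hy, Ideal.span_singleton_le_iff_mem]; exact hxq
      rcases q.isPrime.mul_le.1 h3 with h4 | h4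
      · exact hqp (HeightOneSpectrum.ext (p.isMaximal.eq_of_le q.isPrime.ne_top h4).symm)
      · exact hnot q hq c h4

theorem Adm.exists_ord_eq {S : Finset (Place K)} (hS : Adm S) (n : HeightOneSpectrum (𝓞 K) → ℤ)
    (T : Finset (HeightOneSpectrum (𝓞 K))) :
    ∃ d : Kˣ, ∀ q, Sum.inr q ∉ S → (q ∈ T → ord q d = n q) ∧ (q ∉ T → ord q d = 0) := by
  classical
  induction T using Finset.induction_on with
  | empty => exact ⟨1, fun q _ => ⟨by simp, fun _ => ord_one q⟩⟩
  | insert p T hp ih =>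
    obtain ⟨d, hd⟩ := ih
    by_cases hpS : Sum.inr p ∈ S
    · refine ⟨d, fun q hq => ?_⟩
      have hqp : q ≠ p := by rintro rfl; exact hq hpS
      simpa [Finset.mem_insert, hqp] using hd q hq
    · obtain ⟨u, hu, hu'⟩ := hS.unif p hpS
      refine ⟨d * u ^ n p, fun q hq => ?_⟩
      rw [ord_mul, ord_zpow]
      by_cases hqp : q = p
      · subst hqp
        rw [hu, (hd q hq).2 hp]
        simp
      · rw [hu' q hq hqp, mul_zero, add_zero]
        simpa [Finset.mem_insert, hqp] using hd q hq

end Place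

variable {K : Type u} [Field K] [NumberField K]

namespace IsQuad
variable {E : Type u} [Field E] [Algebra K E] {b : K} {θ : E} {σ : E →ₐ[K] E}

theorem repr_unique (h : IsQuad b θ σ) (hb : ¬ IsSquare b) {x y x' y' : K}
    (e : algebraMap K E x + algebraMap K E y * θ = algebraMap K E x' + algebraMap K E y' * θ) :
    x = x' ∧ y = y' := by
  have hinj := (algebraMap K E).injective
  by_cases hy : y = y'
  · subst hy
    exact ⟨hinj (add_right_cancel e), rfl⟩
  · exfalso
    apply hb
    have hy' : y - y' ≠ 0 := sub_ne_zero.2 hy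
    refine ⟨(x' - x) / (y - y'), hinj ?_⟩
    have hm : algebraMap K E (y - y') ≠ 0 := (_root_.map_ne_zero _).2 hy'
    rw [← h.sq, map_mul, map_div₀, div_mul_div_comm, eq_div_iff (mul_ne_zero hm hm)]
    have e2 : θ * algebraMap K E (y - y') = algebraMap K E (x' - x) := by
      rw [map_sub, map_sub]; linear_combination e
    rw [← e2]; ring

theorem conj_repr (h : IsQuad b θ σ) (x y : K) :
    σ (algebraMap K E x + algebraMap K E y * θ) = algebraMap K E x - algebraMap K E y * θ := by
  simp [h.conj, sub_eq_add_neg]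

theorem norm_repr (h : IsQuad b θ σ) (x y : K) :
    (algebraMap K E x + algebraMap K E y * θ) * σ (algebraMap K E x + algebraMap K E y * θ)
      = algebraMap K E (x ^ 2 - b * y ^ 2) := by
  rw [h.conj_repr, map_sub, map_mul, map_pow, map_pow, ← h.sq]; ring

theorem exists_norm (h : IsQuad b θ σ) (z : E) : ∃ k : K, algebraMap K E k = z * σ z := by
  obtain ⟨x, y, rfl⟩ := h.repr z
  exact ⟨_, (h.norm_repr x y).symm⟩

theorem isNrm_of_norm (h : IsQuad b θ σ) {z : E} {k : K} (hk : algebraMap K E k = z * σ z) :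
    IsNrm b k := by
  obtain ⟨x, y, rfl⟩ := h.repr z
  rw [h.norm_repr] at hk
  exact ⟨x, y, (algebraMap K E).injective hk.symm⟩

theorem exists_lift (h : IsQuad b θ σ) (hb : ¬ IsSquare b) {Ω : Type*} [Field Ω] (φ : K →+* Ω)
    {r : Ω} (hr : r ^ 2 = φ b) : ∃ ψ : E →+* Ω, (∀ x, ψ (algebraMap K E x) = φ x) ∧ ψ θ = r := by
  choose f g hfg using h.repr
  have key : ∀ z x y, z = algebraMap K E x + algebraMap K E y * θ → f z = x ∧ g z = y :=
    fun z x y e => h.repr_unique hb (by rw [← hfg, e])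
  let ψ : E →+* Ω :=
    { toFun := fun z => φ (f z) + φ (g z) * r
      map_one' := by
        have := key 1 1 0 (by simp)
        simp [this.1, this.2]
      map_zero' := by
        have := key 0 0 0 (by simp)
        simp [this.1, this.2]
      map_add' := fun z w => by
        have := key (z + w) (f z + f w) (g z + g w) (by
          nth_rw 1 [hfg z, hfg w]; rw [map_add, map_add]; ring)
        rw [this.1, this.2, map_add, map_add]; ring
      map_mul' := fun z w => by
        have := key (z * w) (f z * f w + b * g z * g w) (f z * g w + g z * f w) (by
          nth_rw 1 [hfg z, hfg w]
          simp only [map_add, map_mul, ← h.sq]; ring)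
        rw [this.1, this.2]
        simp only [map_add, map_mul, ← hr]; ring }
  refine ⟨ψ, fun x => ?_, ?_⟩
  · have := key (algebraMap K E x) x 0 (by simp)
    show φ (f _) + φ (g _) * r = _
    rw [this.1, this.2]; simp
  · have := key θ 0 1 (by simp)
    show φ (f _) + φ (g _) * r = _
    rw [this.1, this.2]; simp

end IsQuad

namespace Place

theorem abv_add_le_max (p : HeightOneSpectrum (𝓞 K)) (x y : K) :
    abv (Sum.inr p) (x + y) ≤ max (abv (Sum.inr p) x) (abv (Sum.inr p) y) := by
  have h : IsUltrametricDist (L (Sum.inr p : Place K)) :=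
    inferInstanceAs (IsUltrametricDist (p.adicCompletion K))
  show ‖ι (Sum.inr p) (x + y)‖ ≤ max ‖ι (Sum.inr p) x‖ ‖ι (Sum.inr p) y‖
  rw [map_add]
  exact IsUltrametricDist.norm_add_le_max _ _

section Quad
variable {E : Type u} [Field E] [NumberField E] [Algebra K E] {b : K} {θ : E} {σ : E →ₐ[K] E}

theorem two_le_card_over (h : IsQuad b θ σ) (hb : ¬ IsSquare b) (v : Place K)
    (hv : IsSquare (ι v b)) : ∃ w w' : Place E, Over w v ∧ Over w' v ∧ w ≠ w' := by
  obtain ⟨r, hr⟩ := hv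
  have hr0 : r ≠ 0 := by
    rintro rfl
    apply hb
    rw [mul_zero, map_eq_zero] at hr
    exact ⟨0, by simpa using hr⟩
  obtain ⟨ψ, hψ, hψθ⟩ := h.exists_lift hb (ι v) (r := r) (by rw [hr, sq])
  obtain ⟨ψ', hψ', hψθ'⟩ := h.exists_lift hb (ι v) (r := -r) (by rw [hr, neg_sq, sq])
  have key : ∀ ψ : E →+* L v, (∀ x, ψ (algebraMap K E x) = ι v x) →
      ∃ w : Place E, Over w v ∧ (abv w).IsEquiv (normAbv ψ) := by
    intro ψ hψ
    have hnt : (normAbv ψ).IsNontrivial := by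
      obtain ⟨x, hx0, hx⟩ := abv_isNontrivial v
      exact ⟨algebraMap K E x, by simpa using hx0, by rw [normAbv_apply, hψ]; exact hx⟩
    obtain ⟨w, hw⟩ := exists_isEquiv (stdNorm v) ψ hnt
    refine ⟨w, ?_, hw⟩
    rw [Over, AbsoluteValue.isEquiv_iff_lt_one_iff]
    intro x
    have := hw.lt_one_iff (x := algebraMap K E x)
    rw [normAbv_apply, hψ] at this
    exact this.symm
  obtain ⟨w, hw, hwe⟩ := key ψ hψ
  obtain ⟨w', hw', hwe'⟩ := key ψ' hψ'
  refine ⟨w, w', hw, hw', ?_⟩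
  rintro rfl
  obtain ⟨c, hc⟩ : ∃ c : K, 2 ≤ ‖ι v c‖ * ‖2 * r‖ := by
    obtain ⟨x, hx⟩ := (abv_isNontrivial v).exists_abv_gt_one
    have h2 : 0 < ‖2 * r‖ := norm_pos_iff.2 (mul_ne_zero two_ne_zero hr0)
    obtain ⟨n, hn⟩ := pow_unbounded_of_one_lt (2 / ‖2 * r‖) hx
    refine ⟨x ^ n, ?_⟩
    rw [map_pow, norm_pow]
    exact ((div_lt_iff₀ h2).1 hn).le
  have hc0 : 0 < ‖ι v c‖ := by
    by_contra hcon
    have : ‖ι v c‖ = 0 := le_antisymm (not_lt.1 hcon) (norm_nonneg _)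
    rw [this] at hc; norm_num at hc
  obtain ⟨k, hk⟩ := (denseRange_ι v).exists_dist_lt r (inv_pos.2 hc0)
  rw [dist_eq_norm] at hk
  have hk' : ‖ι v c‖ * ‖r - ι v k‖ < 1 := by
    rw [← mul_inv_cancel₀ hc0.ne']; gcongr
  have h1 : normAbv ψ (algebraMap K E c * (θ - algebraMap K E k)) < 1 := by
    rw [normAbv_apply, map_mul, map_sub, hψ, hψ, hψθ, norm_mul]
    exact hk'
  have h2 : normAbv ψ' (algebraMap K E c * (θ - algebraMap K E k)) < 1 :=
    hwe'.lt_one_iff.1 (hwe.lt_one_iff.2 h1)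
  rw [normAbv_apply, map_mul, map_sub, hψ', hψ', hψθ', norm_mul] at h2
  have h3 : ‖2 * r‖ ≤ ‖r - ι v k‖ + ‖-r - ι v k‖ := by
    have : 2 * r = (r - ι v k) - (-r - ι v k) := by ring
    rw [this]; exact norm_sub_le _ _
  have h4 : ‖ι v c‖ * ‖2 * r‖ ≤ ‖ι v c‖ * (‖r - ι v k‖ + ‖-r - ι v k‖) := by gcongr
  linarith

open Classical in
/-- The places in `S` at which `b` is not a square. -/
noncomputable def nonsplit (b : K) (S : Finset (Place K)) : Finset (Place K) :=
  S.filter fun v => ¬ IsSquare (ι v b)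

theorem mem_nonsplit {b : K} {S : Finset (Place K)} {v : Place K} :
    v ∈ nonsplit b S ↔ v ∈ S ∧ ¬ IsSquare (ι v b) := by
  simp [nonsplit]

theorem card_above (h : IsQuad b θ σ) (hb : ¬ IsSquare b) (S : Finset (Place K)) :
    2 * S.card ≤ (above E S).card + (nonsplit b S).card := by
  classical
  have h1 : above E S = S.biUnion fun v => (finite_over (E := E) v).toFinset := by
    ext w
    simp [mem_above]
  have h2 : (above E S).card = ∑ v ∈ S, (finite_over (E := E) v).toFinset.card := by
    rw [h1, Finset.card_biUnion]
    intro v _ v' _ hne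
    rw [Function.onFun, Finset.disjoint_left]
    intro w hw hw'
    simp only [Set.Finite.mem_toFinset, Set.mem_ofPred_eq] at hw hw'
    exact hne (hw.unique hw')
  have h3 : (nonsplit b S).card = ∑ v ∈ S, if IsSquare (ι v b) then 0 else 1 := by
    rw [nonsplit, Finset.card_filter]
    refine Finset.sum_congr rfl fun v _ => ?_
    by_cases hv : IsSquare (ι v b) <;> simp [hv]
  rw [h2, h3, ← Finset.sum_add_distrib, mul_comm, ← smul_eq_mul, ← Finset.sum_const]
  refine Finset.sum_le_sum fun v _ => ?_
  by_cases hv : IsSquare (ι v b)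
  · obtain ⟨w, w', hw, hw', hne⟩ := two_le_card_over h hb v hv
    rw [if_pos hv, add_zero]
    have : ({w, w'} : Finset (Place E)) ⊆ (finite_over (E := E) v).toFinset := by
      intro z hz
      simp only [Finset.mem_insert, Finset.mem_singleton] at hz
      simp only [Set.Finite.mem_toFinset, Set.mem_ofPred_eq]
      rcases hz with rfl | rfl <;> assumption
    exact (Finset.card_pair hne).symm.le.trans (Finset.card_le_card this)
  · rw [if_neg hv]
    obtain ⟨w, hw⟩ := exists_over' (E := E) v
    have : 0 < (finite_over (E := E) v).toFinset.card := by
      rw [Finset.card_pos]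
      exact ⟨w, by simpa using hw⟩
    omega

end Quad
end Place

variable {K : Type u} [Field K] [NumberField K]

namespace Place

section Quad
variable {E : Type u} [Field E] [NumberField E] [Algebra K E] {b : K} {θ : E} {σ : E →ₐ[K] E}

theorem Over.not_inl {S : Finset (Place K)} (hS : Adm S) {w : Place E} {v : Place K}
    (h : Over w v) (hv : v ∉ S) : ∃ Q, w = Sum.inr Q := by
  rcases w with w | Q
  · have h1 := (h.eq_one_iff 2).1 (hS.two v hv)
    rw [_root_.map_ofNat, abv_inl_two] at h1
    norm_num at h1
  · exact ⟨Q, rfl⟩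

theorem Over.conj {w : Place E} {v : Place K} (h : Over w v) (σ : E →ₐ[K] E) :
    ∃ w' : Place E, Over w' v ∧ ∀ z, abv w' z = 1 ↔ abv w (σ z) = 1 := by
  have hnt : (normAbv ((ι w).comp σ.toRingHom)).IsNontrivial := by
    obtain ⟨x, hx0, hx⟩ := abv_isNontrivial v
    refine ⟨algebraMap K E x, by simpa using hx0, fun hh => hx ?_⟩
    rw [h.eq_one_iff, ← hh, normAbv_apply]
    simp [abv_eq_normAbv, normAbv_apply]
  obtain ⟨w', hw'⟩ := exists_isEquiv (stdNorm w) _ hnt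
  refine ⟨w', ?_, fun z => hw'.eq_one_iff⟩
  rw [Over, AbsoluteValue.isEquiv_iff_lt_one_iff]
  intro x
  have h1 := hw'.lt_one_iff (x := algebraMap K E x)
  rw [h.lt_one_iff, abv_eq_normAbv, normAbv_apply]
  rw [abv_eq_normAbv, normAbv_apply, normAbv_apply] at h1
  rw [normAbv_apply, RingHom.comp_apply, h1]
  simp

theorem mem_sUnits_above {S : Finset (Place K)} {u : Eˣ} :
    u ∈ sUnits (above E S) ↔ ∀ (w : Place E) (v : Place K), Over w v → v ∉ S → abv w u = 1 := by
  rw [mem_sUnits]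
  constructor
  · exact fun h w v hwv hv => h w (by rwa [hwv.mem_above])
  · intro h w hw
    obtain ⟨v, hv⟩ := exists_over (K := K) w
    exact h w v hv (by rwa [hv.mem_above] at hw)

theorem map_mem_sUnits_above {S : Finset (Place K)} {u : Kˣ} :
    Units.map (algebraMap K E).toMonoidHom u ∈ sUnits (above E S) ↔ u ∈ sUnits S := by
  rw [mem_sUnits_above]
  constructor
  · intro h v hv
    obtain ⟨w, hw⟩ := exists_over' (E := E) v
    exact (hw.eq_one_iff _).2 (h w v hw hv)
  · intro h w v hw hv
    exact (hw.eq_one_iff _).1 (h v hv)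

theorem exists_sUnit_div {S : Finset (Place K)} (hS : Adm S) (h : IsQuad b θ σ)
    (hbS : ∀ v ∉ S, abv v b = 1) (t : E) (ht : t ≠ 0)
    (hc : ∀ (w : Place E) (v : Place K), Over w v → v ∉ S → abv w (σ t) = abv w t) :
    ∃ d : Kˣ, ∀ (w : Place E) (v : Place K), Over w v → v ∉ S →
      abv w (t / algebraMap K E d) = 1 := by
  classical
  obtain ⟨x, y, hxy⟩ := h.repr t
  have h0 : ∀ p : HeightOneSpectrum (𝓞 K), ∃ g : Kˣ, abv (Sum.inr p) x ≤ abv (Sum.inr p) g ∧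
      abv (Sum.inr p) y ≤ abv (Sum.inr p) g ∧ ((g : K) = x ∨ (g : K) = y) := by
    intro p
    rcases le_total (abv (Sum.inr p) y) (abv (Sum.inr p) x) with hle | hle
    · have hx : x ≠ 0 := by
        rintro rfl
        rw [map_zero] at hle
        have hy : y = 0 := (abv (Sum.inr p)).nonpos_iff.1 hle
        apply ht; rw [hxy, hy]; simp
      exact ⟨Units.mk0 x hx, le_rfl, hle, Or.inl rfl⟩
    · have hy : y ≠ 0 := by
        rintro rfl
        rw [map_zero] at hle
        have hx : x = 0 := (abv (Sum.inr p)).nonpos_iff.1 hle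
        apply ht; rw [hxy, hx]; simp
      exact ⟨Units.mk0 y hy, hle, le_rfl, Or.inr rfl⟩
  choose g hgx hgy hg using h0
  have hfin : {p : HeightOneSpectrum (𝓞 K) | ord p (g p) ≠ 0}.Finite := by
    have h1 : ∀ x : K, {p : HeightOneSpectrum (𝓞 K) | x ≠ 0 ∧ abv (Sum.inr p) x ≠ 1}.Finite := by
      intro x
      by_cases hx : x = 0
      · simp [hx]
      · refine ((finite_abv_ne_one hx).preimage Sum.inr_injective.injOn).subset ?_
        exact fun p hp => hp.2
    refine ((h1 x).union (h1 y)).subset fun p hp => ?_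
    have hp' : abv (Sum.inr p) (g p) ≠ 1 := fun h => hp ((ord_eq_zero_iff p _).2 h)
    rcases hg p with h | h
    · left; exact ⟨h ▸ (g p).ne_zero, h ▸ hp'⟩
    · right; exact ⟨h ▸ (g p).ne_zero, h ▸ hp'⟩
  obtain ⟨d, hd⟩ := hS.exists_ord_eq (fun p => ord p (g p)) hfin.toFinset
  refine ⟨d, fun w v hwv hv => ?_⟩
  obtain ⟨Q, rfl⟩ := hwv.not_inl hS hv
  rcases v with v | p
  · exact absurd (hS.inl_mem v) hv
  have hdg : abv (Sum.inr p) ((g p / d : Kˣ) : K) = 1 := by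
    rw [← ord_eq_zero_iff, div_eq_mul_inv, ord_mul, ord_inv]
    by_cases hp : ord p (g p) = 0
    · rw [(hd p hv).2 (by simpa using hp), hp]; simp
    · rw [(hd p hv).1 (by simpa using hp)]; simp
  set W := abv (Sum.inr Q : Place E) with hW
  have hle : ∀ x : K, abv (Sum.inr p) x ≤ abv (Sum.inr p) (g p) →
      W (algebraMap K E x) ≤ W (algebraMap K E (g p)) := by
    intro x hx
    have hg0 : (g p : K) ≠ 0 := (g p).ne_zero
    have h1 : abv (Sum.inr p) (x / g p) ≤ 1 := by
      rw [map_div₀]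
      exact div_le_one_of_le₀ hx (AbsoluteValue.nonneg _ _)
    rw [hwv.le_one_iff, map_div₀, map_div₀] at h1
    exact (div_le_one₀ (W.pos (by simp))).1 h1
  have h2 : W 2 = 1 := by
    have := (hwv.eq_one_iff 2).1 (hS.two _ hv)
    rwa [_root_.map_ofNat] at this
  have hθ : W θ = 1 := by
    have h3 := (hwv.eq_one_iff b).1 (hbS _ hv)
    rw [← h.sq, map_pow] at h3
    exact (pow_eq_one_iff_of_nonneg (W.nonneg _) two_ne_zero).1 h3
  have hct := hc _ _ hwv hv
  rw [← hW] at hct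
  have hx : W (algebraMap K E x) ≤ W t := by
    have e : 2 * algebraMap K E x = t + σ t := by rw [hxy, h.conj_repr]; ring
    calc W (algebraMap K E x) = W (2 * algebraMap K E x) := by rw [map_mul, h2, one_mul]
      _ ≤ max (W t) (W (σ t)) := by rw [e]; exact abv_add_le_max Q _ _
      _ = W t := by rw [hct, max_self]
  have hy : W (algebraMap K E y) ≤ W t := by
    have e : 2 * (algebraMap K E y * θ) = t + -σ t := by rw [hxy, h.conj_repr]; ring
    calc W (algebraMap K E y) = W (2 * (algebraMap K E y * θ)) := by
          rw [map_mul, map_mul, h2, hθ, one_mul, mul_one]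
      _ ≤ max (W t) (W (-σ t)) := by rw [e]; exact abv_add_le_max Q _ _
      _ = W t := by rw [AbsoluteValue.map_neg, hct, max_self]
  have ht' : W t ≤ W (algebraMap K E (g p)) := by
    rw [hxy]
    refine (abv_add_le_max Q _ _).trans (max_le (hle x (hgx p)) ?_)
    rw [map_mul, ← hW, hθ, mul_one]
    exact hle y (hgy p)
  have ht'' : W t = W (algebraMap K E (g p)) := by
    refine le_antisymm ht' ?_
    rcases hg p with h | h <;> rw [h] <;> assumption
  rw [map_div₀, ht'', ← map_div₀, ← map_div₀]
  rw [hwv.eq_one_iff] at hdg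
  rw [← hdg]
  simp [hW]

theorem norm_index_sUnits {S : Finset (Place K)} (hS : Adm S) (hb : ¬ IsSquare b) (hb0 : b ≠ 0)
    (hbS : Units.mk0 b hb0 ∈ sUnits S) (h : IsQuad b θ σ) :
    (nrmGroup b).relIndex (sUnits S) ≠ 0 ∧
      2 * (nrmGroup b).relIndex (sUnits S) ≤ 2 ^ (nonsplit b S).card := by
  have hinj := (algebraMap K E).injective
  have hσ : ∀ u : Eˣ, u ∈ sUnits (above E S) →
      Units.map (σ : E →* E) u ∈ sUnits (above E S) := by
    intro u hu
    rw [mem_sUnits_above] at hu ⊢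
    intro w v hwv hv
    obtain ⟨w', hw', hww'⟩ := hwv.conj σ
    exact (hww' u).1 (hu w' v hw' hv)
  let i : sUnits S →* sUnits (above E S) :=
    ((Units.map (algebraMap K E).toMonoidHom).comp (sUnits S).subtype).codRestrict _
      fun u => map_mem_sUnits_above.2 u.2
  have hi : ∀ u, ((i u : Eˣ) : E) = algebraMap K E (u : Kˣ) := fun u => rfl
  have hex : ∀ z : sUnits (above E S), ∃ k : sUnits S,
      algebraMap K E (k : Kˣ) = (z : Eˣ) * σ (z : Eˣ) := by
    intro z
    obtain ⟨k, hk⟩ := h.exists_norm (z : Eˣ)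
    have hk0 : k ≠ 0 := by
      rintro rfl
      rw [map_zero] at hk
      have := mul_ne_zero (z : Eˣ).ne_zero ((_root_.map_ne_zero σ).2 (z : Eˣ).ne_zero)
      exact this hk.symm
    refine ⟨⟨Units.mk0 k hk0, ?_⟩, hk⟩
    rw [← map_mem_sUnits_above (E := E)]
    have : Units.map (algebraMap K E).toMonoidHom (Units.mk0 k hk0) =
      (z : Eˣ) * Units.map (σ : E →* E) z := Units.ext hk
    rw [this]
    exact mul_mem z.2 (hσ _ z.2)
  choose f hf using hex
  let N : sUnits (above E S) →* sUnits S :=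
    { toFun := f
      map_one' := by
        apply Subtype.ext; apply Units.ext; apply hinj
        rw [hf]; simp
      map_mul' := fun z w => by
        apply Subtype.ext; apply Units.ext; apply hinj
        rw [hf]
        simp only [Subgroup.coe_mul, Units.val_mul, map_mul, hf]; ring }
  have hN : ∀ a, N (i a) = a ^ 2 := by
    intro a
    apply Subtype.ext; apply Units.ext; apply hinj
    show algebraMap K E (f (i a) : Kˣ) = _
    rw [hf, hi]
    simp [sq]
  have h1 : ∀ c, N c ∈ sqGroup (sUnits S) → ∃ a c', c = i a * c' ^ 2 := by
    rintro z ⟨k, hk⟩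
    have hk2 : (algebraMap K E (k : Kˣ)) ^ 2 = (z : Eˣ) * σ (z : Eˣ) := by
      rw [← hf z, ← map_pow]
      exact congrArg (fun u : sUnits S => algebraMap K E (u : Kˣ)) hk
    set z' : E := ((z : Eˣ) : E) with hz'
    set k' : K := ((k : Kˣ) : K) with hk'
    obtain ⟨x, y, hxy⟩ := h.repr z'
    have hτ : z' + σ z' = algebraMap K E (2 * x) := by
      rw [hxy, h.conj_repr, map_mul, _root_.map_ofNat]; ring
    by_cases h0 : 2 * x + 2 * k' = 0
    · have h2 : (z' + algebraMap K E k') ^ 2 = 0 := by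
        have h3 : algebraMap K E (2 * x) = - (2 * algebraMap K E k') := by
          rw [← _root_.map_ofNat (algebraMap K E) 2, ← map_mul, ← map_neg]
          congr 1; linear_combination h0
        rw [h3] at hτ
        linear_combination hk2 + z' * hτ
      have h3 : z' = algebraMap K E (-k') := by
        rw [map_neg]; exact eq_neg_of_add_eq_zero_left (pow_eq_zero_iff two_ne_zero |>.1 h2)
      refine ⟨⟨-k, fun v hv => ?_⟩, 1, ?_⟩
      · rw [Units.val_neg, AbsoluteValue.map_neg]; exact k.2 v hv
      · rw [one_pow, mul_one]
        apply Subtype.ext; apply Units.ext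
        rw [hi]; exact h3
    · set τ : K := 2 * x + 2 * k' with hτdef
      have hz0 : z' ≠ 0 := (z : Eˣ).ne_zero
      have ht2 : (z' + algebraMap K E k') ^ 2 = z' * algebraMap K E τ := by
        rw [hτdef, map_add, ← hτ, map_mul, _root_.map_ofNat]
        linear_combination hk2
      have ht0 : z' + algebraMap K E k' ≠ 0 := by
        intro h3
        rw [h3, zero_pow two_ne_zero] at ht2
        exact mul_ne_zero hz0 ((_root_.map_ne_zero _).2 h0) ht2.symm
      have hzu := mem_sUnits_above.1 z.2
      have hzu' := mem_sUnits_above.1 (hσ _ z.2)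
      obtain ⟨d, hd⟩ := exists_sUnit_div hS h (fun v hv => hbS v hv) _ ht0 (by
        intro w v hwv hv
        have h3 := congrArg σ ht2
        rw [map_pow, map_mul, AlgHom.commutes] at h3
        have h4 : abv w (σ (z' + algebraMap K E k')) ^ 2 = abv w (z' + algebraMap K E k') ^ 2 := by
          rw [← map_pow (abv w) (σ _) 2, ← map_pow (abv w) (z' + _) 2, h3, ht2, map_mul, map_mul]
          congr 1
          rw [hz', hzu w v hwv hv]
          exact hzu' w v hwv hv
        exact (pow_left_inj₀ ((abv w).nonneg _) ((abv w).nonneg _) two_ne_zero).1 h4)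
      have hd0 : algebraMap K E d ≠ 0 := (_root_.map_ne_zero _).2 d.ne_zero
      let t : Eˣ := Units.mk0 ((z' + algebraMap K E k') / algebraMap K E d) (div_ne_zero ht0 hd0)
      have ht : t ∈ sUnits (above E S) := mem_sUnits_above.2 hd
      let a : Kˣ := d ^ 2 / Units.mk0 τ h0
      have ha : Units.map (algebraMap K E).toMonoidHom a = (z : Eˣ) * (t ^ 2)⁻¹ := by
        apply Units.ext
        have hτ0 : algebraMap K E τ ≠ 0 := (_root_.map_ne_zero _).2 h0
        have : algebraMap K E ((d : K) ^ 2 / τ) = z' * (((z' + algebraMap K E k') / algebraMap K E d) ^ 2)⁻¹ := by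
          rw [div_pow, ht2, map_div₀, map_pow]
          field_simp
        simpa [a, t] using this
      refine ⟨⟨a, ?_⟩, ⟨t, ht⟩, ?_⟩
      · rw [← map_mem_sUnits_above (E := E), ha]
        exact mul_mem z.2 (inv_mem (pow_mem ht 2))
      · apply Subtype.ext
        show (z : Eˣ) = Units.map (algebraMap K E).toMonoidHom a * t ^ 2
        rw [ha, inv_mul_cancel_right]
  have hθ0 : θ ≠ 0 := by
    rintro rfl
    have := h.sq
    rw [zero_pow two_ne_zero] at this
    exact hb0 (by simpa using this.symm)
  obtain ⟨e1, e2⟩ := norm_index_le i N hN (sqGroup_index_sUnits S hS.inl_mem)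
    (sqGroup_index_sUnits (above E S) (fun w => by
      obtain ⟨v, hv⟩ := exists_over (K := K) (Sum.inl w : Place E)
      rw [hv.mem_above]
      by_contra hcon
      obtain ⟨Q, hQ⟩ := hv.not_inl hS hcon
      cases hQ)) h1 ⟨Units.mk0 b hb0, hbS⟩ (by
      rintro ⟨c, hc⟩
      apply hb
      refine ⟨((c : Kˣ) : K), ?_⟩
      have := congrArg (fun u : sUnits S => ((u : Kˣ) : K)) hc
      simp only [powMonoidHom_apply, Subgroup.coe_pow, Units.val_pow_eq_pow_val, Units.val_mk0] at this
      rw [← this, sq]) (by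
      refine ⟨⟨Units.mk0 θ hθ0, ?_⟩, ?_⟩
      · rw [mem_sUnits_above]
        intro w v hwv hv
        have h3 := (hwv.eq_one_iff b).1 (hbS _ hv)
        rw [← h.sq, map_pow] at h3
        exact (pow_eq_one_iff_of_nonneg ((abv w).nonneg _) two_ne_zero).1 h3
      · apply Subtype.ext; apply Units.ext
        exact h.sq)
  have e3 : N.range ≤ (nrmGroup b).subgroupOf (sUnits S) := by
    rintro _ ⟨z, rfl⟩
    rw [Subgroup.mem_subgroupOf, mem_nrmGroup]
    exact h.isNrm_of_norm (hf z)
  have e4 : (nrmGroup b).relIndex (sUnits S) ∣ N.range.index := Subgroup.index_dvd_of_le e3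
  refine ⟨fun h0 => e1 (by rw [h0] at e4; exact zero_dvd_iff.1 e4), ?_⟩
  have e5 := Nat.le_of_dvd (Nat.pos_of_ne_zero e1) e4
  have e6 := card_above h hb S
  have e7 : N.range.index * 2 * 2 ^ (above E S).card ≤
      2 ^ (nonsplit b S).card * 2 ^ (above E S).card := by
    calc _ = N.range.index * 2 ^ ((above E S).card + 1) := by rw [pow_succ]; ring
      _ ≤ 2 ^ (2 * S.card) := e2
      _ ≤ 2 ^ ((above E S).card + (nonsplit b S).card) := Nat.pow_le_pow_right two_pos e6
      _ = _ := by rw [pow_add, mul_comm]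
  have e8 := Nat.le_of_mul_le_mul_right e7 (by positivity)
  omega

end Quad

/-- The first inequality. -/
theorem two_mul_relIndex_le {S : Finset (Place K)} (hS : Adm S) {b : K} (hb : ¬ IsSquare b)
    (hb0 : b ≠ 0) (hbS : Units.mk0 b hb0 ∈ sUnits S) :
    (nrmGroup b).relIndex (sUnits S) ≠ 0 ∧
      2 * (nrmGroup b).relIndex (sUnits S) ≤ 2 ^ (nonsplit b S).card := by
  obtain ⟨E, _, _, _, θ, σ, h⟩ := exists_isQuad hb
  exact norm_index_sUnits hS hb hb0 hbS h

end Place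

section Tame

open IsLocalRing

variable {O : Type*} [CommRing O] [IsDomain O] [IsDiscreteValuationRing O] [HenselianLocalRing O]
  {F : Type*} [Field F] [Algebra O F] [IsFractionRing O F]

theorem even_of_isNrm_unit [CharZero F] (h2 : IsUnit (2 : O)) {π : O} (hπ : Irreducible π) {u : O}
    (hu : IsUnit u) (hsq : ¬ IsSquare u) {c : F} (hc : c ≠ 0) (h : IsNrm (algebraMap O F u) c) :
    ∃ (k : ℤ) (w : Oˣ), c = algebraMap O F w * algebraMap O F π ^ (2 * k) := by
  obtain ⟨t, ht⟩ := h2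
  have ht' : (2 : O) * (t⁻¹ : Oˣ) = 1 := by rw [← ht]; simp
  have e : 1 + 4 * ((u - 1) * (t⁻¹ : Oˣ) ^ 2) = u := by
    linear_combination (u - 1) * (2 * (t⁻¹ : Oˣ) + 1) * ht'
  refine even_of_isNrm_one_add_four hπ (ρ := (u - 1) * (t⁻¹ : Oˣ) ^ 2) (fun s hs => hsq ?_) hc
    (by rwa [e])
  rw [← e]
  exact isSquare_one_add_four_mul (by rwa [e]) hs

end Tame

namespace Place

variable {K : Type u} [Field K] [NumberField K]

theorem exists_unit_of_norm_eq_one (p : HeightOneSpectrum (𝓞 K)) {x : L (Sum.inr p : Place K)}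
    (hx : ‖x‖ = 1) : ∃ u : p.adicCompletionIntegers K, IsUnit u ∧
      algebraMap (p.adicCompletionIntegers K) (p.adicCompletion K) u = x := by
  have h1 : ∀ y : p.adicCompletion K, ‖y‖ = 1 → y ∈ p.adicCompletionIntegers K :=
    fun y hy => (adic_norm_le_one_iff p y).2 hy.le
  have hx0 : (show p.adicCompletion K from x) ≠ 0 := fun h => by
    have : ‖(show p.adicCompletion K from x)‖ = 1 := hx
    rw [h] at this; simp at this
  refine ⟨⟨x, h1 x hx⟩, ?_, rfl⟩
  refine IsUnit.of_mul_eq_one ⟨(show p.adicCompletion K from x)⁻¹, h1 _ ?_⟩ ?_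
  · rw [norm_inv]; erw [hx]; simp
  · apply Subtype.ext
    exact mul_inv_cancel₀ hx0

theorem isUnit_two_of_abv (p : HeightOneSpectrum (𝓞 K)) (h2 : abv (Sum.inr p) (2 : K) = 1) :
    IsUnit (2 : p.adicCompletionIntegers K) := by
  obtain ⟨u, hu, e⟩ := exists_unit_of_norm_eq_one p (x := ι (Sum.inr p) 2) h2
  convert hu
  apply Subtype.ext
  refine Eq.trans ?_ e.symm
  rw [_root_.map_ofNat]; rfl

theorem tame_units (p : HeightOneSpectrum (𝓞 K)) (h2 : abv (Sum.inr p) (2 : K) = 1)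
    {x y : L (Sum.inr p : Place K)} (hx : ‖x‖ = 1) (hy : ‖y‖ = 1) : IsNrm x y := by
  obtain ⟨u, hu, rfl⟩ := exists_unit_of_norm_eq_one p hx
  obtain ⟨w, hw, rfl⟩ := exists_unit_of_norm_eq_one p hy
  exact isNrm_units (F := p.adicCompletion K) (isUnit_two_of_abv p h2) hu hw

theorem tame_mul (p : HeightOneSpectrum (𝓞 K)) (h2 : abv (Sum.inr p) (2 : K) = 1)
    {x y : L (Sum.inr p : Place K)} (hx : ‖x‖ = 1) (hy : ‖y‖ = 1) (hx' : ¬ IsSquare x)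
    (hy' : ¬ IsSquare y) : IsSquare (x * y) := by
  obtain ⟨u, hu, rfl⟩ := exists_unit_of_norm_eq_one p hx
  obtain ⟨w, hw, rfl⟩ := exists_unit_of_norm_eq_one p hy
  have := (isSquare_mul_of_not (isUnit_two_of_abv p h2) hu hw (fun h => hx' (h.map _))
    (fun h => hy' (h.map _))).map (algebraMap (p.adicCompletionIntegers K) (p.adicCompletion K))
  rw [map_mul] at this
  exact this

theorem exists_ord_eq_one (p : HeightOneSpectrum (𝓞 K)) : ∃ ϖ : Kˣ, ord p ϖ = 1 := by
  obtain ⟨π, hπ⟩ := p.valuation_exists_uniformizer K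
  have h0 : π ≠ 0 := fun h => by simp [h] at hπ; exact WithZero.exp_ne_zero hπ.symm
  refine ⟨(Units.mk0 π h0)⁻¹, ?_⟩
  have := valuation_eq_exp p (Units.mk0 π h0)
  rw [Units.val_mk0, hπ] at this
  rw [ord_inv, ← WithZero.exp_injective this]; simp

/-- Every element of even order is, up to a square, a unit. -/
theorem exists_unit_of_even (p : HeightOneSpectrum (𝓞 K)) {b : Kˣ} (hb : Even (ord p b)) :
    ∃ (u d : Kˣ), b = u * d ^ 2 ∧ abv (Sum.inr p) (u : K) = 1 := by
  obtain ⟨ϖ, hϖ⟩ := exists_ord_eq_one p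
  obtain ⟨k, hk⟩ := hb
  refine ⟨b * (ϖ ^ k)⁻¹ ^ 2, ϖ ^ k, ?_, ?_⟩
  · rw [mul_assoc, ← mul_pow, inv_mul_cancel, one_pow, mul_one]
  · rw [← ord_eq_zero_iff, ord_mul, sq, ord_mul, ord_inv, ord_zpow, hk, hϖ]; ring

theorem even_ord_of_isNrm (p : HeightOneSpectrum (𝓞 K)) (h2 : IsUnit (2 : p.adicCompletionIntegers K))
    {w : p.adicCompletionIntegers K} (hw : IsUnit w) (hsq : ¬ IsSquare w) {c : Kˣ}
    (h : IsNrm (algebraMap (p.adicCompletionIntegers K) (p.adicCompletion K) w)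
      (algebraMap K (p.adicCompletion K) c)) : Even (ord p c) := by
  obtain ⟨π, hπ⟩ := IsDiscreteValuationRing.exists_irreducible (p.adicCompletionIntegers K)
  obtain ⟨k, z, hz⟩ := even_of_isNrm_unit h2 hπ hw hsq ((_root_.map_ne_zero _).2 c.ne_zero) h
  have hz1 : Valued.v (algebraMap (p.adicCompletionIntegers K) (p.adicCompletion K) z) = 1 :=
    (HeightOneSpectrum.adicCompletionIntegers.isUnit_iff_valued_eq_one).1 z.isUnit
  have h3 := congrArg Valued.v hz
  rw [map_mul, map_zpow₀, hz1, valued_algebraMap, valuation_eq_exp] at h3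
  have hπ0 : Valued.v (algebraMap (p.adicCompletionIntegers K) (p.adicCompletion K) π) ≠ 0 := by
    simpa using hπ.ne_zero
  rw [one_mul, ← WithZero.exp_log hπ0, ← WithZero.exp_zsmul] at h3
  rw [WithZero.exp_injective h3, smul_eq_mul, mul_assoc]
  exact even_two_mul _

theorem tame_ord (p : HeightOneSpectrum (𝓞 K)) (h2 : abv (Sum.inr p) (2 : K) = 1) {b : Kˣ}
    (hb : Even (ord p b)) (hsq : ¬ IsSquare (ι (Sum.inr p) (b : K))) (c : Kˣ) :
    IsNrm (ι (Sum.inr p) (b : K)) (ι (Sum.inr p) (c : K)) ↔ Even (ord p c) := by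
  obtain ⟨u, d, rfl, hu⟩ := exists_unit_of_even p hb
  have hd : ι (Sum.inr p) (d : K) ≠ 0 := (_root_.map_ne_zero _).2 d.ne_zero
  rw [Units.val_mul, Units.val_pow_eq_pow_val, map_mul, map_pow] at hsq ⊢
  rw [isNrm_mul_sq_left hd]
  have hsq' : ¬ IsSquare (ι (Sum.inr p) (u : K)) := fun h => hsq (h.mul ⟨_, sq _⟩)
  constructor
  · intro h
    obtain ⟨w, hw, e⟩ := exists_unit_of_norm_eq_one p (x := ι (Sum.inr p) (u : K)) hu
    refine even_ord_of_isNrm p (isUnit_two_of_abv p h2) hw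
      (fun h => hsq' (e ▸ h.map (algebraMap _ (p.adicCompletion K)))) ?_
    rw [e]; exact h
  · intro h
    obtain ⟨w, e, rfl, hw⟩ := exists_unit_of_even p h
    rw [Units.val_mul, Units.val_pow_eq_pow_val, map_mul, map_pow,
      isNrm_mul_sq_right ((_root_.map_ne_zero _).2 e.ne_zero)]
    exact tame_units p h2 hu hw

theorem tame_odd (p : HeightOneSpectrum (𝓞 K)) (h2 : abv (Sum.inr p) (2 : K) = 1) {b : Kˣ}
    (hb : ¬ Even (ord p b)) {c : Kˣ} (hc : Even (ord p c)) :
    IsNrm (ι (Sum.inr p) (b : K)) (ι (Sum.inr p) (c : K)) ↔ IsSquare (ι (Sum.inr p) (c : K)) := by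
  have hb0 : ι (Sum.inr p) (b : K) ≠ 0 := (_root_.map_ne_zero _).2 b.ne_zero
  have hc0 : ι (Sum.inr p) (c : K) ≠ 0 := (_root_.map_ne_zero _).2 c.ne_zero
  rw [isNrm_comm hb0 hc0]
  constructor
  · intro h
    by_contra hsq
    exact hb ((tame_ord p h2 hc hsq b).1 h)
  · intro h
    exact isNrm_of_isSquare h hc0 _

end Place

theorem IsNrm.iff_of_inv_mul {F : Type*} [Field F] {a c d : F} (hc : c ≠ 0) (hd : d ≠ 0)
    (h : IsNrm a (c⁻¹ * d)) : IsNrm a c ↔ IsNrm a d := by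
  constructor
  · intro h'
    have := h'.mul h
    rwa [mul_inv_cancel_left₀ hc] at this
  · intro h'
    have := h'.mul h.inv
    have e : d * (c⁻¹ * d)⁻¹ = c := by field_simp
    rwa [e] at this

theorem IsSquare.iff_of_inv_mul {F : Type*} [Field F] {c d : F} (hc : c ≠ 0) (hd : d ≠ 0)
    (h : IsSquare (c⁻¹ * d)) : IsSquare c ↔ IsSquare d := by
  constructor
  · intro h'
    have := h'.mul h
    rwa [mul_inv_cancel_left₀ hc] at this
  · intro h'
    have := h'.mul h.inv
    have e : d * (c⁻¹ * d)⁻¹ = c := by field_simp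
    rwa [e] at this

namespace Place

variable {K : Type u} [Field K] [NumberField K]

theorem exists_not_isNrm_infinite (v : InfinitePlace K) {a : v.Completion} (hsq : ¬ IsSquare a) :
    ∃ c : v.Completion, c ≠ 0 ∧ ¬ IsNrm a c := by
  by_cases h : v.IsReal
  · let e : v.Completion ≃+* ℝ := InfinitePlace.Completion.ringEquivRealOfIsReal h
    refine ⟨-1, neg_ne_zero.2 one_ne_zero, ?_⟩
    intro hn
    have ha' : e a < 0 := by
      by_contra! h0
      apply hsq
      have : IsSquare (e a) := ⟨√(e a), (Real.mul_self_sqrt h0).symm⟩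
      have := this.map e.symm
      rwa [e.symm_apply_apply] at this
    obtain ⟨x, y, hxy⟩ := hn.map (e : v.Completion →+* ℝ)
    simp only [map_neg, map_one, RingHom.coe_coe] at hxy
    nlinarith [sq_nonneg x, mul_nonneg (neg_nonneg.2 ha'.le) (sq_nonneg y)]
  · let e : v.Completion ≃+* ℂ := InfinitePlace.Completion.ringEquivComplexOfIsComplex
      (InfinitePlace.not_isReal_iff_isComplex.1 h)
    exfalso
    apply hsq
    obtain ⟨z, hz⟩ := IsAlgClosed.exists_pow_nat_eq (e a) two_pos
    have : IsSquare (e a) := ⟨z, by rw [← hz, sq]⟩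
    have := this.map e.symm
    rwa [e.symm_apply_apply] at this

theorem exists_not_isNrm (v : Place K) {a : L v} (ha : a ≠ 0) (hsq : ¬ IsSquare a) :
    ∃ c : L v, c ≠ 0 ∧ ¬ IsNrm a c := by
  rcases v with v | p
  · exact exists_not_isNrm_infinite v hsq
  · exact _root_.exists_not_isNrm (O := p.adicCompletionIntegers K) (F := p.adicCompletion K) ha hsq

/-- `c` is a norm from `K(√a)` at the place `v`. -/
abbrev NrmAt (v : Place K) (a c : Kˣ) : Prop := IsNrm (ι v (a : K)) (ι v (c : K))

/-- `a` is a square at the place `v`. -/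
abbrev SqAt (v : Place K) (a : Kˣ) : Prop := IsSquare (ι v (a : K))

theorem ι_ne_zero (v : Place K) (c : Kˣ) : ι v (c : K) ≠ 0 := (_root_.map_ne_zero _).2 c.ne_zero

theorem ι_inv_mul (v : Place K) (c d : Kˣ) :
    ι v ((c⁻¹ * d : Kˣ) : K) = (ι v (c : K))⁻¹ * ι v (d : K) := by
  rw [Units.val_mul, map_mul, Units.val_inv_eq_inv_val, map_inv₀]

theorem ι_mul (v : Place K) (c d : Kˣ) :
    ι v ((c * d : Kˣ) : K) = ι v (c : K) * ι v (d : K) := by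
  rw [Units.val_mul, map_mul]

theorem SqAt.nrmAt {v : Place K} {a : Kˣ} (h : SqAt v a) (c : Kˣ) : NrmAt v a c :=
  isNrm_of_isSquare h (ι_ne_zero v a) _

theorem finite_pattern {S : Finset (Place K)} (hS : Adm S) {b : Kˣ} (hb : ¬ IsSquare (b : K))
    (hbS : b ∈ sUnits S) : ∃ T ⊆ nonsplit (b : K) S, ∀ c ∈ sUnits S,
      ¬ ∀ v ∈ nonsplit (b : K) S, (NrmAt v b c ↔ v ∉ T) := by
  by_contra! hall
  obtain ⟨h0, h1⟩ := two_mul_relIndex_le hS hb b.ne_zero (by simpa using hbS)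
  choose c hcS hc using fun T : (nonsplit (b : K) S).powerset =>
    hall T.1 (Finset.mem_powerset.1 T.2)
  set Q := (nrmGroup (b : K)).subgroupOf (sUnits S)
  have hinj : Function.Injective fun T => (QuotientGroup.mk ⟨c T, hcS T⟩ : sUnits S ⧸ Q) := by
    intro T T' h
    have h2 : (⟨c T, hcS T⟩⁻¹ * ⟨c T', hcS T'⟩ : sUnits S) ∈ Q := QuotientGroup.eq.1 h
    rw [Subgroup.mem_subgroupOf] at h2
    have h3 : IsNrm (b : K) ((c T)⁻¹ * c T' : Kˣ) := h2
    apply Subtype.ext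
    have hT := Finset.mem_powerset.1 T.2
    have hT' := Finset.mem_powerset.1 T'.2
    have key : ∀ v ∈ nonsplit (b : K) S, (v ∈ T.1 ↔ v ∈ T'.1) := by
      intro v hv
      have h4 := h3.map (ι v)
      rw [ι_inv_mul] at h4
      have h5 := h4.iff_of_inv_mul (ι_ne_zero v _) (ι_ne_zero v _)
      rw [← not_iff_not, ← hc T v hv, ← hc T' v hv]
      exact h5
    ext v
    exact ⟨fun h => (key v (hT h)).1 h, fun h => (key v (hT' h)).2 h⟩
  have : Q.FiniteIndex := ⟨h0⟩
  have h2 := Nat.card_le_card_of_injective _ hinj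
  rw [Nat.card_eq_fintype_card, Fintype.card_coe, Finset.card_powerset] at h2
  have h3 : 2 ^ (nonsplit (b : K) S).card ≤ (nrmGroup (b : K)).relIndex (sUnits S) := h2
  have : 0 < 2 ^ (nonsplit (b : K) S).card := by positivity
  omega

/-- The places where `c` is not a unit. -/
noncomputable def supp (c : Kˣ) : Finset (Place K) := (finite_abv_ne_one c.ne_zero).toFinset

theorem mem_sUnits_iff_supp {c : Kˣ} {S : Finset (Place K)} : c ∈ sUnits S ↔ supp c ⊆ S := by
  rw [mem_sUnits]
  constructor
  · intro h v hv
    by_contra hv'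
    simp only [supp, Set.Finite.mem_toFinset, Set.mem_ofPred_eq] at hv
    exact hv (h v hv')
  · intro h v hv
    by_contra h'
    exact hv (h (by simpa [supp] using h'))

theorem exists_weak_pattern (b : Kˣ) {S T : Finset (Place K)} (hT : T ⊆ nonsplit (b : K) S) :
    ∃ c : Kˣ, ∀ v ∈ S, (NrmAt v b c ↔ v ∉ T) := by
  classical
  have h1 : ∀ v : Place K, ∃ x : L v, x ≠ 0 ∧ (v ∈ S → (IsNrm (ι v (b : K)) x ↔ v ∉ T)) := by
    intro v
    by_cases hv : v ∈ T
    · obtain ⟨c, hc, hc'⟩ := exists_not_isNrm v (ι_ne_zero v b) (mem_nonsplit.1 (hT hv)).2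
      exact ⟨c, hc, fun _ => by simp [hv, hc']⟩
    · exact ⟨1, one_ne_zero, fun _ => by simp [hv, isNrm_one]⟩
  choose x hx0 hx using h1
  obtain ⟨c, hc0, hc⟩ := exists_isSquare_mul S x (fun v _ => hx0 v)
  refine ⟨Units.mk0 c hc0, fun v hv => ?_⟩
  rw [← hx v hv]
  obtain ⟨d, hd⟩ := hc v hv
  have hιc : ι v c ≠ 0 := (_root_.map_ne_zero _).2 hc0
  refine IsNrm.iff_of_inv_mul hιc (hx0 v) ?_
  have e : (ι v c)⁻¹ * x v = (d * (ι v c)⁻¹) ^ 2 := by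
    field_simp; linear_combination hd
  rw [Units.val_mk0, e]
  exact isNrm_sq _ _

theorem isSquare_of_forall_sqAt (b : Kˣ) (S₀ : Finset (Place K)) (h : ∀ v ∉ S₀, SqAt v b) :
    IsSquare (b : K) := by
  classical
  by_contra hb
  obtain ⟨S, hS₀, hS⟩ := exists_adm (S₀ ∪ supp b)
  choose c hc using fun T : (nonsplit (b : K) S).powerset =>
    exists_weak_pattern b (Finset.mem_powerset.1 T.2)
  set S' := S ∪ Finset.univ.biUnion fun T => supp (c T) with hS'
  have hSS' : S ⊆ S' := Finset.subset_union_left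
  have hns : nonsplit (b : K) S' = nonsplit (b : K) S := by
    ext v
    rw [mem_nonsplit, mem_nonsplit]
    refine ⟨fun ⟨_, h2⟩ => ⟨?_, h2⟩, fun ⟨h1, h2⟩ => ⟨hSS' h1, h2⟩⟩
    by_contra hv
    exact h2 (h v fun h' => hv (hS₀ (Finset.mem_union_left _ h')))
  obtain ⟨T, hT, hTc⟩ := finite_pattern (hS.mono hSS') hb (mem_sUnits_iff_supp.2
    ((Finset.subset_union_right.trans hS₀).trans hSS'))
  rw [hns] at hT hTc
  refine hTc (c ⟨T, Finset.mem_powerset.2 hT⟩) (mem_sUnits_iff_supp.2 ?_)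
    fun v hv => hc ⟨T, Finset.mem_powerset.2 hT⟩ v (mem_nonsplit.1 hv).1
  refine Finset.Subset.trans ?_ Finset.subset_union_right
  exact Finset.subset_biUnion_of_mem (fun T => supp (c T)) (Finset.mem_univ _)

theorem exists_sqAt_not_sqAt (S₀ : Finset (Place K)) (a b : Kˣ) (hb : ¬ IsSquare (b : K))
    (hab : ¬ IsSquare ((a * b : Kˣ) : K)) : ∃ v ∉ S₀, SqAt v a ∧ ¬ SqAt v b := by
  classical
  by_contra! hall
  by_cases ha : IsSquare (a : K)
  · exact hb (isSquare_of_forall_sqAt b S₀ fun v hv => hall v hv (ha.map _))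
  obtain ⟨E, _, _, _, θ, σ, h⟩ := exists_isQuad ha
  obtain ⟨S, hS₀, hS⟩ := exists_adm (S₀ ∪ supp a ∪ supp b)
  have haS : a ∈ sUnits S := mem_sUnits_iff_supp.2 fun v hv => hS₀ (by simp [hv])
  have hbS : b ∈ sUnits S := mem_sUnits_iff_supp.2 fun v hv => hS₀ (by simp [hv])
  have hE : IsSquare (Units.map (algebraMap K E : K →* E) b : E) := by
    refine isSquare_of_forall_sqAt _ (above E S) fun w hw => ?_
    obtain ⟨v, hwv⟩ := exists_over (K := K) w
    have hv : v ∉ S := fun h' => hw (hwv.mem_above.2 h')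
    obtain ⟨ψ, -, hψ⟩ := hwv.exists_hom
    show IsSquare (ι w (algebraMap K E b))
    rw [← hψ]
    by_cases hav : SqAt v a
    · exact (hall v (fun h' => hv (hS₀ (by simp [h']))) hav).map ψ
    by_cases hbv : SqAt v b
    · exact hbv.map ψ
    rcases v with v | p
    · exact absurd (hS.inl_mem v) hv
    have h3 := (tame_mul p (hS.two _ hv) (haS _ hv) (hbS _ hv) hav hbv).map ψ
    rw [map_mul, hψ, ← h.sq, map_pow] at h3
    have hθ : ι w θ ≠ 0 := by
      rw [_root_.map_ne_zero]
      intro h0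
      have := h.sq
      rw [h0, zero_pow two_ne_zero] at this
      exact a.ne_zero ((_root_.map_eq_zero _).1 this.symm)
    obtain ⟨d, hd⟩ := h3
    exact ⟨d / ι w θ, by field_simp; linear_combination hd⟩
  obtain ⟨z, hz⟩ := hE
  obtain ⟨x, y, rfl⟩ := h.repr z
  have hz' : algebraMap K E b + algebraMap K E 0 * θ =
      algebraMap K E (x ^ 2 + a * y ^ 2) + algebraMap K E (2 * x * y) * θ := by
    have hz2 : algebraMap K E b = (algebraMap K E x + algebraMap K E y * θ) *
      (algebraMap K E x + algebraMap K E y * θ) := hz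
    rw [hz2]
    simp only [map_add, map_mul, map_pow, map_zero, ← h.sq, _root_.map_ofNat]
    ring
  obtain ⟨h1, h2⟩ := h.repr_unique ha hz'
  have h3 : x = 0 ∨ y = 0 := by
    rcases mul_eq_zero.1 h2.symm with h3 | h3
    · left; simpa using h3
    · exact Or.inr h3
  rcases h3 with rfl | rfl
  · apply hab
    rw [Units.val_mul, h1]
    exact ⟨a * y, by ring⟩
  · apply hb
    rw [h1]; exact ⟨x, by ring⟩

end Place

theorem index_pi_univ {κ : Type*} [Fintype κ] {G : κ → Type*} [∀ i, Group (G i)]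
    (H : ∀ i, Subgroup (G i)) : (Subgroup.pi Set.univ H).index = ∏ i, (H i).index := by
  simp_rw [Subgroup.index, ← Nat.card_pi]
  refine Nat.card_congr
    ((Quotient.congrRight (fun x y ↦ ?_)).trans (Setoid.piQuotientEquiv _).symm)
  rw [QuotientGroup.leftRel_pi]

namespace Place

variable {K : Type u} [Field K] [NumberField K]

theorem mem_sqGroup_sUnits {S : Finset (Place K)} {c : sUnits S} :
    c ∈ sqGroup (sUnits S) ↔ IsSquare ((c : Kˣ) : K) := by
  rw [mem_sqGroup]
  constructor
  · rintro ⟨d, rfl⟩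
    exact ⟨((d : Kˣ) : K), by rw [← sq]; rfl⟩
  · rintro ⟨d, hd⟩
    have hd0 : d ≠ 0 := fun h => (c : Kˣ).ne_zero (by rw [hd, h, zero_mul])
    refine ⟨⟨Units.mk0 d hd0, fun v hv => ?_⟩, ?_⟩
    · have := c.2 v hv
      rw [hd, map_mul, ← sq] at this
      exact (pow_eq_one_iff_of_nonneg ((abv v).nonneg _) two_ne_zero).1 this
    · apply Subtype.ext; apply Units.ext
      exact (sq _).trans hd.symm

/-- A finite set of places outside `S`, at each of which `a` is a square, and at which the `S`-units
have independent classes modulo squares. -/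
structure Indep (S : Finset (Place K)) (a : Kˣ) (T : Finset (Place K)) : Prop where
  disj : ∀ v ∈ T, v ∉ S
  sq : ∀ v ∈ T, SqAt v a
  surj : ∀ T' ⊆ T, ∃ c ∈ sUnits S, ∀ v ∈ T, (SqAt v c ↔ v ∉ T')

theorem Indep.card_le {S : Finset (Place K)} (hS : Adm S) {a : Kˣ} {T : Finset (Place K)}
    (h : Indep S a T) : T.card ≤ S.card := by
  choose c hcS hc using fun T' : T.powerset => h.surj T'.1 (Finset.mem_powerset.1 T'.2)
  have hinj : Function.Injective
      fun T' => (QuotientGroup.mk ⟨c T', hcS T'⟩ : sUnits S ⧸ sqGroup (sUnits S)) := by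
    intro T₁ T₂ he
    have h2 := mem_sqGroup_sUnits.1 (QuotientGroup.eq.1 he)
    apply Subtype.ext
    have hT := Finset.mem_powerset.1 T₁.2
    have hT' := Finset.mem_powerset.1 T₂.2
    have key : ∀ v ∈ T, (v ∈ T₁.1 ↔ v ∈ T₂.1) := by
      intro v hv
      have h4 : SqAt v ((c T₁)⁻¹ * c T₂) := h2.map (ι v)
      rw [SqAt, ι_inv_mul] at h4
      have h5 := h4.iff_of_inv_mul (ι_ne_zero v _) (ι_ne_zero v _)
      rw [← not_iff_not, ← hc T₁ v hv, ← hc T₂ v hv]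
      exact h5
    ext v
    exact ⟨fun h => (key v (hT h)).1 h, fun h => (key v (hT' h)).2 h⟩
  have hidx := sqGroup_index_sUnits S hS.inl_mem
  have : (sqGroup (sUnits S)).FiniteIndex := ⟨by rw [hidx]; positivity⟩
  have h2 := Nat.card_le_card_of_injective _ hinj
  rw [Nat.card_eq_fintype_card, Fintype.card_coe, Finset.card_powerset] at h2
  have h3 : 2 ^ T.card ≤ (sqGroup (sUnits S)).index := h2
  rw [hidx] at h3
  exact (Nat.pow_le_pow_iff_right (by norm_num)).1 h3

theorem sqAt_mul_iff {S : Finset (Place K)} (hS : Adm S) {c d : Kˣ} {v : Place K}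
    (hc : abv v (c : K) = 1) (hd : abv v (d : K) = 1) (hv : v ∉ S) : SqAt v (c * d) ↔ (SqAt v c ↔ SqAt v d) := by
  rcases v with v | p
  · exact absurd (hS.inl_mem v) hv
  rw [SqAt, ι_mul]
  have hc0 := ι_ne_zero (Sum.inr p) c
  have hd0 := ι_ne_zero (Sum.inr p) d
  constructor
  · intro h
    refine IsSquare.iff_of_inv_mul hc0 hd0 ?_
    have e : (ι (Sum.inr p) (c : K))⁻¹ * ι (Sum.inr p) (d : K) =
      (ι (Sum.inr p) (c : K) * ι (Sum.inr p) (d : K)) *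
        ((ι (Sum.inr p) (c : K))⁻¹ * (ι (Sum.inr p) (c : K))⁻¹) := by field_simp
    rw [e]
    exact h.mul ⟨_, rfl⟩
  · intro h
    by_cases h1 : SqAt (Sum.inr p) c
    · exact h1.mul (h.1 h1)
    · exact tame_mul p (hS.two _ hv) hc hd h1 (fun h2 => h1 (h.2 h2))

theorem exists_maximal_indep {S : Finset (Place K)} (hS : Adm S) {a : Kˣ} (haS : a ∈ sUnits S) :
    ∃ T, Indep S a T ∧ ∀ c ∈ sUnits S, (∀ v ∈ T, SqAt v c) →
      IsSquare (c : K) ∨ IsSquare ((a * c : Kˣ) : K) := by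
  classical
  have hex : ∃ k, ∃ T, Indep S a T ∧ T.card + k = S.card :=
    ⟨S.card, ∅, ⟨by simp, by simp, fun T' _ => ⟨1, one_mem _, by simp⟩⟩, by simp⟩
  obtain ⟨T, hT, hk⟩ := Nat.find_spec hex
  refine ⟨T, hT, fun c hc hcT => ?_⟩
  by_contra! hno
  obtain ⟨v, hv, hva, hvc⟩ := exists_sqAt_not_sqAt (S ∪ T) a c hno.1 hno.2
  rw [Finset.mem_union, not_or] at hv
  have hT' : Indep S a (insert v T) := by
    refine ⟨?_, ?_, ?_⟩
    · intro w hw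
      rcases Finset.mem_insert.1 hw with rfl | hw
      · exact hv.1
      · exact hT.disj w hw
    · intro w hw
      rcases Finset.mem_insert.1 hw with rfl | hw
      · exact hva
      · exact hT.sq w hw
    · intro T' hT'
      obtain ⟨d, hd, hdT⟩ := hT.surj (T' ∩ T) Finset.inter_subset_right
      have hd' : ∀ w ∈ T, (SqAt w d ↔ w ∉ T') := fun w hw => by rw [hdT w hw]; simp [hw]
      by_cases hvd : SqAt v d ↔ v ∉ T'
      · refine ⟨d, hd, fun w hw => ?_⟩
        rcases Finset.mem_insert.1 hw with rfl | hw
        · exact hvd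
        · exact hd' w hw
      · refine ⟨d * c, mul_mem hd hc, fun w hw => ?_⟩
        rcases Finset.mem_insert.1 hw with rfl | hw
        · rw [sqAt_mul_iff hS (hd _ hv.1) (hc _ hv.1) hv.1]
          tauto
        · rw [sqAt_mul_iff hS (hd _ (hT.disj w hw)) (hc _ (hT.disj w hw)) (hT.disj w hw), ← hd' w hw]
          have := hcT w hw
          tauto
  have h1 := hT'.card_le hS
  rw [Finset.card_insert_of_notMem hv.2] at h1
  have h2 : 0 < Nat.find hex := by omega
  refine Nat.find_min hex (m := Nat.find hex - 1) (by omega) ⟨insert v T, hT', ?_⟩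
  rw [Finset.card_insert_of_notMem hv.2]
  omega

theorem card_le_of_maximal_indep {S : Finset (Place K)} (hS : Adm S) {a : Kˣ}
    {T : Finset (Place K)} (hT : ∀ v ∈ T, v ∉ S)
    (h : ∀ c ∈ sUnits S, (∀ v ∈ T, SqAt v c) → IsSquare (c : K) ∨ IsSquare ((a * c : Kˣ) : K)) :
    S.card ≤ T.card + 1 := by
  classical
  let P : sUnits S → T.powerset := fun c =>
    ⟨T.filter fun v => ¬ SqAt v (c : Kˣ), Finset.mem_powerset.2 (Finset.filter_subset _ _)⟩
  have hP : ∀ c d : sUnits S, P c = P d → IsSquare (((c * d : sUnits S) : Kˣ) : K) ∨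
      IsSquare ((a * ((c * d : sUnits S) : Kˣ) : Kˣ) : K) := by
    intro c d hcd
    refine h _ (c * d).2 fun v hv => ?_
    have h1 := Finset.ext_iff.1 (congrArg Subtype.val hcd) v
    simp only [P, Finset.mem_filter, hv, true_and, not_iff_not] at h1
    exact (sqAt_mul_iff hS (c.2 _ (hT v hv)) (d.2 _ (hT v hv)) (hT v hv)).2 h1
  let ref : T.powerset → sUnits S := fun q => if hq : ∃ c, P c = q then hq.choose else 1
  have href : ∀ c, P (ref (P c)) = P c := by
    intro c
    have hq : ∃ d, P d = P c := ⟨c, rfl⟩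
    simp only [ref, dif_pos hq]
    exact hq.choose_spec
  let f : (sUnits S ⧸ sqGroup (sUnits S)) → T.powerset × Prop := fun q =>
    (P q.out, IsSquare (((q.out * ref (P q.out) : sUnits S) : Kˣ) : K))
  have hf : Function.Injective f := by
    intro q q' he
    simp only [f, Prod.mk.injEq] at he
    obtain ⟨h1, h2⟩ := he
    rw [← h1] at h2
    rw [← Quotient.out_eq q, ← Quotient.out_eq q']
    apply QuotientGroup.eq.2
    rw [mem_sqGroup_sUnits]
    set x := q.out
    set y := q'.out
    set z := ref (P x)
    have key : IsSquare (((x * y : sUnits S) : Kˣ) : K) := by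
      have hz0 : (((z : sUnits S) : Kˣ) : K) ≠ 0 := Units.ne_zero _
      by_cases h3 : IsSquare (((x * z : sUnits S) : Kˣ) : K)
      · obtain ⟨s, hs⟩ := h3
        obtain ⟨t, ht⟩ := h2.mp ⟨s, hs⟩
        refine ⟨s * t / (z : Kˣ), ?_⟩
        simp only [Subgroup.coe_mul, Units.val_mul] at hs ht ⊢
        field_simp
        linear_combination ((z : Kˣ) : K) * (y : Kˣ) * hs + s * s * ht
      · obtain ⟨s, hs⟩ := (hP x z (href x).symm).resolve_left h3
        obtain ⟨t, ht⟩ := (hP y z (h1 ▸ (href x).symm)).resolve_left (fun h4 => h3 (h2.mpr h4))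
        refine ⟨s * t / ((z : Kˣ) * a), ?_⟩
        have ha0 := a.ne_zero
        simp only [Subgroup.coe_mul, Units.val_mul] at hs ht ⊢
        field_simp
        linear_combination (a : K) * ((z : Kˣ) : K) * (y : Kˣ) * hs + s * s * ht
    obtain ⟨s, hs⟩ := key
    have hx0 : (((x : sUnits S) : Kˣ) : K) ≠ 0 := Units.ne_zero _
    refine ⟨s / (x : Kˣ), ?_⟩
    simp only [Subgroup.coe_mul, Units.val_mul, Subgroup.coe_inv, Units.val_inv_eq_inv_val] at hs ⊢
    field_simp
    linear_combination hs
  have h2 := Nat.card_le_card_of_injective f hf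
  rw [Nat.card_prod, Nat.card_eq_fintype_card (α := T.powerset), Fintype.card_coe,
    Finset.card_powerset, Nat.card_eq_fintype_card (α := Prop), Fintype.card_prop] at h2
  have h3 : (sqGroup (sUnits S)).index ≤ 2 ^ T.card * 2 := h2
  rw [sqGroup_index_sUnits S hS.inl_mem, ← pow_succ] at h3
  exact (Nat.pow_le_pow_iff_right (by norm_num)).1 h3

variable {K : Type u} [Field K] [NumberField K]

theorem Indep.isSquare {S T : Finset (Place K)} (hS : Adm S) {a : Kˣ} (hT : Indep S a T) {b : Kˣ}
    (hb : b ∈ sUnits (open scoped Classical in S ∪ T)) (hsq : ∀ v ∈ S, SqAt v b) :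
    IsSquare (b : K) := by
  classical
  by_contra hbsq
  obtain ⟨T', hT', hno⟩ := finite_pattern (hS.mono Finset.subset_union_left) hbsq hb
  have hns : ∀ v ∈ nonsplit (b : K) (S ∪ T), v ∈ T := by
    intro v hv
    rw [mem_nonsplit, Finset.mem_union] at hv
    exact hv.1.resolve_left fun h => hv.2 (hsq v h)
  obtain ⟨c, hc⟩ := hS.exists_ord_eq (fun _ => 1) (T'.toRight.filter fun q => Even (ord q b))
  obtain ⟨d, hdS, hd⟩ := hT.surj (T.filter fun v => ¬ (SqAt v c ↔ v ∉ T')) (Finset.filter_subset _ _)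
  have hd' : ∀ v ∈ T, (SqAt v d ↔ (SqAt v c ↔ v ∉ T')) := by
    intro v hv
    rw [hd v hv, Finset.mem_filter]
    simp only [hv, true_and, not_not]
  have hcST : c ∈ sUnits (S ∪ T) := by
    intro v hv
    rw [Finset.mem_union, not_or] at hv
    rcases v with v | q
    · exact absurd (hS.inl_mem v) hv.1
    · rw [← ord_eq_zero_iff]
      refine (hc q hv.1).2 fun h => hv.2 (hns _ (hT' ?_))
      simpa using (Finset.mem_filter.1 h).1
  refine hno (c * d) (mul_mem hcST (sUnits_mono Finset.subset_union_left hdS)) fun v hv => ?_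
  have hvT := hns v hv
  have hvS := hT.disj v hvT
  have hvns := (mem_nonsplit.1 hv).2
  rcases v with v | q
  · exact absurd (hS.inl_mem v) hvS
  have hd0 : ord q d = 0 := (ord_eq_zero_iff q d).2 (hdS _ hvS)
  by_cases hev : Even (ord q b)
  · rw [NrmAt, tame_ord q (hS.two _ hvS) hev hvns, ord_mul, hd0, add_zero]
    by_cases hq : Sum.inr q ∈ T'
    · rw [(hc q hvS).1 (by simp [hq, hev])]
      simp [hq]
    · rw [(hc q hvS).2 (by simp [hq])]
      simp [hq]
  · have hc0 : ord q c = 0 := (hc q hvS).2 (by simp [hev])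
    rw [NrmAt, tame_odd q (hS.two _ hvS) hev (by rw [ord_mul, hd0, hc0]; simp)]
    have := sqAt_mul_iff hS ((ord_eq_zero_iff q c).1 hc0) ((ord_eq_zero_iff q d).1 hd0) hvS
    rw [SqAt] at this
    rw [this, hd' _ hvT]
    tauto

/-- The diagonal embedding of the unit group of `K` into the product of the local unit groups. -/
noncomputable def diag (S : Finset (Place K)) : Kˣ →* (∀ v : S, (L v.1)ˣ) :=
  MonoidHom.pi fun v => Units.map (ι v.1 : K →* L v.1)

theorem diag_apply (S : Finset (Place K)) (c : Kˣ) (v : S) :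
    ((diag S c v : (L v.1)ˣ) : L v.1) = ι v.1 (c : K) := rfl

theorem sqGroup_pi {κ : Type*} {G : κ → Type*} [∀ i, CommGroup (G i)] :
    sqGroup (∀ i, G i) = Subgroup.pi Set.univ fun i => sqGroup (G i) := by
  ext x
  simp only [mem_sqGroup, Subgroup.mem_pi, Set.mem_univ, forall_true_left]
  constructor
  · rintro ⟨h, rfl⟩ i
    exact ⟨h i, rfl⟩
  · intro h
    choose g hg using h
    exact ⟨g, funext hg⟩

/-- The group of families of local units that are norms from `K(√a)` at each place of `S`. -/
noncomputable def locNrm (S : Finset (Place K)) (a : Kˣ) : Subgroup (∀ v : S, (L v.1)ˣ) :=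
  Subgroup.pi Set.univ fun v => nrmGroup (ι v.1 (a : K))

theorem mem_locNrm {S : Finset (Place K)} {a : Kˣ} {x : ∀ v : S, (L v.1)ˣ} :
    x ∈ locNrm S a ↔ ∀ v : S, IsNrm (ι v.1 (a : K)) (x v : L v.1) := by
  simp [locNrm, Subgroup.mem_pi, mem_nrmGroup]

theorem sqGroup_le_locNrm (S : Finset (Place K)) (a : Kˣ) : sqGroup _ ≤ locNrm S a := by
  rw [sqGroup_pi]
  intro x hx
  rw [mem_locNrm]
  intro v
  exact sqGroup_le_nrmGroup _ (hx v (Set.mem_univ _))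

/-- The image of the `S'`-units in the product over `S` has small index modulo local norms, and an
`S'`-unit which is a norm at all places of `S` is a norm. -/
theorem exists_index_le_two {S : Finset (Place K)} (hS : Adm S) {a : Kˣ} (ha : ¬ IsSquare (a : K))
    (haS : a ∈ sUnits S) : ∃ S', S ⊆ S' ∧ (∀ v ∈ S', v ∉ S → SqAt v a) ∧
      ((sUnits S').map (diag S) ⊔ locNrm S a).index ≤ 2 ∧
      ((sUnits S').map (diag S) ⊔ locNrm S a).index ≠ 0 ∧
      (∀ v ∈ S, ¬ SqAt v a → (nrmGroup (ι v (a : K))).index = 2) ∧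
      ∀ c ∈ sUnits S', (∀ v ∈ S, NrmAt v a c) → IsNrm (a : K) (c : K) := by
  classical
  obtain ⟨T, hT, hmax⟩ := exists_maximal_indep hS haS
  have hcard := card_le_of_maximal_indep hS hT.disj hmax
  have hdisj : Disjoint S T := Finset.disjoint_left.2 fun v hv hv' => hT.disj v hv' hv
  set S' := S ∪ T with hS'
  have hSS' : S ⊆ S' := Finset.subset_union_left
  have hadm := hS.mono hSS'
  set Y := ∀ v : S, (L v.1)ˣ
  have hsqY : (sqGroup Y).index = 4 ^ S.card := by
    rw [sqGroup_pi, index_pi_univ, ← prod_sqGroup_index S hS.two]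
    exact Finset.prod_coe_sort S fun v => (sqGroup (L v)ˣ).index
  set Φ := (diag S).comp (sUnits S').subtype with hΦ
  have hrange : Φ.range = (sUnits S').map (diag S) := by
    rw [hΦ, MonoidHom.range_comp, Subgroup.range_subtype]
  have hcomap : (sqGroup Y).comap Φ = sqGroup (sUnits S') := by
    ext c
    rw [Subgroup.mem_comap, mem_sqGroup_sUnits, sqGroup_pi]
    constructor
    · intro h
      refine hT.isSquare hS c.2 fun v hv => ?_
      exact mem_sqGroup_units.1 (h ⟨v, hv⟩ (Set.mem_univ _))
    · intro h v _
      exact mem_sqGroup_units.2 (h.map _)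
  have hrel : (sqGroup Y).relIndex Φ.range = 2 ^ (S.card + T.card) := by
    rw [← Subgroup.index_comap, hcomap, sqGroup_index_sUnits S' hadm.inl_mem, hS',
      Finset.card_union_of_disjoint hdisj]
  set J := Φ.range ⊔ sqGroup Y with hJ
  have hJ1 : 2 ^ (S.card + T.card) * J.index = 4 ^ S.card := by
    rw [← hrel, ← hsqY, ← Subgroup.relIndex_sup_right]
    exact Subgroup.relIndex_mul_index le_sup_right
  have hJ2 : J.index ≤ 2 := by
    by_contra! h
    have h1 : 2 ^ (2 * S.card - 1) ≤ 2 ^ (S.card + T.card) :=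
      Nat.pow_le_pow_right two_pos (by omega)
    have h2 : 4 ^ S.card = 2 ^ (2 * S.card) := by rw [pow_mul]; norm_num
    by_cases h0 : S.card = 0
    · rw [h0] at hJ1; simp only [pow_zero] at hJ1
      have := Nat.eq_one_of_mul_eq_one_left hJ1
      omega
    · have h3 : 2 ^ (2 * S.card) = 2 ^ (2 * S.card - 1) * 2 := by
        rw [← pow_succ]; congr 1; omega
      have h4 : 0 < 2 ^ (2 * S.card - 1) := by positivity
      nlinarith
  have hJ0 : J.index ≠ 0 := by
    intro h
    rw [h, mul_zero] at hJ1
    exact absurd hJ1.symm (by positivity)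
  set M := locNrm S a with hM
  set Q := Φ.range ⊔ M with hQ
  have hJQ : J ≤ Q := sup_le_sup_left (sqGroup_le_locNrm S a) _
  have hQd := Subgroup.index_dvd_of_le hJQ
  have hQ0 : Q.index ≠ 0 := fun h => hJ0 (by rw [h] at hQd; exact zero_dvd_iff.1 hQd)
  have hQ2 : Q.index ≤ 2 := (Nat.le_of_dvd (Nat.pos_of_ne_zero hJ0) hQd).trans hJ2
  have hns : nonsplit (a : K) S' = nonsplit (a : K) S := by
    ext v
    rw [mem_nonsplit, mem_nonsplit, hS', Finset.mem_union]
    have := hT.sq v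
    tauto
  have haS' : a ∈ sUnits S' := sUnits_mono hSS' haS
  obtain ⟨hR0, hR⟩ := two_mul_relIndex_le hadm ha a.ne_zero (by simpa using haS')
  rw [hns] at hR
  set N := (nrmGroup (a : K)).subgroupOf (sUnits S') with hN
  have hR0' : N.index ≠ 0 := hR0
  have hR' : 2 * N.index ≤ 2 ^ (nonsplit (a : K) S).card := hR
  have hNM : N ≤ M.comap Φ := by
    intro c hc
    rw [Subgroup.mem_comap, mem_locNrm]
    intro v
    exact IsNrm.map (ι v.1) (Subgroup.mem_subgroupOf.1 hc)
  have hMQ : M.index = (M.comap Φ).index * Q.index := by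
    rw [Subgroup.index_comap, ← Subgroup.relIndex_sup_right,
      Subgroup.relIndex_mul_index le_sup_right]
  have hMd := Subgroup.index_dvd_of_le hNM
  have hMN : (M.comap Φ).index ≤ N.index := Nat.le_of_dvd (Nat.pos_of_ne_zero hR0') hMd
  let g : Place K → ℕ := fun v => (nrmGroup (ι v (a : K))).index
  have hMprod : M.index = ∏ v ∈ S, g v := by
    rw [hM, locNrm, index_pi_univ]
    exact Finset.prod_coe_sort S g
  have hD0 : (M.comap Φ).index ≠ 0 := fun h => by
    rw [h] at hMd; exact hR0' (zero_dvd_iff.1 hMd)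
  have hM0 : M.index ≠ 0 := by rw [hMQ]; exact mul_ne_zero hD0 hQ0
  have hg0 : ∀ v ∈ S, g v ≠ 0 := by
    rw [hMprod] at hM0
    exact Finset.prod_ne_zero_iff.1 hM0
  have hg2 : ∀ v ∈ nonsplit (a : K) S, 2 ≤ g v := by
    intro v hv
    obtain ⟨hvS, hv⟩ := mem_nonsplit.1 hv
    have h1 : g v ≠ 1 := by
      intro h
      obtain ⟨c, hc0, hc⟩ := exists_not_isNrm v (ι_ne_zero v a) hv
      apply hc
      have : Units.mk0 c hc0 ∈ nrmGroup (ι v (a : K)) := by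
        rw [Subgroup.index_eq_one.1 h]; trivial
      exact this
    have := hg0 v hvS
    omega
  have hprod : ∏ v ∈ nonsplit (a : K) S, g v ≤ ∏ v ∈ S, g v :=
    Finset.prod_le_prod_of_subset_of_one_le' (Finset.filter_subset _ _)
      fun v hv _ => Nat.one_le_iff_ne_zero.2 (hg0 v hv)
  have hlow : 2 ^ (nonsplit (a : K) S).card ≤ ∏ v ∈ nonsplit (a : K) S, g v :=
    Finset.pow_card_le_prod _ _ _ hg2
  have hup : M.index ≤ (M.comap Φ).index * 2 := by rw [hMQ]; exact Nat.mul_le_mul_left _ hQ2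
  have hEq : (M.comap Φ).index = N.index := by omega
  refine ⟨S', hSS', ?_, by rw [← hrange]; exact hQ2, by rw [← hrange]; exact hQ0, ?_, ?_⟩
  · intro v hv hvS
    exact hT.sq v ((Finset.mem_union.1 hv).resolve_left hvS)
  · intro v hv hva
    have hv' : v ∈ nonsplit (a : K) S := mem_nonsplit.2 ⟨hv, hva⟩
    have h1 : ∏ v ∈ nonsplit (a : K) S, g v ≤ 2 ^ (nonsplit (a : K) S).card := by omega
    rw [← Finset.mul_prod_erase _ _ hv'] at h1
    have h2 : 2 ^ ((nonsplit (a : K) S).erase v).card ≤ ∏ v ∈ (nonsplit (a : K) S).erase v, g v :=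
      Finset.pow_card_le_prod _ _ _ fun w hw => hg2 w (Finset.mem_of_mem_erase hw)
    have h3 : (nonsplit (a : K) S).card = ((nonsplit (a : K) S).erase v).card + 1 :=
      (Finset.card_erase_add_one hv').symm
    rw [h3, pow_succ] at h1
    have h4 : 0 < 2 ^ ((nonsplit (a : K) S).erase v).card := by positivity
    have h5 := hg2 v hv'
    show g v = 2
    nlinarith
  · intro c hc hcv
    have hfi : N.FiniteIndex := ⟨hR0'⟩
    have hle : M.comap Φ ≤ N := by
      rw [← Subgroup.relIndex_eq_one]
      have h1 := Subgroup.relIndex_mul_index hNM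
      rw [hEq] at h1
      exact Nat.eq_of_mul_eq_mul_right (Nat.pos_of_ne_zero hR0') (by rw [h1, one_mul])
    have : (⟨c, hc⟩ : sUnits S') ∈ N := hle (mem_locNrm.2 fun v => hcv v.1 v.2)
    exact Subgroup.mem_subgroupOf.1 this

end Place

/-- Fields in which the norm group of each proper quadratic extension has index two. -/
class IsHilbertField (F : Type*) [Field F] : Prop where
  mul_of_not : ∀ {a x y : F}, a ≠ 0 → x ≠ 0 → y ≠ 0 → ¬ IsNrm a x → ¬ IsNrm a y →
    IsNrm a (x * y)
  nondeg : ∀ {a : F}, a ≠ 0 → ¬ IsSquare a → ∃ c : F, c ≠ 0 ∧ ¬ IsNrm a c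

theorem isNrm_mul_iff {F : Type*} [Field F] [IsHilbertField F] {a x y : F} (ha : a ≠ 0)
    (hx : x ≠ 0) (hy : y ≠ 0) : IsNrm a (x * y) ↔ (IsNrm a x ↔ IsNrm a y) := by
  constructor
  · intro h
    exact ⟨fun h1 => h1.of_mul_left hx h, fun h1 => h1.of_mul_left hy (by rwa [mul_comm])⟩
  · intro h
    by_cases h1 : IsNrm a x
    · exact h1.mul (h.1 h1)
    · exact IsHilbertField.mul_of_not ha hx hy h1 fun h2 => h1 (h.2 h2)

open scoped Classical in
/-- The Hilbert symbol. -/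
noncomputable def hilb {F : Type*} [Field F] [IsHilbertField F] (a : Fˣ) : Fˣ →* ℤˣ where
  toFun c := if IsNrm (a : F) c then 1 else -1
  map_one' := by simp [isNrm_one]
  map_mul' x y := by
    rw [Units.val_mul]
    have := isNrm_mul_iff a.ne_zero x.ne_zero y.ne_zero
    by_cases h1 : IsNrm (a : F) x <;> by_cases h2 : IsNrm (a : F) y <;> simp_all

theorem hilb_eq_one_iff {F : Type*} [Field F] [IsHilbertField F] {a c : Fˣ} :
    hilb a c = 1 ↔ IsNrm (a : F) (c : F) := by
  classical
  by_cases h : IsNrm (a : F) (c : F)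
  · simp [hilb, h]
  · simp only [hilb, MonoidHom.coe_mk, OneHom.coe_mk, h, if_false, iff_false]
    decide

theorem hilb_comm {F : Type*} [Field F] [IsHilbertField F] [NeZero (2 : F)] (a c : Fˣ) :
    hilb a c = hilb c a := by
  have h : hilb a c = 1 ↔ hilb c a = 1 := by
    rw [hilb_eq_one_iff, hilb_eq_one_iff, isNrm_comm a.ne_zero c.ne_zero]
  rcases Int.units_eq_one_or (hilb a c) with h1 | h1
  · rw [h1, h.1 h1]
  · rcases Int.units_eq_one_or (hilb c a) with h2 | h2
    · rw [h2, h.2 h2]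
    · rw [h1, h2]

namespace Place

variable {K : Type u} [Field K] [NumberField K]

theorem exists_adm_mem (S₀ : Finset (Place K)) (A : Finset Kˣ) :
    ∃ S, S₀ ⊆ S ∧ Adm S ∧ ∀ a ∈ A, a ∈ sUnits S := by
  classical
  obtain ⟨S, hS₀, hS⟩ := exists_adm (S₀ ∪ A.biUnion supp)
  refine ⟨S, Finset.subset_union_left.trans hS₀, hS, fun a ha => mem_sUnits_iff_supp.2 ?_⟩
  exact (Finset.subset_biUnion_of_mem supp ha).trans (Finset.subset_union_right.trans hS₀)

theorem exists_isSquare_ι_mul (v : Place K) {x : L v} (hx : x ≠ 0) :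
    ∃ a : Kˣ, IsSquare (ι v a * x) := by
  classical
  obtain ⟨a, ha0, ha⟩ := exists_isSquare_mul {v} (fun w => if h : w = v then h ▸ x else 1)
    (by rintro w hw; rw [Finset.mem_singleton] at hw; subst hw; simpa using hx)
  refine ⟨Units.mk0 a ha0, ?_⟩
  simpa using ha v (Finset.mem_singleton_self v)

instance isHilbertField (v : Place K) : IsHilbertField (L v) where
  nondeg := exists_not_isNrm v
  mul_of_not {a x y} ha0 hx hy hax hay := by
    classical
    have hsq : ¬ IsSquare a := fun h => hax (isNrm_of_isSquare h ha0 x)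
    obtain ⟨b, d, hd⟩ := exists_isSquare_ι_mul v ha0
    have hb0 := ι_ne_zero v b
    have hd0 : d ≠ 0 := by rintro rfl; simp [hb0, ha0] at hd
    have hab : a = ι v b * (d * (ι v b)⁻¹) ^ 2 := by field_simp; rw [mul_comm, hd]; ring
    have key : ∀ c, IsNrm a c ↔ IsNrm (ι v b) c := fun c => by
      conv_lhs => rw [hab]
      exact isNrm_mul_sq_left (mul_ne_zero hd0 (inv_ne_zero hb0)) c
    have hbv : ¬ SqAt v b := fun h => hsq (by rw [hab]; exact h.mul (IsSquare.sq _))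
    have hb : ¬ IsSquare (b : K) := fun h => hbv (h.map (ι v))
    obtain ⟨S, hvS, hS, hbS⟩ := exists_adm_mem {v} {b}
    obtain ⟨S', -, -, -, -, h, -⟩ := exists_index_le_two hS hb
      (hbS b (Finset.mem_singleton_self b))
    have hi := h v (hvS (Finset.mem_singleton_self v)) hbv
    rw [key]
    have := (Subgroup.mul_mem_iff_of_index_two hi (a := Units.mk0 x hx) (b := Units.mk0 y hy))
    rw [mem_nrmGroup, mem_nrmGroup, mem_nrmGroup] at this
    simp only [Units.val_mul, Units.val_mk0] at this
    exact this.2 (iff_of_false ((key x).not.1 hax) ((key y).not.1 hay))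

/-- The norm theorem for quadratic extensions. -/
theorem isNrm_of_forall_nrmAt (a c : Kˣ) (h : ∀ v, NrmAt v a c) : IsNrm (a : K) c := by
  classical
  by_cases ha : IsSquare (a : K)
  · exact isNrm_of_isSquare ha a.ne_zero _
  obtain ⟨S, -, hS, hA⟩ := exists_adm_mem ∅ {a, c}
  obtain ⟨S', hSS', -, -, -, -, hN⟩ := exists_index_le_two hS ha (hA a (by simp))
  exact hN c (sUnits_mono hSS' (hA c (by simp))) fun v _ => h v

/-- `T` is the set of places at which `c` is not a norm for some `c`. -/
def Realized (a : Kˣ) (T : Finset (Place K)) : Prop := ∃ c : Kˣ, ∀ v, NrmAt v a c ↔ v ∉ T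

theorem Adm.nrmAt {S : Finset (Place K)} (hS : Adm S) {a c : Kˣ} (ha : a ∈ sUnits S)
    (hc : c ∈ sUnits S) {v : Place K} (hv : v ∉ S) : NrmAt v a c := by
  rcases v with w | p
  · exact absurd (hS.inl_mem w) hv
  · exact tame_units p (hS.two _ hv) (mem_sUnits.1 ha _ hv) (mem_sUnits.1 hc _ hv)

theorem realized_or (a : Kˣ) (ha : ¬ IsSquare (a : K)) (T₁ T₂ : Finset (Place K))
    (h₁ : ∀ v ∈ T₁, ¬ SqAt v a) (h₂ : ∀ v ∈ T₂, ¬ SqAt v a) :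
    Realized a T₁ ∨ Realized a T₂ ∨ ∃ c : Kˣ, ∀ v, NrmAt v a c ↔ (v ∉ T₁ ↔ v ∉ T₂) := by
  classical
  obtain ⟨S, hTS, hS, hA⟩ := exists_adm_mem (T₁ ∪ T₂) {a}
  have haS := hA a (by simp)
  obtain ⟨S', hSS', hsq, hle, hne, -, -⟩ := exists_index_le_two hS ha haS
  set H := (sUnits S').map (diag S) ⊔ locNrm S a with hH
  have hy : ∀ T : Finset (Place K), (∀ v ∈ T, ¬ SqAt v a) → ∃ y : ∀ v : S, (L v.1)ˣ,
      ∀ v : S, IsNrm (ι v.1 (a : K)) (y v : L v.1) ↔ v.1 ∉ T := by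
    intro T hT
    have : ∀ v : S, ∃ y : (L v.1)ˣ, IsNrm (ι v.1 (a : K)) (y : L v.1) ↔ v.1 ∉ T := by
      intro v
      by_cases hv : v.1 ∈ T
      · obtain ⟨c, hc0, hc⟩ := exists_not_isNrm v.1 (ι_ne_zero v.1 a) (hT v.1 hv)
        exact ⟨Units.mk0 c hc0, by simpa [hv] using hc⟩
      · exact ⟨1, by simpa [hv] using isNrm_one _⟩
    choose y hy using this
    exact ⟨y, hy⟩
  have hreal : ∀ y ∈ H, ∀ P : Place K → Prop, (∀ v ∉ S, P v) →
      (∀ v : S, IsNrm (ι v.1 (a : K)) (y v : L v.1) ↔ P v.1) →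
      ∃ c : Kˣ, ∀ v, NrmAt v a c ↔ P v := by
    intro y hyH P hP hyP
    obtain ⟨z, ⟨c, hc, rfl⟩, n, hn, rfl⟩ := Subgroup.mem_sup.1 hyH
    refine ⟨c, fun v => ?_⟩
    by_cases hvS : v ∈ S
    · rw [← hyP ⟨v, hvS⟩, Pi.mul_apply, Units.val_mul,
        isNrm_mul_iff (ι_ne_zero v a) (Units.ne_zero _) (Units.ne_zero _), diag_apply]
      have := mem_locNrm.1 hn ⟨v, hvS⟩
      simp [this]
    · refine iff_of_true ?_ (hP v hvS)
      by_cases hvS' : v ∈ S'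
      · exact (hsq v hvS' hvS).nrmAt c
      · exact (hS.mono hSS').nrmAt (sUnits_mono hSS' haS) hc hvS'
  obtain ⟨y₁, hy₁⟩ := hy T₁ h₁
  obtain ⟨y₂, hy₂⟩ := hy T₂ h₂
  have hn₁ : ∀ v ∉ S, v ∉ T₁ := fun v hv h => hv (hTS (Finset.mem_union_left _ h))
  have hn₂ : ∀ v ∉ S, v ∉ T₂ := fun v hv h => hv (hTS (Finset.mem_union_right _ h))
  by_cases hm₁ : y₁ ∈ H
  · exact Or.inl (hreal y₁ hm₁ _ hn₁ hy₁)
  by_cases hm₂ : y₂ ∈ H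
  · exact Or.inr (Or.inl (hreal y₂ hm₂ _ hn₂ hy₂))
  refine Or.inr (Or.inr (hreal (y₁ * y₂) ?_ _ (fun v hv => iff_of_true (hn₁ v hv) (hn₂ v hv)) ?_))
  · have hi : H.index = 2 := by
      have : H.index ≠ 1 := fun h => hm₁ (by rw [Subgroup.index_eq_one.1 h]; trivial)
      omega
    exact (Subgroup.mul_mem_iff_of_index_two hi).2 (iff_of_false hm₁ hm₂)
  · intro v
    rw [Pi.mul_apply, Units.val_mul,
      isNrm_mul_iff (ι_ne_zero v.1 a) (Units.ne_zero _) (Units.ne_zero _), hy₁, hy₂]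

end Place

namespace Diag

variable {F : Type*} [Field F] {n : ℕ}

/-- The bilinear form of the diagonal form with coefficients `w`. -/
def db (w x y : Fin n → F) : F := ∑ i, w i * x i * y i

/-- The diagonal quadratic form with coefficients `w`. -/
def dq (w x : Fin n → F) : F := ∑ i, w i * x i ^ 2

theorem db_self (w x : Fin n → F) : db w x x = dq w x :=
  Finset.sum_congr rfl fun i _ => by ring

theorem db_comm (w x y : Fin n → F) : db w x y = db w y x :=
  Finset.sum_congr rfl fun i _ => by ring

theorem db_add_left (w x y z : Fin n → F) : db w (x + y) z = db w x z + db w y z := by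
  simp only [db, ← Finset.sum_add_distrib, Pi.add_apply]
  exact Finset.sum_congr rfl fun i _ => by ring

theorem db_smul_left (w : Fin n → F) (c : F) (x z : Fin n → F) :
    db w (c • x) z = c * db w x z := by
  simp only [db, Finset.mul_sum, Pi.smul_apply, smul_eq_mul]
  exact Finset.sum_congr rfl fun i _ => by ring

theorem dq_add (w x y : Fin n → F) : dq w (x + y) = dq w x + dq w y + 2 * db w x y := by
  simp only [db, dq, ← Finset.sum_add_distrib, Pi.add_apply, Finset.mul_sum]
  exact Finset.sum_congr rfl fun i _ => by ring

theorem dq_smul (w : Fin n → F) (c : F) (x : Fin n → F) : dq w (c • x) = c ^ 2 * dq w x := by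
  simp only [dq, Finset.mul_sum, Pi.smul_apply, smul_eq_mul]
  exact Finset.sum_congr rfl fun i _ => by ring

@[simp] theorem db_zero_left (w x : Fin n → F) : db w 0 x = 0 := by simp [db]

theorem db_sum_left {κ : Type*} (s : Finset κ) (w : Fin n → F) (x : κ → Fin n → F)
    (z : Fin n → F) : db w (∑ k ∈ s, x k) z = ∑ k ∈ s, db w (x k) z := by
  classical
  induction s using Finset.induction_on with
  | empty => simp
  | insert a s ha ih => rw [Finset.sum_insert ha, Finset.sum_insert ha, db_add_left, ih]

theorem db_single_left (w : Fin n → F) (i : Fin n) (x : Fin n → F) :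
    db w (Pi.single i 1) x = w i * x i := by
  simp [db, Pi.single_apply]

theorem dq_cons (a : F) (w : Fin n → F) (x : Fin (n + 1) → F) :
    dq (Fin.cons a w : Fin (n + 1) → F) x = a * x 0 ^ 2 + dq w (Fin.tail x) := by
  simp [dq, Fin.sum_univ_succ, Fin.tail]

theorem dq_map {F' : Type*} [Field F'] (φ : F →+* F') (w x : Fin n → F) :
    dq (φ ∘ w) (φ ∘ x) = φ (dq w x) := by simp [dq]

theorem db_map {F' : Type*} [Field F'] (φ : F →+* F') (w x y : Fin n → F) :
    db (φ ∘ w) (φ ∘ x) (φ ∘ y) = φ (db w x y) := by simp [db]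

theorem comp_cons {F' : Type*} (φ : F → F') (a : F) (w : Fin n → F) :
    φ ∘ (Fin.cons a w : Fin (n + 1) → F) = Fin.cons (φ a) (φ ∘ w) := by
  ext i; refine Fin.cases ?_ (fun j => ?_) i <;> simp

/-- The diagonal form `w` is isometric to a restriction of `w'`. -/
def Cong (w w' : Fin n → F) : Prop :=
  ∃ e : (Fin n → F) →ₗ[F] (Fin n → F), ∀ x, dq w' (e x) = dq w x

/-- The diagonal form `w` has a nontrivial zero. -/
def Iso (w : Fin n → F) : Prop := ∃ x, x ≠ 0 ∧ dq w x = 0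

/-- The diagonal form `w` represents `c`. -/
def Rep (w : Fin n → F) (c : F) : Prop := ∃ x, dq w x = c

theorem Cong.refl (w : Fin n → F) : Cong w w := ⟨LinearMap.id, fun _ => rfl⟩

theorem Cong.trans {w₁ w₂ w₃ : Fin n → F} (h : Cong w₁ w₂) (h' : Cong w₂ w₃) : Cong w₁ w₃ := by
  obtain ⟨e, he⟩ := h
  obtain ⟨e', he'⟩ := h'
  exact ⟨e' ∘ₗ e, fun x => by simp [he', he]⟩

variable [NeZero (2 : F)]

theorem db_of_dq {w w' : Fin n → F} {e : (Fin n → F) →ₗ[F] (Fin n → F)}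
    (he : ∀ x, dq w' (e x) = dq w x) (x y : Fin n → F) : db w' (e x) (e y) = db w x y := by
  have h := he (x + y)
  rw [map_add, dq_add, dq_add, he, he] at h
  exact mul_left_cancel₀ (NeZero.ne (2 : F)) (by linear_combination h)

theorem injective_of_dq {w w' : Fin n → F} {e : (Fin n → F) →ₗ[F] (Fin n → F)}
    (hw : ∀ i, w i ≠ 0) (he : ∀ x, dq w' (e x) = dq w x) : Function.Injective e := by
  rw [injective_iff_map_eq_zero]
  intro x hx
  ext i
  have := db_of_dq he x (Pi.single i 1)
  rw [hx, db_zero_left, db_comm, db_single_left] at this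
  simpa [hw i] using this.symm

theorem Cong.symm {w w' : Fin n → F} (hw : ∀ i, w i ≠ 0) (h : Cong w w') : Cong w' w := by
  obtain ⟨e, he⟩ := h
  have hi := injective_of_dq hw he
  let E := LinearEquiv.ofInjectiveEndo e hi
  refine ⟨E.symm.toLinearMap, fun x => ?_⟩
  rw [← he]
  congr 1
  exact E.apply_symm_apply x

theorem cong_iff {w w' : Fin n → F} :
    Cong w w' ↔ ∃ u : Fin n → Fin n → F, ∀ i j, db w' (u i) (u j) = if i = j then w i else 0 := by
  constructor
  · rintro ⟨e, he⟩
    refine ⟨fun i => e (Pi.single i 1), fun i j => ?_⟩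
    rw [db_of_dq he, db_single_left]
    simp [Pi.single_apply]
  · rintro ⟨u, hu⟩
    refine ⟨Fintype.linearCombination F u, fun x => ?_⟩
    rw [← db_self, Fintype.linearCombination_apply, db_sum_left]
    refine Finset.sum_congr rfl fun i _ => ?_
    rw [db_smul_left, db_comm, db_sum_left]
    simp only [db_smul_left, hu]
    simp
    ring

theorem Cong.map {F' : Type*} [Field F'] [NeZero (2 : F')] (φ : F →+* F') {w w' : Fin n → F}
    (h : Cong w w') : Cong (φ ∘ w) (φ ∘ w') := by
  obtain ⟨u, hu⟩ := cong_iff.1 h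
  refine cong_iff.2 ⟨fun i => φ ∘ u i, fun i j => ?_⟩
  rw [db_map, hu]
  split_ifs <;> simp

theorem Cong.rep {w w' : Fin n → F} (h : Cong w w') {c : F} (hc : Rep w c) : Rep w' c := by
  obtain ⟨e, he⟩ := h
  obtain ⟨x, rfl⟩ := hc
  exact ⟨e x, he x⟩

theorem Cong.iso {w w' : Fin n → F} (hw : ∀ i, w i ≠ 0) (h : Cong w w') (hi : Iso w) :
    Iso w' := by
  obtain ⟨e, he⟩ := h
  obtain ⟨x, hx, hx0⟩ := hi
  exact ⟨e x, fun h => hx (injective_of_dq hw he (by rw [h, map_zero])), by rw [he, hx0]⟩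

theorem Cong.cons {w w' : Fin n → F} (h : Cong w w') (a : F) {b : F} (hb : b ≠ 0) :
    Cong (Fin.cons (a * b ^ 2) w : Fin (n + 1) → F) (Fin.cons a w') := by
  obtain ⟨u, hu⟩ := cong_iff.1 h
  refine cong_iff.2 ⟨Fin.cons (Fin.cons b 0) fun i => Fin.cons 0 (u i), fun i j => ?_⟩
  refine Fin.cases ?_ (fun i => ?_) i <;> refine Fin.cases ?_ (fun j => ?_) j
  · simp [db, Fin.sum_univ_succ]; ring
  · simp [db, Fin.sum_univ_succ, (Fin.succ_ne_zero j).symm]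
  · simp [db, Fin.sum_univ_succ]
  · have := hu i j
    simp only [db] at this
    simp [db, Fin.sum_univ_succ, this]

theorem Cong.cons' {w w' : Fin n → F} (h : Cong w w') (a : F) :
    Cong (Fin.cons a w : Fin (n + 1) → F) (Fin.cons a w') := by
  simpa using h.cons a one_ne_zero

theorem cong_binary (a b x y : F) (w : Fin n → F) :
    Cong (Fin.cons (a * x ^ 2 + b * y ^ 2) (Fin.cons (a * b * (a * x ^ 2 + b * y ^ 2)) w) :
      Fin (n + 1 + 1) → F) (Fin.cons a (Fin.cons b w)) := by
  refine cong_iff.2 ⟨Fin.cons (Fin.cons x (Fin.cons y 0)) (Fin.cons (Fin.cons (b * y)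
    (Fin.cons (- a * x) 0)) fun i => Fin.cons 0 (Fin.cons 0 (Pi.single i 1))), fun i j => ?_⟩
  refine Fin.cases ?_ (fun i => Fin.cases ?_ (fun i => ?_) i) i <;>
    refine Fin.cases ?_ (fun j => Fin.cases ?_ (fun j => ?_) j) j
  all_goals try (simp [db, Fin.sum_univ_succ, Fin.ext_iff]; done)
  all_goals try (simp [db, Fin.sum_univ_succ, Fin.ext_iff]; ring; done)
  by_cases h : i = j <;> simp [db, Fin.sum_univ_succ, Pi.single_apply, h, eq_comm]

theorem cons_ne_zero {a : F} {w : Fin n → F} :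
    (∀ i, (Fin.cons a w : Fin (n + 1) → F) i ≠ 0) ↔ a ≠ 0 ∧ ∀ i, w i ≠ 0 := by
  rw [Fin.forall_fin_succ]; simp

theorem rep_cons {a : F} {w : Fin n → F} {c : F} :
    Rep (Fin.cons a w : Fin (n + 1) → F) c ↔ ∃ x d, Rep w d ∧ a * x ^ 2 + d = c := by
  constructor
  · rintro ⟨x, rfl⟩
    exact ⟨x 0, _, ⟨Fin.tail x, rfl⟩, (dq_cons _ _ _).symm⟩
  · rintro ⟨x, _, ⟨y, rfl⟩, rfl⟩
    exact ⟨Fin.cons x y, by simp [dq_cons]⟩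

/-- A form splits off any nonzero value. -/
theorem exists_cong_cons : ∀ {n : ℕ} {w : Fin (n + 1) → F}, (∀ i, w i ≠ 0) → ∀ {c : F}, c ≠ 0 →
    Rep w c → ∃ w' : Fin n → F, (∀ i, w' i ≠ 0) ∧ Cong (Fin.cons c w' : Fin (n + 1) → F) w := by
  intro n
  induction n with
  | zero =>
    intro w hw c hc h
    obtain ⟨x, rfl⟩ := h
    refine ⟨Fin.elim0, fun i => i.elim0, ?_⟩
    have hx : x 0 ≠ 0 := by rintro h; simp [dq, h] at hc
    have := (Cong.refl (Fin.elim0 : Fin 0 → F)).cons (w 0) hx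
    convert this using 1
    · ext i; fin_cases i; simp [dq]
    · ext i; fin_cases i; simp
  | succ n ih =>
    intro w hw c hc h
    obtain ⟨a, w, rfl⟩ : ∃ a v, w = Fin.cons a v := ⟨w 0, Fin.tail w, (Fin.cons_self_tail w).symm⟩
    rw [cons_ne_zero] at hw
    obtain ⟨x, d, hd, rfl⟩ := rep_cons.1 h
    by_cases hd0 : d = 0
    · subst hd0
      have hx : x ≠ 0 := by rintro rfl; simp at hc
      exact ⟨w, hw.2, by simpa using (Cong.refl w).cons a hx⟩
    · obtain ⟨w', hw', hc'⟩ := ih hw.2 hd0 hd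
      refine ⟨Fin.cons (a * d * (a * x ^ 2 + d)) w', cons_ne_zero.2 ⟨?_, hw'⟩, ?_⟩
      · exact mul_ne_zero (mul_ne_zero hw.1 hd0) hc
      · have := (cong_binary a d x 1 w').trans (hc'.cons' a)
        simpa using this

/-- Reflections act transitively on vectors of a given nonzero length. -/
theorem exists_isometry {w u u' : Fin n → F} (h : dq w u = dq w u') (h0 : dq w u ≠ 0) :
    ∃ e : (Fin n → F) →ₗ[F] (Fin n → F), (∀ x, dq w (e x) = dq w x) ∧ e u = u' := by
  have refl : ∀ z : Fin n → F, dq w z ≠ 0 → ∃ e : (Fin n → F) →ₗ[F] (Fin n → F),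
      (∀ x, dq w (e x) = dq w x) ∧ ∀ x, e x = x - (2 * db w x z / dq w z) • z := by
    intro z hz
    refine ⟨⟨⟨fun x => x - (2 * db w x z / dq w z) • z, fun x y => ?_⟩, fun c x => ?_⟩,
      fun x => ?_, fun x => rfl⟩
    · rw [db_add_left]; ext i
      simp only [Pi.sub_apply, Pi.add_apply, Pi.smul_apply, smul_eq_mul]; ring
    · simp only [db_smul_left]; ext i
      simp only [Pi.sub_apply, Pi.smul_apply, smul_eq_mul, RingHom.id_apply]; ring
    · change dq w (x - (2 * db w x z / dq w z) • z) = _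
      rw [sub_eq_add_neg, ← neg_smul, dq_add, dq_smul, db_comm w x (_ • z), db_smul_left, db_comm w z x]
      field_simp
      ring
  have e1 : ∀ s : F, s ^ 2 = 1 → dq w (u + (- s) • u') = 2 * (dq w u - s * db w u u') := by
    intro s hs
    rw [dq_add, dq_smul, db_comm, db_smul_left, db_comm w u' u, ← h]
    linear_combination dq w u * hs
  have e2 : ∀ s : F, db w u (u + (- s) • u') = dq w u - s * db w u u' := by
    intro s
    rw [db_comm, db_add_left, db_self, db_smul_left, db_comm w u' u]; ring
  have e3 : ∀ s : F, s ^ 2 = 1 → dq w u - s * db w u u' ≠ 0 →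
      ∃ e : (Fin n → F) →ₗ[F] (Fin n → F), (∀ x, dq w (e x) = dq w x) ∧ e u = s • u' := by
    intro s hs hne
    have h2 : (2 : F) ≠ 0 := NeZero.ne _
    obtain ⟨e, he, he'⟩ := refl (u + (- s) • u') (by rw [e1 s hs]; exact mul_ne_zero h2 hne)
    refine ⟨e, he, ?_⟩
    rw [he', e1 s hs, e2, div_self (mul_ne_zero h2 hne)]
    ext i; simp
  by_cases hu : dq w u - 1 * db w u u' = 0
  · obtain ⟨e, he, he'⟩ := e3 (-1) (by ring) (by
      intro h'
      have : 2 * dq w u = 0 := by linear_combination hu + h'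
      exact h0 (by simpa [NeZero.ne (2 : F)] using this))
    refine ⟨-e, fun x => ?_, by simp [he']⟩
    rw [LinearMap.neg_apply, ← neg_one_smul F, dq_smul, he]; ring
  · obtain ⟨e, he, he'⟩ := e3 1 (by ring) hu
    exact ⟨e, he, by simpa using he'⟩

/-- Witt cancellation. -/
theorem Cong.cancel {a : F} (ha : a ≠ 0) {w w' : Fin n → F}
    (h : Cong (Fin.cons a w : Fin (n + 1) → F) (Fin.cons a w')) : Cong w w' := by
  obtain ⟨e, he⟩ := h
  set W' : Fin (n + 1) → F := Fin.cons a w' with hW'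
  set W : Fin (n + 1) → F := Fin.cons a w with hW
  set e₀ : Fin (n + 1) → F := Pi.single 0 1 with he₀
  have h1 : dq W e₀ = a := by rw [← db_self, db_single_left]; simp [hW, he₀]
  have h2 : dq W' e₀ = a := by rw [← db_self, db_single_left]; simp [hW', he₀]
  obtain ⟨g, hg, hg'⟩ := exists_isometry (w := W') (u := e e₀) (u' := e₀)
    (by rw [he, h1, h2]) (by rw [he, h1]; exact ha)
  have hge : ∀ x, dq W' ((g ∘ₗ e) x) = dq W x := fun x => by simp [hg, he]
  let i : (Fin n → F) →ₗ[F] (Fin (n + 1) → F) :=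
    ⟨⟨fun x => Fin.cons 0 x, fun x y => by ext j; refine Fin.cases ?_ (fun j => ?_) j <;> simp⟩,
      fun c x => by ext j; refine Fin.cases ?_ (fun j => ?_) j <;> simp⟩
  let t : (Fin (n + 1) → F) →ₗ[F] (Fin n → F) := ⟨⟨Fin.tail, fun x y => rfl⟩, fun c x => rfl⟩
  refine ⟨t ∘ₗ (g ∘ₗ e) ∘ₗ i, fun x => ?_⟩
  have h3 := hge (i x)
  have h4 : (g ∘ₗ e) (i x) 0 = 0 := by
    have := db_of_dq hge e₀ (i x)
    rw [db_single_left, LinearMap.comp_apply, hg', db_single_left] at this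
    simpa [i, hW', ha] using this
  rw [dq_cons, dq_cons, h4] at h3
  change dq w' (Fin.tail ((g ∘ₗ e) (i x))) = _
  simpa [i] using h3

theorem iso_of_cons {a : F} {w : Fin n → F} (h : Iso w) : Iso (Fin.cons a w : Fin (n + 1) → F) := by
  obtain ⟨x, hx, hx0⟩ := h
  refine ⟨Fin.cons 0 x, fun h => hx ?_, by simp [dq_cons, hx0]⟩
  ext i
  simpa using congrFun h i.succ

/-- Isotropic forms are universal. -/
theorem Iso.rep {w : Fin n → F} (hw : ∀ i, w i ≠ 0) (h : Iso w) (c : F) : Rep w c := by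
  obtain ⟨x, hx, hx0⟩ := h
  obtain ⟨i, hi⟩ := Function.ne_iff.1 hx
  set y : Fin n → F := Pi.single i 1
  have hb : db w x y ≠ 0 := by
    rw [db_comm, db_single_left]; exact mul_ne_zero (hw i) hi
  have h2 : (2 : F) ≠ 0 := NeZero.ne _
  refine ⟨((c - dq w y) / (2 * db w x y)) • x + y, ?_⟩
  rw [dq_add, dq_smul, hx0, db_smul_left]
  field_simp
  ring

theorem iso_cons_iff {a : F} (ha : a ≠ 0) {w : Fin n → F} (hw : ∀ i, w i ≠ 0) :
    Iso (Fin.cons a w : Fin (n + 1) → F) ↔ Rep w (-a) := by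
  constructor
  · rintro ⟨x, hx, hx0⟩
    rw [dq_cons] at hx0
    by_cases h : x 0 = 0
    · refine Iso.rep hw ⟨Fin.tail x, fun h' => hx ?_, by simpa [h] using hx0⟩ _
      rw [← Fin.cons_self_tail x, h, h']
      ext j; refine Fin.cases ?_ (fun j => ?_) j <;> simp
    · refine ⟨(x 0)⁻¹ • Fin.tail x, ?_⟩
      rw [dq_smul]
      field_simp
      linear_combination hx0
  · rintro ⟨x, hx⟩
    refine ⟨Fin.cons 1 x, fun h => ?_, by simp [dq_cons, hx]⟩
    simpa using congrFun h 0

end Diag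

theorem isSquare_of_mul_sq {F : Type*} [Field F] {x y : F} (hy : y ≠ 0)
    (h : IsSquare (x * y ^ 2)) : IsSquare x := by
  have := h.div (IsSquare.sq y)
  rwa [mul_div_cancel_right₀ _ (pow_ne_zero 2 hy)] at this

theorem isSquare_mul_trans {F : Type*} [Field F] {x y z : F} (hy : y ≠ 0) (h : IsSquare (x * y))
    (h' : IsSquare (y * z)) : IsSquare (x * z) :=
  isSquare_of_mul_sq hy (by rw [show x * z * y ^ 2 = x * y * (y * z) by ring]; exact h.mul h')

theorem exists_isNrm_isNrm {F : Type*} [Field F] [NeZero (2 : F)] [IsHilbertField F] {s t e : F}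
    (hs : s ≠ 0) (ht : t ≠ 0) (he : e ≠ 0) (hst : ¬ IsSquare (s * t)) :
    ∃ x ≠ 0, IsNrm s x ∧ IsNrm t (e * x) := by
  by_contra! hcon
  have het : ¬ IsNrm t e := fun h => hcon 1 one_ne_zero (isNrm_one s) (by simpa using h)
  have hsub : ∀ x ≠ 0, IsNrm s x → IsNrm t x := by
    intro x hx hsx
    by_contra h
    exact hcon x hx hsx (IsHilbertField.mul_of_not ht he hx het h)
  obtain ⟨y, hy0, hy⟩ := IsHilbertField.nondeg (mul_ne_zero hs ht) hst
  rw [isNrm_comm (mul_ne_zero hs ht) hy0, isNrm_mul_iff hy0 hs ht, isNrm_comm hy0 hs,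
    isNrm_comm hy0 ht] at hy
  have hty : IsNrm t y ∧ ¬ IsNrm s y := by
    by_cases h : IsNrm s y
    · exact absurd (iff_of_true h (hsub y hy0 h)) hy
    · exact ⟨by_contra fun h' => hy (iff_of_false h h'), h⟩
  have hse : ¬ IsNrm s e := fun h => het (hsub e he h)
  have := hsub _ (mul_ne_zero hy0 he) (IsHilbertField.mul_of_not hs hy0 he hty.2 hse)
  exact het (hty.1.of_mul_left hy0 this)

namespace Diag

variable {F : Type*} [Field F] {n : ℕ} [NeZero (2 : F)]

theorem Cong.isSquare_det {w w' : Fin n → F} (h : Cong w w') :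
    IsSquare ((∏ i, w i) * ∏ i, w' i) := by
  obtain ⟨u, hu⟩ := cong_iff.1 h
  have : Matrix.of u * Matrix.diagonal w' * (Matrix.of u).transpose = Matrix.diagonal w := by
    ext i j
    rw [Matrix.mul_apply, Matrix.diagonal_apply, ← hu]
    refine Finset.sum_congr rfl fun k _ => ?_
    rw [Matrix.mul_diagonal, Matrix.transpose_apply, Matrix.of_apply, Matrix.of_apply]
    ring
  have h2 := congrArg Matrix.det this
  rw [Matrix.det_mul, Matrix.det_mul, Matrix.det_transpose, Matrix.det_diagonal,
    Matrix.det_diagonal] at h2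
  rw [← h2]
  exact ⟨(Matrix.of u).det * ∏ i, w' i, by ring⟩

theorem cong_one {w w' : Fin 1 → F} (hw : ∀ i, w i ≠ 0) (hw' : ∀ i, w' i ≠ 0)
    (h : IsSquare ((∏ i, w i) * ∏ i, w' i)) : Cong w w' := by
  obtain ⟨d, hd⟩ := h
  simp only [Fin.prod_univ_one] at hd
  have h0 := hw 0
  have h0' := hw' 0
  have hd0 : d ≠ 0 := by rintro rfl; simp [h0, h0'] at hd
  have := (Cong.refl (Fin.elim0 : Fin 0 → F)).cons (w' 0) (div_ne_zero hd0 h0')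
  convert this using 1
  · ext i; fin_cases i; simp; field_simp; linear_combination hd
  · ext i; fin_cases i; simp

/-- Forms with a common value are isometric if their complements are. -/
theorem cong_of_common {w w' : Fin (n + 1) → F} (hw : ∀ i, w i ≠ 0) (hw' : ∀ i, w' i ≠ 0)
    {c : F} (hc : c ≠ 0) (h : Rep w c) (h' : Rep w' c) :
    ∃ z z' : Fin n → F, (∀ i, z i ≠ 0) ∧ (∀ i, z' i ≠ 0) ∧ Cong (Fin.cons c z : Fin (n + 1) → F) w ∧
      Cong (Fin.cons c z' : Fin (n + 1) → F) w' ∧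
      (IsSquare ((∏ i, w i) * ∏ i, w' i) → IsSquare ((∏ i, z i) * ∏ i, z' i)) ∧
      (Cong z z' → Cong w w') := by
  obtain ⟨z, hz, hz'⟩ := exists_cong_cons hw hc h
  obtain ⟨y, hy, hy'⟩ := exists_cong_cons hw' hc h'
  refine ⟨z, y, hz, hy, hz', hy', fun hd => ?_, fun hzy => ?_⟩
  · have h1 := isSquare_mul_trans (Finset.prod_ne_zero_iff.2 fun i _ => hw i) hz'.isSquare_det hd
    have h2 := hy'.isSquare_det
    rw [mul_comm] at h2
    have h3 := isSquare_mul_trans (Finset.prod_ne_zero_iff.2 fun i _ => hw' i) h1 h2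
    simp only [Fin.prod_univ_succ, Fin.cons_zero, Fin.cons_succ] at h3
    exact isSquare_of_mul_sq hc (by convert h3 using 1; ring)
  · exact ((hz'.symm (cons_ne_zero.2 ⟨hc, hz⟩)).trans (hzy.cons' c)).trans hy'

theorem cong_two {w w' : Fin 2 → F} (hw : ∀ i, w i ≠ 0) (hw' : ∀ i, w' i ≠ 0)
    (h : IsSquare ((∏ i, w i) * ∏ i, w' i)) (hN : IsNrm (-(w 0 * w 1)) (w 0 * w' 0)) :
    Cong w w' := by
  obtain ⟨x, y, hxy⟩ := hN
  have h0 := hw 0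
  have hr : Rep w (w' 0) := ⟨![x / w 0, y], by simp [dq]; field_simp; linear_combination hxy⟩
  have hr' : Rep w' (w' 0) := ⟨![1, 0], by simp [dq]⟩
  obtain ⟨z, z', hz, hz', -, -, hd, hc⟩ := cong_of_common hw hw' (hw' 0) hr hr'
  exact hc (cong_one hz hz' (hd h))

theorem Cong.isNrm_two {w w' : Fin 2 → F} (hw : ∀ i, w i ≠ 0) (h : Cong w' w) :
    IsNrm (-(w 0 * w 1)) (w 0 * w' 0) := by
  obtain ⟨x, hx⟩ := h.rep (c := w' 0) ⟨![1, 0], by simp [dq]⟩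
  refine ⟨w 0 * x 0, x 1, ?_⟩
  rw [← hx]
  simp [dq]
  ring

theorem iso_four [IsHilbertField F] {w : Fin 4 → F} (hw : ∀ i, w i ≠ 0)
    (h : ¬ IsSquare (∏ i, w i)) : Iso w := by
  have h0 := hw 0
  have h1 := hw 1
  have h2 := hw 2
  have h3 := hw 3
  obtain ⟨x, hx, ⟨p, q, hpq⟩, r, u, hru⟩ := exists_isNrm_isNrm (s := -(w 0 * w 1))
    (t := -(w 2 * w 3)) (e := -(w 0 * w 2)) (by simp [*]) (by simp [*]) (by simp [*])
    (by rw [neg_mul_neg]; convert h using 2; simp [Fin.prod_univ_four]; ring)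
  refine ⟨![w 2 * p, w 0 * w 2 * q, r, w 2 * u], fun h => hx ?_, ?_⟩
  · have e0 := congrFun h 0
    have e1 := congrFun h 1
    simp [h0, h2] at e0 e1
    rw [← hpq, e0, e1]; ring
  · simp [dq, Fin.sum_univ_four]
    linear_combination (w 2 ^ 2 * w 0) * hpq + w 2 * hru

theorem rep_of_three [IsHilbertField F] {w : Fin (n + 3) → F} (hw : ∀ i, w i ≠ 0) {c : F}
    (hc : c ≠ 0) (h : ¬ IsSquare (-(w 0 * w 1 * w 2) * c)) : Rep w c := by
  have h3 : ∀ i, (![w 0, w 1, w 2] : Fin 3 → F) i ≠ 0 := by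
    intro i; fin_cases i <;> simp [hw]
  have hI : Iso (Fin.cons (-c) ![w 0, w 1, w 2] : Fin 4 → F) := by
    refine iso_four (cons_ne_zero.2 ⟨neg_ne_zero.2 hc, h3⟩) fun h' => h ?_
    convert h' using 1
    simp [Fin.prod_univ_four]
    ring
  obtain ⟨x, hx⟩ := (iso_cons_iff (neg_ne_zero.2 hc) h3).1 hI
  refine ⟨fun i => if hi : i.1 < 3 then x ⟨i, hi⟩ else 0, ?_⟩
  rw [← neg_neg c, ← hx]
  simp only [dq, Fin.sum_univ_succ]
  simp
  rw [Finset.sum_eq_zero]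
  · simp [Fin.succ, add_assoc]
    left
    simp only [Nat.mod_eq_of_lt (show 2 < n + 3 by omega)]
    simp
  · intro i _
    simp [Fin.succ]

/-- Every three elements can be avoided up to squares. -/
def Big (F : Type*) [Field F] : Prop := ∀ x y z : F, x ≠ 0 → y ≠ 0 → z ≠ 0 →
  ∃ c : F, c ≠ 0 ∧ ¬ IsSquare (x * c) ∧ ¬ IsSquare (y * c) ∧ ¬ IsSquare (z * c)

theorem big_of_index (h : 4 ≤ (sqGroup Fˣ).index) : Big F := by
  classical
  intro x y z hx hy hz
  let q : Fˣ → Fˣ ⧸ sqGroup Fˣ := QuotientGroup.mk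
  have hf : Finite (Fˣ ⧸ sqGroup Fˣ) := Nat.finite_of_card_ne_zero (by
    rw [← Subgroup.index]; omega)
  have := Fintype.ofFinite (Fˣ ⧸ sqGroup Fˣ)
  let S : Finset (Fˣ ⧸ sqGroup Fˣ) := {q (Units.mk0 x hx), q (Units.mk0 y hy), q (Units.mk0 z hz)}
  have hS : S.card < Fintype.card (Fˣ ⧸ sqGroup Fˣ) := by
    have : S.card ≤ 3 := Finset.card_le_three
    rw [Subgroup.index, Nat.card_eq_fintype_card] at h
    omega
  obtain ⟨k, hk⟩ : ∃ k, k ∉ S := by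
    by_contra! hall
    exact absurd (Finset.card_eq_iff_eq_univ S |>.2 (Finset.eq_univ_of_forall hall)) (by omega)
  obtain ⟨c, rfl⟩ := QuotientGroup.mk_surjective k
  have key : ∀ t (ht : t ≠ 0), q (Units.mk0 t ht) ∈ S → ¬ IsSquare (t * (c : F)) := by
    intro t ht hm hsq
    refine hk ?_
    convert hm using 1
    symm
    refine QuotientGroup.eq.2 ?_
    rw [mem_sqGroup_units]
    refine isSquare_of_mul_sq (y := t) ht ?_
    convert hsq using 1
    simp
    field_simp
  exact ⟨c, c.ne_zero, key x hx (by simp [S]), key y hy (by simp [S]), key z hz (by simp [S])⟩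

/-- There are at most two isometry classes of forms with given dimension and determinant. -/
theorem cong_of_three [IsHilbertField F] (hF : Big F) : ∀ {n : ℕ} {w₁ w₂ w₃ : Fin n → F},
    (∀ i, w₁ i ≠ 0) → (∀ i, w₂ i ≠ 0) → (∀ i, w₃ i ≠ 0) →
    IsSquare ((∏ i, w₁ i) * ∏ i, w₂ i) → IsSquare ((∏ i, w₁ i) * ∏ i, w₃ i) →
    Cong w₁ w₂ ∨ Cong w₁ w₃ ∨ Cong w₂ w₃ := by
  intro n
  induction n with
  | zero =>
    intro w₁ w₂ w₃ _ _ _ _ _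
    exact Or.inl ⟨LinearMap.id, fun x => by simp [dq]⟩
  | succ n ih =>
    intro w₁ w₂ w₃ h₁ h₂ h₃ h12 h13
    have h23 : IsSquare ((∏ i, w₂ i) * ∏ i, w₃ i) := by
      rw [mul_comm] at h12
      exact isSquare_mul_trans (Finset.prod_ne_zero_iff.2 fun i _ => h₁ i) h12 h13
    rcases n with _ | _ | n
    · exact Or.inl (cong_one h₁ h₂ h12)
    · by_cases hN : IsNrm (-(w₁ 0 * w₁ 1)) (w₁ 0 * w₂ 0)
      · exact Or.inl (cong_two h₁ h₂ h12 hN)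
      by_cases hN' : IsNrm (-(w₁ 0 * w₁ 1)) (w₁ 0 * w₃ 0)
      · exact Or.inr (Or.inl (cong_two h₁ h₃ h13 hN'))
      refine Or.inr (Or.inr (cong_two h₂ h₃ h23 ?_))
      have := IsHilbertField.mul_of_not (a := -(w₁ 0 * w₁ 1)) (by simp [h₁]) (mul_ne_zero (h₁ 0) (h₂ 0))
        (mul_ne_zero (h₁ 0) (h₃ 0)) hN hN'
      have h5 : IsNrm (-(w₁ 0 * w₁ 1)) (w₂ 0 * w₃ 0) :=
        (isNrm_mul_sq_right (h₁ 0) _ _).1 (by convert this using 1; ring)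
      obtain ⟨d, hd⟩ := h12
      simp only [Nat.reduceAdd, Fin.prod_univ_two] at hd
      have hd0 : d ≠ 0 := by rintro rfl; simp [h₁, h₂] at hd
      have h6 : -(w₂ 0 * w₂ 1) = -(w₁ 0 * w₁ 1) * (d / (w₁ 0 * w₁ 1)) ^ 2 := by
        have := h₁ 0; have := h₁ 1
        field_simp
        linear_combination - hd
      rw [h6]
      exact (isNrm_mul_sq_left (div_ne_zero hd0 (mul_ne_zero (h₁ 0) (h₁ 1))) _).2 h5
    · obtain ⟨c, hc, c1, c2, c3⟩ := hF (-(w₁ 0 * w₁ 1 * w₁ 2)) (-(w₂ 0 * w₂ 1 * w₂ 2))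
        (-(w₃ 0 * w₃ 1 * w₃ 2)) (by simp [h₁]) (by simp [h₂]) (by simp [h₃])
      have r1 := rep_of_three (n := n) h₁ hc c1
      have r2 := rep_of_three (n := n) h₂ hc c2
      have r3 := rep_of_three (n := n) h₃ hc c3
      obtain ⟨z₁, hz₁, hc₁⟩ := exists_cong_cons h₁ hc r1
      obtain ⟨z₂, hz₂, hc₂⟩ := exists_cong_cons h₂ hc r2
      obtain ⟨z₃, hz₃, hc₃⟩ := exists_cong_cons h₃ hc r3
      have hdet : ∀ {w w' : Fin (n + 2 + 1) → F} {z z' : Fin (n + 2) → F},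
          (∀ i, w i ≠ 0) → (∀ i, w' i ≠ 0) →
          Cong (Fin.cons c z : Fin (n + 2 + 1) → F) w →
          Cong (Fin.cons c z' : Fin (n + 2 + 1) → F) w' → IsSquare ((∏ i, w i) * ∏ i, w' i) →
          IsSquare ((∏ i, z i) * ∏ i, z' i) := by
        intro w w' z z' hw hw' hz' hy' hd
        have e1 := isSquare_mul_trans (Finset.prod_ne_zero_iff.2 fun i _ => hw i)
          hz'.isSquare_det hd
        have e2 := hy'.isSquare_det
        rw [mul_comm] at e2
        have e3 := isSquare_mul_trans (Finset.prod_ne_zero_iff.2 fun i _ => hw' i) e1 e2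
        simp only [Fin.prod_univ_succ (n := n + 2), Fin.cons_zero, Fin.cons_succ] at e3
        exact isSquare_of_mul_sq hc (by convert e3 using 1; ring)
      have hlift : ∀ {w w' : Fin (n + 2 + 1) → F} {z z' : Fin (n + 2) → F}, (∀ i, z i ≠ 0) →
          Cong (Fin.cons c z : Fin (n + 2 + 1) → F) w →
          Cong (Fin.cons c z' : Fin (n + 2 + 1) → F) w' → Cong z z' → Cong w w' :=
        fun hz hzw hzw' hzz => ((hzw.symm (cons_ne_zero.2 ⟨hc, hz⟩)).trans (hzz.cons' c)).trans hzw'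
      rcases ih hz₁ hz₂ hz₃ (hdet h₁ h₂ hc₁ hc₂ h12) (hdet h₁ h₃ hc₁ hc₃ h13) with h | h | h
      · exact Or.inl (hlift hz₁ hc₁ hc₂ h)
      · exact Or.inr (Or.inl (hlift hz₁ hc₁ hc₃ h))
      · exact Or.inr (Or.inr (hlift hz₂ hc₂ hc₃ h))

end Diag

namespace Diag

variable {F : Type*} [Field F] {n : ℕ}

theorem Iso.map {F' : Type*} [Field F'] (φ : F →+* F') {w : Fin n → F} (h : Iso w) :
    Iso (φ ∘ w) := by
  obtain ⟨x, hx, hx0⟩ := h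
  refine ⟨φ ∘ x, fun h => hx ?_, by rw [dq_map, hx0, map_zero]⟩
  ext i
  simpa using congrFun h i

variable [NeZero (2 : F)]

theorem iso_two {w : Fin 2 → F} (hw : ∀ i, w i ≠ 0) (h : IsSquare (-(w 0 * w 1))) : Iso w := by
  obtain ⟨d, hd⟩ := h
  refine ⟨![d, w 0], fun h => hw 0 (by simpa using congrFun h 1), ?_⟩
  simp [dq]
  linear_combination - w 0 * hd

theorem iso_four_iff {w : Fin 4 → F} (hw : ∀ i, w i ≠ 0) (h : IsSquare (∏ i, w i)) :
    Iso w ↔ IsNrm (-(w 0 * w 1)) (-(w 0 * w 2)) := by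
  obtain ⟨δ, hδ⟩ := h
  simp only [Fin.prod_univ_four] at hδ
  have h0 := hw 0
  have h1 := hw 1
  have h2 := hw 2
  have h3 := hw 3
  have hδ0 : δ ≠ 0 := by rintro rfl; simp [*] at hδ
  have e3 : w 3 = w 0 * w 1 * w 2 * (δ / (w 0 * w 1 * w 2)) ^ 2 := by
    field_simp; linear_combination hδ
  set ε := δ / (w 0 * w 1 * w 2) with hε
  have hε0 : ε ≠ 0 := div_ne_zero hδ0 (by simp [*])
  constructor
  · rintro ⟨x, hx, hx0⟩
    by_cases hβ : IsSquare (-(w 0 * w 1))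
    · exact isNrm_of_isSquare hβ (by simp [*]) _
    have key : ∀ p q : F, p ^ 2 - -(w 0 * w 1) * q ^ 2 = 0 → p = 0 ∧ q = 0 := by
      intro p q hpq
      have hq : q = 0 := by
        by_contra hq
        exact hβ ⟨p / q, by field_simp; linear_combination - hpq⟩
      subst hq
      exact ⟨by simpa using hpq, rfl⟩
    simp only [dq, Fin.sum_univ_four] at hx0
    rw [e3] at hx0
    have hA : IsNrm (-(w 0 * w 1)) (x 2 ^ 2 - -(w 0 * w 1) * (ε * x 3) ^ 2) := ⟨_, _, rfl⟩
    have hB : IsNrm (-(w 0 * w 1)) ((w 0 * x 0) ^ 2 - -(w 0 * w 1) * (x 1) ^ 2) := ⟨_, _, rfl⟩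
    have heq : (w 0 * x 0) ^ 2 - -(w 0 * w 1) * (x 1) ^ 2 =
        (x 2 ^ 2 - -(w 0 * w 1) * (ε * x 3) ^ 2) * (-(w 0 * w 2)) := by
      linear_combination w 0 * hx0
    rw [heq] at hB
    refine hA.of_mul_left (fun hz => hx ?_) hB
    obtain ⟨z2, z3⟩ := key _ _ hz
    rw [hz, zero_mul] at heq
    obtain ⟨z0, z1⟩ := key _ _ heq
    ext i
    fin_cases i
    · simpa [h0] using z0
    · exact z1
    · exact z2
    · simpa [hε0] using z3
  · rintro ⟨p, q, hpq⟩
    refine ⟨![p / w 0, q, 1, 0], fun h => by simpa using congrFun h 2, ?_⟩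
    simp [dq, Fin.sum_univ_four]
    field_simp
    linear_combination hpq

theorem iso_of_isNrm {w : Fin (n + 3) → F} (hw : ∀ i, w i ≠ 0)
    (h : IsNrm (-(w 0 * w 1)) (-(w 0 * w 2))) : Iso w := by
  obtain ⟨p, q, hpq⟩ := h
  have h0 := hw 0
  refine ⟨Fin.cons (p / w 0) (Fin.cons q (Fin.cons 1 0)), fun h => ?_, ?_⟩
  · have := congrFun h (Fin.succ (Fin.succ 0))
    rw [Fin.cons_succ, Fin.cons_succ, Fin.cons_zero] at this
    exact one_ne_zero this
  · simp [dq, Fin.sum_univ_succ]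
    field_simp
    linear_combination hpq

/-- Isotropy over the discriminant extension descends. -/
theorem iso_of_isQuad {K E : Type u} [Field K] [NumberField K] [Field E] [Algebra K E]
    {w : Fin 4 → K} (hw : ∀ i, w i ≠ 0) {θ : E} {σ : E →ₐ[K] E}
    (hE : IsQuad (∏ i, w i) θ σ) (hd : ¬ IsSquare (∏ i, w i)) (h : Iso (algebraMap K E ∘ w)) :
    Iso w := by
  set d := ∏ i, w i with hdd
  have hd0 : d ≠ 0 := Finset.prod_ne_zero_iff.2 fun i _ => hw i
  obtain ⟨z, hz, hz0⟩ := h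
  choose x y hxy using fun i => hE.repr (z i)
  have h1 : dq (algebraMap K E ∘ w) z = algebraMap K E (dq w x + d * dq w y) +
      algebraMap K E (2 * db w x y) * θ := by
    simp only [dq, db, map_add, map_sum, map_mul, Finset.mul_sum, Finset.sum_mul,
      ← Finset.sum_add_distrib, map_pow]
    refine Finset.sum_congr rfl fun i _ => ?_
    rw [hxy i, Function.comp_apply, _root_.map_ofNat]
    linear_combination algebraMap K E (w i) * algebraMap K E (y i) ^ 2 * hE.sq
  rw [hz0] at h1
  obtain ⟨h2, h3⟩ := hE.repr_unique hd (x := 0) (y := 0) (h1.symm.trans (by simp)).symm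
  have h3' : db w x y = 0 := by simpa using h3.symm
  by_cases hm : dq w y = 0
  · by_cases hy : y = 0
    · refine ⟨x, fun hx => hz ?_, by simpa [hm] using h2.symm⟩
      ext i; rw [hxy, hx, hy]; simp
    · exact ⟨y, hy, hm⟩
  obtain ⟨w', hw', e, he⟩ := exists_cong_cons hw hm ⟨y, rfl⟩
  set W : Fin 4 → K := Fin.cons (dq w y) w' with hW
  have hWne : ∀ i, W i ≠ 0 := cons_ne_zero.2 ⟨hm, hw'⟩
  have h4 : dq W (Pi.single 0 1) = dq w y := by rw [← db_self, db_single_left]; simp [hW]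
  obtain ⟨g, hg, hg'⟩ := exists_isometry (w := w) (u := e (Pi.single 0 1)) (u' := y)
    (by rw [he, h4]) (by rw [he, h4]; exact hm)
  have hge : ∀ x, dq w ((g ∘ₗ e) x) = dq W x := fun x => by simp [hg, he]
  obtain ⟨x', hx'⟩ := (LinearMap.injective_iff_surjective.1 (injective_of_dq hWne hge)) x
  have h5 : x' 0 = 0 := by
    have := db_of_dq hge (Pi.single 0 1) x'
    rw [hx', LinearMap.comp_apply, hg', db_comm, h3', db_single_left] at this
    simpa [hW, hm] using this.symm
  have h6 : dq w' (Fin.tail x') = - (d * dq w y) := by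
    have := hge x'
    rw [hx', dq_cons, h5] at this
    linear_combination - this - h2
  have hdm : - (d * dq w y) ≠ 0 := neg_ne_zero.2 (mul_ne_zero hd0 hm)
  obtain ⟨w'', hw'', hc⟩ := exists_cong_cons hw' hdm ⟨_, h6⟩
  have hc2 : Cong (Fin.cons (dq w y) (Fin.cons (-(d * dq w y)) w'') : Fin 4 → K) w :=
    (hc.cons' _).trans ⟨e, he⟩
  have hsq := hc2.isSquare_det
  rw [← hdd] at hsq
  refine hc2.iso (cons_ne_zero.2 ⟨hm, cons_ne_zero.2 ⟨hdm, hw''⟩⟩) (iso_of_cons (iso_of_cons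
    (iso_two hw'' (isSquare_of_mul_sq (mul_ne_zero hd0 hm) ?_))))
  convert hsq using 1
  rw [Fin.prod_univ_succ, Fin.prod_univ_succ]
  simp
  ring

theorem exists_rep_of_iso {a b : F} (ha : a ≠ 0) (hb : b ≠ 0) {q : Fin (n + 1) → F}
    (hq : ∀ i, q i ≠ 0) (h : Iso (Fin.cons a (Fin.cons b q) : Fin (n + 3) → F)) :
    ∃ c x y : F, c ≠ 0 ∧ a * x ^ 2 + b * y ^ 2 = c ∧ Rep q (-c) := by
  obtain ⟨z, hz, hz0⟩ := h
  rw [dq_cons, dq_cons] at hz0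
  by_cases h0 : a * z 0 ^ 2 + b * z 1 ^ 2 = 0
  · by_cases h1 : z 0 = 0 ∧ z 1 = 0
    · refine ⟨a, 1, 0, ha, by ring, Iso.rep hq ⟨Fin.tail (Fin.tail z), fun h => hz ?_, ?_⟩ _⟩
      · ext i
        refine Fin.cases ?_ (fun i => Fin.cases ?_ (fun i => ?_) i) i
        · exact h1.1
        · exact h1.2
        · exact congrFun h i
      · have : Fin.tail z 0 = z 1 := rfl
        rw [this] at hz0
        linear_combination hz0 - h0
    · have hI : Iso ![a, b] := ⟨![z 0, z 1], fun h => h1 ⟨by simpa using congrFun h 0,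
        by simpa using congrFun h 1⟩, by simpa [dq] using h0⟩
      obtain ⟨x, hx⟩ := hI.rep (by intro i; fin_cases i <;> simp [ha, hb]) (-q 0)
      refine ⟨-q 0, x 0, x 1, neg_ne_zero.2 (hq 0), by simpa [dq] using hx, Pi.single 0 1, ?_⟩
      rw [← db_self, db_single_left]; simp
  · refine ⟨_, _, _, h0, rfl, Fin.tail (Fin.tail z), ?_⟩
    have : Fin.tail z 0 = z 1 := rfl
    rw [this] at hz0
    linear_combination hz0

end Diag

namespace Place

open Diag

variable {K : Type u} [Field K] [NumberField K]

theorem iso_four_of_isSquare {w : Fin 4 → K} (hw : ∀ i, w i ≠ 0) (hd : IsSquare (∏ i, w i))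
    (h : ∀ v : Place K, Iso (ι v ∘ w)) : Iso w := by
  rw [iso_four_iff hw hd]
  refine isNrm_of_forall_nrmAt (Units.mk0 (-(w 0 * w 1)) (by simp [hw]))
    (Units.mk0 (-(w 0 * w 2)) (by simp [hw])) fun v => ?_
  have := (iso_four_iff (w := ι v ∘ w) (by simp [hw]) (by
    have := hd.map (ι v); rwa [map_prod] at this)).1 (h v)
  simpa [NrmAt] using this

theorem iso_four {w : Fin 4 → K} (hw : ∀ i, w i ≠ 0) (h : ∀ v : Place K, Iso (ι v ∘ w)) :
    Iso w := by
  by_cases hd : IsSquare (∏ i, w i)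
  · exact iso_four_of_isSquare hw hd h
  obtain ⟨E, _, _, _, θ, σ, hE⟩ := exists_isQuad hd
  refine iso_of_isQuad hw hE hd (iso_four_of_isSquare (by simp [hw]) ⟨θ, ?_⟩ fun v' => ?_)
  · simp only [Function.comp_apply, ← map_prod, ← hE.sq, sq]
  · obtain ⟨v, hv⟩ := exists_over (K := K) v'
    obtain ⟨ψ, -, hψ⟩ := hv.exists_hom
    have := (h v).map ψ
    convert this using 1
    ext i
    simp [hψ]

/-- The local-global principle for isotropy in dimension at least four. -/
theorem iso_of_forall : ∀ {m : ℕ} {w : Fin (m + 4) → K}, (∀ i, w i ≠ 0) →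
    (∀ v : Place K, Iso (ι v ∘ w)) → Iso w := by
  classical
  intro m
  induction m with
  | zero => exact fun hw h => iso_four hw h
  | succ m ih =>
    intro w hw h
    obtain ⟨a, w, rfl⟩ : ∃ a v, w = Fin.cons a v := ⟨w 0, Fin.tail w, (Fin.cons_self_tail w).symm⟩
    obtain ⟨b, q, rfl⟩ : ∃ a v, w = Fin.cons a v := ⟨w 0, Fin.tail w, (Fin.cons_self_tail w).symm⟩
    obtain ⟨ha, hw⟩ := cons_ne_zero.1 hw
    obtain ⟨hb, hq⟩ := cons_ne_zero.1 hw
    have n1 : -(q 0 * q 1) ≠ 0 := by simp [hq]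
    have n2 : -(q 0 * q 2) ≠ 0 := by simp [hq]
    obtain ⟨S, -, hS, hA⟩ := exists_adm_mem ∅ {Units.mk0 _ n1, Units.mk0 _ n2}
    have hloc : ∀ v : Place K, ∃ c x y : L v, c ≠ 0 ∧ ι v a * x ^ 2 + ι v b * y ^ 2 = c ∧
        Rep (ι v ∘ q) (-c) := fun v => by
      have := h v
      rw [comp_cons, comp_cons] at this
      exact exists_rep_of_iso (by simpa using ha) (by simpa using hb) (by simpa using hq) this
    choose c x y hc hxy hrep using hloc
    obtain ⟨z, hz⟩ := weak_approx (n := Fin 2) S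
      (fun v => (fun t => c v * (ι v a * t 0 ^ 2 + ι v b * t 1 ^ 2)) ⁻¹' {x | x ≠ 0 ∧ IsSquare x})
      (fun v _ => (isOpen_sq v).preimage (by fun_prop))
      (fun v _ => ⟨![x v, y v], by
        simp only [Set.mem_preimage, Set.mem_ofPred_eq]
        simp [hxy, hc v]⟩)
    simp only [Set.mem_preimage, Set.mem_ofPred_eq] at hz
    set e := a * z 0 ^ 2 + b * z 1 ^ 2 with he
    have hz' : ∀ v ∈ S, c v * ι v e ≠ 0 ∧ IsSquare (c v * ι v e) := fun v hv => by
      simpa [he] using hz v hv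
    have he0 : e ≠ 0 := by
      rintro h0
      obtain ⟨v⟩ := (inferInstance : Nonempty (InfinitePlace K))
      exact (hz' (Sum.inl v) (hS.inl_mem v)).1 (by rw [h0]; simp)
    have hI : Iso (Fin.cons e q : Fin (m + 4) → K) := by
      refine ih (cons_ne_zero.2 ⟨he0, hq⟩) fun v => ?_
      rw [comp_cons]
      by_cases hv : v ∈ S
      · rw [iso_cons_iff (by simpa using he0) (by simpa using hq)]
        obtain ⟨hne, d, hd⟩ := hz' v hv
        obtain ⟨t, ht⟩ := hrep v
        refine ⟨(d / c v) • t, ?_⟩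
        have := hc v
        rw [dq_smul, ht]
        field_simp
        linear_combination hd
      · refine iso_of_cons (iso_of_isNrm (by simpa using hq) ?_)
        have := hS.nrmAt (hA _ (by simp)) (hA _ (by simp)) hv (a := Units.mk0 _ n1)
          (c := Units.mk0 _ n2)
        simpa [NrmAt] using this
    rw [iso_cons_iff he0 hq] at hI
    obtain ⟨t, ht⟩ := hI
    refine ⟨Fin.cons (z 0) (Fin.cons (z 1) t), fun h0 => he0 ?_, ?_⟩
    · have e0 := congrFun h0 0
      have e1 := congrFun h0 1
      have e1' : (Fin.cons (z 0) (Fin.cons (z 1) t) : Fin (m + 1 + 4) → K) 1 = z 1 := rfl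
      rw [e1'] at e1
      simp at e0 e1
      rw [he, e0, e1]; ring
    · rw [dq_cons, dq_cons]
      simp [ht, he]

end Place

theorem exists_prod_eq_one {κ : Type*} [Fintype κ] [DecidableEq κ] {H : Subgroup (κ → ℤˣ)}
    (hH : H ≠ ⊤) : ∃ R : Finset κ, R.Nonempty ∧ ∀ h ∈ H, ∏ i ∈ R, h i = 1 := by
  classical
  obtain ⟨g, hg⟩ : ∃ g, g ∉ H := by
    by_contra! h
    exact hH (eq_top_iff.2 fun g _ => h g)
  obtain ⟨φ, hφ⟩ := CommGroup.exists_apply_ne_one_of_hasEnoughRootsOfUnity ((κ → ℤˣ) ⧸ H) ℂ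
    (a := (g : (κ → ℤˣ) ⧸ H)) (fun h => hg ((QuotientGroup.eq_one_iff g).1 h))
  let χ : (κ → ℤˣ) →* ℂˣ := φ.comp (QuotientGroup.mk' H)
  have hχ : ∀ h ∈ H, χ h = 1 := fun h hh => by
    have : QuotientGroup.mk' H h = 1 := (QuotientGroup.eq_one_iff h).2 hh
    simp only [χ, MonoidHom.comp_apply, this, map_one]
  let s : ℤˣ →* ℂˣ := Units.map (Int.castRingHom ℂ).toMonoidHom
  have hs : Function.Injective s := Units.map_injective Int.cast_injective
  let R : Finset κ := Finset.univ.filter fun i => χ (Pi.mulSingle i (-1)) ≠ 1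
  have key : ∀ i u, χ (Pi.mulSingle i u) = if i ∈ R then s u else 1 := by
    intro i u
    rcases Int.units_eq_one_or u with rfl | rfl
    · simp
    · by_cases hi : i ∈ R
      · have h1 : χ (Pi.mulSingle i (-1)) ≠ 1 := by simpa [R] using hi
        have h2 : χ (Pi.mulSingle i (-1)) ^ 2 = 1 := by
          rw [← map_pow, ← Pi.mulSingle_pow]; simp
        rw [if_pos hi]
        have h3 : (χ (Pi.mulSingle i (-1)) : ℂ) = 1 ∨ (χ (Pi.mulSingle i (-1)) : ℂ) = -1 :=
          sq_eq_sq_iff_eq_or_eq_neg.1 (by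
            rw [one_pow, ← Units.val_pow_eq_pow_val, h2, Units.val_one])
        rcases h3 with h3 | h3
        · exact absurd (Units.ext h3) h1
        · ext; rw [h3]; simp [s]
      · rw [if_neg hi]; simpa [R] using hi
  have hall : ∀ h, χ h = s (∏ i ∈ R, h i) := by
    intro h
    rw [← Finset.univ_prod_mulSingle h, map_prod, map_prod, Finset.univ_prod_mulSingle]
    simp only [key]
    rw [Finset.prod_ite_mem, Finset.univ_inter]
  refine ⟨R, ?_, fun h hh => hs (by rw [← hall, hχ h hh, map_one])⟩
  by_contra hR
  rw [Finset.not_nonempty_iff_eq_empty] at hR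
  refine hφ ?_
  have := hall g
  rw [hR, Finset.prod_empty, map_one] at this
  exact this

theorem card_monoidHom_le (Q : Type*) [CommGroup Q] [Finite Q] :
    Finite (Q →* ℤˣ) ∧ Nat.card (Q →* ℤˣ) ≤ Nat.card Q := by
  have hf : Finite (Q →* ℤˣ) := Finite.of_injective (fun f : Q →* ℤˣ => (f : Q → ℤˣ))
    DFunLike.coe_injective
  refine ⟨hf, ?_⟩
  have hf' : Finite (Q →* ℂˣ) := (CommGroup.monoidHom_mulEquiv_of_hasEnoughRootsOfUnity Q ℂ).some.finite_iff.2 inferInstance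
  rw [← CommGroup.card_monoidHom_of_hasEnoughRootsOfUnity Q ℂ]
  refine Nat.card_le_card_of_injective
    (fun f : Q →* ℤˣ => (Units.map (Int.castRingHom ℂ).toMonoidHom).comp f) fun f g h => ?_
  ext x
  have := DFunLike.congr_fun h x
  exact congrArg Units.val (Units.map_injective (f := (Int.castRingHom ℂ).toMonoidHom) Int.cast_injective this)

theorem relIndex_sq_le {P : Type*} [CommGroup P] (β : P →* P →* ℤˣ) {N H : Subgroup P}
    (hN : N.index ≠ 0) (hNH : N ≤ H) (hker : ∀ x, (∀ y, β x y = 1) → x ∈ N)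
    (hH : ∀ x ∈ H, ∀ y ∈ H, β x y = 1) : N.relIndex H * N.relIndex H ≤ N.index := by
  let Hp : Subgroup P :=
    { carrier := {y | ∀ x ∈ H, β x y = 1}
      mul_mem' := fun {a b} ha hb x hx => by rw [map_mul, ha x hx, hb x hx, one_mul]
      one_mem' := fun x _ => map_one _
      inv_mem' := fun {a} ha x hx => by rw [map_inv, ha x hx, inv_one] }
  have hHHp : H ≤ Hp := fun y hy x hx => hH x hx y hy
  have hHp : Hp.index ≠ 0 := by
    have : N.FiniteIndex := ⟨hN⟩
    exact (Subgroup.finiteIndex_of_le (hNH.trans hHHp)).index_ne_zero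
  have hfin : Finite (P ⧸ Hp) := (Nat.card_ne_zero.1 hHp).2
  obtain ⟨hf, hle⟩ := card_monoidHom_le (P ⧸ Hp)
  let ψ : H →* ((P ⧸ Hp) →* ℤˣ) :=
    { toFun := fun x => QuotientGroup.lift Hp (β x) fun y hy => hy x x.2
      map_one' := by ext y; simp
      map_mul' := fun a b => by
        ext y
        change ((β (a * b : P) y : ℤˣ) : ℤ) = ((β a y * β b y : ℤˣ) : ℤ)
        rw [map_mul, MonoidHom.mul_apply] }
  have hψ : ψ.ker ≤ N.subgroupOf H := fun x hx => by
    rw [Subgroup.mem_subgroupOf]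
    refine hker _ fun y => ?_
    exact DFunLike.congr_fun (MonoidHom.mem_ker.1 hx) (y : P ⧸ Hp)
  have h1 : N.relIndex H ≤ Hp.index := by
    have h2 : ψ.ker.index ≤ Hp.index := by
      rw [Subgroup.index_ker, Subgroup.index]
      exact (Nat.card_le_card_of_injective _ Subtype.val_injective).trans hle
    have h3 : ψ.ker.index ≠ 0 := by
      rw [Subgroup.index_ker]
      exact Nat.card_pos.ne'
    exact (Nat.le_of_dvd (Nat.pos_of_ne_zero h3) (Subgroup.index_dvd_of_le hψ)).trans h2
  have h4 : N.relIndex H ≤ N.relIndex Hp := by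
    have h5 : N.relIndex H * H.relIndex Hp = N.relIndex Hp :=
      Subgroup.relIndex_mul_relIndex N H Hp hNH hHHp
    refine Nat.le_of_dvd (Nat.pos_of_ne_zero fun h => hN ?_) ⟨_, h5.symm⟩
    rw [← Subgroup.relIndex_mul_index (hNH.trans hHHp), h, zero_mul]
  calc _ ≤ N.relIndex Hp * Hp.index := Nat.mul_le_mul h4 h1
    _ = _ := Subgroup.relIndex_mul_index (hNH.trans hHHp)

/-- The common slot computation for quaternion algebras. -/
theorem isNrm_iff_of_rep {F : Type*} [Field F] [NeZero (2 : F)] [IsHilbertField F]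
    {a b c x m N : F} (ha : a ≠ 0) (hb : b ≠ 0) (hc : c ≠ 0) (hm : m ≠ 0) (hN : IsNrm a N)
    (hN0 : N ≠ 0) (h1 : m = c * N) (h2 : m = b - a * x ^ 2) :
    IsNrm a c ↔ IsNrm b (-(a * m)) := by
  have e1 : IsNrm a m ↔ IsNrm a c := by
    rw [h1, isNrm_mul_iff ha hc hN0]; simp [hN]
  have e2 : IsNrm (a * b) (m * b) := ⟨b, x, by rw [h2]; ring⟩
  rw [isNrm_comm (mul_ne_zero ha hb) (mul_ne_zero hm hb),
    isNrm_mul_iff (mul_ne_zero hm hb) ha hb, isNrm_comm (mul_ne_zero hm hb) ha,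
    isNrm_comm (mul_ne_zero hm hb) hb, isNrm_mul_iff ha hm hb, isNrm_mul_iff hb hm hb,
    isNrm_comm ha hb] at e2
  have e3 : IsNrm b (-(a * m) * -b) ↔ IsNrm b (-(a * m)) := by
    rw [isNrm_mul_iff hb (neg_ne_zero.2 (mul_ne_zero ha hm)) (neg_ne_zero.2 hb)]
    simp [isNrm_neg_self]
  rw [neg_mul_neg, isNrm_mul_iff hb (mul_ne_zero ha hm) hb, isNrm_mul_iff hb ha hm] at e3
  tauto

namespace Place
variable {K : Type*} [Field K] [NumberField K]

/-- There is a quaternion algebra ramified exactly at `v`. -/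
def Bad (v : Place K) : Prop := ∃ a c : Kˣ, ∀ w, NrmAt w a c ↔ w ≠ v

/-- The local Hilbert symbol of global elements. -/
noncomputable def hilAt (v : Place K) (a : Kˣ) : Kˣ →* ℤˣ :=
  (hilb (Units.map (ι v).toMonoidHom a)).comp (Units.map (ι v).toMonoidHom)

theorem hilAt_eq_one_iff {v : Place K} {a c : Kˣ} : hilAt v a c = 1 ↔ NrmAt v a c := hilb_eq_one_iff

theorem hilAt_eq_neg_one_iff {v : Place K} {a c : Kˣ} : hilAt v a c = -1 ↔ ¬ NrmAt v a c := by
  rw [← hilAt_eq_one_iff]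
  rcases Int.units_eq_one_or (hilAt v a c) with h | h <;> simp [h]

theorem Bad.transfer {v : Place K} (h : Bad v) {b : Kˣ} (hb : ¬ SqAt v b) :
    ∃ c : Kˣ, ∀ w, NrmAt w b c ↔ w ≠ v := by
  obtain ⟨a, c, hac⟩ := h
  have hw : ∀ i, (![(a : K), c, -(a * c)] : Fin 3 → K) i ≠ 0 := by
    intro i; fin_cases i <;> simp
  have hb0 : (-b : K) ≠ 0 := neg_ne_zero.2 b.ne_zero
  have hiso : Diag.Iso (Fin.cons (-b : K) ![(a : K), c, -(a * c)] : Fin (0 + 4) → K) := by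
    refine iso_of_forall (Diag.cons_ne_zero.2 ⟨hb0, hw⟩) fun u => ?_
    by_cases hu : u = v
    · subst hu
      refine Diag.iso_four (fun i => (_root_.map_ne_zero _).2 (Diag.cons_ne_zero.2 ⟨hb0, hw⟩ i))
        fun hsq => hb ?_
      refine isSquare_of_mul_sq (y := ι u ((a : K) * c)) (by simp) ?_
      rw [Fin.prod_univ_four] at hsq
      convert hsq using 1
      simp [Fin.cons]; ring
    · rw [Diag.comp_cons]
      refine Diag.iso_of_cons (Diag.iso_of_isNrm (n := 0) (fun i => (_root_.map_ne_zero _).2 (hw i)) ?_)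
      have h1 := (isNrm_comm (ι_ne_zero u a) (ι_ne_zero u c)).1 ((hac u).2 hu)
      have h3 : IsNrm (ι u (c : K)) (ι u (-(a * c) : K)) := by
        rw [show (-(a * c) : K) = a * -c by ring, map_mul, map_neg]
        exact h1.mul (isNrm_neg_self _)
      rw [isNrm_comm (ι_ne_zero u c) (by simp)] at h3
      have := IsNrm.mul (isNrm_sq (ι u (-(a * c) : K)) (ι u (a : K))) h3
      simpa [mul_comm, mul_assoc, pow_two, mul_left_comm] using this
  rw [Diag.iso_cons_iff hb0 hw, neg_neg] at hiso
  obtain ⟨x, hx⟩ := hiso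
  simp only [Diag.dq, Fin.sum_univ_three, Matrix.cons_val_zero, Matrix.cons_val_one,
    Matrix.cons_val_two, Matrix.tail_cons, Matrix.head_cons, Matrix.cons_val] at hx
  have haK : ¬ IsSquare (a : K) := fun h => by
    have := (hac v).1 (SqAt.nrmAt (h.map (ι v)) c)
    exact this rfl
  by_cases hN : x 1 ^ 2 - a * x 2 ^ 2 = 0
  · have h2 : x 2 = 0 := by
      by_contra h2
      exact haK (isSquare_of_mul_sq h2 ⟨x 1, by linear_combination -hN⟩)
    have h1 : x 1 = 0 := by simpa [h2] using hN
    have hx0 : x 0 ≠ 0 := fun h0 => b.ne_zero (by rw [← hx, h0, h1, h2]; ring)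
    have hb' : (b : K) = a * x 0 ^ 2 := by rw [← hx, h1, h2]; ring
    refine ⟨c, fun w => ?_⟩
    rw [← hac w, NrmAt, NrmAt, hb', map_mul, map_pow,
      isNrm_mul_sq_left ((_root_.map_ne_zero _).2 hx0)]
  · have hm : (c : K) * (x 1 ^ 2 - a * x 2 ^ 2) ≠ 0 := mul_ne_zero c.ne_zero hN
    refine ⟨-(a * Units.mk0 _ hm), fun w => ?_⟩
    rw [← hac w, NrmAt, NrmAt]
    have := isNrm_iff_of_rep (a := ι w (a : K)) (b := ι w (b : K)) (c := ι w (c : K))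
      (x := ι w (x 0)) (m := ι w (c * (x 1 ^ 2 - a * x 2 ^ 2)))
      (N := ι w (x 1 ^ 2 - a * x 2 ^ 2)) (ι_ne_zero w a) (ι_ne_zero w b) (ι_ne_zero w c)
      ((_root_.map_ne_zero _).2 hm) (IsNrm.map _ ⟨x 1, x 2, rfl⟩) ((_root_.map_ne_zero _).2 hN)
      (map_mul _ _ _) (by
        rw [← map_pow, ← map_mul, ← map_sub]
        congr 1
        linear_combination hx)
    rw [this]
    simp

theorem exists_prod_hilAt {S : Finset (Place K)} (hS : Adm S) {a : Kˣ} (ha : ¬ IsSquare (a : K))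
    (haS : a ∈ sUnits S) : ∃ R ⊆ S, R.Nonempty ∧ (∀ v ∈ R, ¬ SqAt v a) ∧
      ∀ c ∈ sUnits S, ∏ v ∈ R, hilAt v a c = 1 := by
  classical
  obtain ⟨T, hT, hTc⟩ := finite_pattern hS ha haS
  let φ : Kˣ →* (nonsplit (a : K) S → ℤˣ) := MonoidHom.pi fun v => hilAt v.1 a
  have hH : (sUnits S).map φ ≠ ⊤ := fun htop => by
    obtain ⟨c, hc, hφ⟩ : (fun v : nonsplit (a : K) S => if v.1 ∈ T then (-1 : ℤˣ) else 1) ∈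
      (sUnits S).map φ := htop ▸ Subgroup.mem_top _
    refine hTc c hc fun v hv => ?_
    have h1 : hilAt v a c = if v ∈ T then -1 else 1 := congrFun hφ ⟨v, hv⟩
    rw [← hilAt_eq_one_iff, h1]
    split_ifs with h <;> simp [h]
  obtain ⟨R, hR, hR1⟩ := exists_prod_eq_one hH
  refine ⟨R.map ⟨Subtype.val, Subtype.val_injective⟩, fun v hv => ?_, hR.map, fun v hv => ?_,
    fun c hc => ?_⟩
  · obtain ⟨w, -, rfl⟩ := Finset.mem_map.1 hv
    exact (mem_nonsplit.1 w.2).1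
  · obtain ⟨w, -, rfl⟩ := Finset.mem_map.1 hv
    exact (mem_nonsplit.1 w.2).2
  · rw [Finset.prod_map]
    exact hR1 _ ⟨c, hc, rfl⟩

theorem exists_pair {a : Kˣ} (ha : ¬ IsSquare (a : K)) {v w : Place K} (hv : ¬ SqAt v a)
    (hw : ¬ SqAt w a) (hbv : ¬ Bad v) (hbw : ¬ Bad w) :
    ∃ c : Kˣ, ∀ u, NrmAt u a c ↔ (u ≠ v ↔ u ≠ w) := by
  rcases realized_or a ha {v} {w} (by simpa using hv) (by simpa using hw) with
    ⟨c, hc⟩ | ⟨c, hc⟩ | ⟨c, hc⟩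
  · exact absurd ⟨a, c, by simpa using hc⟩ hbv
  · exact absurd ⟨a, c, by simpa using hc⟩ hbw
  · exact ⟨c, by simpa using hc⟩

theorem prod_hilAt_of_forall {R : Finset (Place K)} {a c : Kˣ} {P : Place K → Prop}
    [DecidablePred P] (h : ∀ u ∈ R, NrmAt u a c ↔ ¬ P u) :
    ∏ v ∈ R, hilAt v a c = (-1) ^ (R.filter P).card := by
  rw [← Finset.prod_const, Finset.prod_filter]
  refine Finset.prod_congr rfl fun v hv => ?_
  split_ifs with hp
  · rw [hilAt_eq_neg_one_iff, h v hv]; simpa using hp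
  · rw [hilAt_eq_one_iff, h v hv]; exact hp

theorem prod_hilAt_good {S : Finset (Place K)} (hS : Adm S) {a : Kˣ} (ha : ¬ IsSquare (a : K))
    (haS : a ∈ sUnits S) : (∃ v ∈ S, ¬ Bad v ∧ ¬ SqAt v a) ∧
      ∀ c ∈ sUnits S, ∀ G : Finset (Place K), (∀ v, v ∈ G ↔ v ∈ S ∧ ¬ Bad v) →
        ∏ v ∈ G, hilAt v a c = 1 := by
  classical
  let c₁ : Place K → Kˣ := fun v => if h : ∃ c : Kˣ, ∀ w, NrmAt w a c ↔ w ≠ v then h.choose else 1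
  have hc₁ : ∀ v, Bad v → ¬ SqAt v a → ∀ w, NrmAt w a (c₁ v) ↔ w ≠ v := fun v hb hs => by
    have h := hb.transfer hs
    simp only [c₁, dif_pos h]
    exact h.choose_spec
  let c₂ : Place K × Place K → Kˣ := fun q =>
    if h : ∃ c : Kˣ, ∀ u, NrmAt u a c ↔ (u ≠ q.1 ↔ u ≠ q.2) then h.choose else 1
  have hc₂ : ∀ v w, ¬ Bad v → ¬ Bad w → ¬ SqAt v a → ¬ SqAt w a →
      ∀ u, NrmAt u a (c₂ (v, w)) ↔ (u ≠ v ↔ u ≠ w) := fun v w hv hw hsv hsw => by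
    have h := exists_pair ha hsv hsw hv hw
    simp only [c₂, dif_pos h]
    exact h.choose_spec
  obtain ⟨S₁, hSS₁, hS₁, hA⟩ := exists_adm_mem S (S.image c₁ ∪ (S ×ˢ S).image c₂)
  obtain ⟨R, hRS, ⟨r, hr⟩, hRsq, hR⟩ := exists_prod_hilAt hS₁ ha (sUnits_mono hSS₁ haS)
  have hbad : ∀ v ∈ S, v ∈ R → ¬ Bad v := fun v hvS hvR hb => by
    have h1 := hR (c₁ v) (hA _ (Finset.mem_union_left _ (Finset.mem_image_of_mem _ hvS)))
    rw [prod_hilAt_of_forall (P := fun u => u = v) (fun u hu => hc₁ v hb (hRsq v hvR) u),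
      Finset.filter_eq' R v, if_pos hvR] at h1
    simp at h1
  have hgood : ∀ v ∈ S, v ∈ R → ∀ w ∈ S, ¬ Bad w → ¬ SqAt w a → w ∈ R :=
    fun v hvS hvR w hwS hbw hsw => by
    by_contra hwR
    have h1 := hR (c₂ (v, w)) (hA _ (Finset.mem_union_right _ (Finset.mem_image_of_mem _
      (Finset.mk_mem_product hvS hwS))))
    have hne : ∀ u ∈ R, u ≠ w := fun u hu h => hwR (h ▸ hu)
    rw [prod_hilAt_of_forall (P := fun u => u = v) (fun u hu => by
      rw [hc₂ v w (hbad v hvS hvR) hbw (hRsq v hvR) hsw u]; simp [hne u hu]),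
      Finset.filter_eq' R v, if_pos hvR] at h1
    simp at h1
  obtain ⟨s, hsS, hsR⟩ : ∃ s ∈ S, s ∈ R := by
    by_contra! hdis
    rcases r with r | p
    · exact hdis _ (hS.inl_mem r) hr
    obtain ⟨u, hu, hu'⟩ := hS.unif p fun h => hdis _ h hr
    have hord : ∀ q, Sum.inr q ∉ S → ord q a = 0 := fun q hq =>
      (ord_eq_zero_iff q a).2 (mem_sUnits.1 haS _ hq)
    have h1 := hR u (mem_sUnits.2 fun v hv => by
      rcases v with v | q
      · exact absurd (hS₁.inl_mem v) hv
      · refine (ord_eq_zero_iff q u).1 (hu' q (fun h => hv (hSS₁ h)) ?_)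
        rintro rfl
        exact hv (hRS hr))
    rw [prod_hilAt_of_forall (P := fun v => v = Sum.inr p) (fun v hv => by
      rcases v with v | q
      · exact absurd hv (hdis _ (hS.inl_mem v))
      · have hq : Sum.inr q ∉ S := fun h => hdis _ h hv
        rw [NrmAt, tame_ord q (hS.two _ hq) (by simp [hord q hq]) (hRsq _ hv) u, Sum.inr.injEq]
        by_cases hqp : q = p
        · subst hqp; simp [hu]
        · simp [hqp, hu' q hq hqp]),
      Finset.filter_eq' R (Sum.inr p), if_pos hr] at h1
    simp at h1
  refine ⟨⟨s, hsS, hbad s hsS hsR, hRsq s hsR⟩, fun c hc G hG => ?_⟩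
  have h1 := hR c (sUnits_mono hSS₁ hc)
  rw [← Finset.prod_subset (s₁ := R ∩ G) Finset.inter_subset_left fun v hv hv' => by
    rw [hilAt_eq_one_iff]
    by_cases hvS : v ∈ S
    · exact absurd (Finset.mem_inter.2 ⟨hv, (hG v).2 ⟨hvS, hbad v hvS hv⟩⟩) hv'
    · exact hS.nrmAt haS hc hvS] at h1
  rw [← h1]
  refine (Finset.prod_subset Finset.inter_subset_right fun v hv hv' => ?_).symm
  rw [hilAt_eq_one_iff]
  obtain ⟨hvS, hvb⟩ := (hG v).1 hv
  by_cases hsq : SqAt v a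
  · exact hsq.nrmAt c
  · exact absurd (Finset.mem_inter.2 ⟨hgood s hsS hsR v hvS hvb hsq, hv⟩) hv'

theorem isHilbert_hilb_mul {F : Type*} [Field F] [IsHilbertField F] [NeZero (2 : F)] (a b c : Fˣ) :
    hilb (a * b) c = hilb a c * hilb b c := by
  rw [hilb_comm, map_mul, hilb_comm c a, hilb_comm c b]

theorem exists_hilb_pairing {κ : Type*} [Fintype κ] (F : κ → Type*) [∀ i, Field (F i)]
    [∀ i, IsHilbertField (F i)] [∀ i, NeZero (2 : F i)] :
    ∃ β : (∀ i, (F i)ˣ) →* (∀ i, (F i)ˣ) →* ℤˣ, ∀ x y, β x y = ∏ i, hilb (x i) (y i) :=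
  ⟨MonoidHom.mk' (fun x => MonoidHom.mk' (fun y => ∏ v, hilb (x v) (y v))
      fun y z => by simp only [Pi.mul_apply, map_mul, Finset.prod_mul_distrib]) fun x y =>
        MonoidHom.ext fun z => by
          simp only [MonoidHom.mk'_apply, MonoidHom.mul_apply, Pi.mul_apply, isHilbert_hilb_mul,
            Finset.prod_mul_distrib], fun _ _ => rfl⟩

theorem mem_sqGroup_pi {κ : Type*} {F : κ → Type*} [∀ i, Field (F i)] {x : ∀ i, (F i)ˣ} :
    x ∈ sqGroup (∀ i, (F i)ˣ) ↔ ∀ i, IsSquare (x i : F i) := by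
  rw [sqGroup_pi]
  simp only [Subgroup.mem_pi, Set.mem_univ, forall_true_left, mem_sqGroup_units]

/-- There is no quaternion algebra ramified at exactly one place. -/
theorem not_bad (v₀ : Place K) : ¬ Bad v₀ := by
  classical
  intro hv₀
  obtain ⟨S, hS₀, hS, -⟩ := exists_adm_mem {v₀} (∅ : Finset Kˣ)
  have hv₀S : v₀ ∈ S := hS₀ (by simp)
  let G := S.filter fun v => ¬ Bad v
  have hG : ∀ v, v ∈ G ↔ v ∈ S ∧ ¬ Bad v := fun v => Finset.mem_filter
  obtain ⟨β, hβ⟩ := exists_hilb_pairing fun v : G => L v.1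
  let N := sqGroup (∀ v : G, (L v.1)ˣ)
  have hNi : N.index = ∏ v ∈ G, (sqGroup (L v)ˣ).index := by
    rw [show N = _ from sqGroup_pi, index_pi_univ]
    exact Finset.prod_coe_sort G fun v => (sqGroup (L v)ˣ).index
  have hprod := prod_sqGroup_index S hS.two
  rw [← Finset.prod_filter_mul_prod_filter_not S (fun v => ¬ Bad v)] at hprod
  change (∏ v ∈ G, _) * _ = _ at hprod
  rw [← hNi] at hprod
  have hpos : ∀ v ∈ S, (sqGroup (L v)ˣ).index ≠ 0 := fun v hv h => by
    have h1 := prod_sqGroup_index S hS.two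
    rw [Finset.prod_eq_zero hv h] at h1
    exact absurd h1.symm (by positivity)
  have hN0 : N.index ≠ 0 := fun h => by
    rw [h, zero_mul] at hprod
    exact absurd hprod.symm (by positivity)
  let φ : sUnits S →* (∀ v : G, (L v.1)ˣ) := (MonoidHom.pi fun v : G => Units.map (ι v.1).toMonoidHom).comp
    (sUnits S).subtype
  have hφ : ∀ x v, ((φ x v : (L v.1)ˣ) : L v.1) = ι v.1 ((x : Kˣ) : K) := fun _ _ => rfl
  have hcomap : N.comap φ = sqGroup (sUnits S) := by
    ext x
    rw [Subgroup.mem_comap, mem_sqGroup_sUnits, show φ x ∈ N ↔ _ from mem_sqGroup_pi]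
    refine ⟨fun h => ?_, fun h v => h.map (ι v.1)⟩
    by_contra hx
    obtain ⟨⟨v, hvS, hvb, hv⟩, -⟩ := prod_hilAt_good hS hx x.2
    exact hv (h ⟨v, (hG v).2 ⟨hvS, hvb⟩⟩)
  have hcard : N.relIndex (φ.range ⊔ N) = 2 ^ S.card := by
    rw [Subgroup.relIndex_sup_right, ← Subgroup.index_comap, hcomap,
      sqGroup_index_sUnits S hS.inl_mem]
  have hker : ∀ x, (∀ y, β x y = 1) → x ∈ N := fun x hx => by
    refine mem_sqGroup_pi.2 fun v => ?_
    by_contra hsq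
    obtain ⟨c, hc0, hc⟩ := exists_not_isNrm v.1 (x v).ne_zero hsq
    refine hc ?_
    have h1 := hx (Pi.mulSingle v (Units.mk0 c hc0))
    rw [hβ, Finset.prod_eq_single v (fun w _ hw => by rw [Pi.mulSingle_eq_of_ne hw, map_one])
      (by simp), Pi.mulSingle_eq_same] at h1
    exact hilb_eq_one_iff.1 h1
  have hN2 : ∀ x ∈ N, ∀ y, β x y = 1 ∧ β y x = 1 := by
    intro x hx y
    obtain ⟨z, rfl⟩ := mem_sqGroup.1 hx
    have : ∀ u : ℤˣ, u ^ 2 = 1 := fun u => by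
      rcases Int.units_eq_one_or u with rfl | rfl <;> simp
    exact ⟨by rw [map_pow, MonoidHom.pow_apply, this], by rw [map_pow, this]⟩
  have hisot : ∀ x ∈ φ.range ⊔ N, ∀ y ∈ φ.range ⊔ N, β x y = 1 := by
    intro x hx y hy
    obtain ⟨_, ⟨x, rfl⟩, x', hx', rfl⟩ := Subgroup.mem_sup.1 hx
    obtain ⟨_, ⟨y, rfl⟩, y', hy', rfl⟩ := Subgroup.mem_sup.1 hy
    rw [map_mul β, MonoidHom.mul_apply, (hN2 x' hx' _).1, mul_one, map_mul, (hN2 y' hy' _).2,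
      mul_one, hβ]
    change ∏ v : G, hilAt v.1 (x : Kˣ) (y : Kˣ) = 1
    rw [Finset.prod_coe_sort G fun v => hilAt v (x : Kˣ) (y : Kˣ)]
    by_cases hsq : IsSquare ((x : Kˣ) : K)
    · exact Finset.prod_eq_one fun v _ => hilAt_eq_one_iff.2 (SqAt.nrmAt (hsq.map (ι v)) _)
    · exact (prod_hilAt_good hS hsq x.2).2 y y.2 G hG
  have hle := relIndex_sq_le β hN0 le_sup_right hker hisot
  rw [hcard, ← mul_pow] at hle
  have hbad : 2 ≤ ∏ v ∈ S.filter (fun v => ¬ ¬ Bad v), (sqGroup (L v)ˣ).index := by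
    have hmem : v₀ ∈ S.filter (fun v => ¬ ¬ Bad v) := Finset.mem_filter.2 ⟨hv₀S, not_not.2 hv₀⟩
    have h2 : 2 ≤ (sqGroup (L v₀)ˣ).index := by
      have h1 : (sqGroup (L v₀)ˣ).index ≠ 1 := fun h => by
        obtain ⟨a, c, hac⟩ := hv₀
        have : Units.map (ι v₀).toMonoidHom a ∈ sqGroup (L v₀)ˣ := by
          rw [Subgroup.index_eq_one.1 h]; exact Subgroup.mem_top _
        rw [mem_sqGroup_units] at this
        exact (hac v₀).1 (SqAt.nrmAt this c) rfl
      have := hpos v₀ hv₀S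
      omega
    refine h2.trans (Nat.le_of_dvd (Nat.pos_of_ne_zero (Finset.prod_ne_zero_iff.2 fun v hv =>
      hpos v (Finset.mem_filter.1 hv).1)) (Finset.dvd_prod_of_mem _ hmem))
  have : N.index * 2 ≤ N.index := by
    calc N.index * 2 ≤ N.index * _ := Nat.mul_le_mul_left _ hbad
      _ = 4 ^ S.card := hprod
      _ ≤ _ := by simpa using hle
  omega

end Place

namespace Place
variable {K : Type*} [Field K] [NumberField K]
open Diag

theorem exists_forall_ne {a : Kˣ} {v₀ : Place K} (hv₀ : ¬ SqAt v₀ a) (T : Finset (Place K))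
    (hT : ∀ v ∈ T, ¬ SqAt v a) : ∃ c : Kˣ, ∀ v ≠ v₀, NrmAt v a c ↔ v ∉ T := by
  classical
  have ha : ¬ IsSquare (a : K) := fun h => hv₀ (h.map (ι v₀))
  induction T using Finset.induction_on with
  | empty => exact ⟨1, fun v _ => by simpa [NrmAt] using isNrm_one (ι v (a : K))⟩
  | insert w T hw ih =>
    obtain ⟨c, hc⟩ := ih fun v hv => hT v (Finset.mem_insert_of_mem hv)
    obtain ⟨d, hd⟩ := exists_pair ha hv₀ (hT w (Finset.mem_insert_self _ _)) (not_bad _) (not_bad _)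
    refine ⟨c * d, fun v hv => ?_⟩
    have h1 := hc v hv
    have h2 := hd v
    rw [NrmAt, Units.val_mul, map_mul, isNrm_mul_iff (ι_ne_zero v a) (ι_ne_zero v c)
      (ι_ne_zero v d)]
    by_cases hvw : v = w
    · subst hvw; simp [h1, h2, hv, hw]
    · simp [h1, h2, hv, hvw]

theorem nrmAt_of_forall_ne {v₀ : Place K} {a c : Kˣ} (h : ∀ v ≠ v₀, NrmAt v a c) :
    NrmAt v₀ a c := by
  by_contra h0
  refine not_bad v₀ ⟨a, c, fun w => ⟨?_, h w⟩⟩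
  rintro hw rfl
  exact h0 hw

theorem big_inr (p : HeightOneSpectrum (𝓞 K)) : Big (L (Sum.inr p : Place K)) := by
  refine big_of_index ?_
  have h := sqGroup_index_inr p
  have h2 : abv (Sum.inr p : Place K) 2 ≤ 1 := by
    rw [abv_inr_le_one_iff]
    exact_mod_cast p.valuation_le_one (2 : 𝓞 K)
  have h3 : (4 : ℝ) ≤ ((sqGroup (p.adicCompletion K)ˣ).index : ℝ) := by
    rw [← h]
    exact mul_le_of_le_one_right (Nat.cast_nonneg _) h2
  exact_mod_cast h3

theorem det_of_forall_ne (v₀ : Place K) {n : ℕ} {w w' : Fin n → K} (hw : ∀ i, w i ≠ 0)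
    (hw' : ∀ i, w' i ≠ 0) (h : ∀ v ≠ v₀, Cong (ι v ∘ w) (ι v ∘ w')) :
    IsSquare ((∏ i, w i) * ∏ i, w' i) := by
  have h0 : (∏ i, w i) * ∏ i, w' i ≠ 0 :=
    mul_ne_zero (Finset.prod_ne_zero_iff.2 fun i _ => hw i)
      (Finset.prod_ne_zero_iff.2 fun i _ => hw' i)
  refine isSquare_of_forall_sqAt (Units.mk0 _ h0) {v₀} fun v hv => ?_
  have := (h v (by simpa using hv)).isSquare_det
  simpa [SqAt] using this

/-- Two quadratic forms which are isometric at all places but one are isometric. -/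
theorem cong_of_forall_ne (p : HeightOneSpectrum (𝓞 K)) : ∀ {n : ℕ} {w w' : Fin n → K},
    (∀ i, w i ≠ 0) → (∀ i, w' i ≠ 0) → (∀ v ≠ Sum.inr p, Cong (ι v ∘ w) (ι v ∘ w')) →
    Cong w w' := by
  intro n
  induction n with
  | zero => exact fun _ _ _ => ⟨0, fun x => by simp [dq]⟩
  | succ n ih =>
    intro w w' hw hw' h
    have hdet := det_of_forall_ne _ hw hw' h
    rcases n with _ | _ | m
    · exact cong_one hw hw' hdet
    · refine cong_two hw hw' hdet ?_
      let a : Kˣ := Units.mk0 (-(w 0 * w 1)) (by simp [hw])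
      let c : Kˣ := Units.mk0 (w 0 * w' 0) (by simp [hw, hw'])
      have hac : ∀ v ≠ Sum.inr p, NrmAt v a c := fun v hv => by
        have h1 := Cong.isNrm_two (by simpa using hw) ((h v hv).symm (by simpa using hw))
        simpa [NrmAt, a, c] using h1
      refine isNrm_of_forall_nrmAt a c fun v => ?_
      by_cases hv : v = Sum.inr p
      · subst hv; exact nrmAt_of_forall_ne hac
      · exact hac v hv
    · have hn : ∀ v : Place K, ∀ i, (ι v ∘ w) i ≠ 0 := fun v => by simpa using hw
      have hn' : ∀ v : Place K, ∀ i, (ι v ∘ w') i ≠ 0 := fun v => by simpa using hw'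
      let D : ∀ v : Place K, L v := fun v => -((ι v ∘ w') 0 * (ι v ∘ w') 1 * (ι v ∘ w') 2)
      have hloc : ∀ v : Place K, ∃ c : L v, c ≠ 0 ∧ Rep (ι v ∘ w) c ∧
          (v = Sum.inr p → ¬ IsSquare (D v * c)) := fun v => by
        by_cases hv : v = Sum.inr p
        · have hb : Big (L v) := hv ▸ big_inr p
          obtain ⟨c, hc, h1, h2, -⟩ := hb (-((ι v ∘ w) 0 * (ι v ∘ w) 1 * (ι v ∘ w) 2)) (D v) 1
            (neg_ne_zero.2 (mul_ne_zero (mul_ne_zero (hn v 0) (hn v 1)) (hn v 2)))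
            (neg_ne_zero.2 (mul_ne_zero (mul_ne_zero (hn' v 0) (hn' v 1)) (hn' v 2))) one_ne_zero
          exact ⟨c, hc, rep_of_three (n := m) (hn v) hc h1, fun _ => h2⟩
        · refine ⟨ι v (w 0), hn v 0, ⟨Pi.single 0 1, ?_⟩, fun h => absurd h hv⟩
          rw [← db_self, db_single_left]
          simp
      choose c hc hrep hD using hloc
      choose y hy using hrep
      obtain ⟨x, hx⟩ := weak_approx (n := Fin (m + 3)) {Sum.inr p}
        (fun v => (fun t => c v * dq (ι v ∘ w) t) ⁻¹' {x | x ≠ 0 ∧ IsSquare x})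
        (fun v _ => (isOpen_sq v).preimage (by unfold dq; fun_prop))
        (fun v _ => ⟨y v, by
          simp only [Set.mem_preimage, Set.mem_ofPred_eq, hy]
          exact ⟨mul_ne_zero (hc v) (hc v), c v, rfl⟩⟩)
      have hx' := hx _ (Finset.mem_singleton_self _)
      simp only [Set.mem_preimage, Set.mem_ofPred_eq] at hx'
      change _ * dq (_ ∘ w) (_ ∘ x) ≠ 0 ∧ IsSquare (_ * dq (_ ∘ w) (_ ∘ x)) at hx'
      rw [dq_map] at hx'
      obtain ⟨hne, hsq⟩ := hx'
      have he0 : dq w x ≠ 0 := fun h0 => hne (by rw [h0, map_zero, mul_zero])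
      have hI : Iso (Fin.cons (-dq w x) w' : Fin (m + 4) → K) := by
        refine iso_of_forall (cons_ne_zero.2 ⟨neg_ne_zero.2 he0, hw'⟩) fun v => ?_
        rw [comp_cons, iso_cons_iff (by simpa using he0) (by simpa using hw'), map_neg, neg_neg]
        by_cases hv : v = Sum.inr p
        · subst hv
          refine rep_of_three (n := m) (hn' _) (by simpa using he0) fun hs => ?_
          refine hD _ rfl (isSquare_mul_trans (y := ι (Sum.inr p) (dq w x)) (by simpa using he0)
            hs ?_)
          rwa [mul_comm]
        · refine (h v hv).rep ⟨ι v ∘ x, dq_map _ _ _⟩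
      rw [iso_cons_iff (neg_ne_zero.2 he0) hw', neg_neg] at hI
      obtain ⟨z, z', hz, hz', hwz, hwz', -, hcong⟩ := cong_of_common hw hw' he0 ⟨x, rfl⟩ hI
      refine hcong (ih hz hz' fun v hv => ?_)
      have h1 := hwz.map (ι v)
      have h2 := hwz'.map (ι v)
      rw [comp_cons] at h1 h2
      refine Cong.cancel (a := ι v (dq w x)) (by simpa using he0) ((h1.trans (h v hv)).trans ?_)
      refine h2.symm ?_
      rw [cons_ne_zero]
      exact ⟨by simpa using he0, by simpa using hz'⟩

end Place

section

open Matrix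

theorem Matrix.det_blockDiagonal'_eq_prod {R : Type*} [CommRing R] {ω : Type*} [Fintype ω]
    [DecidableEq ω] {d : ω → Type*} [∀ i, Fintype (d i)] [∀ i, DecidableEq (d i)]
    (M : ∀ i, Matrix (d i) (d i) R) : (blockDiagonal' M).det = ∏ i, (M i).det := by
  letI : LinearOrder ω := LinearOrder.lift' (Fintype.equivFin ω) (Fintype.equivFin ω).injective
  rw [(blockTriangular_blockDiagonal' M).det_fintype]
  refine Finset.prod_congr rfl fun k _ => ?_
  let e : d k ≃ {x : Σ i, d i // x.1 = k} :=
    { toFun := fun x => ⟨⟨k, x⟩, rfl⟩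
      invFun := fun x => x.2 ▸ x.1.2
      left_inv := fun x => rfl
      right_inv := by rintro ⟨⟨i, x⟩, rfl⟩; rfl }
  rw [← Matrix.det_submatrix_equiv_self e]
  convert rfl
  ext x y
  simp [e, Matrix.toSquareBlock, Matrix.toSquareBlockProp]

section Congruence
variable {F : Type*} [Field F] {m n l : Type*} [Fintype m] [Fintype n] [Fintype l]
  [DecidableEq m] [DecidableEq n] [DecidableEq l]

/-- Congruence of square matrices, i.e. isometry of the corresponding bilinear forms. -/
def MC (M : Matrix m m F) (N : Matrix n n F) : Prop :=
  ∃ (P : Matrix m n F) (Q : Matrix n m F), P * Q = 1 ∧ Q * P = 1 ∧ P * N * Pᵀ = M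

namespace MC

theorem refl (M : Matrix m m F) : MC M M := ⟨1, 1, by simp, by simp, by simp⟩

theorem symm {M : Matrix m m F} {N : Matrix n n F} : MC M N → MC N M := by
  rintro ⟨P, Q, h1, h2, rfl⟩
  refine ⟨Q, P, h2, h1, ?_⟩
  calc Q * (P * N * Pᵀ) * Qᵀ = (Q * P) * N * (Q * P)ᵀ := by
        simp only [Matrix.transpose_mul, Matrix.mul_assoc]
    _ = N := by simp [h2]

theorem trans {M : Matrix m m F} {N : Matrix n n F} {L : Matrix l l F} :
    MC M N → MC N L → MC M L := by
  rintro ⟨P, Q, h1, h2, rfl⟩ ⟨P', Q', h1', h2', rfl⟩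
  refine ⟨P * P', Q' * Q, ?_, ?_, ?_⟩
  · rw [Matrix.mul_assoc, ← Matrix.mul_assoc P', h1', Matrix.one_mul, h1]
  · rw [Matrix.mul_assoc, ← Matrix.mul_assoc Q, h2, Matrix.one_mul, h2']
  · simp only [Matrix.transpose_mul, Matrix.mul_assoc]

theorem map {F' : Type*} [Field F'] (φ : F →+* F') {M : Matrix m m F} {N : Matrix n n F} :
    MC M N → MC (M.map φ) (N.map φ) := by
  rintro ⟨P, Q, h1, h2, rfl⟩
  refine ⟨P.map φ, Q.map φ, ?_, ?_, ?_⟩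
  · rw [← Matrix.map_mul, h1, Matrix.map_one _ φ.map_zero φ.map_one]
  · rw [← Matrix.map_mul, h2, Matrix.map_one _ φ.map_zero φ.map_one]
  · rw [Matrix.map_mul, Matrix.map_mul, Matrix.transpose_map]

theorem of_mul {M N P : Matrix m m F} (h : P * N * Pᵀ = M) (hM : M.det ≠ 0) : MC M N := by
  have hP : IsUnit P.det := by
    rw [isUnit_iff_ne_zero]
    rintro h0
    rw [← h, Matrix.det_mul, Matrix.det_mul, h0] at hM
    simp at hM
  exact ⟨P, P⁻¹, Matrix.mul_nonsing_inv _ hP, Matrix.nonsing_inv_mul _ hP, h⟩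

theorem submatrix (N : Matrix n n F) (e : m ≃ n) : MC (N.submatrix e e) N := by
  refine ⟨(1 : Matrix n n F).submatrix e id, (1 : Matrix n n F).submatrix id e, ?_, ?_, ?_⟩
  · rw [← Matrix.submatrix_mul _ _ _ _ _ Function.bijective_id]; simp
  · rw [← Matrix.submatrix_mul _ _ _ _ _ e.bijective]; simp
  · ext i j
    simp [Matrix.mul_apply, Matrix.one_apply, Matrix.submatrix_apply]

theorem isSquare_det {M N : Matrix m m F} : MC M N → IsSquare (M.det * N.det) := by
  rintro ⟨P, Q, -, -, rfl⟩
  exact ⟨P.det * N.det, by rw [Matrix.det_mul, Matrix.det_mul, Matrix.det_transpose]; ring⟩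

theorem det_ne_zero {M N : Matrix m m F} : MC M N → M.det ≠ 0 → N.det ≠ 0 := by
  rintro ⟨P, Q, -, -, rfl⟩ h h0
  simp [Matrix.det_mul, h0] at h

theorem fromBlocks {A : Matrix m m F} {A' : Matrix n n F} {m' n' : Type*} [Fintype m']
    [Fintype n'] [DecidableEq m'] [DecidableEq n'] {D : Matrix m' m' F} {D' : Matrix n' n' F} :
    MC A A' → MC D D' → MC (fromBlocks A 0 0 D) (fromBlocks A' 0 0 D') := by
  rintro ⟨P, Q, h1, h2, rfl⟩ ⟨P', Q', h1', h2', rfl⟩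
  refine ⟨Matrix.fromBlocks P 0 0 P', Matrix.fromBlocks Q 0 0 Q', ?_, ?_, ?_⟩
  · simp [Matrix.fromBlocks_multiply, h1, h1']
  · simp [Matrix.fromBlocks_multiply, h2, h2']
  · simp [Matrix.fromBlocks_multiply, Matrix.fromBlocks_transpose]

theorem blockDiagonal' {ω : Type*} [Fintype ω] [DecidableEq ω] {d : ω → Type*}
    [∀ i, Fintype (d i)] [∀ i, DecidableEq (d i)] {M N : ∀ i, Matrix (d i) (d i) F}
    (h : ∀ i, MC (M i) (N i)) : MC (blockDiagonal' M) (blockDiagonal' N) := by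
  choose P Q h1 h2 h3 using h
  refine ⟨Matrix.blockDiagonal' P, Matrix.blockDiagonal' Q, ?_, ?_, ?_⟩
  · rw [← Matrix.blockDiagonal'_mul, funext h1]; exact Matrix.blockDiagonal'_one
  · rw [← Matrix.blockDiagonal'_mul, funext h2]; exact Matrix.blockDiagonal'_one
  · rw [← Matrix.blockDiagonal'_mul, Matrix.blockDiagonal'_transpose, ← Matrix.blockDiagonal'_mul,
      funext h3]

end MC

theorem mc_diagonal_iff [NeZero (2 : F)] {n : ℕ} {w w' : Fin n → F} (hw : ∀ i, w i ≠ 0) :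
    MC (diagonal w) (diagonal w') ↔ Diag.Cong w w' := by
  have key : ∀ u : Matrix (Fin n) (Fin n) F, ∀ i j,
      (u * diagonal w' * uᵀ) i j = Diag.db w' (u i) (u j) := by
    intro u i j
    rw [Matrix.mul_apply]
    simp only [Matrix.mul_diagonal, Matrix.transpose_apply, Diag.db]
    exact Finset.sum_congr rfl fun k _ => by ring
  rw [Diag.cong_iff]
  constructor
  · rintro ⟨P, Q, -, -, h⟩
    exact ⟨P, fun i j => by rw [← key, h, diagonal_apply]⟩
  · rintro ⟨u, hu⟩
    refine MC.of_mul (P := Matrix.of u) ?_ ?_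
    · ext i j; rw [key, diagonal_apply]; exact hu i j
    · rw [det_diagonal]; exact Finset.prod_ne_zero_iff.2 fun i _ => hw i

theorem exists_mc_diagonal [NeZero (2 : F)] (M : Matrix m m F) (hM : M.IsSymm) (hd : M.det ≠ 0) :
    ∃ w : Fin (Fintype.card m) → F, (∀ i, w i ≠ 0) ∧ MC M (diagonal w) := by
  have : Invertible (2 : F) := invertibleOfNonzero (NeZero.ne 2)
  obtain ⟨v, hv⟩ := LinearMap.BilinForm.exists_orthogonal_basis (B := Matrix.toBilin' M)
    ⟨fun x y => by
      simp only [Matrix.toBilin'_apply']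
      rw [Matrix.dotProduct_mulVec, dotProduct_comm, ← Matrix.mulVec_transpose, hM.eq]; rfl⟩
  have hc : Module.finrank F (m → F) = Fintype.card m := Module.finrank_fintype_fun_eq_card F
  set b := v.reindex (finCongr hc)
  set P : Matrix (Fin (Fintype.card m)) m F := Matrix.of fun i => b i
  have hPM : ∀ i j, (P * M * Pᵀ) i j = Matrix.toBilin' M (b i) (b j) := by
    intro i j
    rw [Matrix.toBilin'_apply', Matrix.mul_assoc]
    rfl
  have hPd : P * M * Pᵀ = diagonal fun i => Matrix.toBilin' M (b i) (b i) := by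
    ext i j
    rw [hPM, diagonal_apply]
    split_ifs with h
    · rw [h]
    · have := hv (i := (finCongr hc).symm i) (j := (finCongr hc).symm j) (by simpa using h)
      simpa [b] using this
  set Q : Matrix m (Fin (Fintype.card m)) F := Matrix.of fun i j => b.repr (Pi.single i 1) j
  have hQP : Q * P = 1 := by
    ext i j
    have := congrFun (b.sum_repr (Pi.single i 1)) j
    simpa [Matrix.mul_apply, Matrix.one_apply, P, Q, Pi.single_apply, eq_comm] using this
  have hPQ : P * Q = 1 := by
    exact (Matrix.mul_eq_one_comm_of_card_eq _ _ _ (by simp)).1 hQP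
  have hMC : MC M (diagonal fun i => Matrix.toBilin' M (b i) (b i)) :=
    MC.symm ⟨P, Q, hPQ, hQP, hPd⟩
  refine ⟨_, fun i h0 => hd ?_, hMC⟩
  obtain ⟨P', Q', h1, h2, h3⟩ := hMC
  have e := Fintype.equivFin m
  have h4 := MC.trans ⟨P', Q', h1, h2, h3⟩ (MC.submatrix _ e).symm
  by_contra h5
  refine h4.det_ne_zero h5 ?_
  rw [Matrix.det_submatrix_equiv_self, det_diagonal]
  exact Finset.prod_eq_zero (Finset.mem_univ i) h0

theorem MC.isSquare_prod {M N : Matrix m m F} {w w' : Fin (Fintype.card m) → F}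
    (h : MC M (diagonal w)) (h' : MC N (diagonal w')) (hM : M.det ≠ 0) (hN : N.det ≠ 0)
    (hd : IsSquare (M.det * N.det)) : IsSquare ((∏ i, w i) * ∏ i, w' i) := by
  have e := Fintype.equivFin m
  have key : ∀ {M : Matrix m m F} {w : Fin (Fintype.card m) → F}, MC M (diagonal w) →
      IsSquare (M.det * ∏ i, w i) := fun {M w} h => by
    have := (h.trans (MC.submatrix _ e).symm).isSquare_det
    rwa [Matrix.det_submatrix_equiv_self, det_diagonal] at this
  have h1 := key h
  rw [mul_comm] at h1
  exact isSquare_mul_trans hM h1 (isSquare_mul_trans hN hd (key h'))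

theorem MC.cancel_option [NeZero (2 : F)] {a : F} (ha : a ≠ 0) {w w' : m → F}
    (hw : ∀ i, w i ≠ 0)
    (h : MC (diagonal fun o : Option m => o.elim a w) (diagonal fun o : Option m => o.elim a w')) :
    MC (diagonal w) (diagonal w') := by
  set e := Fintype.equivFin m
  have key : ∀ w : m → F, MC (diagonal (Fin.cons a (w ∘ e.symm) : Fin (Fintype.card m + 1) → F))
      (diagonal fun o : Option m => o.elim a w) := by
    intro w
    convert MC.submatrix (diagonal fun o : Option m => o.elim a w)
      ((finSuccEquiv _).trans e.symm.optionCongr) using 1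
    rw [Matrix.submatrix_diagonal_equiv]
    congr 1
    ext i
    refine Fin.cases ?_ (fun i => ?_) i <;> simp <;> rfl
  have h1 := ((key w).trans h).trans (key w').symm
  have h1 := (mc_diagonal_iff (Diag.cons_ne_zero.2 ⟨ha, fun i => hw (e.symm i)⟩)).1 h1
  have h2 := (mc_diagonal_iff fun i => hw _).2 (Diag.Cong.cancel ha h1)
  have h3 : ∀ w : m → F, MC (diagonal (w ∘ e.symm)) (diagonal w) := fun w => by
    rw [← Matrix.submatrix_diagonal_equiv]; exact MC.submatrix _ _
  exact ((h3 w).symm.trans h2).trans (h3 w')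

theorem MC.cancel_diagonal [NeZero (2 : F)] {k : ℕ} : ∀ {c : Fin k → F}, (∀ i, c i ≠ 0) →
    ∀ {w w' : m → F}, (∀ i, w i ≠ 0) →
    MC (diagonal (Sum.elim c w)) (diagonal (Sum.elim c w')) → MC (diagonal w) (diagonal w') := by
  induction k with
  | zero =>
    intro c hc w w' hw h
    have h3 : ∀ w : m → F, MC (diagonal w) (diagonal (Sum.elim c w)) := fun w => by
      convert MC.submatrix (diagonal (Sum.elim c w)) (Equiv.emptySum (Fin 0) m).symm using 1
      rw [Matrix.submatrix_diagonal_equiv]; rfl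
    exact ((h3 w).trans h).trans (h3 w').symm
  | succ k ih =>
    intro c hc w w' hw h
    refine ih (c := Fin.tail c) (fun i => hc _) hw (MC.cancel_option (hc 0) ?_ ?_)
    · rintro (i | i)
      exacts [hc _, hw _]
    have h3 : ∀ w : m → F, MC (diagonal fun o => Option.elim o (c 0) (Sum.elim (Fin.tail c) w))
        (diagonal (Sum.elim c w)) := fun w => by
      convert MC.submatrix (diagonal (Sum.elim c w)) ((Equiv.optionEquivSumPUnit.{0} _).trans
        ((Equiv.sumComm _ _).trans ((Equiv.sumAssoc _ _ _).symm.trans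
        (Equiv.sumCongr ((Equiv.sumComm _ _).trans ((Equiv.optionEquivSumPUnit.{0} _).symm.trans
          (finSuccEquiv k).symm)) (Equiv.refl m))))) using 1
      rw [Matrix.submatrix_diagonal_equiv]
      congr 1
      ext o
      rcases o with _ | o | o <;> simp [Fin.tail]
    exact ((h3 w).trans h).trans (h3 w').symm

theorem MC.cancel [NeZero (2 : F)] {C : Matrix n n F} {A A' : Matrix m m F} (hC : C.IsSymm)
    (hC0 : C.det ≠ 0) (hA : A.IsSymm) (hA0 : A.det ≠ 0) (hA' : A'.IsSymm) (hA0' : A'.det ≠ 0)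
    (h : MC (Matrix.fromBlocks A 0 0 C) (Matrix.fromBlocks A' 0 0 C)) : MC A A' := by
  obtain ⟨c, hc, hcC⟩ := exists_mc_diagonal C hC hC0
  obtain ⟨a, ha, haA⟩ := exists_mc_diagonal A hA hA0
  obtain ⟨a', ha', haA'⟩ := exists_mc_diagonal A' hA' hA0'
  have h3 : ∀ {A : Matrix m m F} {a : Fin (Fintype.card m) → F}, MC A (diagonal a) →
      MC (diagonal (Sum.elim c a)) (Matrix.fromBlocks A 0 0 C) := by
    intro A a h
    refine MC.trans ?_ (MC.fromBlocks h hcC).symm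
    rw [Matrix.fromBlocks_diagonal]
    convert MC.submatrix (diagonal (Sum.elim a c)) (Equiv.sumComm _ _) using 1
    rw [Matrix.submatrix_diagonal_equiv]
    congr 1
    ext (i | i) <;> rfl
  have h4 := MC.cancel_diagonal hc ha (((h3 haA).trans h).trans (h3 haA').symm)
  exact (haA.trans h4).trans haA'.symm

theorem MC.cancel_blockDiagonal' [NeZero (2 : F)] {ω : Type*} [Fintype ω] [DecidableEq ω]
    {d : ω → Type*} [∀ i, Fintype (d i)] [∀ i, DecidableEq (d i)]
    {M N : ∀ i, Matrix (d i) (d i) F} (hM : ∀ i, (M i).IsSymm) (hN : ∀ i, (N i).IsSymm)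
    (hM0 : ∀ i, (M i).det ≠ 0) (hN0 : ∀ i, (N i).det ≠ 0) (k : ω) (hk : ∀ i ≠ k, M i = N i)
    (h : MC (Matrix.blockDiagonal' M) (Matrix.blockDiagonal' N)) : MC (M k) (N k) := by
  let d' : {i // i ≠ k} → Type _ := fun i => d i
  let e : (d k ⊕ Σ i : {i // i ≠ k}, d i) ≃ Σ i, d i :=
    { toFun := Sum.elim (fun x => ⟨k, x⟩) fun x => ⟨x.1.1, x.2⟩
      invFun := fun x => if h : x.1 = k then Sum.inl (h ▸ x.2) else Sum.inr ⟨⟨x.1, h⟩, x.2⟩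
      left_inv := by
        rintro (x | ⟨⟨i, hi⟩, x⟩)
        · simp
        · simp [hi]
      right_inv := by
        rintro ⟨i, x⟩
        by_cases hi : i = k
        · subst hi; simp
        · simp [hi] }
  have key : ∀ M : ∀ i, Matrix (d i) (d i) F, MC (Matrix.fromBlocks (M k) 0 0
      (Matrix.blockDiagonal' fun i : {i // i ≠ k} => M i)) (Matrix.blockDiagonal' M) := by
    intro M
    convert MC.submatrix (Matrix.blockDiagonal' M) e using 1
    ext (x | ⟨⟨i, hi⟩, x⟩) (y | ⟨⟨j, hj⟩, y⟩)
    · simp [e]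
    · simp [e, Matrix.blockDiagonal'_apply, hj.symm]
    · simp [e, Matrix.blockDiagonal'_apply, hi]
    · by_cases hij : i = j
      · subst hij; simp [e]
      · simp [e, Matrix.blockDiagonal'_apply, hij]
  have h1 := ((key M).trans h).trans (key N).symm
  have h2 : (fun i : {i // i ≠ k} => M i) =
      fun i : {i // i ≠ k} => N i := funext fun i => hk i.1 i.2
  rw [← h2] at h1
  refine MC.cancel ?_ ?_ (hM k) (hM0 k) (hN k) (hN0 k) h1
  · exact (Matrix.blockDiagonal'_transpose _).trans (by simp only [(hM _).eq])
  · rw [Matrix.det_blockDiagonal'_eq_prod]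
    exact Finset.prod_ne_zero_iff.2 fun i _ => hM0 _

theorem MC.of_three [IsHilbertField F] [NeZero (2 : F)] (hF : Diag.Big F) {M₁ M₂ M₃ : Matrix m m F}
    (h₁ : M₁.IsSymm) (h₂ : M₂.IsSymm) (h₃ : M₃.IsSymm) (d₁ : M₁.det ≠ 0) (d₂ : M₂.det ≠ 0)
    (d₃ : M₃.det ≠ 0) (h12 : IsSquare (M₁.det * M₂.det)) (h13 : IsSquare (M₁.det * M₃.det)) :
    MC M₁ M₂ ∨ MC M₁ M₃ ∨ MC M₂ M₃ := by
  obtain ⟨w₁, hw₁, e₁⟩ := exists_mc_diagonal M₁ h₁ d₁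
  obtain ⟨w₂, hw₂, e₂⟩ := exists_mc_diagonal M₂ h₂ d₂
  obtain ⟨w₃, hw₃, e₃⟩ := exists_mc_diagonal M₃ h₃ d₃
  have key := Diag.cong_of_three hF hw₁ hw₂ hw₃ (MC.isSquare_prod e₁ e₂ d₁ d₂ h12)
    (MC.isSquare_prod e₁ e₃ d₁ d₃ h13)
  rw [← mc_diagonal_iff hw₁, ← mc_diagonal_iff hw₁, ← mc_diagonal_iff hw₂] at key
  rcases key with h | h | h
  exacts [Or.inl ((e₁.trans h).trans e₂.symm), Or.inr (Or.inl ((e₁.trans h).trans e₃.symm)),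
    Or.inr (Or.inr ((e₂.trans h).trans e₃.symm))]

end Congruence

end

section

open Matrix Topology

section Near
variable {F : Type*} [Field F] [TopologicalSpace F] [IsTopologicalDivisionRing F] [T1Space F]

theorem MC.schur {m n : Type*} [Fintype m] [Fintype n] [DecidableEq m] [DecidableEq n]
    (A : Matrix m m F) (B : Matrix m n F) (D : Matrix n n F) (hD : D.IsSymm) (hD0 : D.det ≠ 0) :
    MC (Matrix.fromBlocks A B Bᵀ D) (Matrix.fromBlocks (A - B * D⁻¹ * Bᵀ) 0 0 D) := by
  have hu : IsUnit D.det := hD0.isUnit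
  have hinv : D⁻¹ᵀ = D⁻¹ := by rw [Matrix.transpose_nonsing_inv, hD.eq]
  refine ⟨Matrix.fromBlocks 1 (B * D⁻¹) 0 1, Matrix.fromBlocks 1 (-(B * D⁻¹)) 0 1, ?_, ?_, ?_⟩
  · simp [Matrix.fromBlocks_multiply]
  · simp [Matrix.fromBlocks_multiply]
  · simp [Matrix.fromBlocks_multiply, Matrix.fromBlocks_transpose, Matrix.mul_assoc, hinv,
      Matrix.nonsing_inv_mul _ hu, Matrix.mul_nonsing_inv_cancel_left _ _ hu]

/-- Symmetric matrices close to an invertible diagonal matrix are congruent to it. -/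
theorem eventually_mc_diagonal (hsq : IsOpen {x : F | x ≠ 0 ∧ IsSquare x}) (m : Type)
    [Fintype m] [DecidableEq m] (w : m → F) (hw : ∀ i, w i ≠ 0) :
    ∀ᶠ M in 𝓝 (diagonal w), M.IsSymm → MC M (diagonal w) := by
  suffices H : ∀ (m : Type) [Finite m], ∀ [Fintype m] [DecidableEq m], ∀ w : m → F,
      (∀ i, w i ≠ 0) → ∀ᶠ M in 𝓝 (diagonal w), M.IsSymm → MC M (diagonal w) from H m w hw
  clear hw w
  have equivH : ∀ {α β : Type} [Fintype α] [DecidableEq α] [Fintype β] [DecidableEq β] (e : α ≃ β),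
      (∀ w : α → F, (∀ i, w i ≠ 0) → ∀ᶠ M in 𝓝 (diagonal w), M.IsSymm → MC M (diagonal w)) →
      ∀ w : β → F, (∀ i, w i ≠ 0) → ∀ᶠ M in 𝓝 (diagonal w), M.IsSymm → MC M (diagonal w) := by
    intro α β _ _ _ _ e h w hw
    have hc : Continuous fun M : Matrix β β F => M.submatrix e e :=
      continuous_id.matrix_submatrix e e
    have h1 := h (w ∘ e) fun i => hw _
    rw [← Matrix.submatrix_diagonal_equiv] at h1
    filter_upwards [hc.continuousAt.eventually h1] with M hM hs
    exact ((MC.submatrix M e).symm.trans (hM (hs.submatrix e))).trans (MC.submatrix _ e)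
  intro m _
  induction m using Finite.induction_empty_option with
  | of_equiv e ih =>
    rename_i _ α β
    intro _ _ w hw
    let _ : Fintype α := Fintype.ofEquiv _ e.symm
    let _ : DecidableEq α := Classical.decEq _
    exact equivH e ih w hw
  | h_empty =>
    intro _ _ w hw
    exact Filter.Eventually.of_forall fun M _ => by
      convert MC.refl M
      exact Subsingleton.elim _ _
  | h_option ih =>
    rename_i α _
    intro _ _
    let _ : DecidableEq α := Classical.decEq _
    refine equivH (Equiv.optionEquivSumPUnit.{0} α).symm fun w hw => ?_
    set S : Matrix (α ⊕ PUnit.{1}) (α ⊕ PUnit.{1}) F → Matrix α α F := fun M =>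
      M.toBlocks₁₁ - M.toBlocks₁₂ * (M.toBlocks₂₂)⁻¹ * (M.toBlocks₁₂)ᵀ with hS
    have hinv : ∀ D : Matrix PUnit.{1} PUnit.{1} F, D⁻¹ = diagonal fun _ => (D ⟨⟩ ⟨⟩)⁻¹ := by
      intro D
      rw [Matrix.inv_subsingleton]
      simp [Ring.inverse_eq_inv']
    have hS0 : S (diagonal w) = diagonal (w ∘ Sum.inl) := by
      have h12 : (diagonal w).toBlocks₁₂ = 0 := by ext i j; simp [Matrix.toBlocks₁₂]
      ext i j
      simp [hS, h12, Matrix.toBlocks₁₁, diagonal_apply]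
    have hSc : ContinuousAt S (diagonal w) := by
      have hne : (diagonal w) (Sum.inr PUnit.unit) (Sum.inr PUnit.unit) ≠ 0 := by simp [hw]
      have hc : ∀ a b, ContinuousAt (fun M : Matrix (α ⊕ PUnit.{1}) (α ⊕ PUnit.{1}) F => M a b)
        (diagonal w) := fun a b => (continuous_id.matrix_elem a b).continuousAt
      refine continuousAt_pi.2 fun i => continuousAt_pi.2 fun j => ?_
      have : (fun M => S M i j) = fun M => M (Sum.inl i) (Sum.inl j) - M (Sum.inl i) (Sum.inr ⟨⟩) *
          (M (Sum.inr ⟨⟩) (Sum.inr ⟨⟩))⁻¹ * M (Sum.inl j) (Sum.inr ⟨⟩) := by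
        ext M
        simp [hS, hinv, Matrix.toBlocks₁₁, Matrix.toBlocks₁₂, Matrix.toBlocks₂₂, Matrix.mul_apply]
      rw [this]
      exact (hc _ _).sub (((hc _ _).mul ((hc _ _).inv₀ hne)).mul (hc _ _))
    have h1 := hSc.eventually (p := fun M => M.IsSymm → MC M (diagonal (w ∘ Sum.inl)))
      (by rw [hS0]; exact ih _ fun i => hw _)
    have hc : Continuous fun M : Matrix (α ⊕ PUnit.{1}) (α ⊕ PUnit.{1}) F =>
        M (Sum.inr ⟨⟩) (Sum.inr ⟨⟩) * (w (Sum.inr ⟨⟩))⁻¹ :=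
      (continuous_id.matrix_elem _ _).mul continuous_const
    have h2 := hc.continuousAt.eventually (p := fun x => x ≠ 0 ∧ IsSquare x)
      (hsq.mem_nhds (x := (diagonal w) (Sum.inr ⟨⟩) (Sum.inr ⟨⟩) * (w (Sum.inr ⟨⟩))⁻¹) (by
        simp [hw]))
    filter_upwards [h1, h2] with M hM ⟨h0, c, hc⟩ hs
    have hM' : M = Matrix.fromBlocks M.toBlocks₁₁ M.toBlocks₁₂ (M.toBlocks₁₂)ᵀ M.toBlocks₂₂ := by
      conv_lhs => rw [← Matrix.fromBlocks_toBlocks M]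
      congr 1
      ext i j
      exact hs.apply _ _
    have h00 : M (Sum.inr ⟨⟩) (Sum.inr ⟨⟩) ≠ 0 := left_ne_zero_of_mul h0
    have hw0 := hw (Sum.inr ⟨⟩)
    have hD : M.toBlocks₂₂.IsSymm := by ext i j; rfl
    have hD0 : M.toBlocks₂₂.det ≠ 0 := by simpa [Matrix.toBlocks₂₂] using h00
    have hSs : (S M).IsSymm := by
      ext i j
      simp [hS, hinv, Matrix.toBlocks₁₁, Matrix.toBlocks₁₂, Matrix.toBlocks₂₂, Matrix.mul_apply,
        hs.apply (Sum.inl i) (Sum.inl j)]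
      ring
    have hDw : MC M.toBlocks₂₂ (diagonal (w ∘ Sum.inr)) := by
      refine MC.of_mul (P := diagonal fun _ => c) ?_ hD0
      ext ⟨⟩ ⟨⟩
      simp [Matrix.toBlocks₂₂, Matrix.mul_apply]
      field_simp at hc
      linear_combination - hc
    have := (MC.schur M.toBlocks₁₁ M.toBlocks₁₂ M.toBlocks₂₂ hD hD0).trans
      (MC.fromBlocks (hM hSs) hDw)
    rw [← hM', Matrix.fromBlocks_diagonal] at this
    convert this
    ext (i | i) <;> rfl

/-- The symmetric matrices congruent to a given nondegenerate one form an open set. -/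
theorem eventually_mc [NeZero (2 : F)] (hsq : IsOpen {x : F | x ≠ 0 ∧ IsSquare x}) {m : Type*}
    [Fintype m] [DecidableEq m] (N : Matrix m m F) (hN : N.IsSymm) (hN0 : N.det ≠ 0) :
    ∀ᶠ M in 𝓝 N, M.IsSymm → MC M N := by
  obtain ⟨w, hw, P, Q, h1, h2, h3⟩ := exists_mc_diagonal N hN hN0
  have hc : Continuous fun M : Matrix m m F => Q * M * Qᵀ :=
    (continuous_const.matrix_mul continuous_id).matrix_mul continuous_const
  have h4 : Q * N * Qᵀ = diagonal w := by
    rw [← h3]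
    calc Q * (P * diagonal w * Pᵀ) * Qᵀ = (Q * P) * diagonal w * (Q * P)ᵀ := by
          simp only [Matrix.transpose_mul, Matrix.mul_assoc]
      _ = diagonal w := by simp [h2]
  have h5 := (hc.continuousAt (x := N)).eventually (p := fun M => M.IsSymm → MC M (diagonal w)) (by
    simp only [h4]; exact eventually_mc_diagonal hsq _ w hw)
  filter_upwards [h5] with M hM hs
  have h6 : MC (Q * M * Qᵀ) M := ⟨Q, P, h2, h1, rfl⟩
  refine (h6.symm.trans (hM ?_)).trans (MC.symm ⟨P, Q, h1, h2, h3⟩)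
  rw [Matrix.IsSymm, Matrix.transpose_mul, Matrix.transpose_mul, Matrix.transpose_transpose, hs.eq,
    Matrix.mul_assoc]

end Near

end

section

open Matrix

theorem Diag.cong_of_forall_isNrm {F : Type*} [Field F] [NeZero (2 : F)] {U : Set F} (h0 : ∀ a ∈ U, a ≠ 0)
    (hmul : ∀ a ∈ U, ∀ b ∈ U, a * b ∈ U)
    (hN : ∀ a ∈ U, ∀ b ∈ U, IsNrm (-(a * b)) a) : ∀ {n : ℕ} {w w' : Fin n → F},
    (∀ i, w i ∈ U) → (∀ i, w' i ∈ U) → IsSquare ((∏ i, w i) * ∏ i, w' i) → Diag.Cong w w' := by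
  intro n
  induction n with
  | zero => exact fun _ _ _ => ⟨0, fun x => by simp [dq]⟩
  | succ n ih =>
    rcases n with _ | n
    · exact fun hw hw' h => cong_one (fun i => h0 _ (hw i)) (fun i => h0 _ (hw' i)) h
    intro w w' hw hw' h
    have key : ∀ w : Fin (n + 1 + 1) → F, (∀ i, w i ∈ U) → Cong (Fin.cons 1 (Fin.cons (w 0 * w 1)
        fun i => w i.succ.succ) : Fin (n + 1 + 1) → F) w := by
      intro w hw
      obtain ⟨x, y, hxy⟩ := hN _ (hw 0) _ (hw 1)
      have hw0 := h0 _ (hw 0)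
      have h1 : w 0 * (x / w 0) ^ 2 + w 1 * y ^ 2 = 1 := by
        field_simp
        linear_combination hxy
      have := cong_binary (w 0) (w 1) (x / w 0) y fun i => w i.succ.succ
      rw [h1, mul_one] at this
      convert this using 1
      ext i
      refine Fin.cases ?_ (fun i => Fin.cases ?_ (fun i => ?_) i) i <;> simp
    have hw2 : ∀ w : Fin (n + 1 + 1) → F, (∀ i, w i ∈ U) → ∀ i, (Fin.cons (w 0 * w 1)
        fun i => w i.succ.succ : Fin (n + 1) → F) i ∈ U := by
      intro w hw i
      refine Fin.cases ?_ (fun i => ?_) i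
      · exact hmul _ (hw _) _ (hw _)
      · exact hw _
    have h1 : Cong (Fin.cons (w 0 * w 1) fun i => w i.succ.succ : Fin (n + 1) → F)
        (Fin.cons (w' 0 * w' 1) fun i => w' i.succ.succ) := by
      refine ih (hw2 w hw) (hw2 w' hw') ?_
      simp only [Fin.prod_univ_succ, Fin.cons_zero, Fin.cons_succ, Fin.succ_zero_eq_one] at h ⊢
      convert h using 2 <;> ring
    refine (Cong.trans ((key w hw).symm ?_) (h1.cons' 1)).trans (key w' hw')
    exact Diag.cons_ne_zero.2 ⟨one_ne_zero, fun i => h0 _ (hw2 w hw i)⟩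

namespace Place
variable {K : Type*} [Field K] [NumberField K] {m : Type*} [Fintype m] [DecidableEq m]

theorem ι_mc_diagonal (v : Place K) {n : ℕ} {M : Matrix m m K} {w : Fin n → K}
    (h : MC M (diagonal w)) : MC (M.map (ι v)) (diagonal (ι v ∘ w)) := by
  have := h.map (ι v)
  rwa [Matrix.diagonal_map (map_zero _)] at this

theorem mc_of_forall_ne (p : HeightOneSpectrum (𝓞 K)) {M N : Matrix m m K} (hM : M.IsSymm)
    (hN : N.IsSymm) (hM0 : M.det ≠ 0) (hN0 : N.det ≠ 0)
    (h : ∀ v ≠ Sum.inr p, MC (M.map (ι v)) (N.map (ι v))) : MC M N := by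
  obtain ⟨w, hw, e⟩ := exists_mc_diagonal M hM hM0
  obtain ⟨w', hw', e'⟩ := exists_mc_diagonal N hN hN0
  refine (e.trans ((mc_diagonal_iff hw).2 (cong_of_forall_ne p hw hw' fun v hv => ?_))).trans e'.symm
  rw [← mc_diagonal_iff fun i => (_root_.map_ne_zero _).2 (hw i)]
  exact ((ι_mc_diagonal v e).symm.trans (h v hv)).trans (ι_mc_diagonal v e')

theorem finite_not_mc {M N : Matrix m m K} (hM : M.IsSymm)
    (hN : N.IsSymm) (hM0 : M.det ≠ 0) (hN0 : N.det ≠ 0)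
    (h : ∀ p, IsSquare (ι (Sum.inr p) (M.det * N.det))) :
    {v : Place K | ¬ MC (M.map (ι v)) (N.map (ι v))}.Finite := by
  classical
  obtain ⟨w, hw, e⟩ := exists_mc_diagonal M hM hM0
  obtain ⟨w', hw', e'⟩ := exists_mc_diagonal N hN hN0
  obtain ⟨S, -, hS, hA⟩ := exists_adm_mem (∅ : Finset (Place K))
    (Finset.univ.image (fun i => Units.mk0 _ (hw i)) ∪ Finset.univ.image fun i => Units.mk0 _ (hw' i))
  refine S.finite_toSet.subset fun v hv => ?_
  by_contra hvS
  rcases v with v | p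
  · exact hvS (hS.inl_mem v)
  refine hv ?_
  have e1 := ι_mc_diagonal (Sum.inr p) e
  have e2 := ι_mc_diagonal (Sum.inr p) e'
  refine (e1.trans ((mc_diagonal_iff fun i => (_root_.map_ne_zero _).2 (hw i)).2 ?_)).trans e2.symm
  refine Diag.cong_of_forall_isNrm
    (U := {x | ∃ u ∈ sUnits S, x = ι (Sum.inr p) ((u : Kˣ) : K)}) ?_ ?_ ?_ (fun i => ?_)
    (fun i => ?_) ?_
  · rintro _ ⟨u, -, rfl⟩; exact ι_ne_zero _ u
  · rintro _ ⟨u, hu, rfl⟩ _ ⟨u', hu', rfl⟩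
    exact ⟨u * u', mul_mem hu hu', by simp⟩
  · rintro _ ⟨u, hu, rfl⟩ _ ⟨u', hu', rfl⟩
    have h1 : (-1 : Kˣ) ∈ sUnits S := mem_sUnits.2 fun v _ => by simp
    have := hS.nrmAt (mul_mem h1 (mul_mem hu hu')) hu hvS
    simpa [NrmAt] using this
  · exact ⟨_, hA (Units.mk0 _ (hw i)) (by simp), rfl⟩
  · exact ⟨_, hA (Units.mk0 _ (hw' i)) (by simp), rfl⟩
  · have hd : ∀ M : Matrix m m K, (M.map (ι (Sum.inr p))).det = ι (Sum.inr p) M.det := fun M =>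
      (RingHom.map_det (ι (Sum.inr p)) M).symm
    refine e1.isSquare_prod e2 ?_ ?_ ?_
    · rw [hd]; exact (_root_.map_ne_zero _).2 hM0
    · rw [hd]; exact (_root_.map_ne_zero _).2 hN0
    · rw [hd, hd, ← map_mul]; exact h p

end Place

/-- Over a field in which every element is a square, nondegenerate forms are classified by rank. -/
theorem mc_of_forall_isSquare {F : Type*} [Field F] [NeZero (2 : F)] (hF : ∀ x : F, IsSquare x)
    {m : Type*} [Fintype m] [DecidableEq m] {M N : Matrix m m F} (hM : M.IsSymm)
    (hN : N.IsSymm) (hM0 : M.det ≠ 0) (hN0 : N.det ≠ 0) : MC M N := by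
  obtain ⟨w, hw, e⟩ := exists_mc_diagonal M hM hM0
  obtain ⟨w', hw', e'⟩ := exists_mc_diagonal N hN hN0
  refine (e.trans ((mc_diagonal_iff hw).2 ?_)).trans e'.symm
  refine Diag.cong_of_forall_isNrm (U := {x | x ≠ 0}) (fun _ h => h) (fun _ h _ h' => mul_ne_zero h h')
    (fun a ha b hb => ?_) hw hw' (hF _)
  exact isNrm_of_isSquare (hF _) (neg_ne_zero.2 (mul_ne_zero ha hb)) _

end

section Cyclic

variable {F V : Type*} [Field F] [AddCommGroup V] [Module F V]

/-- An irreducible factor of the characteristic polynomial has a nontrivial kernel. -/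
theorem exists_aeval_eq_zero_of_dvd_charpoly [FiniteDimensional F V] (T : Module.End F V) {q : F[X]}
    (hq : Irreducible q) (h : q ∣ LinearMap.charpoly T) : ∃ x ≠ 0, aeval T q x = 0 := by
  by_contra! hcon
  have hinj : Function.Injective (aeval T q) := by
    rw [injective_iff_map_eq_zero]
    exact fun x hx => by_contra fun h0 => hcon x h0 hx
  have := Fact.mk hq
  let A := AdjoinRoot q
  have hroot : (LinearMap.charpoly (T.baseChange A)).IsRoot (AdjoinRoot.root q) := by
    rw [LinearMap.charpoly_baseChange]
    obtain ⟨c, hc⟩ := h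
    rw [hc, Polynomial.map_mul, IsRoot.def, eval_mul, eval_map_algebraMap, AdjoinRoot.aeval_eq,
      AdjoinRoot.mk_self, zero_mul]
  rw [← Module.End.hasEigenvalue_iff_isRoot_charpoly] at hroot
  obtain ⟨v, hv⟩ := hroot.exists_hasEigenvector
  have h1 := Module.End.aeval_apply_of_hasEigenvector (p := q.map (algebraMap F A)) hv
  rw [eval_map_algebraMap, AdjoinRoot.aeval_eq, AdjoinRoot.mk_self, zero_smul, aeval_map_algebraMap] at h1
  have h2 : aeval (T.baseChange A) q = (aeval T q).baseChange A :=
    Polynomial.aeval_algHom_apply (Module.End.baseChangeHom F A V) T q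
  rw [h2] at h1
  have h3 : Function.Injective ((aeval T q).baseChange A) :=
    Module.Flat.lTensor_preserves_injective_linearMap (M := A) _ hinj
  exact hv.2 (h3 (by rw [h1, map_zero]))

variable {B : LinearMap.BilinForm F V} {T : Module.End F V}

theorem bilin_pow_pow (hT : ∀ x y, B (T x) (T y) = B x y)
    (k : ℕ) (x y : V) : B ((T ^ k) x) ((T ^ k) y) = B x y := by
  induction k with
  | zero => rfl
  | succ k ih => rw [pow_succ', Module.End.mul_apply, Module.End.mul_apply, hT, ih]

/-- The adjoint of `f(T)` is `f(T⁻¹)`. -/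
theorem bilin_aeval_left (hT : ∀ x y, B (T x) (T y) = B x y)
    (f : F[X]) (x y : V) :
    B (aeval T f x) ((T ^ f.natDegree) y) = B x (aeval T f.reverse y) := by
  have h1 : aeval T f.reverse y = ∑ k ∈ Finset.range (f.natDegree + 1),
      f.coeff (f.natDegree - k) • (T ^ k) y := by
    rw [aeval_eq_sum_range' (n := f.natDegree + 1) (Nat.lt_succ_of_le (reverse_natDegree_le f)),
      LinearMap.sum_apply]
    refine Finset.sum_congr rfl fun k hk => ?_
    rw [LinearMap.smul_apply, coeff_reverse, revAt_le (Nat.lt_succ_iff.1 (Finset.mem_range.1 hk))]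
  rw [h1, aeval_eq_sum_range, LinearMap.sum_apply, map_sum, LinearMap.sum_apply, map_sum,
    ← Finset.sum_range_reflect]
  refine Finset.sum_congr rfl fun k hk => ?_
  have hk' : k ≤ f.natDegree := Nat.lt_succ_iff.1 (Finset.mem_range.1 hk)
  have e : f.natDegree + 1 - 1 - k = f.natDegree - k := by omega
  have e2 : (T ^ f.natDegree) y = (T ^ (f.natDegree - k)) ((T ^ k) y) := by
    rw [← Module.End.mul_apply, ← pow_add]; congr 2; omega
  rw [e, LinearMap.smul_apply, map_smul, map_smul, LinearMap.smul_apply, e2, bilin_pow_pow hT]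

theorem bilin_aeval_eq_zero (hT : ∀ x y, B (T x) (T y) = B x y)
    {f : F[X]} (hf : f.reverse = f) {x : V} (hx : aeval T f x = 0) (y : V) :
    B x (aeval T f y) = 0 := by
  rw [← hf, ← bilin_aeval_left hT, hx, map_zero, LinearMap.zero_apply]

theorem exists_bilin_ne_zero (hT : ∀ x y, B (T x) (T y) = B x y)
    (hB : B.Nondegenerate) {f k q c : F[X]}
    (hf : f.reverse = f)
    (h1 : IsCoprime f (X ^ 2 - 1)) (hfk : IsCoprime f k) (hk : aeval T (f * k) = 0)
    (hqc : f = q * c) (hcop : IsCoprime q c) {x₀ : V} (hx₀ : x₀ ≠ 0) (hqx : aeval T q x₀ = 0) :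
    ∃ x, aeval T f x = 0 ∧ (B (aeval T c x) x ≠ 0 ∨ B (aeval T c x) (T x) ≠ 0) := by
  by_contra! hcon
  have hcomm : ∀ (p r : F[X]) (x : V), aeval T p (aeval T r x) = aeval T r (aeval T p x) := by
    intro p r x
    rw [← Module.End.mul_apply, ← Module.End.mul_apply, ← map_mul, ← map_mul, mul_comm]
  have hTc : ∀ (p : F[X]) (x : V), aeval T p (T x) = T (aeval T p x) := by
    intro p x
    simpa using hcomm p Polynomial.X x
  have hTU : ∀ x, aeval T f x = 0 → aeval T f (T x) = 0 := fun x hx => by rw [hTc, hx, map_zero]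
  have hadd : ∀ x y, aeval T f x = 0 → aeval T f y = 0 → aeval T f (x + y) = 0 :=
    fun x y hx hy => by rw [map_add, hx, hy, add_zero]
  have p1 : ∀ x y, aeval T f x = 0 → aeval T f y = 0 →
      B (aeval T c x) y + B (aeval T c y) x = 0 := by
    intro x y hx hy
    have a1 := (hcon _ (hadd x y hx hy)).1
    have a2 := (hcon _ hx).1
    have a3 := (hcon _ hy).1
    simp only [map_add, LinearMap.add_apply] at a1
    linear_combination a1 - a2 - a3
  have p2 : ∀ x y, aeval T f x = 0 → aeval T f y = 0 →
      B (aeval T c x) (T y) + B (aeval T c y) (T x) = 0 := by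
    intro x y hx hy
    have a1 := (hcon _ (hadd x y hx hy)).2
    have a2 := (hcon _ hx).2
    have a3 := (hcon _ hy).2
    simp only [map_add, LinearMap.add_apply] at a1
    linear_combination a1 - a2 - a3
  have p3 : ∀ x y, aeval T f x = 0 → aeval T f y = 0 →
      B (aeval T c y) (aeval T (X ^ 2 - 1 : F[X]) x) = 0 := by
    intro x y hx hy
    have a1 := p1 (T x) (T y) (hTU x hx) (hTU y hy)
    have a2 := p2 (T x) y (hTU x hx) hy
    rw [hTc, hTc, hT, hT] at a1
    rw [hTc, hT] at a2
    have a4 := p1 x y hx hy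
    have : aeval T (X ^ 2 - 1 : F[X]) x = T (T x) - x := by
      simp [pow_two]
    rw [this, map_sub]
    linear_combination a2 - a4
  have p4 : ∀ x y, aeval T f x = 0 → aeval T f y = 0 → B (aeval T c y) x = 0 := by
    intro x y hx hy
    obtain ⟨a, b, hab⟩ := h1
    have : x = aeval T (X ^ 2 - 1 : F[X]) (aeval T b x) := by
      conv_lhs => rw [← Module.End.one_apply (R := F) x, ← map_one (aeval (R := F) T), ← hab, map_add, map_mul,
        map_mul, LinearMap.add_apply, Module.End.mul_apply, Module.End.mul_apply, hx, map_zero, zero_add,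
        hcomm]
    rw [this]
    exact p3 _ _ (by rw [hcomm, hx, map_zero]) hy
  have p5 : ∀ y, aeval T f y = 0 → aeval T c y = 0 := by
    intro y hy
    refine hB.1 _ fun z => ?_
    obtain ⟨a, b, hab⟩ := hfk
    have : z = aeval T f (aeval T a z) + aeval T (b * k) z := by
      conv_lhs => rw [← Module.End.one_apply (R := F) z, ← map_one (aeval (R := F) T), ← hab, map_add, map_mul,
        LinearMap.add_apply, Module.End.mul_apply, hcomm]
    rw [this, map_add, bilin_aeval_eq_zero hT hf (by rw [hcomm, hy, map_zero]), zero_add]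
    refine p4 _ _ ?_ hy
    rw [← Module.End.mul_apply, ← map_mul, show f * (b * k) = b * (f * k) by ring, map_mul, hk,
      mul_zero, LinearMap.zero_apply]
  refine hx₀ ?_
  obtain ⟨a, b, hab⟩ := hcop
  have h0 : aeval T f x₀ = 0 := by rw [hqc, mul_comm, map_mul, Module.End.mul_apply, hqx, map_zero]
  rw [← Module.End.one_apply (R := F) x₀, ← map_one (aeval (R := F) T), ← hab, map_add, map_mul,
        map_mul, LinearMap.add_apply, Module.End.mul_apply, Module.End.mul_apply, hqx, p5 _ h0, map_zero,
        map_zero, add_zero]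

/-- Conditions under which `e` generates a nondegenerate cyclic subspace isomorphic to `F[X]/(f)`. -/
structure IsCyclicVec {F V : Type*} [Field F] [AddCommGroup V] [Module F V]
    (B : LinearMap.BilinForm F V) (T : Module.End F V) (f : F[X]) (e : V) : Prop where
  aeval_eq : aeval T f e = 0
  dvd : ∀ p : F[X], (∀ r : F[X], B (aeval T p e) (aeval T r e) = 0) → f ∣ p

theorem exists_common_ne_zero {F V ι : Type*} [Field F] [Infinite F] [AddCommGroup V] [Module F V]
    (U : Submodule F V) (b : ι → LinearMap.BilinForm F V) (s : Finset ι)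
    (h : ∀ i ∈ s, ∃ x ∈ U, b i x x ≠ 0) : ∃ e ∈ U, ∀ i ∈ s, b i e e ≠ 0 := by
  classical
  induction s using Finset.induction_on with
  | empty => exact ⟨0, U.zero_mem, by simp⟩
  | insert a s ha ih =>
    obtain ⟨e, he, hes⟩ := ih fun i hi => h i (Finset.mem_insert_of_mem hi)
    obtain ⟨x, hx, hxa⟩ := h a (Finset.mem_insert_self _ _)
    let P : ι → F[X] := fun i => C (b i e e) + C (b i e x + b i x e) * X + C (b i x x) * X ^ 2
    have hP : ∀ i ∈ insert a s, P i ≠ 0 := by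
      intro i hi h0
      have c0 : (P i).coeff 0 = b i e e := by simp [P]
      have c2 : (P i).coeff 2 = b i x x := by simp [P, coeff_X, coeff_C]
      rw [h0, coeff_zero] at c0 c2
      rcases Finset.mem_insert.1 hi with rfl | hi
      · exact hxa c2.symm
      · exact hes i hi c0.symm
    have hprod : ∏ i ∈ insert a s, P i ≠ 0 := Finset.prod_ne_zero_iff.2 hP
    obtain ⟨l, hl⟩ := Infinite.exists_notMem_finset (∏ i ∈ insert a s, P i).roots.toFinset
    refine ⟨e + l • x, U.add_mem he (U.smul_mem _ hx), fun i hi h0 => hl ?_⟩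
    rw [Multiset.mem_toFinset, mem_roots hprod, IsRoot.def, eval_prod]
    refine Finset.prod_eq_zero hi ?_
    simp only [map_add, map_smul, LinearMap.add_apply, LinearMap.smul_apply, smul_eq_mul] at h0
    simp only [P, eval_add, eval_mul, eval_C, eval_X, eval_pow]
    linear_combination h0

theorem exists_X_mul_aeval {f : F[X]} (hf : f.coeff 0 ≠ 0) {e : V} (he : aeval T f e = 0) :
    ∃ u : F[X], e = T (aeval T u e) := by
  refine ⟨-C (f.coeff 0)⁻¹ * f.divX, ?_⟩
  have h1 : aeval T (f.divX * X + C (f.coeff 0)) e = 0 := by rw [divX_mul_X_add, he]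
  rw [map_add, aeval_C, LinearMap.add_apply, Module.algebraMap_end_apply, mul_comm, map_mul,
    Module.End.mul_apply, aeval_X] at h1
  rw [map_mul, map_neg, aeval_C, Module.End.mul_apply, LinearMap.neg_apply,
    Module.algebraMap_end_apply, map_neg, map_smul, eq_neg_of_add_eq_zero_left h1, smul_neg, neg_neg,
    smul_smul, inv_mul_cancel₀ hf, one_smul]

theorem exists_isCyclicVec [Infinite F] [FiniteDimensional F V] (hT : ∀ x y, B (T x) (T y) = B x y)
    (hB : B.Nondegenerate) {f k : F[X]}
    (hm : f.Monic) (hf : f.reverse = f) (hsf : Squarefree f)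
    (h1 : IsCoprime f (X ^ 2 - 1)) (hfk : IsCoprime f k) (hk : aeval T (f * k) = 0)
    (hd : f ∣ LinearMap.charpoly T) : ∃ e, IsCyclicVec B T f e := by
  classical
  have hf0 : f ≠ 0 := hm.ne_zero
  let s := (UniqueFactorizationMonoid.normalizedFactors f).toFinset
  have key : ∀ q ∈ s, ∃ c : F[X], f = q * c ∧ ∃ b : LinearMap.BilinForm F V,
      (∃ x ∈ LinearMap.ker (aeval T f), b x x ≠ 0) ∧
      ∀ x, b x x ≠ 0 → ∃ r : F[X], B (aeval T c x) (aeval T r x) ≠ 0 := by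
    intro q hq
    have hq := Multiset.mem_toFinset.1 hq
    have hqi := UniqueFactorizationMonoid.irreducible_of_normalized_factor q hq
    obtain ⟨c, hc⟩ := UniqueFactorizationMonoid.dvd_of_mem_normalizedFactors hq
    obtain ⟨x₀, hx₀, hqx⟩ := exists_aeval_eq_zero_of_dvd_charpoly T hqi
      ((Dvd.intro c hc.symm).trans hd)
    have hcop : IsCoprime q c := by
      rw [hqi.coprime_iff_not_dvd]
      rintro ⟨c', rfl⟩
      exact hqi.not_isUnit (hsf q ⟨c', by rw [hc, mul_assoc]⟩)
    obtain ⟨x, hx, h | h⟩ := exists_bilin_ne_zero hT hB hf h1 hfk hk hc hcop hx₀ hqx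
    · exact ⟨c, hc, B.comp (aeval T c) LinearMap.id, ⟨x, hx, h⟩, fun x hx => ⟨1, by simpa using hx⟩⟩
    · exact ⟨c, hc, B.comp (aeval T c) T, ⟨x, hx, h⟩, fun x hx => ⟨X, by simpa using hx⟩⟩
  choose! c hc b hb hb' using key
  obtain ⟨e, he, hes⟩ := exists_common_ne_zero (LinearMap.ker (aeval T f)) b s hb
  have he : aeval T f e = 0 := he
  refine ⟨e, he, fun p hp => ?_⟩
  have hc0 : f.coeff 0 ≠ 0 := by
    rw [← hf, coeff_zero_reverse, hm.leadingCoeff]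
    exact one_ne_zero
  obtain ⟨u, hu⟩ := exists_X_mul_aeval hc0 he
  have hX : ∀ p : F[X], (∀ r : F[X], B (aeval T p e) (aeval T r e) = 0) →
      ∀ r : F[X], B (aeval T (X * p) e) (aeval T r e) = 0 := by
    intro p hp r
    have : aeval T r e = T (aeval T (r * u) e) := by
      conv_lhs => rw [hu]
      have h3 := LinearMap.congr_fun (congrArg (aeval T) (mul_comm r X)) (aeval T u e)
      simp only [map_mul, Module.End.mul_apply, aeval_X] at h3 ⊢
      exact h3
    rw [this, map_mul, Module.End.mul_apply, aeval_X, hT]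
    exact hp _
  let I : Ideal F[X] :=
    { carrier := {p | ∀ r : F[X], B (aeval T p e) (aeval T r e) = 0}
      add_mem' := fun {a b} ha hb r => by
        rw [map_add, LinearMap.add_apply, map_add, LinearMap.add_apply, ha r, hb r, add_zero]
      zero_mem' := fun r => by simp
      smul_mem' := by
        intro a p hp
        simp only [smul_eq_mul]
        induction a using Polynomial.induction_on' with
        | add a b ha hb =>
          intro r
          rw [add_mul, map_add, LinearMap.add_apply, map_add, LinearMap.add_apply, ha r, hb r, add_zero]
        | monomial n a =>
          rw [← C_mul_X_pow_eq_monomial]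
          have : ∀ r : F[X], B (aeval T (X ^ n * p) e) (aeval T r e) = 0 := by
            induction n with
            | zero => simpa using hp
            | succ n ih => rw [pow_succ', mul_assoc]; exact hX _ ih
          intro r
          rw [mul_assoc, map_mul, aeval_C, Module.End.mul_apply, Module.algebraMap_end_apply, map_smul,
            LinearMap.smul_apply, this, smul_zero] }
  have hfI : f ∈ I := fun r => by rw [he, map_zero, LinearMap.zero_apply]
  obtain ⟨g, hg⟩ := (inferInstance : I.IsPrincipal).principal
  have hgI : g ∈ I := by rw [hg]; exact Submodule.mem_span_singleton_self g
  have hpg : g ∣ p := by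
    have : p ∈ I := hp
    rw [hg] at this
    exact Ideal.mem_span_singleton.1 this
  refine dvd_trans ?_ hpg
  obtain ⟨h, hh⟩ : g ∣ f := by
    rw [hg] at hfI
    exact Ideal.mem_span_singleton.1 hfI
  by_cases hu : IsUnit h
  · rw [hh]
    exact (hu.mul_right_dvd).2 dvd_rfl
  · exfalso
    have hh0 : h ≠ 0 := right_ne_zero_of_mul (hh ▸ hf0)
    obtain ⟨q, hq⟩ := UniqueFactorizationMonoid.exists_mem_normalizedFactors hh0 hu
    have hqs : q ∈ s := Multiset.mem_toFinset.2 (Multiset.mem_of_le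
      ((UniqueFactorizationMonoid.dvd_iff_normalizedFactors_le_normalizedFactors hh0 hf0).1
        (Dvd.intro_left g hh.symm)) hq)
    have hq0 := UniqueFactorizationMonoid.ne_zero_of_mem_normalizedFactors hq
    obtain ⟨h', rfl⟩ := UniqueFactorizationMonoid.dvd_of_mem_normalizedFactors hq
    have hcq : c q = h' * g := mul_left_cancel₀ hq0 (by rw [← hc q hqs, hh]; ring)
    obtain ⟨r, hr⟩ := hb' q hqs e (hes q hqs)
    refine hr ?_
    have : c q ∈ I := hcq ▸ I.mul_mem_left h' hgI
    exact this r

theorem coe_aeval_restrict {Z : Submodule F V} (hZ : ∀ z ∈ Z, T z ∈ Z) (p : F[X]) (z : Z) :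
    ((aeval (T.restrict hZ) p z : Z) : V) = aeval T p z := by
  induction p using Polynomial.induction_on' with
  | add a b ha hb => simp [ha, hb]
  | monomial n a =>
    have : ∀ z : Z, (((T.restrict hZ) ^ n) z : V) = (T ^ n) z := by
      induction n with
      | zero => simp
      | succ n ih => intro z; rw [pow_succ, pow_succ, Module.End.mul_apply, ih]; rfl
    simp [aeval_monomial, this]

theorem exists_isCyclicVec_family {F : Type*} [Field F] [Infinite F] {Ω : Type*} [DecidableEq Ω]
    (m : Ω → F[X]) (g : F[X])
    (hm : ∀ ω, (m ω).Monic) (hrev : ∀ ω, (m ω).reverse = m ω) (hsf : ∀ ω, Squarefree (m ω))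
    (h1 : ∀ ω, IsCoprime (m ω) (X ^ 2 - 1)) (hg : ∀ ω, ∃ k, m ω * k = g ∧ IsCoprime (m ω) k)
    (s : Finset Ω) : ∀ {V : Type*} [AddCommGroup V] [Module F V] [FiniteDimensional F V]
    {B : LinearMap.BilinForm F V} (hB : B.Nondegenerate) (hs : B.IsSymm) {T : Module.End F V}
    (hT : ∀ x y, B (T x) (T y) = B x y) (hgT : aeval T g = 0)
    (hc : LinearMap.charpoly T = ∏ ω ∈ s, m ω),
    ∃ e : Ω → V, (∀ ω ∈ s, IsCyclicVec B T (m ω) (e ω)) ∧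
      ∀ ω ∈ s, ∀ ω' ∈ s, ω ≠ ω' → ∀ p r : F[X], B (aeval T p (e ω)) (aeval T r (e ω')) = 0 := by
  induction s using Finset.induction_on with
  | empty => intros; exact ⟨0, by simp, by simp⟩
  | insert a s ha ih =>
    intro V _ _ _ B hB hs T hT hgT hc
    obtain ⟨k, hk, hcop⟩ := hg a
    rw [Finset.prod_insert ha] at hc
    obtain ⟨e, he⟩ := exists_isCyclicVec hT hB (hm a) (hrev a) (hsf a) (h1 a) hcop
      (by rw [hk, hgT]) (Dvd.intro _ hc.symm)
    let φ : F[X] →ₗ[F] V := (LinearMap.applyₗ e).comp (aeval T).toLinearMap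
    have hφ : ∀ p, φ p = aeval T p e := fun p => rfl
    let W : Submodule F V := LinearMap.range φ
    let Z := B.orthogonal W
    have hTφ : ∀ p, T (φ p) = φ (X * p) := fun p => by
      rw [hφ, hφ, map_mul, aeval_X, Module.End.mul_apply]
    have hWT : ∀ w ∈ W, T w ∈ W := by
      rintro _ ⟨p, rfl⟩
      exact ⟨X * p, (hTφ p).symm⟩
    have hWT' : ∀ w ∈ W, ∃ w' ∈ W, T w' = w := by
      rintro _ ⟨p, rfl⟩
      obtain ⟨u, hu⟩ := exists_X_mul_aeval (f := m a) (T := T)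
        (by rw [← hrev a, coeff_zero_reverse, (hm a).leadingCoeff]; exact one_ne_zero) he.aeval_eq
      refine ⟨φ (p * u), ⟨_, rfl⟩, ?_⟩
      rw [hTφ, show X * (p * u) = p * (X * u) by ring, hφ, map_mul, Module.End.mul_apply]
      conv_rhs => rw [hφ, hu]
      rw [map_mul, aeval_X, Module.End.mul_apply]
    have hZmem : ∀ z, z ∈ Z ↔ ∀ w ∈ W, B w z = 0 := fun z => Iff.rfl
    have hZT : ∀ z ∈ Z, T z ∈ Z := by
      intro z hz w hw
      obtain ⟨w', hw', rfl⟩ := hWT' w hw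
      exact (hT _ _).trans (hz w' hw')
    have hdisj : Disjoint W Z := by
      rw [Submodule.disjoint_def]
      rintro _ ⟨p, rfl⟩ hz
      obtain ⟨c, rfl⟩ := he.dvd p fun r => by
        rw [← hs.eq]
        exact hz (φ r) ⟨r, rfl⟩
      rw [hφ, mul_comm, map_mul, Module.End.mul_apply, he.aeval_eq, map_zero]
    have hcompl : IsCompl W Z :=
      (LinearMap.BilinForm.isCompl_orthogonal_iff_disjoint hs.isRefl).2 hdisj
    have hcp : LinearMap.charpoly T =
        LinearMap.charpoly (T.restrict hWT) * LinearMap.charpoly (T.restrict hZT) := by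
      rw [← LinearMap.charpoly_prodMap, ← LinearEquiv.charpoly_conj (W.prodEquivOfIsCompl Z hcompl)]
      congr 1
      refine LinearMap.ext fun v => ?_
      obtain ⟨⟨w, z⟩, rfl⟩ := (W.prodEquivOfIsCompl Z hcompl).surjective v
      rw [LinearEquiv.conj_apply_apply, LinearEquiv.symm_apply_apply]
      simp
    have hcW : LinearMap.charpoly (T.restrict hWT) = m a := by
      refine Polynomial.eq_of_monic_of_dvd_of_natDegree_le (hm a) (LinearMap.charpoly_monic _) ?_ ?_
      · refine he.dvd _ fun r => ?_
        have heW : e ∈ W := ⟨1, by simp [hφ]⟩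
        have := coe_aeval_restrict hWT (LinearMap.charpoly (T.restrict hWT)) ⟨e, heW⟩
        rw [LinearMap.aeval_self_charpoly] at this
        rw [← this]
        simp
      · rw [LinearMap.charpoly_natDegree]
        have hle : W ≤ (degreeLT F (m a).natDegree).map φ := by
          rintro _ ⟨p, rfl⟩
          refine ⟨p %ₘ m a, ?_, ?_⟩
          · rw [SetLike.mem_coe, mem_degreeLT, ← degree_eq_natDegree (hm a).ne_zero]
            exact degree_modByMonic_lt p (hm a)
          · conv_rhs => rw [← modByMonic_add_div p (m a)]
            rw [map_add, mul_comm, hφ (_ * _), map_mul, Module.End.mul_apply, he.aeval_eq, map_zero, add_zero]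
        have hfd : FiniteDimensional F (degreeLT F (m a).natDegree) :=
          Module.Finite.equiv (degreeLTEquiv F (m a).natDegree).symm
        refine (Submodule.finrank_mono hle).trans ((Submodule.finrank_map_le _ _).trans ?_)
        rw [(degreeLTEquiv F (m a).natDegree).finrank_eq, Module.finrank_fin_fun]
    rw [hcp, hcW] at hc
    have hBZ : (B.restrict Z).Nondegenerate := by
      refine LinearMap.BilinForm.nondegenerate_restrict_of_disjoint_orthogonal B hs.isRefl ?_
      rw [Submodule.disjoint_def]
      intro z hz hz'
      refine hB.2 z fun y => ?_
      obtain ⟨w, hw, z', hz'', rfl⟩ := Submodule.mem_sup.1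
        (show y ∈ W ⊔ Z by rw [hcompl.sup_eq_top]; trivial)
      have a1 : B w z = 0 := hz w hw
      have a2 : B z' z = 0 := hz' z' hz''
      rw [map_add, LinearMap.add_apply, a1, a2, add_zero]
    obtain ⟨e', he', horth⟩ := ih hBZ (hs.restrict Z) (T := T.restrict hZT) (fun x y => hT x y)
      (LinearMap.ext fun z => Subtype.ext (by rw [coe_aeval_restrict, hgT]; rfl))
      (mul_left_cancel₀ (hm a).ne_zero hc)
    have hne : ∀ ω ∈ s, ω ≠ a := fun ω hω h => ha (h ▸ hω)
    have hval : ∀ (ω) (p : F[X]), aeval T p (e' ω : V) = (aeval (T.restrict hZT) p (e' ω) : Z) :=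
      fun ω p => (coe_aeval_restrict hZT p (e' ω)).symm
    have hWZ : ∀ ω (p r : F[X]), B (aeval T p e) (aeval T r (e' ω : V)) = 0 := by
      intro ω p r
      rw [hval]
      exact (aeval (T.restrict hZT) r (e' ω)).2 _ ⟨p, rfl⟩
    refine ⟨fun ω => if ω = a then e else e' ω, fun ω hω => ?_, fun ω hω ω' hω' hωω' p r => ?_⟩
    · rcases Finset.mem_insert.1 hω with rfl | hω
      · simpa using he
      · simp only [hne ω hω, if_false]
        refine ⟨?_, fun p hp => (he' ω hω).2 p fun r => ?_⟩
        · rw [hval, (he' ω hω).1]; rfl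
        · rw [← hp r, hval, hval]; rfl
    · rcases Finset.mem_insert.1 hω with rfl | h1
      · rcases Finset.mem_insert.1 hω' with rfl | h2
        · exact absurd rfl hωω'
        · simp only [hne ω' h2, if_false, if_true]
          exact hWZ _ _ _
      · rcases Finset.mem_insert.1 hω' with rfl | h2
        · simp only [hne ω h1, if_false, if_true]
          rw [← hs.eq]
          exact hWZ _ _ _
        · simp only [hne ω h1, hne ω' h2, if_false]
          rw [hval, hval]
          exact horth ω h1 ω' h2 hωω' p r

end Cyclic

section

open Matrix

/-- The Gram matrix of the form `(x, y) ↦ c(x · σ y) + c(y · σ x)` for a functional with coordinates `c`,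
after base change along `φ`. -/
noncomputable def twist {K F E ι : Type*} [Field K] [Field F] [CommRing E] [Algebra K E] [Fintype ι] (φ : K →+* F)
    (b : Module.Basis ι K E) (σ : E →ₐ[K] E) (c : ι → F) : Matrix ι ι F :=
  Matrix.of fun i j => ∑ k, c k * φ (b.repr (b i * σ (b j) + b j * σ (b i)) k)

theorem gram_eq_mul {F V ι : Type*} [Field F] [AddCommGroup V] [Module F V] [Fintype ι] [DecidableEq ι]
    (b : Module.Basis ι F V) (B : LinearMap.BilinForm F V) (v : ι → V) :
    (b.toMatrix v)ᵀ * LinearMap.BilinForm.toMatrix b B * b.toMatrix v =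
      Matrix.of fun i j => B (v i) (v j) := by
  ext i j
  rw [Matrix.of_apply, LinearMap.BilinForm.apply_eq_dotProduct_toMatrix_mulVec b, Matrix.mul_assoc,
    Matrix.mul_apply]
  rfl

theorem Polynomial.reverse_map_field {K F : Type*} [Field K] [Field F] (φ : K →+* F) (f : K[X]) :
    (f.map φ).reverse = f.reverse.map φ := by
  ext n
  rw [coeff_map, coeff_reverse, coeff_reverse, natDegree_map, coeff_map]

namespace IsCyclicVec

variable {F V : Type*} [Field F] [AddCommGroup V] [Module F V]
  {B : LinearMap.BilinForm F V} {T : Module.End F V}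

theorem aeval_eq_of_dvd {f : F[X]} {e : V} (he : IsCyclicVec B T f e) {p r : F[X]} (h : f ∣ p - r) :
    aeval T p e = aeval T r e := by
  obtain ⟨c, hc⟩ := h
  rw [← sub_eq_zero, ← LinearMap.sub_apply, ← map_sub, hc, mul_comm, map_mul, Module.End.mul_apply,
    he.aeval_eq, map_zero]

theorem det_gram_ne_zero {f : F[X]} (hf : f.Monic) {e : V} (he : IsCyclicVec B T f e) {n : ℕ}
    (hn : f.natDegree = n) :
    (Matrix.of fun i j : Fin n => B ((T ^ (i : ℕ)) e) ((T ^ (j : ℕ)) e)).det ≠ 0 := by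
  intro h0
  obtain ⟨v, hv0, hv⟩ := Matrix.exists_vecMul_eq_zero_iff.2 h0
  let p : F[X] := ∑ i : Fin n, C (v i) * X ^ (i : ℕ)
  have hp : aeval T p e = ∑ i, v i • (T ^ (i : ℕ)) e := by
    simp [p, map_sum, LinearMap.sum_apply, Module.algebraMap_end_apply]
  have hdeg : p.degree < f.degree := by
    rw [degree_eq_natDegree hf.ne_zero, hn]
    exact degree_sum_fin_lt _
  have hdvd : f ∣ p := by
    refine he.dvd p fun r => ?_
    rw [he.aeval_eq_of_dvd (p := r) (r := r %ₘ f) (by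
      rw [modByMonic_eq_sub_mul_div, sub_sub_cancel]; exact dvd_mul_right _ _),
      aeval_eq_sum_range' (p := r %ₘ f) (n := n), LinearMap.sum_apply, map_sum, ← Fin.sum_univ_eq_sum_range
        (fun i => B (aeval T p e) (((r %ₘ f).coeff i • T ^ i) e))]
    · refine Finset.sum_eq_zero fun j _ => ?_
      have := congrFun hv j
      rw [LinearMap.smul_apply, map_smul, hp, map_sum, LinearMap.sum_apply]
      simp only [Matrix.vecMul, dotProduct, Matrix.of_apply, Pi.zero_apply] at this
      simp only [map_smul, LinearMap.smul_apply, smul_eq_mul, this, mul_zero]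
    · rw [← hn]
      by_cases h : f = 1
      · exfalso
        subst h
        rw [natDegree_one] at hn
        subst hn
        exact hv0 (Subsingleton.elim _ _)
      · exact natDegree_modByMonic_lt r hf h
  have hp0 : p = 0 := by
    by_contra hne
    exact absurd (degree_le_of_dvd hdvd hne) (not_le.2 hdeg)
  refine hv0 (funext fun i => ?_)
  have := congrArg (fun q : F[X] => q.coeff (i : ℕ)) hp0
  simpa [p, finsetSum_coeff, coeff_C_mul, coeff_X_pow, Fin.val_inj] using this

variable [NeZero (2 : F)]

theorem gram_eq_twist {K : Type*} [Field K] (φ : K →+* F) {f : K[X]} (hf : f.Monic)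
    (hT : ∀ x y, B (T x) (T y) = B x y) (hs : B.IsSymm)
    {e : V} (he : IsCyclicVec B T (f.map φ) e) (σ : AdjoinRoot f →ₐ[K] AdjoinRoot f)
    (hσ : AdjoinRoot.root f * σ (AdjoinRoot.root f) = 1) :
    (Matrix.of fun i j : Fin f.natDegree => B ((T ^ (i : ℕ)) e) ((T ^ (j : ℕ)) e)) =
      twist φ (AdjoinRoot.powerBasisAux' hf) σ fun k => B ((T ^ (k : ℕ)) e) e / 2 := by
  have hb : ∀ i : Fin f.natDegree, AdjoinRoot.powerBasisAux' hf i = AdjoinRoot.root f ^ (i : ℕ) := by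
    intro i
    exact (AdjoinRoot.powerBasis' hf).basis_eq_pow i
  have hrepr : ∀ p : K[X], ∑ k : Fin f.natDegree, B ((T ^ (k : ℕ)) e) e / 2 *
      φ ((AdjoinRoot.powerBasisAux' hf).repr (AdjoinRoot.mk f p) k) = B (aeval T (p.map φ) e) e / 2 := by
    intro p
    have h1 : aeval T (p.map φ) e = aeval T ((p %ₘ f).map φ) e := by
      refine he.aeval_eq_of_dvd ?_
      rw [← Polynomial.map_sub, modByMonic_eq_sub_mul_div, sub_sub_cancel]
      exact Polynomial.map_dvd φ (dvd_mul_right _ _)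
    have h2 : (p %ₘ f) = ∑ k : Fin f.natDegree, C ((p %ₘ f).coeff k) * X ^ (k : ℕ) := by
      conv_lhs => rw [← sum_modByMonic_coeff hf (n := f.natDegree) degree_le_natDegree (p := p)]
      simp [C_mul_X_pow_eq_monomial]
    rw [h1, h2, Polynomial.map_sum, map_sum, LinearMap.sum_apply, map_sum, LinearMap.sum_apply,
      Finset.sum_div]
    refine Finset.sum_congr rfl fun k _ => ?_
    rw [AdjoinRoot.powerBasisAux'_repr_apply_to_fun, AdjoinRoot.modByMonicHom_mk]
    simp [Module.algebraMap_end_apply]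
    ring
  have hij : ∀ i j : Fin f.natDegree, ∑ k : Fin f.natDegree, B ((T ^ (k : ℕ)) e) e / 2 * φ ((AdjoinRoot.powerBasisAux' hf).repr
      (AdjoinRoot.powerBasisAux' hf i * σ (AdjoinRoot.powerBasisAux' hf j)) k) =
      B ((T ^ (i : ℕ)) e) ((T ^ (j : ℕ)) e) / 2 := by
    intro i j
    obtain ⟨p, hp⟩ := AdjoinRoot.mk_surjective (AdjoinRoot.powerBasisAux' hf i * σ (AdjoinRoot.powerBasisAux' hf j))
    rw [← hp, hrepr, ← bilin_pow_pow hT j]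
    congr 3
    have h1 : AdjoinRoot.mk f (X ^ (j : ℕ) * p) = AdjoinRoot.mk f (X ^ (i : ℕ)) := by
      rw [map_mul, hp, hb, hb, map_pow, map_pow, map_pow, AdjoinRoot.mk_X, mul_left_comm, ← mul_pow, hσ,
        one_pow, mul_one]
    have h2 := he.aeval_eq_of_dvd (p := (X ^ (j : ℕ) * p).map φ) (r := (X ^ (i : ℕ)).map φ) (by
      rw [← Polynomial.map_sub]
      exact Polynomial.map_dvd φ (AdjoinRoot.mk_eq_mk.1 h1))
    simpa [Module.End.mul_apply] using h2
  ext i j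
  rw [twist, Matrix.of_apply, Matrix.of_apply]
  simp only [map_add, Finsupp.add_apply, mul_add, Finset.sum_add_distrib]
  rw [hij, hij, ← hs.eq ((T ^ (j : ℕ)) e), add_halves]

end IsCyclicVec

theorem exists_mc_twist {K F : Type*} [Field K] [Field F] [CharZero F] (φ : K →+* F)
    {Ω : Type*} [Fintype Ω] [DecidableEq Ω] (f : Ω → K[X]) (g : K[X])
    (hm : ∀ ω, (f ω).Monic) (hrev : ∀ ω, (f ω).reverse = f ω) (hsep : ∀ ω, (f ω).Separable)
    (h1 : ∀ ω, IsCoprime (f ω) (X ^ 2 - 1)) (hg : ∀ ω, ∃ k, f ω * k = g ∧ IsCoprime (f ω) k)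
    (σ : ∀ ω, AdjoinRoot (f ω) →ₐ[K] AdjoinRoot (f ω))
    (hσ : ∀ ω, AdjoinRoot.root (f ω) * σ ω (AdjoinRoot.root (f ω)) = 1)
    {V : Type*} [AddCommGroup V] [Module F V] [FiniteDimensional F V]
    (b : Module.Basis (Σ ω, Fin (f ω).natDegree) F V)
    {B : LinearMap.BilinForm F V} (hB : B.Nondegenerate) (hs : B.IsSymm) {T : Module.End F V}
    (hT : ∀ x y, B (T x) (T y) = B x y) (hgT : aeval T (g.map φ) = 0)
    (hc : LinearMap.charpoly T = ∏ ω, (f ω).map φ) :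
    ∃ c : ∀ ω, Fin (f ω).natDegree → F, MC (LinearMap.BilinForm.toMatrix b B)
      (Matrix.blockDiagonal' fun ω => twist φ (AdjoinRoot.powerBasisAux' (hm ω)) (σ ω) (c ω)) := by
  obtain ⟨e, he, horth⟩ := exists_isCyclicVec_family (fun ω => (f ω).map φ) (g.map φ)
    (fun ω => (hm ω).map φ) (fun ω => by rw [Polynomial.reverse_map_field, hrev])
    (fun ω => ((hsep ω).map).squarefree)
    (fun ω => by simpa using (h1 ω).map (mapRingHom φ))
    (fun ω => by
      obtain ⟨k, hk, hcop⟩ := hg ω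
      exact ⟨k.map φ, by rw [← Polynomial.map_mul, hk], hcop.map (mapRingHom φ)⟩)
    Finset.univ hB hs hT hgT hc
  refine ⟨fun ω k => B ((T ^ (k : ℕ)) (e ω)) (e ω) / 2, ?_⟩
  simp only [← fun ω => (he ω (Finset.mem_univ _)).gram_eq_twist φ (hm ω) hT hs (σ ω) (hσ ω)]
  refine (MC.of_mul (P := (b.toMatrix fun x : Σ ω, Fin (f ω).natDegree => (T ^ (x.2 : ℕ)) (e x.1))ᵀ)
    ?_ ?_).symm
  · rw [Matrix.transpose_transpose, gram_eq_mul]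
    ext ⟨ω, i⟩ ⟨ω', j⟩
    by_cases h : ω = ω'
    · subst h
      simp
    · rw [Matrix.blockDiagonal'_apply_ne _ _ _ h]
      simpa using horth ω (Finset.mem_univ _) ω' (Finset.mem_univ _) h (X ^ (i : ℕ)) (X ^ (j : ℕ))
  · rw [Matrix.det_blockDiagonal'_eq_prod]
    exact Finset.prod_ne_zero_iff.2 fun ω _ =>
      (he ω (Finset.mem_univ _)).det_gram_ne_zero ((hm ω).map φ) (natDegree_map φ)

end

namespace Place

variable {K E : Type u} [Field K] [NumberField K] [Field E] [NumberField E] [Algebra K E]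

theorem exists_over_hom_of_isometry {v : Place K} {Ω : Type*} [NormedField Ω] [CompleteSpace Ω]
    (hΩ : StdNorm Ω) (φ : E →+* Ω) (j : L v →+* Ω) (hj : ∀ x, ‖j x‖ = ‖x‖)
    (hφ : ∀ x : K, φ (algebraMap K E x) = j (ι v x)) :
    ∃ w : Place E, Over w v ∧ ∃ ψ : L w →+* Ω, ∀ x, ψ (ι w x) = φ x := by
  have hn : ∀ x : K, normAbv φ (algebraMap K E x) = abv v x := fun x => by
    rw [normAbv_apply, hφ, hj]; rfl
  obtain ⟨w, hw⟩ := exists_isEquiv hΩ φ (by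
    obtain ⟨x, hx0, hx⟩ := abv_isNontrivial v
    exact ⟨algebraMap K E x, (_root_.map_ne_zero _).2 hx0, by rwa [hn]⟩)
  obtain ⟨ψ, -, hψ⟩ := exists_completion_hom φ w hw
  refine ⟨w, fun x y => ?_, ψ, hψ⟩
  have := hw (algebraMap K E x) (algebraMap K E y)
  rw [hn, hn] at this
  exact this.symm

/-- A finite extension of a completion of `K` receiving `E` receives a completion of `E`. -/
theorem exists_over_hom (v : Place K) {Ω : Type*} [Field Ω] [Algebra (L v) Ω]
    [FiniteDimensional (L v) Ω] (φ : E →+* Ω)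
    (hφ : ∀ x : K, φ (algebraMap K E x) = algebraMap (L v) Ω (ι v x)) :
    ∃ w : Place E, Over w v ∧ ∃ ψ : L w →+* Ω, ∀ x, ψ (ι w x) = φ x := by
  let _ : NontriviallyNormedField (L v) :=
    { instNormedField v with non_trivial := exists_one_lt_norm v }
  rcases stdNorm v with hu | ⟨j, hj⟩
  · let _ : NormedField Ω := spectralNorm.normedField (L v) Ω
    have hc : CompleteSpace Ω := spectralNorm.completeSpace (L v) Ω
    have hult : IsUltrametricDist Ω :=
      IsUltrametricDist.isUltrametricDist_of_isNonarchimedean_norm isNonarchimedean_spectralNorm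
    exact exists_over_hom_of_isometry (Or.inl hult) φ (algebraMap (L v) Ω)
      (fun x => spectralNorm_extends x) hφ
  · let _ : Algebra (L v) ℂ := j.toAlgebra
    let J : Ω →ₐ[L v] ℂ := IsAlgClosed.lift
    let _ : NormedField Ω := NormedField.induced Ω ℂ J J.injective
    have hJ : ∀ x : Ω, ‖x‖ = ‖J x‖ := fun x => rfl
    have hJ' : ∀ x : L v, ‖algebraMap (L v) Ω x‖ = ‖x‖ := fun x => by
      rw [hJ, J.commutes, ← hj]; rfl
    let _ : NormedSpace (L v) Ω :=
      { (inferInstance : Module (L v) Ω) with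
        norm_smul_le := fun r x => by
          rw [Algebra.smul_def, norm_mul, hJ'] }
    have hc : CompleteSpace Ω := FiniteDimensional.complete (L v) Ω
    exact exists_over_hom_of_isometry (Or.inr ⟨J, fun x => rfl⟩) φ (algebraMap (L v) Ω) hJ' hφ

theorem exists_nrm_tensor (v : Place K) {d y : Eˣ} (h : ∀ w : Place E, Over w v → NrmAt w d y) :
    ∃ p q : L v ⊗[K] E, p ^ 2 - (1 ⊗ₜ[K] (d : E)) * q ^ 2 = 1 ⊗ₜ[K] (y : E) := by
  have : FiniteDimensional K E := Module.Finite.of_restrictScalars_finite ℚ K E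
  have := Algebra.FormallyEtale.of_isSeparable K E
  have : Algebra.FinitePresentation K E := Algebra.FinitePresentation.of_finiteType.1 inferInstance
  have : Algebra.Etale K E := { }
  obtain ⟨I, _, Ω, _, _, e, hΩ⟩ := (Algebra.Etale.iff_exists_algEquiv_prod (L v) (L v ⊗[K] E)).1
    inferInstance
  have key : ∀ i, ∃ p q : Ω i, p ^ 2 - e (1 ⊗ₜ[K] (d : E)) i * q ^ 2 = e (1 ⊗ₜ[K] (y : E)) i := by
    intro i
    have := (hΩ i).1
    let φ : E →+* Ω i := ((Pi.evalRingHom Ω i).comp (e : L v ⊗[K] E →+* ∀ i, Ω i)).comp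
      (Algebra.TensorProduct.includeRight : E →ₐ[K] L v ⊗[K] E).toRingHom
    obtain ⟨w, hw, ψ, hψ⟩ := exists_over_hom v φ fun x => by
      change e (1 ⊗ₜ[K] algebraMap K E x) i = _
      have h1 : (1 : L v) ⊗ₜ[K] algebraMap K E x = algebraMap (L v) (L v ⊗[K] E) (ι v x) := by
        rw [Algebra.algebraMap_eq_smul_one, ← TensorProduct.smul_tmul, Algebra.smul_def, mul_one]
        rfl
      rw [h1, e.commutes]
      rfl
    obtain ⟨p, q, hpq⟩ := h w hw
    refine ⟨ψ p, ψ q, ?_⟩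
    have := congrArg ψ hpq
    rwa [map_sub, map_pow, map_mul, map_pow, hψ, hψ] at this
  choose p q hpq using key
  refine ⟨e.symm p, e.symm q, e.injective ?_⟩
  rw [map_sub, map_pow, map_mul, map_pow, e.apply_symm_apply, e.apply_symm_apply]
  exact funext hpq

end Place

section

open Matrix

section Gram

variable {K E ι : Type*} [Field K] [CommRing E] [Algebra K E]

/-- The bilinear form `(x, y) ↦ s(x · σ y)`. -/
noncomputable def trForm (σ : E →ₐ[K] E) (s : E →ₗ[K] K) : LinearMap.BilinForm K E :=
  ((LinearMap.mul K E).compl₂ σ.toLinearMap).compr₂ s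

theorem trForm_apply (σ : E →ₐ[K] E) (s : E →ₗ[K] K) (x y : E) : trForm σ s x y = s (x * σ y) := rfl

variable [Fintype ι] [DecidableEq ι] (b : Module.Basis ι K E) (σ : E →ₐ[K] E)

/-- The Gram matrix of `trForm σ s`. -/
noncomputable def gramMat (s : E →ₗ[K] K) : Matrix ι ι K := LinearMap.BilinForm.toMatrix b (trForm σ s)

theorem gramMat_apply (s : E →ₗ[K] K) (i j : ι) : gramMat b σ s i j = s (b i * σ (b j)) := by
  rw [gramMat, LinearMap.BilinForm.toMatrix_apply, trForm_apply]

/-- The functional `z ↦ s(y z)`. -/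
noncomputable def mulFun (y : E) (s : E →ₗ[K] K) : E →ₗ[K] K := s ∘ₗ LinearMap.mulLeft K y

theorem mulFun_apply (y : E) (s : E →ₗ[K] K) (z : E) : mulFun y s z = s (y * z) := rfl

theorem mc_gram_mulFun (s : E →ₗ[K] K) (x y : E) (hxy : x * σ x = y)
    (h : (gramMat b σ (mulFun y s)).det ≠ 0) : MC (gramMat b σ (mulFun y s)) (gramMat b σ s) := by
  refine MC.of_mul (P := (b.toMatrix fun i => x * b i)ᵀ) ?_ h
  rw [transpose_transpose, gramMat, gram_eq_mul]
  ext i j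
  rw [of_apply, gramMat_apply, trForm_apply, mulFun_apply, map_mul σ, ← hxy]
  congr 1
  ring

/-- Base change of a functional. -/
noncomputable def funBase (F : Type*) [Field F] [Algebra K F] (s : E →ₗ[K] K) : F ⊗[K] E →ₗ[F] F :=
  (TensorProduct.AlgebraTensorModule.rid K F F).toLinearMap ∘ₗ s.baseChange F

theorem gram_baseChange (F : Type*) [Field F] [Algebra K F] (s : E →ₗ[K] K) :
    gramMat (b.baseChange F) (Algebra.TensorProduct.map (AlgHom.id F F) σ) (funBase F s) =
      (gramMat b σ s).map (algebraMap K F) := by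
  ext i j
  rw [gramMat_apply, map_apply, gramMat_apply]
  simp [funBase, Algebra.algebraMap_eq_smul_one]

theorem mulFun_baseChange (F : Type*) [Field F] [Algebra K F] (y : E) (s : E →ₗ[K] K) :
    funBase F (mulFun y s) = mulFun (1 ⊗ₜ[K] y) (funBase F s) := by
  ext z
  simp [funBase, mulFun_apply]

theorem det_gram_mulFun (s : E →ₗ[K] K) (y : E) :
    (gramMat b σ (mulFun y s)).det = Algebra.norm K y * (gramMat b σ s).det := by
  rw [Algebra.norm_eq_matrix_det b, ← Matrix.det_transpose (Algebra.leftMulMatrix b y), ← Matrix.det_mul]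
  congr 1
  ext i j
  rw [gramMat_apply, mul_apply, mulFun_apply, ← mul_assoc]
  conv_lhs => rw [← b.sum_repr (y * b i)]
  rw [Finset.sum_mul, map_sum]
  refine Finset.sum_congr rfl fun k _ => ?_
  rw [transpose_apply, Algebra.leftMulMatrix_eq_repr_mul, gramMat_apply, smul_mul_assoc, map_smul,
    smul_eq_mul]

theorem isSymm_gram (hσ : ∀ z, σ (σ z) = z) {s : E →ₗ[K] K} (hs : ∀ z, s (σ z) = s z) :
    (gramMat b σ s).IsSymm := by
  ext i j
  rw [transpose_apply, gramMat_apply, gramMat_apply, ← hs, map_mul, hσ, mul_comm]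

/-- The functional with coordinates `c`, symmetrized. -/
noncomputable def symFun (c : ι → K) : E →ₗ[K] K :=
  (b.constr K c) + (b.constr K c) ∘ₗ σ.toLinearMap

theorem symFun_conj (hσ : ∀ z, σ (σ z) = z) (c : ι → K) (z : E) :
    symFun b σ c (σ z) = symFun b σ c z := by
  simp [symFun, hσ, add_comm]

theorem twist_map {F : Type*} [Field F] (hσ : ∀ z, σ (σ z) = z) (φ : K →+* F) (c : ι → K) :
    (gramMat b σ (symFun b σ c)).map φ = twist φ b σ (fun i => φ (c i)) := by
  ext i j
  rw [map_apply, gramMat_apply, twist, of_apply]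
  simp only [symFun, LinearMap.add_apply, LinearMap.comp_apply, AlgHom.toLinearMap_apply, map_mul, hσ]
  rw [← map_add, Module.Basis.constr_apply_fintype, map_sum]
  refine Finset.sum_congr rfl fun k _ => ?_
  rw [smul_eq_mul, map_mul, mul_comm, Module.Basis.equivFun_apply, mul_comm (b j)]

end Gram

section Field

variable {K E ι : Type*} [Field K] [Field E] [Algebra K E] [Fintype ι] [DecidableEq ι]
  (b : Module.Basis ι K E) (σ : E →ₐ[K] E)

theorem det_gram_ne_zero (hσ : ∀ z, σ (σ z) = z) {s : E →ₗ[K] K} (hs : s ≠ 0) : (gramMat b σ s).det ≠ 0 := by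
  intro h0
  obtain ⟨v, hv0, hv⟩ := exists_vecMul_eq_zero_iff.2 h0
  set x := ∑ i, v i • b i with hx
  have hx0 : x ≠ 0 := by
    intro h
    refine hv0 (funext fun i => ?_)
    exact Fintype.linearIndependent_iff.1 b.linearIndependent v h i
  have h1 : ∀ j, s (x * σ (b j)) = 0 := by
    intro j
    have := congrFun hv j
    simp only [vecMul, dotProduct, Pi.zero_apply, gramMat_apply] at this
    rw [hx, Finset.sum_mul, map_sum, ← this]
    exact Finset.sum_congr rfl fun i _ => by rw [smul_mul_assoc, map_smul, smul_eq_mul]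
  have h2 : s ∘ₗ LinearMap.mulLeft K x ∘ₗ σ.toLinearMap = 0 := b.ext fun j => h1 j
  refine hs (LinearMap.ext fun z => ?_)
  have := LinearMap.congr_fun h2 (σ (x⁻¹ * z))
  simpa [hσ, hx0] using this

theorem exists_mulFun_eq [FiniteDimensional K E] {s : E →ₗ[K] K} (hs : s ≠ 0) (s' : E →ₗ[K] K) :
    ∃ y : E, s' = mulFun y s := by
  let Φ : E →ₗ[K] Module.Dual K E := LinearMap.compr₂ (LinearMap.mul K E) s
  have hinj : Function.Injective Φ := by
    rw [injective_iff_map_eq_zero]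
    intro y hy
    by_contra hy0
    refine hs (LinearMap.ext fun z => ?_)
    have := LinearMap.congr_fun hy (y⁻¹ * z)
    simpa [Φ, hy0] using this
  obtain ⟨y, hy⟩ := (LinearMap.injective_iff_surjective_of_finrank_eq_finrank
    (Subspace.dual_finrank_eq (K := K) (V := E)).symm).1 hinj s'
  exact ⟨y, hy.symm⟩

/-- The fixed field of `σ`. -/
def fixedBy : IntermediateField K E where
  carrier := {x | σ x = x}
  mul_mem' {a b} ha hb := by
    change σ (a * b) = a * b
    rw [map_mul, ha, hb]
  add_mem' {a b} ha hb := by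
    change σ (a + b) = a + b
    rw [map_add, ha, hb]
  algebraMap_mem' r := σ.commutes r
  inv_mem' x hx := by
    change σ x⁻¹ = x⁻¹
    rw [map_inv₀, hx]

theorem mem_fixedBy {x : E} : x ∈ fixedBy σ ↔ σ x = x := Iff.rfl

theorem exists_mulFun_fixedBy_eq [FiniteDimensional K E] (hσ : ∀ z, σ (σ z) = z) {s s' : E →ₗ[K] K}
    (hs : s ≠ 0) (hs' : s' ≠ 0) (h : ∀ z, s (σ z) = s z) (h' : ∀ z, s' (σ z) = s' z) :
    ∃ y : (fixedBy σ)ˣ, s' = mulFun ((y : fixedBy σ) : E) s := by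
  obtain ⟨y, hy⟩ := exists_mulFun_eq hs s'
  have hfix : σ y = y := by
    by_contra hne
    have hne : σ y - y ≠ 0 := sub_ne_zero.2 hne
    refine hs (LinearMap.ext fun z => ?_)
    have key : ∀ z, s ((σ y - y) * z) = 0 := by
      intro z
      have h1 := h' z
      rw [hy, mulFun_apply, mulFun_apply, ← h, map_mul, hσ] at h1
      rw [sub_mul, map_sub, h1, sub_self]
    simpa [hne] using key ((σ y - y)⁻¹ * z)
  have hy0 : y ≠ 0 := by
    rintro rfl
    exact hs' (by rw [hy]; ext z; simp [mulFun_apply])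
  exact ⟨Units.mk0 ⟨y, hfix⟩ (fun h0 => hy0 (congrArg Subtype.val h0)), hy⟩

theorem isSquare_norm_fixedBy [NeZero (2 : K)] [FiniteDimensional K E] (hσ : ∀ z, σ (σ z) = z) (hσ1 : ∃ z, σ z ≠ z)
    (y : fixedBy σ) : IsSquare (Algebra.norm K (y : E)) := by
  obtain ⟨z₀, hz₀⟩ := hσ1
  have h2 : (2 : E) ≠ 0 := by
    have := (_root_.map_ne_zero (algebraMap K E)).2 (NeZero.ne (2 : K))
    rwa [_root_.map_ofNat] at this
  set θ := z₀ - σ z₀ with hθ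
  have hθ0 : θ ≠ 0 := sub_ne_zero.2 (Ne.symm hz₀)
  have hθσ : σ θ = -θ := by rw [hθ, map_sub, hσ, neg_sub]
  have hli : LinearIndependent (fixedBy σ) ![1, θ] := by
    rw [LinearIndependent.pair_iff]
    intro p q hpq
    simp only [IntermediateField.smul_def, smul_eq_mul, mul_one] at hpq
    have h3 := congrArg σ hpq
    rw [map_add, map_mul, hθσ, (mem_fixedBy σ).1 p.2, (mem_fixedBy σ).1 q.2, map_zero] at h3
    have hp : 2 * (p : E) = 0 := by linear_combination hpq + h3
    have hp : (p : E) = 0 := (mul_eq_zero.1 hp).resolve_left h2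
    refine ⟨Subtype.ext hp, Subtype.ext ?_⟩
    rw [hp, zero_add] at hpq
    exact (mul_eq_zero.1 hpq).resolve_right hθ0
  have hsp : ⊤ ≤ Submodule.span (fixedBy σ) (Set.range ![1, θ]) := by
    rintro z -
    have h1 : σ ((z + σ z) / 2) = (z + σ z) / 2 := by
      rw [map_div₀, map_add, hσ, _root_.map_ofNat, add_comm]
    have h3 : σ ((z - σ z) / (2 * θ)) = (z - σ z) / (2 * θ) := by
      rw [map_div₀, map_sub, hσ, map_mul, _root_.map_ofNat, hθσ]
      field_simp
      ring
    have : z = (⟨_, h1⟩ : fixedBy σ) • (1 : E) + (⟨_, h3⟩ : fixedBy σ) • θ := by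
      simp only [IntermediateField.smul_def, smul_eq_mul, mul_one]
      field_simp
      ring
    rw [this]
    exact Submodule.add_mem _ (Submodule.smul_mem _ _ (Submodule.subset_span ⟨0, rfl⟩))
      (Submodule.smul_mem _ _ (Submodule.subset_span ⟨1, rfl⟩))
  have hfr : Module.finrank (fixedBy σ) E = 2 := by
    rw [Module.finrank_eq_card_basis (Module.Basis.mk hli hsp), Fintype.card_fin]
  have h4 : Algebra.norm (fixedBy σ) (y : E) = y ^ 2 := by
    rw [← hfr]
    exact Algebra.norm_algebraMap y
  rw [← Algebra.norm_norm (S := fixedBy σ) (a := (y : E)), h4, map_pow]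
  exact ⟨_, sq _⟩

end Field

namespace Place

variable {K E : Type u} [Field K] [NumberField K] [Field E] [NumberField E] [Algebra K E]
  {ι' : Type*} [Fintype ι'] [DecidableEq ι'] (b : Module.Basis ι' K E) (σ : E →ₐ[K] E)

/-- `d` is the square of an element negated by `σ`. -/
def IsDisc (d : (fixedBy σ)ˣ) : Prop := ∃ θ : E, σ θ = -θ ∧ ((d : fixedBy σ) : E) = θ ^ 2

theorem exists_isDisc (hσ : ∀ z, σ (σ z) = z) (h1 : ∃ z, σ z ≠ z) : ∃ d : (fixedBy σ)ˣ, IsDisc σ d := by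
  obtain ⟨z, hz⟩ := h1
  have hθ : σ (z - σ z) = -(z - σ z) := by rw [map_sub, hσ, neg_sub]
  have hfix : (z - σ z) ^ 2 ∈ fixedBy σ := by
    rw [mem_fixedBy, map_pow, hθ, neg_sq]
  refine ⟨Units.mk0 ⟨_, hfix⟩ fun h0 => ?_, z - σ z, hθ, rfl⟩
  exact pow_ne_zero 2 (sub_ne_zero.2 (Ne.symm hz)) (congrArg Subtype.val h0)

theorem mulFun_ne_zero {y : E} (hy : y ≠ 0) {s : E →ₗ[K] K} (hs : s ≠ 0) : mulFun y s ≠ 0 := by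
  intro h
  refine hs (LinearMap.ext fun z => ?_)
  have := LinearMap.congr_fun h (y⁻¹ * z)
  rwa [mulFun_apply, mul_inv_cancel_left₀ hy] at this

theorem coe_unit_ne_zero (y : (fixedBy σ)ˣ) : ((y : fixedBy σ) : E) ≠ 0 := fun h =>
  y.ne_zero (Subtype.ext h)

theorem mc_of_forall_nrmAt (hσ : ∀ z, σ (σ z) = z) {d : (fixedBy σ)ˣ} (hd : IsDisc σ d)
    {s : E →ₗ[K] K} (hs : s ≠ 0) (v : Place K) {y : (fixedBy σ)ˣ}
    (h : ∀ w : Place (fixedBy σ), Over w v → NrmAt w d y) :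
    MC ((gramMat b σ (mulFun ((y : fixedBy σ) : E) s)).map (Place.ι v)) ((gramMat b σ s).map (Place.ι v)) := by
  obtain ⟨θ, hθ, hdθ⟩ := hd
  obtain ⟨p, q, hpq⟩ := exists_nrm_tensor v h
  let J : L v ⊗[K] fixedBy σ →ₐ[L v] L v ⊗[K] E :=
    Algebra.TensorProduct.map (AlgHom.id (L v) (L v)) (fixedBy σ).val
  let τ : L v ⊗[K] E →ₐ[L v] L v ⊗[K] E := Algebra.TensorProduct.map (AlgHom.id (L v) (L v)) σ
  have hτJ : ∀ z, τ (J z) = J z := by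
    intro z
    induction z with
    | zero => simp
    | add x y hx hy => rw [map_add, map_add, hx, hy]
    | tmul a x =>
      simp only [τ, J, Algebra.TensorProduct.map_tmul]
      congr 1
      exact x.2
  have hdet : ((gramMat b σ (mulFun ((y : fixedBy σ) : E) s)).map (Place.ι v)).det ≠ 0 := by
    rw [← RingHom.mapMatrix_apply, ← RingHom.map_det]
    exact (_root_.map_ne_zero _).2
      (det_gram_ne_zero b σ hσ (mulFun_ne_zero (coe_unit_ne_zero σ y) hs))
  have e1 := gram_baseChange b σ (L v) (mulFun ((y : fixedBy σ) : E) s)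
  have e2 := gram_baseChange b σ (L v) s
  rw [← e1] at hdet ⊢
  rw [← e2]
  rw [mulFun_baseChange] at hdet ⊢
  refine mc_gram_mulFun _ _ _ (J p + (1 ⊗ₜ θ) * J q) _ ?_ hdet
  change (J p + (1 ⊗ₜ θ) * J q) * τ (J p + (1 ⊗ₜ θ) * J q) = _
  have hτθ : τ (1 ⊗ₜ θ) = - (1 ⊗ₜ θ) := by
    simp only [τ, Algebra.TensorProduct.map_tmul, hθ, map_one, TensorProduct.tmul_neg]
  have hJd : J (1 ⊗ₜ (d : fixedBy σ)) = (1 ⊗ₜ θ) ^ 2 := by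
    simp only [J, Algebra.TensorProduct.map_tmul, map_one, Algebra.TensorProduct.tmul_pow, one_pow, ← hdθ]
    rfl
  have hJy : J (1 ⊗ₜ (y : fixedBy σ)) = 1 ⊗ₜ ((y : fixedBy σ) : E) := by
    simp only [J, Algebra.TensorProduct.map_tmul, map_one]
    rfl
  have := congrArg J hpq
  rw [sq, sq, map_sub, map_mul, map_mul, map_mul, hJd, hJy] at this
  rw [map_add, map_mul, hτJ, hτJ, hτθ, ← this]
  ring

/-- Functionals giving nondegenerate symmetric forms. -/
def IsSymFun (s : E →ₗ[K] K) : Prop := s ≠ 0 ∧ ∀ z, s (σ z) = s z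

theorem IsSymFun.mulFun {s : E →ₗ[K] K} (hs : IsSymFun σ s) (y : (fixedBy σ)ˣ) :
    IsSymFun σ (mulFun ((y : fixedBy σ) : E) s) := by
  refine ⟨mulFun_ne_zero (coe_unit_ne_zero σ y) hs.1, fun z => ?_⟩
  rw [mulFun_apply, mulFun_apply, ← hs.2 (_ * z), map_mul σ, (mem_fixedBy σ).1 (y : fixedBy σ).2]

theorem exists_change (hσ : ∀ z, σ (σ z) = z) {d : (fixedBy σ)ˣ} (hd : IsDisc σ d)
    {s s'' : E →ₗ[K] K} (hs : IsSymFun σ s) (hs'' : IsSymFun σ s'') {v u : Place K} (huv : u ≠ v)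
    {w₀ : Place (fixedBy σ)} (hw₀ : ¬ SqAt w₀ d) (hw₀u : Over w₀ u) :
    ∃ s' : E →ₗ[K] K, IsSymFun σ s' ∧
      MC ((gramMat b σ s').map (Place.ι v)) ((gramMat b σ s'').map (Place.ι v)) ∧
      ∀ v', v' ≠ v → v' ≠ u →
        MC ((gramMat b σ s').map (Place.ι v')) ((gramMat b σ s).map (Place.ι v')) := by
  classical
  have : FiniteDimensional K E := Module.Finite.of_restrictScalars_finite ℚ K E
  obtain ⟨y, rfl⟩ := exists_mulFun_fixedBy_eq σ hσ hs.1 hs''.1 hs.2 hs''.2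
  let T : Finset (Place (fixedBy σ)) := (finite_over (E := fixedBy σ) v).toFinset.filter fun w => ¬ NrmAt w d y
  have hT : ∀ w, w ∈ T ↔ Over w v ∧ ¬ NrmAt w d y := by
    intro w
    simp only [T, Finset.mem_filter, Set.Finite.mem_toFinset, Set.mem_ofPred_eq]
  obtain ⟨c, hc⟩ := exists_forall_ne hw₀ T fun w hw hsq => ((hT w).1 hw).2 (hsq.nrmAt y)
  have hne : ∀ {w v'}, Over w v' → v' ≠ u → w ≠ w₀ := by
    rintro w v' hw hv' rfl
    exact hv' (hw.unique hw₀u)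
  refine ⟨mulFun ((c : fixedBy σ) : E) s, hs.mulFun σ c, ?_, fun v' hv' hu' => ?_⟩
  · have h1 : mulFun ((c : fixedBy σ) : E) s =
        mulFun (((c / y : (fixedBy σ)ˣ) : fixedBy σ) : E) (mulFun ((y : fixedBy σ) : E) s) := by
      ext z
      rw [mulFun_apply, mulFun_apply, mulFun_apply, ← mul_assoc]
      congr 2
      rw [← IntermediateField.coe_mul, ← Units.val_mul, mul_div_cancel]
    rw [h1]
    refine mc_of_forall_nrmAt b σ hσ hd (hs.mulFun σ y).1 v fun w hw => ?_
    have h2 := hc w (hne hw huv.symm)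
    rw [hT] at h2
    have h3 : NrmAt w d c ↔ NrmAt w d y := by rw [h2]; tauto
    have h4 := isNrm_mul_iff (ι_ne_zero w d) (ι_ne_zero w (c / y)) (ι_ne_zero w y)
    rw [← map_mul, ← Units.val_mul, div_mul_cancel] at h4
    unfold NrmAt at h3 ⊢
    tauto
  · refine mc_of_forall_nrmAt b σ hσ hd hs.1 v' fun w hw => ?_
    rw [hc w (hne hw hu'), hT]
    exact fun h => hv' (hw.unique h.1)

variable {K E M : Type u} [Field K] [NumberField K] [Field E] [NumberField E] [Algebra K E]
  [Field M] [NumberField M] [Algebra K M]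

theorem exists_over_of_algHom (j : E →ₐ[K] M) {W : Place M} {u : Place K} (hW : Over W u) :
    ∃ w : Place E, Over w u ∧ ∀ d : Eˣ, SqAt w d → SqAt W (Units.map (j : E →* M) d) := by
  let _ : Algebra E M := j.toRingHom.toAlgebra
  obtain ⟨w, hw⟩ := exists_over (K := E) W
  obtain ⟨u', hu'⟩ := exists_over (K := K) w
  have h1 : Over W u' := fun x y => by
    refine (hu' x y).trans ((hw (algebraMap K E x) (algebraMap K E y)).trans ?_)
    change ‖Place.ι W (j (algebraMap K E x))‖ ≤ ‖Place.ι W (j (algebraMap K E y))‖ ↔ _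
    rw [j.commutes, j.commutes]
    rfl
  obtain rfl := hW.unique h1
  refine ⟨w, hu', fun d hd => ?_⟩
  obtain ⟨ψ, -, hψ⟩ := hw.exists_hom
  obtain ⟨r, hr⟩ := hd
  exact ⟨ψ r, by rw [← map_mul, ← hr, hψ]; rfl⟩

/-- The map induced on fixed fields. -/
def fixedMap {σ : E →ₐ[K] E} {τ : M →ₐ[K] M} (j : E →ₐ[K] M) (hj : ∀ z, τ (j z) = j (σ z)) :
    fixedBy σ →ₐ[K] fixedBy τ :=
  (j.comp (fixedBy σ).val).codRestrict (fixedBy τ).toSubalgebra fun z => by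
    change τ (j z) = j z
    rw [hj, (mem_fixedBy σ).1 z.2]

theorem exists_common_place {E' : Type u} [Field E'] [NumberField E'] [Algebra K E']
    {σ : E →ₐ[K] E} {σ' : E' →ₐ[K] E'} {τ : M →ₐ[K] M} (j : E →ₐ[K] M) (hj : ∀ z, τ (j z) = j (σ z))
    (j' : E' →ₐ[K] M) (hj' : ∀ z, τ (j' z) = j' (σ' z)) {d : (fixedBy σ)ˣ} (hd : IsDisc σ d)
    {d' : (fixedBy σ')ˣ} (hd' : IsDisc σ' d') (S : Finset (Place K)) :
    ∃ u ∉ S, (∃ w : Place (fixedBy σ), Over w u ∧ ¬ SqAt w d) ∧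
      ∃ w : Place (fixedBy σ'), Over w u ∧ ¬ SqAt w d' := by
  obtain ⟨θ, hθ, hdθ⟩ := hd
  obtain ⟨θ', hθ', hdθ'⟩ := hd'
  let h := fixedMap j hj
  let h' := fixedMap j' hj'
  set D : (fixedBy τ)ˣ := Units.map (h : fixedBy σ →* fixedBy τ) d with hD
  set D' : (fixedBy τ)ˣ := Units.map (h' : fixedBy σ' →* fixedBy τ) d' with hD'
  have hDM : ((D : fixedBy τ) : M) = j θ ^ 2 := by
    rw [← map_pow, ← hdθ]; rfl
  have hDM' : ((D' : fixedBy τ) : M) = j' θ' ^ 2 := by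
    rw [← map_pow, ← hdθ']; rfl
  have hτθ : τ (j θ) = - j θ := by rw [hj, hθ, map_neg]
  have hτθ' : τ (j' θ') = - j' θ' := by rw [hj', hθ', map_neg]
  have hnsq : ¬ IsSquare (D : fixedBy τ) := by
    rintro ⟨x, hx⟩
    have hx' : j θ ^ 2 = (x : M) ^ 2 := by rw [← hDM, hx, sq]; rfl
    have h0 : j θ ≠ 0 := fun h0 => coe_unit_ne_zero τ D (by rw [hDM, h0]; ring)
    have hxτ := (mem_fixedBy τ).1 x.2
    have : τ (j θ) = j θ := by
      rcases sq_eq_sq_iff_eq_or_eq_neg.1 hx' with h1 | h1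
      · rw [h1, hxτ]
      · rw [h1, map_neg, hxτ]
    exact h0 (self_eq_neg.1 (this.symm.trans hτθ))
  obtain ⟨W, hWS, hW⟩ : ∃ W ∉ above (fixedBy τ) S, ¬ SqAt W D := by
    by_contra! hc
    exact hnsq (isSquare_of_forall_sqAt D _ hc)
  have hW' : ¬ SqAt W D' := by
    rintro ⟨r, hr⟩
    apply hW
    have hfix : j θ / j' θ' ∈ fixedBy τ := by
      rw [mem_fixedBy, map_div₀, hτθ, hτθ', neg_div_neg_eq]
    have h1 : (D : fixedBy τ) = D' * (⟨_, hfix⟩ * ⟨_, hfix⟩) := by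
      refine Subtype.ext ?_
      have h0 : j' θ' ≠ 0 := fun h0 => coe_unit_ne_zero τ D' (by rw [hDM', h0]; ring)
      change ((D : fixedBy τ) : M) = ((D' : fixedBy τ) : M) * (j θ / j' θ' * (j θ / j' θ'))
      rw [hDM, hDM']
      field_simp
    refine ⟨r * Place.ι W ⟨_, hfix⟩, ?_⟩
    rw [h1, map_mul, map_mul, hr]
    ring
  obtain ⟨u, hu⟩ := exists_over (K := K) W
  obtain ⟨w, hw, hw1⟩ := exists_over_of_algHom h hu
  obtain ⟨w', hw', hw1'⟩ := exists_over_of_algHom h' hu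
  exact ⟨u, fun huS => hWS (mem_above.2 ⟨u, huS, hu⟩), ⟨w, hw, fun h => hW (hw1 d h)⟩,
    ⟨w', hw', fun h => hW' (hw1' d' h)⟩⟩

section Family

variable {K : Type u} [Field K] [NumberField K] {Ω : Type*} [Fintype Ω] [DecidableEq Ω]
  {ι' : Ω → Type*} [∀ ω, Fintype (ι' ω)] [∀ ω, DecidableEq (ι' ω)]
  {E : Ω → Type u} [∀ ω, Field (E ω)] [∀ ω, NumberField (E ω)] [∀ ω, Algebra K (E ω)]
  (b : ∀ ω, Module.Basis (ι' ω) K (E ω)) (σ : ∀ ω, E ω →ₐ[K] E ω)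

/-- The orthogonal sum of the forms attached to a family of functionals. -/
noncomputable def gramSum (s : ∀ ω, E ω →ₗ[K] K) : Matrix (Σ ω, ι' ω) (Σ ω, ι' ω) K :=
  Matrix.blockDiagonal' fun ω => gramMat (b ω) (σ ω) (s ω)

theorem gramSum_map {F : Type*} [Field F] (φ : K →+* F) (s : ∀ ω, E ω →ₗ[K] K) :
    (gramSum b σ s).map φ = Matrix.blockDiagonal' fun ω => (gramMat (b ω) (σ ω) (s ω)).map φ := by
  rw [gramSum, Matrix.blockDiagonal'_map _ _ (map_zero φ)]

theorem isSymm_blockDiagonal' {F : Type*} [Field F] {M : ∀ ω, Matrix (ι' ω) (ι' ω) F}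
    (h : ∀ ω, (M ω).IsSymm) : (Matrix.blockDiagonal' M).IsSymm := by
  rw [Matrix.IsSymm, Matrix.blockDiagonal'_transpose]
  congr 1
  exact funext h

theorem det_map_ne_zero {m : Type*} [Fintype m] [DecidableEq m] {M : Matrix m m K} (h : M.det ≠ 0)
    (v : Place K) : (M.map (Place.ι v)).det ≠ 0 := by
  rw [← RingHom.mapMatrix_apply, ← RingHom.map_det]
  exact (_root_.map_ne_zero _).2 h

theorem det_map_eq {m : Type*} [Fintype m] [DecidableEq m] (M : Matrix m m K)
    (v : Place K) : (M.map (Place.ι v)).det = Place.ι v M.det := by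
  rw [← RingHom.mapMatrix_apply, ← RingHom.map_det]

variable {b σ}

theorem isSymm_gramSum (hσ : ∀ ω z, σ ω (σ ω z) = z) {s : ∀ ω, E ω →ₗ[K] K}
    (hs : ∀ ω, IsSymFun (σ ω) (s ω)) : (gramSum b σ s).IsSymm :=
  isSymm_blockDiagonal' fun ω => isSymm_gram (b ω) (σ ω) (hσ ω) (hs ω).2

theorem det_gramSum_ne_zero (hσ : ∀ ω z, σ ω (σ ω z) = z) {s : ∀ ω, E ω →ₗ[K] K}
    (hs : ∀ ω, IsSymFun (σ ω) (s ω)) : (gramSum b σ s).det ≠ 0 := by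
  rw [gramSum, Matrix.det_blockDiagonal'_eq_prod]
  exact Finset.prod_ne_zero_iff.2 fun ω _ => det_gram_ne_zero (b ω) (σ ω) (hσ ω) (hs ω).1

theorem isSquare_det_gramSum (hσ : ∀ ω z, σ ω (σ ω z) = z) {s s' : ∀ ω, E ω →ₗ[K] K}
    (hs : ∀ ω, IsSymFun (σ ω) (s ω)) (hs' : ∀ ω, IsSymFun (σ ω) (s' ω))
    (h1 : ∀ ω, ∃ z, σ ω z ≠ z) :
    IsSquare ((gramSum b σ s).det * (gramSum b σ s').det) := by
  rw [gramSum, gramSum, Matrix.det_blockDiagonal'_eq_prod, Matrix.det_blockDiagonal'_eq_prod,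
    ← Finset.prod_mul_distrib]
  refine Finset.isSquare_prod _ fun ω _ => ?_
  have : FiniteDimensional K (E ω) := Module.Finite.of_restrictScalars_finite ℚ K (E ω)
  obtain ⟨y, hy⟩ := exists_mulFun_fixedBy_eq (σ ω) (hσ ω) (hs ω).1 (hs' ω).1 (hs ω).2 (hs' ω).2
  rw [hy, det_gram_mulFun]
  obtain ⟨r, hr⟩ := isSquare_norm_fixedBy (σ ω) (hσ ω) (h1 ω) (y : fixedBy (σ ω))
  exact ⟨r * (gramMat (b ω) (σ ω) (s ω)).det, by rw [hr]; ring⟩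

theorem isSymm_twist {F E ι : Type*} [Field F] [CommRing E] [Algebra K E] [Fintype ι] (φ : K →+* F)
    (b : Module.Basis ι K E) (σ : E →ₐ[K] E) (c : ι → F) : (twist φ b σ c).IsSymm := by
  ext i j
  simp only [transpose_apply, twist, of_apply, add_comm]

/-- The matrix `B` is locally an orthogonal sum of forms attached to functionals. -/
def LocSum (b : ∀ ω, Module.Basis (ι' ω) K (E ω)) (σ : ∀ ω, E ω →ₐ[K] E ω)
    (B : Matrix (Σ ω, ι' ω) (Σ ω, ι' ω) K) (v : Place K) : Prop :=
  ∃ c : ∀ ω, ι' ω → L v, MC (B.map (Place.ι v))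
    (Matrix.blockDiagonal' fun ω => twist (Place.ι v) (b ω) (σ ω) (c ω))

variable {B : Matrix (Σ ω, ι' ω) (Σ ω, ι' ω) K}

theorem exists_approx (hσ : ∀ ω z, σ ω (σ ω z) = z) (hB : B.det ≠ 0) (S : Finset (Place K))
    (hS : S.Nonempty) (hloc : ∀ v ∈ S, LocSum b σ B v) :
    ∃ s : ∀ ω, E ω →ₗ[K] K, (∀ ω, IsSymFun (σ ω) (s ω)) ∧
      ∀ v ∈ S, MC (B.map (Place.ι v)) ((gramSum b σ s).map (Place.ι v)) := by
  let A : ∀ v : Place K, ((Σ ω, ι' ω) → L v) → Matrix (Σ ω, ι' ω) (Σ ω, ι' ω) (L v) := fun v c =>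
    Matrix.blockDiagonal' fun ω => twist (Place.ι v) (b ω) (σ ω) fun i => c ⟨ω, i⟩
  have hA : ∀ v, Continuous (A v) := by
    intro v
    refine Continuous.matrix_blockDiagonal' (continuous_pi fun ω => continuous_matrix fun i j => ?_)
    simp only [twist, of_apply]
    fun_prop
  obtain ⟨a, ha⟩ := weak_approx S (fun v => {c | MC (B.map (Place.ι v)) (A v c)})
    (fun v hv => by
      rw [isOpen_iff_mem_nhds]
      intro c hc
      have h1 := eventually_mc (isOpen_sq v) (A v c)
        (isSymm_blockDiagonal' fun ω => isSymm_twist _ _ _ _) (hc.det_ne_zero (det_map_ne_zero hB v))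
      filter_upwards [(hA v).continuousAt.eventually h1] with c' hc'
      exact hc.trans (hc' (isSymm_blockDiagonal' fun ω => isSymm_twist _ _ _ _)).symm)
    (fun v hv => by
      obtain ⟨c, hc⟩ := hloc v hv
      exact ⟨fun x => c x.1 x.2, hc⟩)
  have h2 : ∀ v ∈ S, MC (B.map (Place.ι v))
      ((gramSum b σ fun ω => symFun (b ω) (σ ω) fun i => a ⟨ω, i⟩).map (Place.ι v)) := by
    intro v hv
    rw [gramSum_map, funext fun ω => twist_map (b ω) (σ ω) (hσ ω) (Place.ι v) fun i => a ⟨ω, i⟩]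
    exact ha v hv
  refine ⟨_, fun ω => ⟨fun h0 => ?_, symFun_conj (b ω) (σ ω) (hσ ω) _⟩, h2⟩
  obtain ⟨v, hv⟩ := hS
  have h3 := (h2 v hv).det_ne_zero (det_map_ne_zero hB v)
  rw [gramSum_map, Matrix.det_blockDiagonal'_eq_prod, Finset.prod_ne_zero_iff] at h3
  apply h3 ω (Finset.mem_univ ω)
  have : Nonempty (ι' ω) := (b ω).index_nonempty
  rw [h0]
  have h4 : (gramMat (b ω) (σ ω) 0).map (Place.ι v) = 0 := by
    ext i j
    simp [gramMat_apply]
  rw [h4, Matrix.det_zero]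

theorem isSquare_of_locSum (hσ : ∀ ω z, σ ω (σ ω z) = z) (h1 : ∀ ω, ∃ z, σ ω z ≠ z) (hB : B.det ≠ 0)
    {s : ∀ ω, E ω →ₗ[K] K} (hs : ∀ ω, IsSymFun (σ ω) (s ω)) {v : Place K} (hv : LocSum b σ B v) :
    IsSquare (Place.ι v (B.det * (gramSum b σ s).det)) := by
  obtain ⟨t, ht, hBt⟩ := exists_approx hσ hB {v} ⟨v, Finset.mem_singleton_self v⟩ fun v' hv' => by
    rwa [Finset.mem_singleton.1 hv']
  obtain ⟨r, hr⟩ := (hBt v (Finset.mem_singleton_self v)).isSquare_det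
  rw [det_map_eq, det_map_eq, ← map_mul] at hr
  obtain ⟨q, hq⟩ := isSquare_det_gramSum (b := b) hσ ht hs h1
  have h0 := det_gramSum_ne_zero (b := b) hσ ht
  refine ⟨r * Place.ι v (q / (gramSum b σ t).det), ?_⟩
  rw [mul_mul_mul_comm, ← hr, ← map_mul, ← map_mul]
  congr 1
  field_simp
  rw [sq, ← hq]
  ring

/-- The local class of the forms attached to functionals on `E ω` is not constant at `v`. -/
def Active (b : ∀ ω, Module.Basis (ι' ω) K (E ω)) (σ : ∀ ω, E ω →ₐ[K] E ω) (v : Place K) (ω : Ω) : Prop :=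
  ∃ s₁ s₂ : E ω →ₗ[K] K, IsSymFun (σ ω) s₁ ∧ IsSymFun (σ ω) s₂ ∧
    ¬ MC ((gramMat (b ω) (σ ω) s₁).map (Place.ι v)) ((gramMat (b ω) (σ ω) s₂).map (Place.ι v))

theorem exists_active (hσ : ∀ ω z, σ ω (σ ω z) = z) (hB : B.det ≠ 0)
    {s : ∀ ω, E ω →ₗ[K] K} (hs : ∀ ω, IsSymFun (σ ω) (s ω)) {v : Place K} (hv : LocSum b σ B v)
    (hne : ¬ MC (B.map (Place.ι v)) ((gramSum b σ s).map (Place.ι v))) : ∃ ω, Active b σ v ω := by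
  obtain ⟨t, ht, hBt⟩ := exists_approx hσ hB {v} ⟨v, Finset.mem_singleton_self v⟩ fun v' hv' => by
    rwa [Finset.mem_singleton.1 hv']
  by_contra! hc
  refine hne ((hBt v (Finset.mem_singleton_self v)).trans ?_)
  rw [gramSum_map, gramSum_map]
  refine MC.blockDiagonal' fun ω => ?_
  by_contra h
  exact hc ω ⟨_, _, ht ω, hs ω, h⟩

theorem exists_update (hσ : ∀ ω z, σ ω (σ ω z) = z) (h1 : ∀ ω, ∃ z, σ ω z ≠ z) (hBs : B.IsSymm)
    (hB : B.det ≠ 0) {s : ∀ ω, E ω →ₗ[K] K} (hs : ∀ ω, IsSymFun (σ ω) (s ω))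
    {p : HeightOneSpectrum (𝓞 K)} (hv : LocSum b σ B (Sum.inr p))
    (hne : ¬ MC (B.map (Place.ι (Sum.inr p))) ((gramSum b σ s).map (Place.ι (Sum.inr p))))
    {ω : Ω} (hω : Active b σ (Sum.inr p) ω) {d : (fixedBy (σ ω))ˣ} (hd : IsDisc (σ ω) d)
    {u : Place K} (hu : u ≠ Sum.inr p) (hw : ∃ w : Place (fixedBy (σ ω)), Over w u ∧ ¬ SqAt w d) :
    ∃ s' : ∀ ω, E ω →ₗ[K] K, (∀ ω, IsSymFun (σ ω) (s' ω)) ∧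
      MC (B.map (Place.ι (Sum.inr p))) ((gramSum b σ s').map (Place.ι (Sum.inr p))) ∧
      ∀ v', v' ≠ Sum.inr p → v' ≠ u →
        (MC (B.map (Place.ι v')) ((gramSum b σ s').map (Place.ι v')) ↔
          MC (B.map (Place.ι v')) ((gramSum b σ s).map (Place.ι v'))) := by
  set v : Place K := Sum.inr p with hvp
  obtain ⟨w, hwu, hwd⟩ := hw
  obtain ⟨s₁, s₂, hs₁, hs₂, h12⟩ := hω
  obtain ⟨s'', hs'', hss''⟩ : ∃ s'', IsSymFun (σ ω) s'' ∧
      ¬ MC ((gramMat (b ω) (σ ω) (s ω)).map (Place.ι v)) ((gramMat (b ω) (σ ω) s'').map (Place.ι v)) := by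
    by_contra! hc
    exact h12 ((hc s₁ hs₁).symm.trans (hc s₂ hs₂))
  obtain ⟨t, ht, htv, hto⟩ := exists_change (b ω) (σ ω) (hσ ω) hd (hs ω) hs'' hu hwd hwu
  set s' := Function.update s ω t with hs'
  have hs'ω : s' ω = t := by rw [hs', Function.update_self]
  have hs'o : ∀ i, i ≠ ω → s' i = s i := fun i hi => by rw [hs', Function.update_of_ne hi]
  have hsym : ∀ i, IsSymFun (σ i) (s' i) := by
    intro i
    by_cases hi : i = ω
    · subst hi
      rwa [hs'ω]
    · rw [hs'o i hi]
      exact hs i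
  refine ⟨s', hsym, ?_, fun v' hv' hu' => ?_⟩
  · rcases MC.of_three (big_inr p) (hBs.map (Place.ι v)) ((isSymm_gramSum hσ hs).map (Place.ι v))
      ((isSymm_gramSum hσ hsym).map (Place.ι v)) (det_map_ne_zero hB v)
      (det_map_ne_zero (det_gramSum_ne_zero hσ hs) v) (det_map_ne_zero (det_gramSum_ne_zero hσ hsym) v)
      (by rw [det_map_eq, det_map_eq, ← map_mul]; exact isSquare_of_locSum hσ h1 hB hs hv)
      (by rw [det_map_eq, det_map_eq, ← map_mul]; exact isSquare_of_locSum hσ h1 hB hsym hv) with h | h | h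
    · exact absurd h hne
    · exact h
    · rw [gramSum_map, gramSum_map] at h
      have := MC.cancel_blockDiagonal' (fun i => (isSymm_gram (b i) (σ i) (hσ i) (hs i).2).map _)
        (fun i => (isSymm_gram (b i) (σ i) (hσ i) (hsym i).2).map _)
        (fun i => det_map_ne_zero (det_gram_ne_zero (b i) (σ i) (hσ i) (hs i).1) v)
        (fun i => det_map_ne_zero (det_gram_ne_zero (b i) (σ i) (hσ i) (hsym i).1) v) ω
        (fun i hi => by rw [hs'o i hi]) h
      rw [hs'ω] at this
      exact absurd (this.trans htv) hss''
  · have key : MC ((gramSum b σ s').map (Place.ι v')) ((gramSum b σ s).map (Place.ι v')) := by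
      rw [gramSum_map, gramSum_map]
      refine MC.blockDiagonal' fun i => ?_
      by_cases hi : i = ω
      · subst hi
        rw [hs'ω]
        exact hto v' hv' hu'
      · rw [hs'o i hi]
        exact MC.refl _
    exact ⟨fun h => h.trans key, fun h => h.trans key.symm⟩

end Family

section Family

variable {K : Type u} [Field K] [NumberField K] {Ω : Type*} [Fintype Ω] [DecidableEq Ω]
  {ι' : Ω → Type*} [∀ ω, Fintype (ι' ω)] [∀ ω, DecidableEq (ι' ω)]
  {E : Ω → Type u} [∀ ω, Field (E ω)] [∀ ω, NumberField (E ω)] [∀ ω, Algebra K (E ω)]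
  {b : ∀ ω, Module.Basis (ι' ω) K (E ω)} {σ : ∀ ω, E ω →ₐ[K] E ω}
  {B : Matrix (Σ ω, ι' ω) (Σ ω, ι' ω) K}

theorem isSquare_of_isComplex {v : InfinitePlace K} (hv : v.IsComplex) (x : L (Sum.inl v)) : IsSquare x := by
  let e : L (Sum.inl v) ≃+* ℂ := InfinitePlace.Completion.ringEquivComplexOfIsComplex hv
  obtain ⟨z, hz⟩ := IsAlgClosed.exists_eq_mul_self (e x)
  exact ⟨e.symm z, e.injective (by rw [map_mul, e.apply_symm_apply, hz])⟩

theorem exists_gramSum_mc_of_ne (hσ : ∀ ω z, σ ω (σ ω z) = z) (h1 : ∀ ω, ∃ z, σ ω z ≠ z)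
    (hBs : B.IsSymm) (hB : B.det ≠ 0) (hfin : ∀ p, LocSum b σ B (Sum.inr p))
    {d : ∀ ω, (fixedBy (σ ω))ˣ} (hd : ∀ ω, IsDisc (σ ω) (d ω))
    (hlink : ∀ ω ω' (S : Finset (Place K)), ∃ u ∉ S,
      (∃ w : Place (fixedBy (σ ω)), Over w u ∧ ¬ SqAt w (d ω)) ∧
      ∃ w : Place (fixedBy (σ ω')), Over w u ∧ ¬ SqAt w (d ω'))
    (p₀ : HeightOneSpectrum (𝓞 K)) (n : ℕ) (s : ∀ ω, E ω →ₗ[K] K) (hs : ∀ ω, IsSymFun (σ ω) (s ω))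
    (hinf : ∀ v, MC (B.map (Place.ι (Sum.inl v))) ((gramSum b σ s).map (Place.ι (Sum.inl v))))
    (hn : {v | ¬ MC (B.map (Place.ι v)) ((gramSum b σ s).map (Place.ι v))}.ncard ≤ n) :
    ∃ s : ∀ ω, E ω →ₗ[K] K, (∀ ω, IsSymFun (σ ω) (s ω)) ∧ ∃ p : HeightOneSpectrum (𝓞 K),
      ∀ v ≠ Sum.inr p, MC (B.map (Place.ι v)) ((gramSum b σ s).map (Place.ι v)) := by
  classical
  induction n generalizing s with
  | zero =>
    refine ⟨s, hs, p₀, fun v _ => ?_⟩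
    have hf := finite_not_mc hBs (isSymm_gramSum (b := b) hσ hs) hB (det_gramSum_ne_zero hσ hs)
      fun p => isSquare_of_locSum hσ h1 hB hs (hfin p)
    by_contra hv
    have h2 := (Set.ncard_eq_zero hf).1 (Nat.le_zero.1 hn)
    exact Set.notMem_empty v (h2 ▸ hv)
  | succ n ih =>
    have hf := finite_not_mc hBs (isSymm_gramSum (b := b) hσ hs) hB (det_gramSum_ne_zero hσ hs)
      fun p => isSquare_of_locSum hσ h1 hB hs (hfin p)
    by_cases hp : ∃ p : HeightOneSpectrum (𝓞 K),
      ∀ v ≠ Sum.inr p, MC (B.map (Place.ι v)) ((gramSum b σ s).map (Place.ι v))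
    · exact ⟨s, hs, hp⟩
    push Not at hp
    obtain ⟨v, hv, hvD⟩ := hp p₀
    obtain ⟨p, rfl⟩ : ∃ p, v = Sum.inr p := by
      rcases v with v | p
      · exact absurd (hinf v) hvD
      · exact ⟨p, rfl⟩
    obtain ⟨v', hv', hvD'⟩ := hp p
    obtain ⟨p', rfl⟩ : ∃ p, v' = Sum.inr p := by
      rcases v' with v | p
      · exact absurd (hinf v) hvD'
      · exact ⟨p, rfl⟩
    obtain ⟨ω, hω⟩ := exists_active hσ hB hs (hfin p) hvD
    obtain ⟨ω', hω'⟩ := exists_active hσ hB hs (hfin p') hvD'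
    obtain ⟨u, hu, hw, hw'⟩ := hlink ω ω'
      (insert (Sum.inr p) (insert (Sum.inr p') (Finset.univ.map Function.Embedding.inl)))
    simp only [Finset.mem_insert, Finset.mem_map, Finset.mem_univ, true_and, not_or, not_exists,
      Function.Embedding.inl_apply] at hu
    obtain ⟨hu1, hu2, hu3⟩ := hu
    obtain ⟨s₁, hs₁, hs₁p, hs₁o⟩ := exists_update hσ h1 hBs hB hs (hfin p) hvD hω (hd ω) hu1 hw
    obtain ⟨s₂, hs₂, hs₂p, hs₂o⟩ := exists_update hσ h1 hBs hB hs₁ (hfin p')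
      (fun h => hvD' ((hs₁o _ hv' (Ne.symm hu2)).1 h)) hω' (hd ω') hu2 hw'
    refine ih s₂ hs₂ (fun v => ?_) ?_
    · rw [hs₂o _ Sum.inl_ne_inr (hu3 v), hs₁o _ Sum.inl_ne_inr (hu3 v)]
      exact hinf v
    · have hsub : {v | ¬ MC (B.map (Place.ι v)) ((gramSum b σ s₂).map (Place.ι v))} ⊆
          insert u (({v | ¬ MC (B.map (Place.ι v)) ((gramSum b σ s).map (Place.ι v))} \ {Sum.inr p})
            \ {Sum.inr p'}) := by
        intro v hv
        rw [Set.mem_ofPred_eq] at hv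
        rw [Set.mem_insert_iff]
        by_cases hvu : v = u
        · exact Or.inl hvu
        have hvp' : v ≠ Sum.inr p' := by
          rintro rfl
          exact hv hs₂p
        rw [hs₂o v hvp' hvu] at hv
        have hvp : v ≠ Sum.inr p := by
          rintro rfl
          exact hv hs₁p
        rw [hs₁o v hvp hvu] at hv
        exact Or.inr ⟨⟨hv, hvp⟩, hvp'⟩
      have hf1 := (hf.sdiff (t := {Sum.inr p})).sdiff (t := {Sum.inr p'})
      refine (Set.ncard_le_ncard hsub (hf1.insert u)).trans ((Set.ncard_insert_le _ _).trans ?_)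
      have e1 := Set.ncard_sdiff_singleton_add_one (s := {v | ¬ MC (B.map (Place.ι v))
        ((gramSum b σ s).map (Place.ι v))}) (a := Sum.inr p) hvD hf
      have e2 := Set.ncard_sdiff_singleton_add_one (s := {v | ¬ MC (B.map (Place.ι v))
        ((gramSum b σ s).map (Place.ι v))} \ {Sum.inr p}) (a := Sum.inr p') ⟨hvD', hv'⟩ hf.sdiff
      omega

theorem exists_mc_gramSum (hσ : ∀ ω z, σ ω (σ ω z) = z) (h1 : ∀ ω, ∃ z, σ ω z ≠ z)
    (hBs : B.IsSymm) (hB : B.det ≠ 0) (hfin : ∀ p, LocSum b σ B (Sum.inr p))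
    (hreal : ∀ v : InfinitePlace K, v.IsReal → LocSum b σ B (Sum.inl v))
    {d : ∀ ω, (fixedBy (σ ω))ˣ} (hd : ∀ ω, IsDisc (σ ω) (d ω))
    (hlink : ∀ ω ω' (S : Finset (Place K)), ∃ u ∉ S,
      (∃ w : Place (fixedBy (σ ω)), Over w u ∧ ¬ SqAt w (d ω)) ∧
      ∃ w : Place (fixedBy (σ ω')), Over w u ∧ ¬ SqAt w (d ω')) :
    ∃ s : ∀ ω, E ω →ₗ[K] K, (∀ ω, IsSymFun (σ ω) (s ω)) ∧ MC B (gramSum b σ s) := by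
  classical
  obtain ⟨I, hI, hI'⟩ := Ring.not_isField_iff_exists_prime.1 (RingOfIntegers.not_isField K)
  let p₀ : HeightOneSpectrum (𝓞 K) := ⟨I, hI', hI⟩
  obtain ⟨s, hs, hsS⟩ := exists_approx (b := b) hσ hB
    (insert (Sum.inr p₀) ((Finset.univ.filter fun v : InfinitePlace K => v.IsReal).map Function.Embedding.inl))
    (Finset.insert_nonempty _ _) (fun v hv => by
      rcases Finset.mem_insert.1 hv with rfl | hv
      · exact hfin p₀
      · obtain ⟨w, hw, rfl⟩ := Finset.mem_map.1 hv
        exact hreal w (Finset.mem_filter.1 hw).2)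
  have hinf : ∀ v, MC (B.map (Place.ι (Sum.inl v))) ((gramSum b σ s).map (Place.ι (Sum.inl v))) := by
    intro v
    rcases v.isReal_or_isComplex with hv | hv
    · exact hsS _ (Finset.mem_insert_of_mem (Finset.mem_map.2
        ⟨v, Finset.mem_filter.2 ⟨Finset.mem_univ v, hv⟩, rfl⟩))
    · exact mc_of_forall_isSquare (isSquare_of_isComplex hv) (hBs.map _)
        ((isSymm_gramSum hσ hs).map _) (det_map_ne_zero hB _)
        (det_map_ne_zero (det_gramSum_ne_zero hσ hs) _)
  obtain ⟨t, ht, p, htp⟩ := exists_gramSum_mc_of_ne hσ h1 hBs hB hfin hd hlink p₀ _ s hs hinf le_rfl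
  exact ⟨t, ht, mc_of_forall_ne p hBs (isSymm_gramSum hσ ht) hB (det_gramSum_ne_zero hσ ht) htp⟩

end Family

end Place

section Involution

variable {K : Type u} [Field K]

theorem root_ne_zero {f : K[X]} (hm : f.Monic) (hr : f.reverse = f) [hirr : Fact (Irreducible f)] :
    AdjoinRoot.root f ≠ 0 := by
  intro h0
  have h1 := AdjoinRoot.eval₂_root f
  have h2 : f.coeff 0 = 1 := by
    conv_lhs => rw [← hr]
    rw [Polynomial.coeff_zero_reverse, hm.leadingCoeff]
  rw [h0, Polynomial.eval₂_at_zero, h2, map_one] at h1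
  exact one_ne_zero (α := AdjoinRoot f) h1

theorem eval₂_inv_root {f : K[X]} (hm : f.Monic) (hr : f.reverse = f) [hirr : Fact (Irreducible f)] :
    eval₂ ((Algebra.ofId K (AdjoinRoot f) : K →ₐ[K] AdjoinRoot f) : K →+* AdjoinRoot f)
      (AdjoinRoot.root f)⁻¹ f = 0 := by
  let _ : Invertible (AdjoinRoot.root f) := invertibleOfNonzero (root_ne_zero hm hr)
  have h := (Polynomial.eval₂_reverse_eq_zero_iff (AdjoinRoot.of f) (AdjoinRoot.root f) f).2
    (AdjoinRoot.eval₂_root f)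
  rwa [hr, invOf_eq_inv] at h

/-- The involution of `K[X]/(f)` inverting the root of a symmetric polynomial. -/
noncomputable def invRoot {f : K[X]} (hm : f.Monic) (hr : f.reverse = f) [hirr : Fact (Irreducible f)] :
    AdjoinRoot f →ₐ[K] AdjoinRoot f :=
  AdjoinRoot.liftAlgHom f (Algebra.ofId K (AdjoinRoot f)) (AdjoinRoot.root f)⁻¹ (eval₂_inv_root hm hr)

variable {f : K[X]} (hm : f.Monic) (hr : f.reverse = f) [hirr : Fact (Irreducible f)]

theorem invRoot_root : invRoot hm hr (AdjoinRoot.root f) = (AdjoinRoot.root f)⁻¹ := by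
  exact AdjoinRoot.liftAlgHom_root _ _ _ _

theorem root_mul_invRoot : AdjoinRoot.root f * invRoot hm hr (AdjoinRoot.root f) = 1 := by
  rw [invRoot_root, mul_inv_cancel₀ (root_ne_zero hm hr)]

theorem invRoot_invRoot (z : AdjoinRoot f) : invRoot hm hr (invRoot hm hr z) = z := by
  have h : (invRoot hm hr).comp (invRoot hm hr) = AlgHom.id K _ := by
    apply AdjoinRoot.algHom_ext
    rw [AlgHom.comp_apply, invRoot_root, map_inv₀, invRoot_root, inv_inv, AlgHom.id_apply]
  exact DFunLike.congr_fun h z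

theorem isCoprime_sq_sub_one (hirr : Irreducible f) (he : Even f.natDegree) : IsCoprime f (Polynomial.X ^ 2 - 1) := by
  refine hirr.coprime_iff_not_dvd.2 fun h => ?_
  have h1 := hirr.natDegree_pos
  have h2 : (Polynomial.X ^ 2 - 1 : K[X]) = (Polynomial.X - Polynomial.C 1) * (Polynomial.X - Polynomial.C (-1)) := by
    rw [map_neg, map_one]; ring
  rw [h2] at h
  have key : ∀ c : K, ¬ f ∣ Polynomial.X - Polynomial.C c := by
    intro c hc
    have := Polynomial.natDegree_le_of_dvd hc (Polynomial.X_sub_C_ne_zero c)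
    rw [Polynomial.natDegree_X_sub_C] at this
    obtain ⟨k, hk⟩ := he
    omega
  exact (hirr.prime.dvd_or_dvd h).elim (key _) (key _)

theorem exists_invRoot_ne (he : Even f.natDegree) : ∃ z, invRoot hm hr z ≠ z := by
  refine ⟨AdjoinRoot.root f, fun h => ?_⟩
  have h1 := root_mul_invRoot hm hr
  rw [h] at h1
  obtain ⟨a, b, hab⟩ := isCoprime_sq_sub_one hirr.out he
  have := congrArg (AdjoinRoot.mk f) hab
  rw [map_add, map_mul, map_mul, AdjoinRoot.mk_self, map_sub, map_pow, AdjoinRoot.mk_X, sq, h1, map_one,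
    sub_self, mul_zero, mul_zero, zero_add] at this
  exact zero_ne_one this

instance numberField_adjoinRoot [NumberField K] (f : K[X]) [hirr : Fact (Irreducible f)] :
    NumberField (AdjoinRoot f) := by
  have : FiniteDimensional K (AdjoinRoot f) := (AdjoinRoot.powerBasis hirr.out.ne_zero).finite
  exact NumberField.of_module_finite K _

end Involution

namespace Place

variable {K : Type u} [Field K] [NumberField K]

theorem exists_common_place_of_isField {E E' : Type u} [Field E] [NumberField E] [Algebra K E] [Field E']
    [NumberField E'] [Algebra K E'] (h : IsField (E ⊗[K] E')) {σ : E →ₐ[K] E} {σ' : E' →ₐ[K] E'}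
    {d : (fixedBy σ)ˣ} (hd : IsDisc σ d) {d' : (fixedBy σ')ˣ} (hd' : IsDisc σ' d') (S : Finset (Place K)) :
    ∃ u ∉ S, (∃ w : Place (fixedBy σ), Over w u ∧ ¬ SqAt w d) ∧
      ∃ w : Place (fixedBy σ'), Over w u ∧ ¬ SqAt w d' := by
  have : FiniteDimensional K E := Module.Finite.of_restrictScalars_finite ℚ K E
  have : FiniteDimensional K E' := Module.Finite.of_restrictScalars_finite ℚ K E'
  let _ : Field (E ⊗[K] E') := h.toField
  have : NumberField (E ⊗[K] E') := NumberField.of_module_finite K _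
  refine exists_common_place (M := E ⊗[K] E') (τ := Algebra.TensorProduct.map σ σ')
    Algebra.TensorProduct.includeLeft (fun z => ?_) Algebra.TensorProduct.includeRight (fun z => ?_) hd hd' S
  · simp
  · simp

end Place

section BlockAlg

variable {K : Type*} [Field K] {Ω : Type*} [Fintype Ω] [DecidableEq Ω] {n : Ω → Type*}
  [∀ ω, Fintype (n ω)] [∀ ω, DecidableEq (n ω)]

theorem charpoly_blockDiagonal' (M : ∀ ω, Matrix (n ω) (n ω) K) :
    (Matrix.blockDiagonal' M).charpoly = ∏ ω, (M ω).charpoly := by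
  have h : (Matrix.blockDiagonal' M).charmatrix = Matrix.blockDiagonal' fun ω => (M ω).charmatrix := by
    ext ⟨i, k⟩ ⟨j, l⟩
    by_cases hij : i = j
    · subst hij
      rw [Matrix.blockDiagonal'_apply_eq, Matrix.charmatrix_apply, Matrix.charmatrix_apply,
        Matrix.blockDiagonal'_apply_eq]
      by_cases hkl : k = l
      · subst hkl
        simp
      · rw [Matrix.diagonal_apply_ne _ hkl, Matrix.diagonal_apply_ne]
        exact fun h => hkl (by simpa using h)
    · rw [Matrix.blockDiagonal'_apply_ne _ _ _ hij, Matrix.charmatrix_apply_ne _ _ _ (by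
        rintro h
        exact hij (congrArg Sigma.fst h)), Matrix.blockDiagonal'_apply_ne _ _ _ hij, map_zero, neg_zero]
  rw [Matrix.charpoly, h, Matrix.det_blockDiagonal'_eq_prod]
  rfl

variable (n K) in
/-- The block diagonal embedding as an algebra homomorphism. -/
def blockAlgHom : (∀ ω, Matrix (n ω) (n ω) K) →ₐ[K] Matrix (Σ ω, n ω) (Σ ω, n ω) K :=
  { Matrix.blockDiagonal'RingHom n K with
    commutes' := fun r => by
      change Matrix.blockDiagonal' (fun ω => algebraMap K (Matrix (n ω) (n ω) K) r) = _
      simp only [Matrix.algebraMap_eq_diagonal]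
      exact Matrix.blockDiagonal'_diagonal _ }

/-- Conjugation by an invertible matrix as an algebra homomorphism. -/
def conjAlgHom {m : Type*} [Fintype m] [DecidableEq m] (P Q : Matrix m m K) (h : P * Q = 1) (h' : Q * P = 1) :
    Matrix m m K →ₐ[K] Matrix m m K where
  toFun M := Q * M * P
  map_one' := by rw [mul_one, h']
  map_mul' M N := by
    have : Q * M * P * (Q * N * P) = Q * M * (P * Q) * N * P := by simp only [mul_assoc]
    rw [this, h, mul_one]
    simp only [mul_assoc]
  map_zero' := by rw [mul_zero, zero_mul]
  map_add' M N := by rw [mul_add, add_mul]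
  commutes' r := by rw [← Algebra.commutes, mul_assoc, h', mul_one]

theorem exists_isometry_of_mc (f : Ω → K[X]) (hm : ∀ ω, (f ω).Monic)
    (σ : ∀ ω, AdjoinRoot (f ω) →ₐ[K] AdjoinRoot (f ω))
    (hσ : ∀ ω, AdjoinRoot.root (f ω) * σ ω (AdjoinRoot.root (f ω)) = 1)
    (s : ∀ ω, AdjoinRoot (f ω) →ₗ[K] K) {V : Type*} [AddCommGroup V] [Module K V] [FiniteDimensional K V]
    (bV : Module.Basis (Σ ω, Fin (f ω).natDegree) K V) {B : LinearMap.BilinForm K V} (hB : B.Nondegenerate)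
    (h : MC (LinearMap.BilinForm.toMatrix bV B)
      (Matrix.blockDiagonal' fun ω => gramMat (AdjoinRoot.powerBasisAux' (hm ω)) (σ ω) (s ω))) :
    ∃ t : V ≃ₗ[K] V, (∀ x y, B (t x) (t y) = B x y) ∧
      LinearMap.charpoly (t : V →ₗ[K] V) = ∏ ω, f ω ∧
      ∀ q : K[X], aeval (t : V →ₗ[K] V) q = 0 ↔ ∀ ω, f ω ∣ q := by
  obtain ⟨P, Q, hPQ, hQP, hPG⟩ := h
  set G := Matrix.blockDiagonal' fun ω => gramMat (AdjoinRoot.powerBasisAux' (hm ω)) (σ ω) (s ω) with hG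
  have hT1 : Pᵀ * Qᵀ = 1 := by rw [← transpose_mul, hQP, transpose_one]
  have hT2 : Qᵀ * Pᵀ = 1 := by rw [← transpose_mul, hPQ, transpose_one]
  let R : ∀ ω, Matrix (Fin (f ω).natDegree) (Fin (f ω).natDegree) K := fun ω =>
    Algebra.leftMulMatrix (AdjoinRoot.powerBasisAux' (hm ω)) (AdjoinRoot.root (f ω))
  set C := Matrix.blockDiagonal' R with hC
  let Ψ : Matrix (Σ ω, Fin (f ω).natDegree) (Σ ω, Fin (f ω).natDegree) K →ₐ[K] (V →ₗ[K] V) :=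
    ((Matrix.toLinAlgEquiv bV : _ ≃ₐ[K] _) : _ →ₐ[K] (V →ₗ[K] V)).comp (conjAlgHom Pᵀ Qᵀ hT1 hT2)
  have hΨ : ∀ M, Ψ M = 0 ↔ M = 0 := by
    intro M
    refine ⟨fun h0 => ?_, fun h0 => by rw [h0, map_zero]⟩
    have h1 : Qᵀ * M * Pᵀ = 0 := (map_eq_zero_iff _ (Matrix.toLinAlgEquiv bV).injective).1 h0
    calc M = (Pᵀ * Qᵀ) * M * (Pᵀ * Qᵀ) := by rw [hT1, one_mul, mul_one]
      _ = Pᵀ * (Qᵀ * M * Pᵀ) * Qᵀ := by simp only [mul_assoc]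
      _ = 0 := by rw [h1, mul_zero, zero_mul]
  have hCG : Cᵀ * G * C = G := by
    rw [hC, hG, Matrix.blockDiagonal'_transpose, ← Matrix.blockDiagonal'_mul, ← Matrix.blockDiagonal'_mul]
    congr 1
    funext ω
    change (LinearMap.toMatrix _ _ _)ᵀ * LinearMap.BilinForm.toMatrix _ _ * LinearMap.toMatrix _ _ _ = _
    rw [← LinearMap.BilinForm.toMatrix_comp, gramMat]
    congr 1
    refine LinearMap.ext₂ fun x y => ?_
    change trForm (σ ω) (s ω) (AdjoinRoot.root (f ω) * x) (AdjoinRoot.root (f ω) * y) = _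
    rw [trForm_apply, trForm_apply, map_mul (σ ω), mul_mul_mul_comm, hσ, one_mul]
  have hmat : LinearMap.toMatrix bV bV (Ψ C) = Qᵀ * C * Pᵀ := LinearMap.toMatrix_toLin bV bV _
  have hiso : ∀ x y, B (Ψ C x) (Ψ C y) = B x y := by
    have : B.comp (Ψ C) (Ψ C) = B := by
      apply (LinearMap.BilinForm.toMatrix bV).injective
      rw [LinearMap.BilinForm.toMatrix_comp bV bV, hmat, ← hPG]
      calc (Qᵀ * C * Pᵀ)ᵀ * (P * G * Pᵀ) * (Qᵀ * C * Pᵀ)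
          = P * Cᵀ * (Q * P) * G * (Pᵀ * Qᵀ) * C * Pᵀ := by
            simp only [transpose_mul, transpose_transpose, mul_assoc]
        _ = P * (Cᵀ * G * C) * Pᵀ := by
            rw [hQP, hT1, mul_one, mul_one]
            simp only [mul_assoc]
        _ = P * G * Pᵀ := by rw [hCG]
    intro x y
    exact LinearMap.congr_fun₂ this x y
  have hinj : Function.Injective (Ψ C) := by
    rw [injective_iff_map_eq_zero]
    intro x hx
    refine hB.1 x fun y => ?_
    rw [← hiso, hx, map_zero, LinearMap.zero_apply]
  have hcoe : ((LinearEquiv.ofInjectiveEndo (Ψ C) hinj : V ≃ₗ[K] V) : V →ₗ[K] V) = Ψ C := by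
    ext x
    rfl
  refine ⟨LinearEquiv.ofInjectiveEndo (Ψ C) hinj, hiso, ?_, fun q => ?_⟩
  · rw [hcoe, ← LinearMap.charpoly_toMatrix (Ψ C) bV, hmat, mul_assoc, Matrix.charpoly_mul_comm, mul_assoc, hT1,
      mul_one, hC, charpoly_blockDiagonal']
    refine Finset.prod_congr rfl fun ω _ => ?_
    have h1 := charpoly_leftMulMatrix (AdjoinRoot.powerBasis' (hm ω))
    rw [AdjoinRoot.powerBasis'_gen, AdjoinRoot.minpoly_root (hm ω).ne_zero, (hm ω).leadingCoeff, inv_one, map_one,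
      mul_one] at h1
    exact h1
  · have h1 : C = blockAlgHom K _ R := rfl
    rw [hcoe, aeval_algHom_apply, hΨ, h1, aeval_algHom_apply]
    have h2 : aeval R q = fun ω => aeval (R ω) q := by
      funext ω
      exact (aeval_algHom_apply (Pi.evalAlgHom K _ ω) R q).symm
    have h3 : ∀ ω, aeval (R ω) q = 0 ↔ f ω ∣ q := by
      intro ω
      rw [aeval_algHom_apply, map_eq_zero_iff _ (Algebra.leftMulMatrix_injective _), AdjoinRoot.aeval_eq,
        AdjoinRoot.mk_eq_zero]
    have h4 : blockAlgHom K _ (aeval R q) = 0 ↔ aeval R q = 0 :=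
      ⟨fun h => Matrix.blockDiagonal'_injective (h.trans Matrix.blockDiagonal'_zero.symm),
        fun h => by rw [h, map_zero]⟩
    rw [h4, h2, funext_iff]
    exact forall_congr' h3

end BlockAlg

section Localize

theorem map_twist {K F F' E ι : Type*} [Field K] [Field F] [Field F'] [CommRing E] [Algebra K E]
    [Fintype ι] (φ : K →+* F) (e : F →+* F') (b : Module.Basis ι K E) (σ : E →ₐ[K] E) (c : ι → F) :
    (twist φ b σ c).map e = twist (e.comp φ) b σ fun k => e (c k) := by
  ext i j
  simp only [twist, map_apply, of_apply, map_sum, map_mul, RingHom.comp_apply]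

theorem toMatrix_baseChange {K F V ι : Type*} [Field K] [Field F] [Algebra K F] [AddCommGroup V]
    [Module K V] [Fintype ι] [DecidableEq ι] (b : Module.Basis ι K V) (B : LinearMap.BilinForm K V) :
    LinearMap.BilinForm.toMatrix (b.baseChange F) (LinearMap.BilinForm.baseChange F B) =
      (LinearMap.BilinForm.toMatrix b B).map (algebraMap K F) := by
  ext i j
  rw [LinearMap.BilinForm.toMatrix_apply, Module.Basis.baseChange_apply, Module.Basis.baseChange_apply,
    LinearMap.BilinForm.baseChange_tmul, map_apply, LinearMap.BilinForm.toMatrix_apply, mul_one,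
    Algebra.algebraMap_eq_smul_one]

theorem isCoprime_of_monic_irreducible {K ι : Type*} [Field K] {f : ι → K[X]} (hf : Function.Injective f)
    (hm : ∀ i, (f i).Monic) (hirr : ∀ i, Irreducible (f i)) {i j : ι} (h : i ≠ j) :
    IsCoprime (f i) (f j) :=
  (hirr i).coprime_iff_not_dvd.2 fun hd => h (hf (eq_of_monic_of_associated (hm i) (hm j)
    ((hirr i).associated_of_dvd (hirr j) hd)))

theorem prod_sigma_fin {M : Type*} [CommMonoid M] {r : ℕ} (f : Fin r → M) (n : Fin r → ℕ) :
    ∏ ω : Σ i, Fin (n i), f ω.1 = ∏ i, f i ^ n i := by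
  rw [Fintype.prod_sigma]
  refine Finset.prod_congr rfl fun i _ => ?_
  exact Fin.prod_const (n i) (f i)

theorem exists_mc_twist_of_hasIsometryWith {K F : Type*} [Field K] [CharZero K] [Field F] [CharZero F]
    [Algebra K F] {Ω : Type*} [Fintype Ω] [DecidableEq Ω] (f : Ω → K[X]) (g : K[X])
    (hm : ∀ ω, (f ω).Monic) (hirr : ∀ ω, Irreducible (f ω)) (hr : ∀ ω, (f ω).reverse = f ω)
    (he : ∀ ω, Even (f ω).natDegree) (hg : ∀ ω, ∃ k, f ω * k = g ∧ IsCoprime (f ω) k)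
    (σ : ∀ ω, AdjoinRoot (f ω) →ₐ[K] AdjoinRoot (f ω))
    (hσ : ∀ ω, AdjoinRoot.root (f ω) * σ ω (AdjoinRoot.root (f ω)) = 1)
    {V : Type*} [AddCommGroup V] [Module K V] [FiniteDimensional K V]
    (bV : Module.Basis (Σ ω, Fin (f ω).natDegree) K V) {B : LinearMap.BilinForm K V}
    (hB : (LinearMap.BilinForm.toMatrix bV B).det ≠ 0) (hs : B.IsSymm)
    (h : HasIsometryWith F (F ⊗[K] V) (LinearMap.BilinForm.baseChange F B)
      ((∏ ω, f ω).map (algebraMap K F)) (g.map (algebraMap K F))) :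
    ∃ c : ∀ ω, Fin (f ω).natDegree → F,
      MC ((LinearMap.BilinForm.toMatrix bV B).map (algebraMap K F)) (Matrix.blockDiagonal' fun ω =>
        twist (algebraMap K F) (AdjoinRoot.powerBasisAux' (hm ω)) (σ ω) (c ω)) := by
  have hF : ∀ ω, Fact (Irreducible (f ω)) := fun ω => ⟨hirr ω⟩
  obtain ⟨t, ht, hc, hmin⟩ := h
  rw [← toMatrix_baseChange]
  refine exists_mc_twist (algebraMap K F) f g hm hr (fun ω => (hirr ω).separable)
    (fun ω => isCoprime_sq_sub_one (hirr ω) (he ω)) hg σ hσ (bV.baseChange F) ?_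
    ⟨(LinearMap.BilinForm.IsSymm.baseChange F (LinearMap.BilinForm.isSymm_iff.1 hs)).eq⟩
    (T := (t : F ⊗[K] V →ₗ[F] F ⊗[K] V)) ht ?_ ?_
  · rw [LinearMap.BilinForm.nondegenerate_iff_det_ne_zero (bV.baseChange F), toMatrix_baseChange,
      ← RingHom.mapMatrix_apply, ← RingHom.map_det]
    exact (_root_.map_ne_zero _).2 hB
  · rw [← hmin]
    exact minpoly.aeval F (t : Module.End F (F ⊗[K] V))
  · rw [hc, Polynomial.map_prod]

theorem Place.locSum_of_isReal {K : Type u} [Field K] [NumberField K] {Ω : Type*} [Fintype Ω] [DecidableEq Ω]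
    {ι' : Ω → Type*} [∀ ω, Fintype (ι' ω)] [∀ ω, DecidableEq (ι' ω)] {E : Ω → Type u} [∀ ω, Field (E ω)]
    [∀ ω, NumberField (E ω)] [∀ ω, Algebra K (E ω)] {b : ∀ ω, Module.Basis (ι' ω) K (E ω)}
    {σ : ∀ ω, E ω →ₐ[K] E ω} {B : Matrix (Σ ω, ι' ω) (Σ ω, ι' ω) K} {v : InfinitePlace K} (hv : v.IsReal)
    {c : ∀ ω, ι' ω → ℝ}
    (h : MC (B.map (InfinitePlace.embedding_of_isReal hv)) (Matrix.blockDiagonal' fun ω =>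
      twist (InfinitePlace.embedding_of_isReal hv) (b ω) (σ ω) (c ω))) :
    LocSum b σ B (Sum.inl v) := by
  let e : ℝ →+* v.Completion := (InfinitePlace.Completion.ringEquivRealOfIsReal hv).symm
  have he : e.comp (InfinitePlace.embedding_of_isReal hv) = algebraMap K v.Completion := by
    refine RingHom.ext fun x => (InfinitePlace.Completion.ringEquivRealOfIsReal hv).symm_apply_eq.2 ?_
    exact (InfinitePlace.Completion.extensionEmbeddingOfIsReal_coe hv (WithAbs.toAbs _ x)).symm
  have h' := h.map e
  rw [Matrix.blockDiagonal'_map _ _ (map_zero e)] at h'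
  simp only [map_twist, he] at h'
  rw [Matrix.map_map, ← RingHom.coe_comp, he] at h'
  exact ⟨fun ω k => e (c ω k), h'⟩

theorem Place.exists_common_place_of_eq_or_isField {K : Type u} [Field K] [NumberField K] {p q : K[X]}
    [Fact (Irreducible p)] [Fact (Irreducible q)] (hp : p.Monic) (hp' : p.reverse = p) (hq : q.Monic)
    (hq' : q.reverse = q) (h : p = q ∨ IsField (AdjoinRoot p ⊗[K] AdjoinRoot q))
    {d : (fixedBy (invRoot hp hp'))ˣ} (hd : IsDisc (invRoot hp hp') d)
    {d' : (fixedBy (invRoot hq hq'))ˣ} (hd' : IsDisc (invRoot hq hq') d') (S : Finset (Place K)) :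
    ∃ u ∉ S, (∃ w : Place (fixedBy (invRoot hp hp')), Over w u ∧ ¬ SqAt w d) ∧
      ∃ w : Place (fixedBy (invRoot hq hq')), Over w u ∧ ¬ SqAt w d' := by
  rcases h with rfl | h
  · exact exists_common_place (M := AdjoinRoot p) (τ := invRoot hp hp') (AlgHom.id K _) (fun _ => rfl)
      (AlgHom.id K _) (fun _ => rfl) hd hd' S
  · exact exists_common_place_of_isField h hd hd' S

theorem hasIsometryWith_of_local {K : Type u} [Field K] [NumberField K] {Ω : Type*} [Fintype Ω]
    [DecidableEq Ω] (f : Ω → K[X]) (g : K[X])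
    (hm : ∀ ω, (f ω).Monic) (hirr : ∀ ω, Irreducible (f ω)) (hr : ∀ ω, (f ω).reverse = f ω)
    (he : ∀ ω, Even (f ω).natDegree) (hg : ∀ ω, ∃ k, f ω * k = g ∧ IsCoprime (f ω) k) (hgm : g.Monic)
    (hdvd : ∀ q, (∀ ω, f ω ∣ q) → g ∣ q)
    (hindep : ∀ ω ω', f ω = f ω' ∨ IsField (AdjoinRoot (f ω) ⊗[K] AdjoinRoot (f ω')))
    {V : Type*} [AddCommGroup V] [Module K V] [FiniteDimensional K V]
    (hdim : Module.finrank K V = (∏ ω, f ω).natDegree)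
    (B : LinearMap.BilinForm K V) (hB : B.Nondegenerate) (hs : B.IsSymm)
    (hfin : ∀ v : HeightOneSpectrum (𝓞 K),
      HasIsometryWith (v.adicCompletion K) ((v.adicCompletion K) ⊗[K] V)
        (LinearMap.BilinForm.baseChange (v.adicCompletion K) B)
        ((∏ ω, f ω).map (algebraMap K (v.adicCompletion K)))
        (g.map (algebraMap K (v.adicCompletion K))))
    (hreal : ∀ φ : K →+* ℝ,
      letI : Algebra K ℝ := φ.toAlgebra
      HasIsometryWith ℝ (ℝ ⊗[K] V) (LinearMap.BilinForm.baseChange ℝ B)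
        ((∏ ω, f ω).map φ) (g.map φ)) :
    HasIsometryWith K V B (∏ ω, f ω) g := by
  have hF : ∀ ω, Fact (Irreducible (f ω)) := fun ω => ⟨hirr ω⟩
  let bV : Module.Basis (Σ ω, Fin (f ω).natDegree) K V :=
    (Module.finBasis K V).reindex (Fintype.equivOfCardEq (by
      rw [Fintype.card_fin, hdim, natDegree_prod_of_monic _ _ fun ω _ => hm ω, Fintype.card_sigma]
      simp only [Fintype.card_fin]))
  let σ : ∀ ω, AdjoinRoot (f ω) →ₐ[K] AdjoinRoot (f ω) := fun ω => invRoot (hm ω) (hr ω)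
  have hσ : ∀ ω, AdjoinRoot.root (f ω) * σ ω (AdjoinRoot.root (f ω)) = 1 :=
    fun ω => root_mul_invRoot (hm ω) (hr ω)
  have hdet : (LinearMap.BilinForm.toMatrix bV B).det ≠ 0 :=
    (LinearMap.BilinForm.nondegenerate_iff_det_ne_zero bV).1 hB
  have hσ2 : ∀ ω z, σ ω (σ ω z) = z := fun ω => invRoot_invRoot (hm ω) (hr ω)
  have hσ1 : ∀ ω, ∃ z, σ ω z ≠ z := fun ω => exists_invRoot_ne (hm ω) (hr ω) (he ω)
  choose d hd using fun ω => Place.exists_isDisc (σ ω) (hσ2 ω) (hσ1 ω)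
  obtain ⟨s, -, hms⟩ := Place.exists_mc_gramSum (b := fun ω => AdjoinRoot.powerBasisAux' (hm ω)) hσ2 hσ1
    (B := LinearMap.BilinForm.toMatrix bV B)
    (by
      ext i j
      rw [transpose_apply, LinearMap.BilinForm.toMatrix_apply, LinearMap.BilinForm.toMatrix_apply]
      exact hs.eq _ _)
    hdet
    (fun p => by
      have : CharZero (p.adicCompletion K) :=
        charZero_of_injective_algebraMap (algebraMap K (p.adicCompletion K)).injective
      exact exists_mc_twist_of_hasIsometryWith f g hm hirr hr he hg σ hσ bV hdet hs (hfin p))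
    (fun v hv => by
      let φ := InfinitePlace.embedding_of_isReal hv
      let _ : Algebra K ℝ := φ.toAlgebra
      obtain ⟨c, hc⟩ := exists_mc_twist_of_hasIsometryWith f g hm hirr hr he hg σ hσ bV hdet hs (hreal φ)
      exact Place.locSum_of_isReal hv hc)
    hd
    (fun ω ω' S => Place.exists_common_place_of_eq_or_isField (hm ω) (hr ω) (hm ω') (hr ω')
      (hindep ω ω') (hd ω) (hd ω') S)
  obtain ⟨t, ht, hc, hq⟩ := exists_isometry_of_mc f hm σ hσ s bV hB hms
  refine ⟨t, ht, hc, eq_of_monic_of_associated (minpoly.monic (Algebra.IsIntegral.isIntegral _)) hgm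
    (associated_of_dvd_dvd (minpoly.dvd _ _ ((hq g).2 fun ω => ?_)) (hdvd _ ((hq _).1 (minpoly.aeval _ _))))⟩
  obtain ⟨k, hk, -⟩ := hg ω
  exact ⟨k, hk.symm⟩

end Localize

end

end

theorem stmt_5 {K : Type*} [Field K] [NumberField K]
    {r : ℕ} (f : Fin r → Polynomial K) (n : Fin r → ℕ)
    (hdist : Function.Injective f)
    (hmonic : ∀ i, (f i).Monic) (hirr : ∀ i, Irreducible (f i))
    (hsymm : ∀ i, (f i).reverse = f i) (heven : ∀ i, Even (f i).natDegree)
    (hn : ∀ i, 1 ≤ n i)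
    (hindep : ∀ i j, i ≠ j → IsField (AdjoinRoot (f i) ⊗[K] AdjoinRoot (f j)))
    {V : Type*} [AddCommGroup V] [Module K V] [FiniteDimensional K V]
    (hdim : Module.finrank K V = (∏ i, f i ^ n i).natDegree)
    (B : LinearMap.BilinForm K V) (hBnd : B.Nondegenerate) (hBsymm : B.IsSymm)
    (hfin : ∀ v : IsDedekindDomain.HeightOneSpectrum (NumberField.RingOfIntegers K),
      letI : SMulCommClass K (v.adicCompletion K) (v.adicCompletion K) :=
        Algebra.to_smulCommClass
      HasIsometryWith (v.adicCompletion K) ((v.adicCompletion K) ⊗[K] V)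
        (LinearMap.BilinForm.baseChange (v.adicCompletion K) B)
        ((∏ i, f i ^ n i).map (algebraMap K (v.adicCompletion K)))
        ((∏ i, f i).map (algebraMap K (v.adicCompletion K))))
    (hreal : ∀ φ : K →+* ℝ,
      letI : Algebra K ℝ := φ.toAlgebra
      HasIsometryWith ℝ (ℝ ⊗[K] V) (LinearMap.BilinForm.baseChange ℝ B)
        ((∏ i, f i ^ n i).map φ) ((∏ i, f i).map φ)) :
    HasIsometryWith K V B (∏ i, f i ^ n i) (∏ i, f i) := by
  have hcop : ∀ {i j}, i ≠ j → IsCoprime (f i) (f j) := isCoprime_of_monic_irreducible hdist hmonic hirr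
  rw [← prod_sigma_fin] at hdim ⊢
  simp only [← prod_sigma_fin] at hfin hreal
  refine hasIsometryWith_of_local (fun ω : Σ i, Fin (n i) => f ω.1) (∏ i, f i) (fun ω => hmonic ω.1)
    (fun ω => hirr ω.1) (fun ω => hsymm ω.1) (fun ω => heven ω.1)
    (fun ω => ⟨∏ j ∈ Finset.univ.erase ω.1, f j, Finset.mul_prod_erase _ _ (Finset.mem_univ _),
      IsCoprime.prod_right fun j hj => hcop (Finset.ne_of_mem_erase hj).symm⟩)
    (monic_prod_of_monic _ _ fun i _ => hmonic i)
    (fun q hq => Finset.prod_dvd_of_coprime (fun i _ j _ hij => hcop hij) fun i _ => hq ⟨i, ⟨0, hn i⟩⟩)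
    (fun ω ω' => ?_) hdim B hBnd hBsymm hfin hreal
  by_cases h : ω.1 = ω'.1
  · exact Or.inl (congrArg f h)
  · exact Or.inr (hindep _ _ h)
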